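/- Let S be a compact, orientable, two-dimensional embedded C^∞ submanifold of ℝ³ without boundary. There exist constants c > 0 and h₀ > 0, depending only on S and γ₀ (in particular independent of z₀ and h), such that for every z₀ ∈ S and every admissible quasi-uniform triangulation T_h with h ≤ h₀, the cut-off lifted logarithm l̃ and its discrete projection l̃_h satisfy the L²-estimate ( ∫_S (l̃ − L̃_h)² )^{1/2} ≤ c h. -/

import Mathlib

open MeasureTheory Metric
open scoped RealInnerProductSpace ENNReal NNReal

noncomputable section

/-- Ambient Euclidean space `ℝ³`. -/
abbrev E3 : Type := EuclideanSpace ℝ (Fin 3)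

/-- The tangential gradient of `w : E3 → ℝ` along the set `A` at `x`, with values projected
onto the subspace `P`: the orthogonal projection onto `P` of the Riesz representative of the
derivative of `w` within `A` at `x`. -/
def tGrad (A : Set E3) (P : Submodule ℝ E3) (w : E3 → ℝ) (x : E3) : E3 :=
  (Submodule.orthogonalProjectionOnto P ((InnerProductSpace.toDual ℝ E3).symm (fderivWithin ℝ w A x)) : E3)

/-- A compact, orientable, two-dimensional embedded `C^∞` submanifold of `ℝ³` without boundary,
described by a global smooth unit normal field `n` and local smooth regular defining functions. -/
structure SmoothSurface where
  S : Set E3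
  n : E3 → E3
  compact : IsCompact S
  nonempty : S.Nonempty
  localLevel : ∀ x ∈ S, ∃ U : Set E3, ∃ F : E3 → ℝ, IsOpen U ∧ x ∈ U ∧
    ContDiff ℝ (⊤ : ℕ∞) F ∧ S ∩ U = {y ∈ U | F y = 0} ∧
    (∀ y ∈ U, gradient F y ≠ 0) ∧
    (∀ y, y ∈ S ∩ U → ∃ t : ℝ, gradient F y = t • n y)
  n_unit : ∀ x ∈ S, ‖n x‖ = 1
  n_smooth : ∃ U : Set E3, IsOpen U ∧ S ⊆ U ∧ ContDiffOn ℝ (⊤ : ℕ∞) n U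

namespace SmoothSurface

variable (Srf : SmoothSurface)

/-- The tangent plane of `S` at `x`, as the orthogonal complement of the normal. -/
def tangent (x : E3) : Submodule ℝ E3 := (ℝ ∙ Srf.n x)ᗮ

/-- The tangential gradient `∇_S w` on the surface. -/
def grad (w : E3 → ℝ) (x : E3) : E3 := tGrad Srf.S (Srf.tangent x) w x

/-- The bilinear form `a(v,w) = ∫_S (⟨∇_S v, ∇_S w⟩ + v w)` (w.r.t. 2-dimensional
Hausdorff measure on `S`). -/
def aForm (v w : E3 → ℝ) : ℝ :=
  ∫ x in Srf.S, (⟪Srf.grad v x, Srf.grad w x⟫ + v x * w x) ∂μH[2]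

end SmoothSurface

/-- The (closed, flat) triangle with vertices `t.1, t.2.1, t.2.2`. -/
def triOf (t : E3 × E3 × E3) : Set E3 := convexHull ℝ {t.1, t.2.1, t.2.2}

/-- The vertex set of a triangle. -/
def vertsOf (t : E3 × E3 × E3) : Set E3 := {t.1, t.2.1, t.2.2}

/-- The plane spanned by a triangle. -/
def planeOf (t : E3 × E3 × E3) : Set E3 := (affineSpan ℝ (vertsOf t) : Set E3)

/-- The direction (2-dimensional linear subspace) of the plane of a triangle. -/
def dirOf (t : E3 × E3 × E3) : Submodule ℝ E3 := (affineSpan ℝ (vertsOf t)).direction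

/-- The triangle-wise tangential gradient `∇_{S_h} w` on the triangle `t`. -/
def gradTri (t : E3 × E3 × E3) (w : E3 → ℝ) (x : E3) : E3 := tGrad (triOf t) (dirOf t) w x

/-- An admissible quasi-uniform triangulation `T_h` of the surface `Srf` with mesh parameter `h`
and quasi-uniformity constant `γ₀`, together with the nearest-point projection `a` defined on
a tubular neighbourhood `N` of the surface. -/
structure Triangulation (Srf : SmoothSurface) (γ₀ h : ℝ) where
  T : Finset (E3 × E3 × E3)
  a : E3 → E3
  N : Set E3
  T_nonempty : T.Nonempty
  indep : ∀ t ∈ T, AffineIndependent ℝ ![t.1, t.2.1, t.2.2]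
  verts_on : ∀ t ∈ T, vertsOf t ⊆ Srf.S
  meet : ∀ t ∈ T, ∀ t' ∈ T, t ≠ t' →
    triOf t ∩ triOf t' = ∅ ∨
    (∃ v, v ∈ vertsOf t ∩ vertsOf t' ∧ triOf t ∩ triOf t' = {v}) ∨
    (∃ v w, v ≠ w ∧ v ∈ vertsOf t ∩ vertsOf t' ∧ w ∈ vertsOf t ∩ vertsOf t' ∧
      triOf t ∩ triOf t' = segment ℝ v w)
  diam_le : ∀ t ∈ T, Metric.diam (triOf t) ≤ h
  disk : ∀ t ∈ T, ∃ y ∈ triOf t, closedBall y (γ₀ * h) ∩ planeOf t ⊆ triOf t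
  N_open : IsOpen N
  S_sub : Srf.S ⊆ N
  Sh_sub : (⋃ t ∈ T, triOf t) ⊆ N
  a_smooth : ContDiffOn ℝ (⊤ : ℕ∞) a N
  a_mem : ∀ x ∈ N, a x ∈ Srf.S
  a_nearest : ∀ x ∈ N, ∀ y ∈ Srf.S, dist x (a x) ≤ dist x y
  a_unique : ∀ x ∈ N, ∀ y ∈ Srf.S, dist x y = dist x (a x) → y = a x
  a_bij : Set.BijOn a (⋃ t ∈ T, triOf t) Srf.S

namespace Triangulation

variable {Srf : SmoothSurface} {γ₀ h : ℝ} (Tr : Triangulation Srf γ₀ h)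

/-- The polyhedral surface `S_h`, the union of the triangles. -/
def Sh : Set E3 := ⋃ t ∈ Tr.T, triOf t

/-- Membership in the finite element space `V_h` of continuous, piecewise affine functions
on `S_h` (as functions `E3 → ℝ`; only the values on `S_h` are relevant). -/
def IsVh (v : E3 → ℝ) : Prop :=
  ContinuousOn v Tr.Sh ∧
  ∀ t ∈ Tr.T, ∃ (L : E3 →ₗ[ℝ] ℝ) (c : ℝ), ∀ x ∈ triOf t, v x = L x + c


/-- The discrete bilinear form
`a_h(v,w) = ∫_{S_h} (⟨∇_{S_h} v, ∇_{S_h} w⟩ + v w)`, computed triangle by triangle. -/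
def ahForm (v w : E3 → ℝ) : ℝ :=
  ∑ t ∈ Tr.T, ∫ x in triOf t,
    (⟪gradTri t v x, gradTri t w x⟫ + v x * w x) ∂μH[2]

/-- The lift of a function on `S_h` to a function on `S` via the inverse of `a|_{S_h}`. -/
def liftS (w : E3 → ℝ) : E3 → ℝ := fun y => w (Function.invFunOn Tr.a Tr.Sh y)

/-- The lift of `f : S → ℝ` to `S_h` is `f ∘ a`. -/
def liftSh (f : E3 → ℝ) : E3 → ℝ := fun x => f (Tr.a x)

end Triangulation

/-- `f` is smooth in a neighbourhood of the set `A`. -/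
def SmoothNear (f : E3 → ℝ) (A : Set E3) : Prop :=
  ∃ V : Set E3, IsOpen V ∧ A ⊆ V ∧ ContDiffOn ℝ (⊤ : ℕ∞) f V

/-- `u` is the (weak, hence smooth) solution of `-Δ_S u + u = f` on the surface `Srf`. -/
def IsSolution (Srf : SmoothSurface) (f u : E3 → ℝ) : Prop :=
  SmoothNear u Srf.S ∧
  ∀ φ : E3 → ℝ, ContDiff ℝ (⊤ : ℕ∞) φ → Srf.aForm u φ = ∫ x in Srf.S, f x * φ x ∂μH[2]

/-- `uh` is the discrete Galerkin solution in `V_h` with data the lift `f ∘ a` of `f`. -/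
def Triangulation.IsDiscreteSolution {Srf : SmoothSurface} {γ₀ h : ℝ}
    (Tr : Triangulation Srf γ₀ h) (f uh : E3 → ℝ) : Prop :=
  Tr.IsVh uh ∧
  ∀ φh : E3 → ℝ, Tr.IsVh φh →
    Tr.ahForm uh φh = ∫ x in Tr.Sh, f (Tr.a x) * φh x ∂μH[2]

/-- Orthogonal projection onto the affine tangent plane of `S` at `z₀`. -/
def SmoothSurface.P0 (Srf : SmoothSurface) (z₀ : E3) (x : E3) : E3 :=
  z₀ + (Submodule.orthogonalProjectionOnto (Srf.tangent z₀) (x - z₀) : E3)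

/-- `r(x) = ‖P₀(x) − z₀‖`, the distance of the tangential projection of `x` to `z₀`. -/
def SmoothSurface.rfn (Srf : SmoothSurface) (z₀ : E3) (x : E3) : ℝ :=
  ‖Srf.P0 z₀ x - z₀‖

/-- The affine tangent plane `z₀ + T_{z₀}S`. -/
def SmoothSurface.tplane (Srf : SmoothSurface) (z₀ : E3) : Set E3 :=
  {x : E3 | x - z₀ ∈ Srf.tangent z₀}

/-- The disk `D = B₁₀₀(z₀)` in the affine tangent plane at `z₀`. -/
def SmoothSurface.disk100 (Srf : SmoothSurface) (z₀ : E3) : Set E3 :=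
  Srf.tplane z₀ ∩ closedBall z₀ 100

/-- `r₁ > 0` is a graph radius for `S`: uniformly in `z₀ ∈ S`, the piece `B_{2r₁}(z₀) ∩ S`
is a graph over the tangent plane at `z₀`, in particular `P₀` is injective on it. -/
def SmoothSurface.IsGraphRadius (Srf : SmoothSurface) (r₁ : ℝ) : Prop :=
  0 < r₁ ∧ r₁ ≤ 1 ∧ ∀ z₀ ∈ Srf.S, Set.InjOn (Srf.P0 z₀) (Srf.S ∩ closedBall z₀ (2 * r₁))

/-- `ζ` is an admissible smooth cutoff at `z₀`: supported in the ball of radius `3r₁/2`,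
equal to `1` on the ball of radius `r₁`, with `C²`-bounds at most `Cζ` (uniform in `z₀`). -/
def IsCutoff (z₀ : E3) (r₁ Cζ : ℝ) (ζ : E3 → ℝ) : Prop :=
  ContDiff ℝ (⊤ : ℕ∞) ζ ∧ tsupport ζ ⊆ closedBall z₀ (3 / 2 * r₁) ∧
  (∀ x ∈ closedBall z₀ r₁, ζ x = 1) ∧
  ∀ x : E3, |ζ x| + ‖fderiv ℝ ζ x‖ + ‖fderiv ℝ (fderiv ℝ ζ) x‖ ≤ Cζ

/-- `v` is the Neumann Green's function with pole `z₀` of `−Δ + 1` on the disk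
`D = B₁₀₀(z₀)` in the tangent plane at `z₀`: it is smooth away from the pole, satisfies
`∫_D (⟨∇v, ∇φ⟩ + v φ) = φ(z₀)` for every smooth test function, and differs from
`(1/2π) log‖· − z₀‖` by an `H²(D)`-function with norm at most `CG`. -/
def SmoothSurface.IsGreen (Srf : SmoothSurface) (z₀ : E3) (CG : ℝ) (v : E3 → ℝ) : Prop :=
  ContDiffOn ℝ (⊤ : ℕ∞) v (Srf.disk100 z₀ \ {z₀}) ∧
  (∀ φ : E3 → ℝ, ContDiff ℝ (⊤ : ℕ∞) φ →
    ∫ x in Srf.disk100 z₀,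
      (⟪tGrad (Srf.disk100 z₀) (Srf.tangent z₀) v x,
        tGrad (Srf.disk100 z₀) (Srf.tangent z₀) φ x⟫ + v x * φ x) ∂μH[2] = φ z₀) ∧
  (∫ x in Srf.disk100 z₀,
      ((v x - (1 / (2 * Real.pi)) * Real.log ‖x - z₀‖) ^ 2 +
        ‖fderivWithin ℝ (fun y => v y - (1 / (2 * Real.pi)) * Real.log ‖y - z₀‖)
            (Srf.disk100 z₀) x‖ ^ 2 +
        ‖fderivWithin ℝ
            (fun y => fderivWithin ℝ
              (fun y' => v y' - (1 / (2 * Real.pi)) * Real.log ‖y' - z₀‖)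
              (Srf.disk100 z₀) y)
            (Srf.disk100 z₀) x‖ ^ 2) ∂μH[2]) ≤ CG

/-- The approximate Green's function `g̃(x) = ζ(x) v(P₀(x))` on `S`. -/
def approxGreen (Srf : SmoothSurface) (z₀ : E3) (ζ v : E3 → ℝ) : E3 → ℝ :=
  fun x => ζ x * v (Srf.P0 z₀ x)

/-- The cut-off lifted logarithm `l̃(x) = ζ(x) log r(x)` on `S`. -/
def cutLog (Srf : SmoothSurface) (z₀ : E3) (ζ : E3 → ℝ) : E3 → ℝ :=
  fun x => ζ x * Real.log (Srf.rfn z₀ x)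

/-- `lh` is the discrete (Galerkin) projection of the function `w` on `S`:
`a_h(lh, v_h) = a(w, V_h)` for all `v_h ∈ V_h`, where `V_h` is the lift of `v_h` to `S`. -/
def Triangulation.IsDiscreteProjection {Srf : SmoothSurface} {γ₀ h : ℝ}
    (Tr : Triangulation Srf γ₀ h) (w lh : E3 → ℝ) : Prop :=
  Tr.IsVh lh ∧ ∀ vh : E3 → ℝ, Tr.IsVh vh → Tr.ahForm lh vh = Srf.aForm w (Tr.liftS vh)


section

/-- A global smooth map which is the nearest point projection close to the surface. -/
structure Tube (Srf : SmoothSurface) where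
  A : E3 → E3
  L : ℝ
  δ : ℝ
  hL : 1 ≤ L
  hδ : 0 < δ
  hδ1 : δ ≤ 1
  smooth : ContDiff ℝ (⊤ : ℕ∞) A
  lip : ∀ x y, ‖A x - A y‖ ≤ L * ‖x - y‖
  dlip : ∀ x y, ‖fderiv ℝ A x - fderiv ℝ A y‖ ≤ L * ‖x - y‖
  mem : ∀ z, ∀ x ∈ Srf.S, dist z x < δ → A z ∈ Srf.S
  nearest : ∀ z, ∀ x ∈ Srf.S, dist z x < δ → ∀ y ∈ Srf.S, dist z (A z) ≤ dist z y
  unique : ∀ z, ∀ x ∈ Srf.S, dist z x < δ → ∀ y ∈ Srf.S, dist z y = dist z (A z) → y = A z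

theorem exists_tube {Srf : SmoothSurface} {γ₀ h : ℝ} (Tr : Triangulation Srf γ₀ h) :
    Nonempty (Tube Srf) := by
  obtain ⟨δ', hδ', hsub⟩ := Srf.compact.exists_cthickening_subset_open Tr.N_open Tr.S_sub
  have hd : Disjoint (Metric.thickening δ' Srf.S)ᶜ (cthickening (δ'/2) Srf.S) := by
    rw [Set.disjoint_compl_left_iff_subset]
    exact cthickening_subset_thickening' hδ' (by linarith) _
  obtain ⟨χ, h0, h1, -⟩ := exists_contMDiffMap_zero_one_of_isClosed (n := (⊤ : ℕ∞))
    (modelWithCornersSelf ℝ E3)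
    (isOpen_thickening.isClosed_compl) (isClosed_cthickening) hd
  have hχ : ContDiff ℝ (⊤ : ℕ∞) (χ : E3 → ℝ) := χ.contMDiff.contDiff
  have hcl : tsupport (χ : E3 → ℝ) ⊆ cthickening δ' Srf.S := by
    apply closure_minimal _ isClosed_cthickening
    intro x hx
    apply thickening_subset_cthickening
    by_contra hc
    exact hx (h0 hc)
  set A : E3 → E3 := fun x => χ x • Tr.a x with hA
  have hAs : ContDiff ℝ (⊤ : ℕ∞) A := by
    rw [contDiff_iff_contDiffAt]
    intro x
    by_cases hx : x ∈ tsupport (χ : E3 → ℝ)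
    · have hN : x ∈ Tr.N := hsub (hcl hx)
      exact hχ.contDiffAt.smul (Tr.a_smooth.contDiffAt (Tr.N_open.mem_nhds hN))
    · have : A =ᶠ[nhds x] fun _ => 0 := by
        have := (isClosed_tsupport (χ : E3 → ℝ)).isOpen_compl.mem_nhds hx
        filter_upwards [this] with y hy
        have h5 : χ y = 0 := image_eq_zero_of_notMem_tsupport hy
        simp [hA, h5]
      exact contDiffAt_const.congr_of_eventuallyEq this
  have hAc : HasCompactSupport A := by
    apply HasCompactSupport.intro (Srf.compact.cthickening (r := δ'))
    intro x hx
    have : x ∉ tsupport (χ : E3 → ℝ) := fun h => hx (hcl h)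
    have h5 : χ x = 0 := image_eq_zero_of_notMem_tsupport this
    simp [hA, h5]
  obtain ⟨L1, hL1⟩ := hAs.lipschitzWith_of_hasCompactSupport hAc (by simp)
  have hAd : ContDiff ℝ (⊤ : ℕ∞) (fderiv ℝ A) := hAs.fderiv_right (by simp)
  obtain ⟨L2, hL2⟩ := hAd.lipschitzWith_of_hasCompactSupport (hAc.fderiv (𝕜 := ℝ)) (by simp)
  have hin : ∀ z, ∀ x ∈ Srf.S, dist z x < min 1 (δ'/2) → z ∈ Tr.N ∧ A z = Tr.a z := by
    intro z x hx hz
    have h2 : z ∈ cthickening (δ'/2) Srf.S := by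
      apply thickening_subset_cthickening
      rw [mem_thickening_iff]
      exact ⟨x, hx, lt_of_lt_of_le hz (min_le_right _ _)⟩
    refine ⟨hsub (cthickening_mono (by linarith) _ h2), ?_⟩
    have := h1 h2
    simp only [Pi.one_apply] at this
    simp [hA, this]
  refine ⟨⟨A, max 1 (max L1 L2), min 1 (δ'/2), le_max_left _ _, by positivity, min_le_left _ _, hAs,
    ?_, ?_, ?_, ?_, ?_⟩⟩
  · intro x y
    have := hL1.dist_le_mul x y
    rw [dist_eq_norm, dist_eq_norm] at this
    refine this.trans (mul_le_mul_of_nonneg_right ?_ (norm_nonneg _))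
    exact (le_max_left _ _).trans (le_max_right _ _)
  · intro x y
    have := hL2.dist_le_mul x y
    rw [dist_eq_norm, dist_eq_norm] at this
    refine this.trans (mul_le_mul_of_nonneg_right ?_ (norm_nonneg _))
    exact (le_max_right _ _).trans (le_max_right _ _)
  · intro z x hx hz
    obtain ⟨hN, ha⟩ := hin z x hx hz
    rw [ha]; exact Tr.a_mem z hN
  · intro z x hx hz
    obtain ⟨hN, ha⟩ := hin z x hx hz
    rw [ha]; exact Tr.a_nearest z hN
  · intro z x hx hz
    obtain ⟨hN, ha⟩ := hin z x hx hz
    rw [ha]; exact Tr.a_unique z hN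

end

section

namespace Tube
variable {Srf : SmoothSurface} (𝒯 : Tube Srf)

/-- derivative of the projection -/
def D (z : E3) : E3 →L[ℝ] E3 := fderiv ℝ 𝒯.A z

/-- tubular neighbourhood -/
def U : Set E3 := Metric.thickening 𝒯.δ Srf.S

theorem mem_U {z : E3} : z ∈ 𝒯.U ↔ ∃ x ∈ Srf.S, dist z x < 𝒯.δ := mem_thickening_iff

theorem U_open : IsOpen 𝒯.U := isOpen_thickening

theorem S_sub_U {x : E3} (hx : x ∈ Srf.S) : x ∈ 𝒯.U :=
  𝒯.mem_U.2 ⟨x, hx, by simpa using 𝒯.hδ⟩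

theorem L_pos : 0 < 𝒯.L := lt_of_lt_of_le one_pos 𝒯.hL

theorem A_mem {z : E3} (hz : z ∈ 𝒯.U) : 𝒯.A z ∈ Srf.S := by
  obtain ⟨x, hx, h⟩ := 𝒯.mem_U.1 hz
  exact 𝒯.mem z x hx h

theorem A_nearest {z : E3} (hz : z ∈ 𝒯.U) {y : E3} (hy : y ∈ Srf.S) :
    ‖z - 𝒯.A z‖ ≤ ‖z - y‖ := by
  obtain ⟨x, hx, h⟩ := 𝒯.mem_U.1 hz
  simpa [dist_eq_norm] using 𝒯.nearest z x hx h y hy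

theorem fix {x : E3} (hx : x ∈ Srf.S) : 𝒯.A x = x := by
  have := 𝒯.A_nearest (𝒯.S_sub_U hx) hx
  simp only [sub_self, norm_zero, norm_le_zero_iff] at this
  exact (sub_eq_zero.1 this).symm

theorem mem_U_of {z x : E3} (hx : x ∈ Srf.S) (h : ‖z - x‖ < 𝒯.δ) : z ∈ 𝒯.U :=
  𝒯.mem_U.2 ⟨x, hx, by rwa [dist_eq_norm]⟩

theorem diff (z : E3) : DifferentiableAt ℝ 𝒯.A z :=
  𝒯.smooth.contDiffAt.differentiableAt (by simp)

theorem hasD (z : E3) : HasFDerivAt 𝒯.A (𝒯.D z) z := (𝒯.diff z).hasFDerivAt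

theorem cont : Continuous 𝒯.A := 𝒯.smooth.continuous

theorem D_cont : Continuous 𝒯.D := 𝒯.smooth.continuous_fderiv (by simp)

theorem D_norm (z : E3) : ‖𝒯.D z‖ ≤ 𝒯.L :=
  norm_fderiv_le_of_lip' ℝ 𝒯.L_pos.le (Filter.Eventually.of_forall fun x => 𝒯.lip x z)

theorem D_lip (x y : E3) : ‖𝒯.D x - 𝒯.D y‖ ≤ 𝒯.L * ‖x - y‖ := 𝒯.dlip x y

theorem D_le (z w : E3) : ‖𝒯.D z w‖ ≤ 𝒯.L * ‖w‖ :=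
  ((𝒯.D z).le_opNorm w).trans (mul_le_mul_of_nonneg_right (𝒯.D_norm z) (norm_nonneg _))

theorem D_lip_apply (x y w : E3) : ‖𝒯.D x w - 𝒯.D y w‖ ≤ 𝒯.L * ‖x - y‖ * ‖w‖ := by
  have := (𝒯.D x - 𝒯.D y).le_opNorm w
  exact this.trans (mul_le_mul_of_nonneg_right (𝒯.D_lip x y) (norm_nonneg _))

theorem taylor {x y z : E3} {ρ : ℝ} (hy : ‖y - x‖ ≤ ρ) (hz : ‖z - x‖ ≤ ρ) :
    ‖𝒯.A y - 𝒯.A z - 𝒯.D x (y - z)‖ ≤ 𝒯.L * ρ * ‖y - z‖ := by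
  have hc : Convex ℝ (closedBall x ρ) := convex_closedBall x ρ
  refine hc.norm_image_sub_le_of_norm_hasFDerivWithin_le' (f' := 𝒯.D)
    (fun w _ => (𝒯.hasD w).hasFDerivWithinAt) (fun w hw => ?_)
    (by simpa [dist_eq_norm] using hz) (by simpa [dist_eq_norm] using hy)
  refine (𝒯.D_lip w x).trans (mul_le_mul_of_nonneg_left ?_ 𝒯.L_pos.le)
  simpa [dist_eq_norm] using hw

theorem second_diff (x y p : E3) :
    ‖(𝒯.A (x + p) - 𝒯.A x) - (𝒯.A (y + p) - 𝒯.A y)‖ ≤ 𝒯.L * ‖p‖ * ‖x - y‖ := by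
  refine (convex_univ).norm_image_sub_le_of_norm_hasFDerivWithin_le
    (f := fun x => 𝒯.A (x + p) - 𝒯.A x) (f' := fun x => 𝒯.D (x + p) - 𝒯.D x) ?_ ?_
    (Set.mem_univ y) (Set.mem_univ x)
  · intro w _
    apply HasFDerivAt.hasFDerivWithinAt
    have h1 : HasFDerivAt (fun x => 𝒯.A (x + p)) (𝒯.D (w + p)) w := by
      have := (𝒯.hasD (w + p)).comp w ((hasFDerivAt_id w).add_const p)
      simpa [Function.comp_def] using this
    exact h1.sub (𝒯.hasD w)
  · intro w _
    simpa using 𝒯.D_lip (w + p) w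

theorem idem {z : E3} (hz : z ∈ 𝒯.U) : 𝒯.A (𝒯.A z) = 𝒯.A z := 𝒯.fix (𝒯.A_mem hz)

theorem A_eq_ev {z : E3} (hz : z ∈ 𝒯.U) : ∀ᶠ w in nhds z, 𝒯.A (𝒯.A w) = 𝒯.A w :=
  Filter.mem_of_superset (𝒯.U_open.mem_nhds hz) fun _ hw => 𝒯.idem hw

theorem D_comp {z : E3} (hz : z ∈ 𝒯.U) (w : E3) : 𝒯.D (𝒯.A z) (𝒯.D z w) = 𝒯.D z w := by
  have h1 : HasFDerivAt (𝒯.A ∘ 𝒯.A) ((𝒯.D (𝒯.A z)).comp (𝒯.D z)) z :=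
    (𝒯.hasD (𝒯.A z)).comp z (𝒯.hasD z)
  have h2 : HasFDerivAt (𝒯.A ∘ 𝒯.A) (𝒯.D z) z :=
    (𝒯.hasD z).congr_of_eventuallyEq (𝒯.A_eq_ev hz)
  exact DFunLike.congr_fun (h1.unique h2) w

theorem A_dist {z x : E3} (hz : z ∈ 𝒯.U) (hx : x ∈ Srf.S) : ‖𝒯.A z - x‖ ≤ 2 * ‖z - x‖ := by
  have h1 := 𝒯.A_nearest hz hx
  have h2 : 𝒯.A z - x = (z - x) - (z - 𝒯.A z) := by abel
  rw [h2]
  refine (norm_sub_le _ _).trans ?_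
  linarith

end Tube

theorem SmoothSurface.gradF {Srf : SmoothSurface} {x : E3} (hx : x ∈ Srf.S) :
    ∃ U : Set E3, ∃ F : E3 → ℝ, IsOpen U ∧ x ∈ U ∧ ContDiff ℝ (⊤ : ℕ∞) F ∧
      (∀ y ∈ U, (y ∈ Srf.S ↔ F y = 0)) ∧
      ∀ y ∈ U, y ∈ Srf.S → ∃ t : ℝ, t ≠ 0 ∧ ∀ w, fderiv ℝ F y w = t * ⟪Srf.n y, w⟫ := by
  obtain ⟨U, F, hU, hxU, hF, hS, hg, ht⟩ := Srf.localLevel x hx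
  refine ⟨U, F, hU, hxU, hF, ?_, ?_⟩
  · intro y hy
    constructor
    · intro h
      have : y ∈ Srf.S ∩ U := ⟨h, hy⟩
      rw [hS] at this
      exact this.2
    · intro h
      have : y ∈ {y ∈ U | F y = 0} := ⟨hy, h⟩
      rw [← hS] at this
      exact this.1
  · intro y hy hyS
    obtain ⟨t, h⟩ := ht y ⟨hyS, hy⟩
    refine ⟨t, ?_, ?_⟩
    · rintro rfl
      exact hg y hy (by simpa using h)
    · intro w
      have : fderiv ℝ F y w = ⟪gradient F y, w⟫ := by
        rw [gradient, InnerProductSpace.toDual_symm_apply]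
      rw [this, h, real_inner_smul_left]

namespace Tube
variable {Srf : SmoothSurface} (𝒯 : Tube Srf)

theorem n_inner_self {x : E3} (hx : x ∈ Srf.S) : ⟪Srf.n x, Srf.n x⟫ = 1 := by
  rw [real_inner_self_eq_norm_sq, Srf.n_unit x hx]; norm_num

/-- the range of the derivative is tangential -/
theorem n_D {z : E3} (hz : z ∈ 𝒯.U) (w : E3) : ⟪Srf.n (𝒯.A z), 𝒯.D z w⟫ = 0 := by
  obtain ⟨U, F, hU, hxU, hF, hS, ht⟩ := SmoothSurface.gradF (𝒯.A_mem hz)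
  obtain ⟨t, ht0, hft⟩ := ht _ hxU (𝒯.A_mem hz)
  have hFd : HasFDerivAt F (fderiv ℝ F (𝒯.A z)) (𝒯.A z) :=
    (hF.contDiffAt.differentiableAt (by simp)).hasFDerivAt
  have h1 := hFd.comp z (𝒯.hasD z)
  have h2 : HasFDerivAt (F ∘ 𝒯.A) (0 : E3 →L[ℝ] ℝ) z := by
    apply (hasFDerivAt_const (0:ℝ) z).congr_of_eventuallyEq
    filter_upwards [𝒯.U_open.mem_nhds hz, 𝒯.cont.continuousAt.preimage_mem_nhds (hU.mem_nhds hxU)]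
      with y hy hy2
    exact (hS _ hy2).1 (𝒯.A_mem hy)
  have h3 := DFunLike.congr_fun (h1.unique h2) w
  simp only [ContinuousLinearMap.comp_apply, zero_apply, hft] at h3
  exact (mul_eq_zero.1 h3).resolve_left ht0

theorem normal {z : E3} (hz : z ∈ 𝒯.U) :
    z - 𝒯.A z = ⟪Srf.n (𝒯.A z), z - 𝒯.A z⟫ • Srf.n (𝒯.A z) := by
  obtain ⟨U, F, hU, hxU, hF, hS, ht⟩ := SmoothSurface.gradF (𝒯.A_mem hz)
  obtain ⟨t, ht0, hft⟩ := ht _ hxU (𝒯.A_mem hz)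
  set y := 𝒯.A z with hy
  have hyS : y ∈ Srf.S := 𝒯.A_mem hz
  have hFd : HasStrictFDerivAt F (fderiv ℝ F y) y :=
    hF.contDiffAt.hasStrictFDerivAt (by simp)
  have hφ : HasStrictFDerivAt (fun x : E3 => ‖x - z‖ ^ 2) (2 • (innerSL ℝ (y - z))) y := by
    have := (hasStrictFDerivAt_norm_sq (y - z)).comp y ((hasStrictFDerivAt_id y).sub_const z)
    simpa only [id, ContinuousLinearMap.comp_id] using this
  have hext : IsLocalExtrOn (fun x : E3 => ‖x - z‖ ^ 2) {x | F x = F y} y := by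
    left
    have : U ∈ nhdsWithin y {x | F x = F y} := mem_nhdsWithin_of_mem_nhds (hU.mem_nhds hxU)
    filter_upwards [this, self_mem_nhdsWithin] with x hxU' hxF
    have hxS : x ∈ Srf.S := by
      rw [hS x hxU']
      exact Eq.trans hxF ((hS y hxU).1 hyS)
    have := 𝒯.A_nearest hz hxS
    rw [norm_sub_rev y z, norm_sub_rev x z]
    gcongr
  obtain ⟨a, b, hab, h⟩ := hext.exists_multipliers_of_hasStrictFDerivAt_1d hFd hφ
  have h' : ∀ w, a * (t * ⟪Srf.n y, w⟫) + b * (2 * ⟪y - z, w⟫) = 0 := by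
    intro w
    have := DFunLike.congr_fun h w
    simpa [hft, -map_sub, -inner_sub_left] using this
  have hb : b ≠ 0 := by
    rintro rfl
    have := h' (Srf.n y)
    rw [n_inner_self hyS] at this
    simp [ht0] at this
    exact hab (by simp [this])
  have h3 : z - y = (a * t / (2 * b)) • Srf.n y := by
    apply ext_inner_right ℝ
    intro w
    have := h' w
    rw [real_inner_smul_left]
    have e : ⟪z - y, w⟫ = - ⟪y - z, w⟫ := by rw [← inner_neg_left]; simp
    rw [e]
    field_simp
    linarith
  have h4 : ⟪Srf.n y, z - y⟫ = a * t / (2 * b) := by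
    rw [h3, real_inner_smul_right, n_inner_self hyS, mul_one]
  rw [h4]
  exact h3

theorem n_diff {x : E3} (hx : x ∈ Srf.S) : DifferentiableAt ℝ Srf.n x := by
  obtain ⟨U, hU, hSU, hn⟩ := Srf.n_smooth
  exact (hn.contDiffAt (hU.mem_nhds (hSU hx))).differentiableAt (by simp)

theorem D_apply {x : E3} (hx : x ∈ Srf.S) (w : E3) :
    𝒯.D x w = w - ⟪Srf.n x, w⟫ • Srf.n x := by
  have hA := 𝒯.fix hx
  have hn : HasFDerivAt (fun z => Srf.n (𝒯.A z)) ((fderiv ℝ Srf.n x).comp (𝒯.D x)) x := by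
    have h0 : HasFDerivAt Srf.n (fderiv ℝ Srf.n x) (𝒯.A x) := by
      rw [hA]; exact (n_diff hx).hasFDerivAt
    exact h0.comp x (𝒯.hasD x)
  have hid : HasFDerivAt (fun z => z - 𝒯.A z) (ContinuousLinearMap.id ℝ E3 - 𝒯.D x) x :=
    (hasFDerivAt_id x).sub (𝒯.hasD x)
  have h2 := (hn.inner ℝ hid).smul hn
  have h3 : HasFDerivAt (fun z => z - 𝒯.A z) _ x := h2.congr_of_eventuallyEq
    (Filter.mem_of_superset (𝒯.U_open.mem_nhds (𝒯.S_sub_U hx)) fun z hz => 𝒯.normal hz)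
  have h4 := DFunLike.congr_fun (hid.unique h3) w
  have h5 := 𝒯.n_D (𝒯.S_sub_U hx) w
  rw [hA] at h5
  simp [hA, fderivInnerCLM_apply, inner_sub_right, h5] at h4
  rw [← h4]; abel

theorem normality {z : E3} (hz : z ∈ 𝒯.U) (w : E3) : ⟪z - 𝒯.A z, 𝒯.D (𝒯.A z) w⟫ = 0 := by
  rw [𝒯.normal hz, real_inner_smul_left]
  have := 𝒯.n_D (𝒯.S_sub_U (𝒯.A_mem hz)) w
  rw [𝒯.idem hz] at this
  rw [this, mul_zero]

theorem D_symm {x : E3} (hx : x ∈ Srf.S) (v w : E3) : ⟪𝒯.D x v, w⟫ = ⟪v, 𝒯.D x w⟫ := by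
  rw [𝒯.D_apply hx, 𝒯.D_apply hx, inner_sub_left, inner_sub_right, real_inner_smul_left,
    real_inner_smul_right, real_inner_comm (Srf.n x) v]
  ring

theorem D_proj_norm {x : E3} (hx : x ∈ Srf.S) (w : E3) : ‖𝒯.D x w‖ ≤ ‖w‖ := by
  have h1 : ⟪𝒯.D x w, 𝒯.D x w⟫ = ⟪w, 𝒯.D x w⟫ := by
    have h := 𝒯.D_comp (𝒯.S_sub_U hx) w
    rw [𝒯.fix hx] at h
    rw [𝒯.D_symm hx, h]
  rw [real_inner_self_eq_norm_sq] at h1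
  have h2 := real_inner_le_norm w (𝒯.D x w)
  by_cases h0 : ‖𝒯.D x w‖ = 0
  · rw [h0]; positivity
  · have : 0 < ‖𝒯.D x w‖ := lt_of_le_of_ne (norm_nonneg _) (Ne.symm h0)
    nlinarith

theorem tangent_mem {x : E3} {v : E3} :
    v ∈ Srf.tangent x ↔ ⟪Srf.n x, v⟫ = 0 := Submodule.mem_orthogonal_singleton_iff_inner_right

theorem D_tangent {x : E3} (hx : x ∈ Srf.S) {v : E3} (hv : v ∈ Srf.tangent x) : 𝒯.D x v = v := by
  rw [𝒯.D_apply hx, tangent_mem.1 hv]; simp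

theorem D_mem_tangent {x : E3} (hx : x ∈ Srf.S) (v : E3) : 𝒯.D x v ∈ Srf.tangent x := by
  have := 𝒯.n_D (𝒯.S_sub_U hx) v
  rw [𝒯.fix hx] at this
  exact tangent_mem.2 this

theorem D_eq_proj {x : E3} (hx : x ∈ Srf.S) (v : E3) :
    (Submodule.orthogonalProjectionOnto (Srf.tangent x) v : E3) = 𝒯.D x v := by
  rw [← Submodule.starProjection_apply]
  apply Submodule.eq_starProjection_of_mem_of_inner_eq_zero (𝒯.D_mem_tangent hx v)
  intro w hw
  rw [𝒯.D_apply hx]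
  simp only [sub_sub_cancel, real_inner_smul_left]
  rw [tangent_mem.1 hw, mul_zero]

/-- surface points are nearly tangential to each other -/
theorem normal_small {x y z ν : E3} {ρ : ℝ} (hyS : y ∈ Srf.S) (hzS : z ∈ Srf.S)
    (hν : ∀ w, ⟪ν, 𝒯.D x w⟫ = 0) (hy : ‖y - x‖ ≤ ρ) (hz : ‖z - x‖ ≤ ρ) :
    |⟪ν, y - z⟫| ≤ 𝒯.L * ρ * ‖ν‖ * ‖y - z‖ := by
  have h := 𝒯.taylor hy hz
  rw [𝒯.fix hyS, 𝒯.fix hzS] at h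
  have h1 : ⟪ν, y - z⟫ = ⟪ν, y - z - 𝒯.D x (y - z)⟫ := by
    rw [inner_sub_right ν (y - z), hν, sub_zero]
  rw [h1]
  refine (abs_real_inner_le_norm _ _).trans ?_
  calc _ ≤ ‖ν‖ * (𝒯.L * ρ * ‖y - z‖) := by gcongr
    _ = _ := by ring

end Tube

end

section

theorem haus_le {X Y : Type*} [MetricSpace X] [MeasurableSpace X] [BorelSpace X]
    [MetricSpace Y] [MeasurableSpace Y] [BorelSpace Y] {W : Set X} (φ : X → Y) {Λ : ℝ} (hΛ : 0 ≤ Λ)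
    (h : ∀ x ∈ W, ∀ y ∈ W, dist x y ≤ Λ * dist (φ x) (φ y)) :
    μH[2] W ≤ ENNReal.ofReal (Λ ^ 2) * μH[2] (φ '' W) := by
  rcases W.eq_empty_or_nonempty with rfl | ⟨x0, hx0⟩
  · simp
  have : Nonempty X := ⟨x0⟩
  have hinj : Set.InjOn φ W := by
    intro x hx y hy hxy
    have := h x hx y hy
    rw [hxy, dist_self, mul_zero] at this
    exact dist_le_zero.1 this
  have hl : LipschitzOnWith Λ.toNNReal (Function.invFunOn φ W) (φ '' W) := by
    apply LipschitzOnWith.of_dist_le_mul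
    rintro _ ⟨x, hx, rfl⟩ _ ⟨y, hy, rfl⟩
    rw [hinj.leftInvOn_invFunOn hx, hinj.leftInvOn_invFunOn hy, Real.coe_toNNReal _ hΛ]
    exact h x hx y hy
  have h2 := hl.hausdorffMeasure_image_le (d := 2) (by norm_num)
  rw [hinj.leftInvOn_invFunOn.image_image] at h2
  refine h2.trans (le_of_eq ?_)
  congr 1
  rw [ENNReal.ofReal_pow hΛ]
  simp [ENNReal.ofReal]

theorem map_le {X Y : Set E3} {φ : E3 → E3} (hφ : Measurable φ)
    (hm : Set.MapsTo φ X Y) {Λ : ℝ} (hΛ : 0 ≤ Λ)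
    (h : ∀ x ∈ X, ∀ y ∈ X, ‖x - y‖ ≤ Λ * ‖φ x - φ y‖) :
    (μH[2].restrict X).map φ ≤ ENNReal.ofReal (Λ ^ 2) • (μH[2] : Measure E3).restrict Y := by
  rw [Measure.le_iff]
  intro E hE
  rw [Measure.map_apply hφ hE, Measure.restrict_apply (hφ hE), Measure.smul_apply,
    Measure.restrict_apply hE, smul_eq_mul]
  refine (haus_le φ hΛ (W := φ ⁻¹' E ∩ X) ?_).trans ?_
  · intro x hx y hy
    rw [dist_eq_norm, dist_eq_norm]
    exact h x hx.2 y hy.2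
  · gcongr
    rintro _ ⟨x, ⟨hx1, hx2⟩, rfl⟩
    exact ⟨hx1, hm hx2⟩

theorem seg_null (v w : E3) : μH[2] (segment ℝ v w) = 0 := by
  rcases Measure.hausdorffMeasure_zero_or_top (d₁ := 1) (d₂ := 2) (by norm_num) (segment ℝ v w) with h | h
  · exact h
  · rw [hausdorffMeasure_segment] at h
    exact absurd h (edist_ne_top _ _)

theorem integral_compare {Ω : Type*} [MeasurableSpace Ω] {μ ν : Measure Ω} {ε : ℝ} (hε : 0 ≤ ε)
    (h1 : ν ≤ ENNReal.ofReal (1 + ε) • μ) (h2 : μ ≤ ENNReal.ofReal (1 + ε) • ν) {g : Ω → ℝ}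
    (hg : Integrable g μ) : |∫ x, g x ∂ν - ∫ x, g x ∂μ| ≤ ε * ∫ x, |g x| ∂μ := by
  have hgν : Integrable g ν := (hg.smul_measure (c := ENNReal.ofReal (1 + ε)) (by simp)).mono_measure h1
  have key : ∀ f : Ω → ℝ, (∀ x, 0 ≤ f x) → Integrable f μ → Integrable f ν →
      |∫ x, f x ∂ν - ∫ x, f x ∂μ| ≤ ε * ∫ x, f x ∂μ := by
    intro f hf hfμ hfν
    have e1 : ∫ x, f x ∂ν ≤ (1 + ε) * ∫ x, f x ∂μ := by
      have := integral_mono_measure h1 (Filter.Eventually.of_forall hf)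
        (hfμ.smul_measure (by simp))
      rwa [integral_smul_measure, ENNReal.toReal_ofReal (by linarith), smul_eq_mul] at this
    have e2 : ∫ x, f x ∂μ ≤ (1 + ε) * ∫ x, f x ∂ν := by
      have := integral_mono_measure h2 (Filter.Eventually.of_forall hf)
        (hfν.smul_measure (by simp))
      rwa [integral_smul_measure, ENNReal.toReal_ofReal (by linarith), smul_eq_mul] at this
    have p1 : 0 ≤ ∫ x, f x ∂μ := integral_nonneg hf
    have p2 : 0 ≤ ∫ x, f x ∂ν := integral_nonneg hf
    rw [abs_le]
    constructor
    · nlinarith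
    · linarith
  have hp := key (fun x => max (g x) 0) (fun x => le_max_right _ _) hg.pos_part hgν.pos_part
  have hn := key (fun x => max (-g x) 0) (fun x => le_max_right _ _) hg.neg_part hgν.neg_part
  have d1 : ∀ x, g x = max (g x) 0 - max (-g x) 0 := by
    intro x
    rcases le_total 0 (g x) with h | h <;> simp [h]
  have d2 : ∀ x, |g x| = max (g x) 0 + max (-g x) 0 := by
    intro x
    rcases le_total 0 (g x) with h | h <;> simp [h, abs_of_nonneg, abs_of_nonpos]
  have i1 : ∫ x, g x ∂ν = ∫ x, max (g x) 0 ∂ν - ∫ x, max (-g x) 0 ∂ν := by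
    rw [← integral_sub hgν.pos_part hgν.neg_part]
    exact integral_congr_ae (Filter.Eventually.of_forall d1)
  have i2 : ∫ x, g x ∂μ = ∫ x, max (g x) 0 ∂μ - ∫ x, max (-g x) 0 ∂μ := by
    rw [← integral_sub hg.pos_part hg.neg_part]
    exact integral_congr_ae (Filter.Eventually.of_forall d1)
  have i3 : ∫ x, |g x| ∂μ = ∫ x, max (g x) 0 ∂μ + ∫ x, max (-g x) 0 ∂μ := by
    rw [← integral_add hg.pos_part hg.neg_part]
    exact integral_congr_ae (Filter.Eventually.of_forall d2)
  rw [i1, i2, i3]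
  rw [abs_le] at hp hn ⊢
  constructor <;> linarith [hp.1, hp.2, hn.1, hn.2]

/-- orthonormal coordinates on a plane -/
theorem plane_coords (P : Submodule ℝ E3) (hP : Module.finrank ℝ P = 2) :
    ∃ b : Fin 2 → E3, (∀ i, b i ∈ P) ∧ Orthonormal ℝ b ∧
      ∀ w ∈ P, w = ⟪b 0, w⟫ • b 0 + ⟪b 1, w⟫ • b 1 := by
  let B : OrthonormalBasis (Fin 2) ℝ P := (stdOrthonormalBasis ℝ P).reindex (finCongr hP)
  refine ⟨fun i => (B i : E3), fun i => (B i).2, ?_, ?_⟩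
  · exact B.orthonormal.comp_linearIsometry P.subtypeₗᵢ
  · intro w hw
    have := B.sum_repr ⟨w, hw⟩
    have h2 := congrArg (Subtype.val) this
    simp only [Fin.sum_univ_two, B.repr_apply_apply] at h2
    exact h2.symm

theorem norm_sq_coords {b : Fin 2 → E3} (hb : Orthonormal ℝ b) {w : E3}
    (hw : w = ⟪b 0, w⟫ • b 0 + ⟪b 1, w⟫ • b 1) : ‖w‖ ^ 2 = ⟪b 0, w⟫ ^ 2 + ⟪b 1, w⟫ ^ 2 := by
  rw [← real_inner_self_eq_norm_sq]
  have h : ∀ v : E3, v = ⟪b 0, w⟫ • b 0 + ⟪b 1, w⟫ • b 1 →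
      ⟪v, w⟫ = ⟪b 0, w⟫ ^ 2 + ⟪b 1, w⟫ ^ 2 := by
    rintro v rfl
    rw [inner_add_left, real_inner_smul_left, real_inner_smul_left]
    ring
  exact h w hw

theorem plane_upper {W : Set E3} {P : Submodule ℝ E3} (hP : Module.finrank ℝ P = 2) {π : E3 →ₗ[ℝ] E3}
    (hπ : ∀ x, π x ∈ P) (hW : ∀ x ∈ W, ∀ y ∈ W, ‖x - y‖ ≤ 2 * ‖π (x - y)‖) {c : E3} {ρ : ℝ}
    (hρ : 0 ≤ ρ) (hc : ∀ x ∈ W, ‖π (x - c)‖ ≤ ρ) : μH[2] W ≤ ENNReal.ofReal (64 * ρ ^ 2) := by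
  obtain ⟨b, hbP, hb, hbw⟩ := plane_coords P hP
  let f : E3 → (Fin 2 → ℝ) := fun x i => ⟪b i, π x⟫
  have hsup : ∀ w, ‖π w‖ ≤ 2 * ‖f w‖ := by
    intro w
    have h1 := norm_sq_coords hb (hbw _ (hπ w))
    have h2 : |⟪b 0, π w⟫| ≤ ‖f w‖ := norm_le_pi_norm (f w) 0
    have h3 : |⟪b 1, π w⟫| ≤ ‖f w‖ := norm_le_pi_norm (f w) 1
    have h4 := sq_le_sq' (by linarith [neg_abs_le ⟪b 0, π w⟫]) ((le_abs_self _).trans h2)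
    have h5 := sq_le_sq' (by linarith [neg_abs_le ⟪b 1, π w⟫]) ((le_abs_self _).trans h3)
    have h6 : 0 ≤ ‖f w‖ := norm_nonneg _
    apply abs_le_of_sq_le_sq' _ (by positivity) |>.2
    nlinarith
  have hfs : ∀ x y, f x - f y = f (x - y) := by
    intro x y
    ext i
    simp [f, inner_sub_right]
  refine (haus_le f (W := W) (Λ := 4) (by norm_num) ?_).trans ?_
  · intro x hx y hy
    rw [dist_eq_norm, dist_eq_norm, hfs]
    linarith [hW x hx y hy, hsup (x - y)]
  · have hsub : f '' W ⊆ closedBall (f c) ρ := by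
      rintro _ ⟨x, hx, rfl⟩
      rw [mem_closedBall, dist_eq_norm, hfs, pi_norm_le_iff_of_nonneg hρ]
      intro i
      have := abs_real_inner_le_norm (b i) (π (x - c))
      rw [hb.1 i, one_mul] at this
      exact this.trans (hc x hx)
    have h1 : μH[2] (f '' W) ≤ ENNReal.ofReal ((2 * ρ) ^ 2) := by
      refine (measure_mono hsub).trans ?_
      have := hausdorffMeasure_pi_real (ι := Fin 2)
      simp only [Fintype.card_fin, Nat.cast_ofNat] at this
      rw [this, Real.volume_pi_closedBall _ hρ]
      simp
    calc ENNReal.ofReal (4 ^ 2) * μH[2] (f '' W)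
        ≤ ENNReal.ofReal (4 ^ 2) * ENNReal.ofReal ((2 * ρ) ^ 2) := by gcongr
      _ = ENNReal.ofReal (64 * ρ ^ 2) := by
        rw [← ENNReal.ofReal_mul (by norm_num)]; congr 1; ring

theorem plane_lower {W : Set E3} {P : Submodule ℝ E3} (hP : Module.finrank ℝ P = 2) {c : E3} {ρ : ℝ}
    (hρ : 0 ≤ ρ) (hc : ∀ τ ∈ P, ‖τ‖ ≤ ρ → c + τ ∈ W) : ENNReal.ofReal (ρ ^ 2) ≤ μH[2] W := by
  obtain ⟨b, hbP, hb, hbw⟩ := plane_coords P hP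
  let f : E3 → (Fin 2 → ℝ) := fun x i => ⟪b i, x⟫
  have hfs : ∀ x y, f x - f y = f (x - y) := by
    intro x y
    ext i
    simp [f, inner_sub_right]
  have hlip : LipschitzWith 1 f := by
    apply LipschitzWith.of_dist_le_mul
    intro x y
    rw [dist_eq_norm, dist_eq_norm, hfs, NNReal.coe_one, one_mul, pi_norm_le_iff_of_nonneg (norm_nonneg _)]
    intro i
    have := abs_real_inner_le_norm (b i) (x - y)
    rwa [hb.1 i, one_mul] at this
  have h1 := hlip.hausdorffMeasure_image_le (d := 2) (by norm_num) W
  simp only [ENNReal.coe_one, ENNReal.one_rpow, one_mul] at h1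
  refine le_trans ?_ h1
  have hsub : closedBall (f c) (ρ / 2) ⊆ f '' W := by
    intro q hq
    rw [mem_closedBall, dist_eq_norm, pi_norm_le_iff_of_nonneg (by positivity)] at hq
    have q0 := hq 0
    have q1 := hq 1
    simp only [Pi.sub_apply, Real.norm_eq_abs] at q0 q1
    set s := q 0 - f c 0 with hs
    set t := q 1 - f c 1 with ht
    have h01 : ⟪b 0, b 1⟫ = 0 := hb.2 (by decide)
    have h10 : ⟪b 1, b 0⟫ = 0 := hb.2 (by decide)
    have h00 : ⟪b 0, b 0⟫ = 1 := by rw [real_inner_self_eq_norm_sq, hb.1]; norm_num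
    have h11 : ⟪b 1, b 1⟫ = 1 := by rw [real_inner_self_eq_norm_sq, hb.1]; norm_num
    refine ⟨c + (s • b 0 + t • b 1), hc _ (P.add_mem (P.smul_mem _ (hbP 0)) (P.smul_mem _ (hbP 1))) ?_, ?_⟩
    · refine (norm_add_le _ _).trans ?_
      rw [norm_smul, norm_smul, hb.1, hb.1, Real.norm_eq_abs, Real.norm_eq_abs]
      linarith
    · ext i
      fin_cases i
      · simp [f, inner_add_right, real_inner_smul_right, hb.1, h01]
        rw [hs]; simp [f]
      · simp [f, inner_add_right, real_inner_smul_right, hb.1, h10]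
        rw [ht]; simp [f]
  refine le_trans ?_ (measure_mono hsub)
  have := hausdorffMeasure_pi_real (ι := Fin 2)
  simp only [Fintype.card_fin, Nat.cast_ofNat] at this
  rw [this, Real.volume_pi_closedBall _ (by positivity)]
  simp only [Fintype.card_fin]
  apply ENNReal.ofReal_le_ofReal
  apply le_of_eq; ring

theorem finrank_tangent {Srf : SmoothSurface} {x : E3} (hx : x ∈ Srf.S) :
    Module.finrank ℝ (Srf.tangent x) = 2 := by
  have : Fact (Module.finrank ℝ E3 = 2 + 1) := ⟨by simp⟩
  apply Submodule.finrank_orthogonal_span_singleton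
  intro h
  have := Srf.n_unit x hx
  rw [h] at this
  simp at this

/-- surface measure -/
def SmoothSurface.μ (Srf : SmoothSurface) : Measure E3 := (μH[2] : Measure E3).restrict Srf.S

namespace Tube
variable {Srf : SmoothSurface} (𝒯 : Tube Srf)

theorem mu_ball_small {x : E3} (hx : x ∈ Srf.S) {ρ : ℝ} (hρ : 0 ≤ ρ) (hρ1 : 𝒯.L * ρ ≤ 1 / 2) :
    μH[2] (Srf.S ∩ closedBall x ρ) ≤ ENNReal.ofReal (64 * ρ ^ 2) := by
  apply plane_upper (finrank_tangent hx) (π := (𝒯.D x : E3 →ₗ[ℝ] E3)) (c := x) _ _ hρ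
  · intro y hy
    simp only [mem_closedBall, dist_eq_norm, Set.mem_inter_iff] at hy
    exact (𝒯.D_proj_norm hx _).trans hy.2
  · exact fun y => 𝒯.D_mem_tangent hx y
  · intro y hy z hz
    simp only [mem_closedBall, dist_eq_norm, Set.mem_inter_iff] at hy hz
    have h := 𝒯.taylor hy.2 hz.2
    rw [𝒯.fix hy.1, 𝒯.fix hz.1] at h
    have h2 := norm_sub_norm_le (y - z) (𝒯.D x (y - z))
    have h3 : 𝒯.L * ρ * ‖y - z‖ ≤ 1 / 2 * ‖y - z‖ := by gcongr
    change ‖y - z‖ ≤ 2 * ‖𝒯.D x (y - z)‖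
    linarith

theorem mu_S_lt (𝒯 : Tube Srf) : μH[2] Srf.S < ⊤ := by
  apply Srf.compact.measure_lt_top_of_nhdsWithin
  intro x hx
  have hL := 𝒯.L_pos
  refine ⟨Srf.S ∩ closedBall x (1 / (2 * 𝒯.L)), ?_, ?_⟩
  · exact inter_mem_nhdsWithin _ (closedBall_mem_nhds x (by positivity))
  · refine (𝒯.mu_ball_small hx (by positivity) (le_of_eq ?_)).trans_lt ENNReal.ofReal_lt_top
    field_simp

theorem finite_μ (𝒯 : Tube Srf) : IsFiniteMeasure Srf.μ := ⟨by
  rw [SmoothSurface.μ, Measure.restrict_apply_univ]; exact 𝒯.mu_S_lt⟩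

theorem meas_S : MeasurableSet Srf.S := Srf.compact.measurableSet

theorem mu_ball (𝒯 : Tube Srf) : ∃ C > 0, ∀ x ∈ Srf.S, ∀ ρ, 0 ≤ ρ →
    Srf.μ (closedBall x ρ) ≤ ENNReal.ofReal (C * ρ ^ 2) := by
  have hL := 𝒯.L_pos
  refine ⟨64 + (μH[2] Srf.S).toReal * (2 * 𝒯.L) ^ 2, by positivity, ?_⟩
  intro x hx ρ hρ
  rw [SmoothSurface.μ, Measure.restrict_apply measurableSet_closedBall, Set.inter_comm]
  rcases le_total (𝒯.L * ρ) (1 / 2) with h | h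
  · refine (𝒯.mu_ball_small hx hρ h).trans (ENNReal.ofReal_le_ofReal ?_)
    gcongr
    have : 0 ≤ (μH[2] Srf.S).toReal * (2 * 𝒯.L) ^ 2 := by positivity
    linarith
  · refine (measure_mono Set.inter_subset_left).trans ?_
    refine (le_of_eq (ENNReal.ofReal_toReal 𝒯.mu_S_lt.ne).symm).trans ?_
    apply ENNReal.ofReal_le_ofReal
    have h1 : 1 ≤ (2 * 𝒯.L * ρ) ^ 2 := one_le_pow₀ (by linarith)
    have h2 : 0 ≤ (μH[2] Srf.S).toReal := ENNReal.toReal_nonneg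
    have h3 : 0 ≤ 64 * ρ ^ 2 := by positivity
    nlinarith [mul_le_mul_of_nonneg_left h1 h2]

end Tube

end

section

theorem real_cs {P Q R : ℝ} (hR : 0 ≤ R) (h : ∀ t : ℝ, 0 < t → 2 * R ≤ t * P + Q / t)
    (hP : 0 ≤ P) (hQ : 0 ≤ Q) : R ≤ √P * √Q := by
  have h2 : ∀ t : ℝ, 0 ≤ P * (t * t) + (-2 * R) * t + Q := by
    intro t
    rcases lt_or_ge 0 t with ht | ht
    · have := h t ht
      have h3 : 2 * R * t ≤ (t * P + Q / t) * t := by gcongr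
      have h4 : (t * P + Q / t) * t = P * (t * t) + Q := by field_simp
      linarith
    · have h3 : 0 ≤ P * (t * t) := mul_nonneg hP (mul_self_nonneg t)
      have h4 : 0 ≤ (-2 * R) * t := by nlinarith
      linarith
  have h3 := discrim_le_zero h2
  rw [discrim] at h3
  rw [← Real.sqrt_mul hP]
  apply Real.le_sqrt_of_sq_le
  nlinarith

theorem cs_int {Ω : Type*} [MeasurableSpace Ω] {μ : Measure Ω} {p q r : Ω → ℝ}
    (hp : Integrable p μ) (hq : Integrable q μ) (hp0 : ∀ᵐ x ∂μ, 0 ≤ p x) (hq0 : ∀ᵐ x ∂μ, 0 ≤ q x)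
    (h : ∀ᵐ x ∂μ, r x ^ 2 ≤ p x * q x) :
    |∫ x, r x ∂μ| ≤ √(∫ x, p x ∂μ) * √(∫ x, q x ∂μ) := by
  apply real_cs (abs_nonneg _) _ (integral_nonneg_of_ae hp0) (integral_nonneg_of_ae hq0)
  intro t ht
  have hb : ∀ᵐ x ∂μ, ‖r x‖ ≤ (t * p x + q x / t) / 2 := by
    filter_upwards [hp0, hq0, h] with x h1 h2 h3
    rw [Real.norm_eq_abs]
    apply abs_le_of_sq_le_sq _ (by positivity)
    refine h3.trans ?_
    have e : (t * p x + q x / t) / 2 = (t * t * p x + q x) / (2 * t) := by field_simp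
    rw [e, div_pow, le_div_iff₀ (by positivity)]
    nlinarith [sq_nonneg (t * t * p x - q x)]
  have := norm_integral_le_of_norm_le (((hp.const_mul t).add (hq.div_const t)).div_const 2) hb
  rw [Real.norm_eq_abs] at this
  have e2 : ∫ x, (t * p x + q x / t) / 2 ∂μ = (t * ∫ x, p x ∂μ + (∫ x, q x ∂μ) / t) / 2 := by
    rw [integral_div, integral_add (hp.const_mul t) (hq.div_const t), integral_const_mul, integral_div]
  simp only [Pi.add_apply] at this
  rw [e2] at this
  linarith

namespace Tube
variable {Srf : SmoothSurface} (𝒯 : Tube Srf)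

/-- tangential gradient through the projection -/
def G (w : E3 → ℝ) (x : E3) : E3 :=
  (InnerProductSpace.toDual ℝ E3).symm (fderiv ℝ (w ∘ 𝒯.A) x)

theorem G_inner (w : E3 → ℝ) (x τ : E3) : ⟪𝒯.G w x, τ⟫ = fderiv ℝ (w ∘ 𝒯.A) x τ := by
  rw [G, InnerProductSpace.toDual_symm_apply]

theorem G_norm (w : E3 → ℝ) (x : E3) : ‖𝒯.G w x‖ = ‖fderiv ℝ (w ∘ 𝒯.A) x‖ := by
  rw [G, LinearIsometryEquiv.norm_map]

theorem G_measurable (w : E3 → ℝ) : Measurable (𝒯.G w) :=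
  (InnerProductSpace.toDual ℝ E3).symm.continuous.measurable.comp (measurable_fderiv ℝ _)

/-- Lipschitz functions which are a.e. differentiable along the surface -/
structure MemW (w : E3 → ℝ) : Prop where
  lip : ∃ K : ℝ≥0, LipschitzWith K w
  diff : ∀ᵐ x ∂Srf.μ, DifferentiableAt ℝ (w ∘ 𝒯.A) x

variable {𝒯}

theorem MemW.continuous {w : E3 → ℝ} (h : 𝒯.MemW w) : Continuous w := by
  obtain ⟨K, hK⟩ := h.lip
  exact hK.continuous

theorem A_lipw : LipschitzWith 𝒯.L.toNNReal 𝒯.A := by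
  apply LipschitzWith.of_dist_le_mul
  intro x y
  rw [dist_eq_norm, dist_eq_norm, Real.coe_toNNReal _ 𝒯.L_pos.le]
  exact 𝒯.lip x y

theorem MemW.lip_bar {w : E3 → ℝ} (h : 𝒯.MemW w) : ∃ K : ℝ≥0, LipschitzWith K (w ∘ 𝒯.A) := by
  obtain ⟨K, hK⟩ := h.lip
  exact ⟨_, hK.comp A_lipw⟩

theorem MemW.G_bdd {w : E3 → ℝ} (h : 𝒯.MemW w) : ∃ K : ℝ, 0 ≤ K ∧ ∀ x, ‖𝒯.G w x‖ ≤ K := by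
  obtain ⟨K, hK⟩ := h.lip_bar
  refine ⟨K, K.2, fun x => ?_⟩
  rw [G_norm]
  exact norm_fderiv_le_of_lipschitz ℝ hK

theorem ae_mem_S : ∀ᵐ x ∂Srf.μ, x ∈ Srf.S := ae_restrict_mem meas_S

theorem cont_bdd {w : E3 → ℝ} (h : Continuous w) : ∃ K : ℝ, 0 ≤ K ∧ ∀ x ∈ Srf.S, |w x| ≤ K := by
  obtain ⟨K, hK⟩ := Srf.compact.exists_bound_of_continuousOn h.continuousOn
  refine ⟨max K 0, le_max_right _ _, fun x hx => (hK x hx).trans (le_max_left _ _)⟩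

theorem integrable_of_bdd (𝒯 : Tube Srf) {f : E3 → ℝ} (hf : AEStronglyMeasurable f Srf.μ) {K : ℝ}
    (hK : ∀ᵐ x ∂Srf.μ, |f x| ≤ K) : Integrable f Srf.μ := by
  have := 𝒯.finite_μ
  exact Integrable.of_bound hf K hK

theorem integrable_cont (𝒯 : Tube Srf) {f : E3 → ℝ} (hf : Continuous f) : Integrable f Srf.μ := by
  obtain ⟨K, -, hK⟩ := cont_bdd (Srf := Srf) hf
  exact 𝒯.integrable_of_bdd hf.aestronglyMeasurable (ae_mem_S.mono hK)

theorem MemW.int_inner {v w : E3 → ℝ} (hv : 𝒯.MemW v) (hw : 𝒯.MemW w) :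
    Integrable (fun x => ⟪𝒯.G v x, 𝒯.G w x⟫) Srf.μ := by
  obtain ⟨K, hK0, hK⟩ := hv.G_bdd
  obtain ⟨K', hK0', hK'⟩ := hw.G_bdd
  apply 𝒯.integrable_of_bdd (K := K * K')
  · exact ((𝒯.G_measurable v).inner (𝒯.G_measurable w)).aestronglyMeasurable
  · refine Filter.Eventually.of_forall fun x => (abs_real_inner_le_norm _ _).trans ?_
    exact mul_le_mul (hK x) (hK' x) (norm_nonneg _) hK0

theorem MemW.int_mul {v w : E3 → ℝ} (hv : 𝒯.MemW v) (hw : 𝒯.MemW w) :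
    Integrable (fun x => v x * w x) Srf.μ := 𝒯.integrable_cont (hv.continuous.mul hw.continuous)

theorem MemW.int_a {v w : E3 → ℝ} (hv : 𝒯.MemW v) (hw : 𝒯.MemW w) :
    Integrable (fun x => ⟪𝒯.G v x, 𝒯.G w x⟫ + v x * w x) Srf.μ := (hv.int_inner hw).add (hv.int_mul hw)

theorem MemW.int_e {v : E3 → ℝ} (hv : 𝒯.MemW v) :
    Integrable (fun x => ‖𝒯.G v x‖ ^ 2 + v x ^ 2) Srf.μ := by
  refine (hv.int_a hv).congr (Filter.Eventually.of_forall fun x => ?_)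
  simp only [real_inner_self_eq_norm_sq]; ring

theorem MemW.int_g2 {v : E3 → ℝ} (hv : 𝒯.MemW v) :
    Integrable (fun x => ‖𝒯.G v x‖ ^ 2) Srf.μ := by
  refine (hv.int_inner hv).congr (Filter.Eventually.of_forall fun x => ?_)
  simp only [real_inner_self_eq_norm_sq]

theorem MemW.int_sq {v : E3 → ℝ} (hv : 𝒯.MemW v) : Integrable (fun x => v x ^ 2) Srf.μ :=
  𝒯.integrable_cont (hv.continuous.pow 2)

theorem MemW.add {v w : E3 → ℝ} (hv : 𝒯.MemW v) (hw : 𝒯.MemW w) : 𝒯.MemW (fun x => v x + w x) := by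
  obtain ⟨K, hK⟩ := hv.lip
  obtain ⟨K', hK'⟩ := hw.lip
  refine ⟨⟨_, hK.add hK'⟩, ?_⟩
  filter_upwards [hv.diff, hw.diff] with x h1 h2
  exact h1.add h2

theorem MemW.smul {v : E3 → ℝ} (hv : 𝒯.MemW v) (c : ℝ) : 𝒯.MemW (fun x => c * v x) := by
  obtain ⟨K, hK⟩ := hv.lip
  refine ⟨⟨‖c‖₊ * K, (lipschitzWith_smul c).comp hK⟩, ?_⟩
  filter_upwards [hv.diff] with x h1
  exact h1.const_mul c

theorem MemW.sub {v w : E3 → ℝ} (hv : 𝒯.MemW v) (hw : 𝒯.MemW w) : 𝒯.MemW (fun x => v x - w x) := by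
  have := hv.add (hw.smul (-1))
  simpa [sub_eq_add_neg] using this

theorem G_add {v w : E3 → ℝ} {x : E3} (hv : DifferentiableAt ℝ (v ∘ 𝒯.A) x)
    (hw : DifferentiableAt ℝ (w ∘ 𝒯.A) x) :
    𝒯.G (fun x => v x + w x) x = 𝒯.G v x + 𝒯.G w x := by
  rw [G, G, G, ← map_add]
  congr 1
  exact fderiv_add hv hw

theorem G_sub {v w : E3 → ℝ} {x : E3} (hv : DifferentiableAt ℝ (v ∘ 𝒯.A) x)
    (hw : DifferentiableAt ℝ (w ∘ 𝒯.A) x) :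
    𝒯.G (fun x => v x - w x) x = 𝒯.G v x - 𝒯.G w x := by
  rw [G, G, G, ← map_sub]
  congr 1
  exact fderiv_sub hv hw

theorem G_smul {v : E3 → ℝ} {x : E3} (c : ℝ) (hv : DifferentiableAt ℝ (v ∘ 𝒯.A) x) :
    𝒯.G (fun x => c * v x) x = c • 𝒯.G v x := by
  rw [G, G, ← map_smul]
  congr 1
  exact fderiv_const_mul hv c

variable (𝒯)
/-- the bilinear form -/
def aF (v w : E3 → ℝ) : ℝ := ∫ x, (⟪𝒯.G v x, 𝒯.G w x⟫ + v x * w x) ∂Srf.μ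

/-- energy norm -/
def N (w : E3 → ℝ) : ℝ := √(𝒯.aF w w)

variable {𝒯}

theorem aF_comm (v w : E3 → ℝ) : 𝒯.aF v w = 𝒯.aF w v := by
  unfold aF
  congr 1
  ext x
  rw [real_inner_comm, mul_comm]

theorem aF_add_left {u v w : E3 → ℝ} (hu : 𝒯.MemW u) (hv : 𝒯.MemW v) (hw : 𝒯.MemW w) :
    𝒯.aF (fun x => u x + v x) w = 𝒯.aF u w + 𝒯.aF v w := by
  unfold aF
  rw [← integral_add (hu.int_a hw) (hv.int_a hw)]
  apply integral_congr_ae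
  filter_upwards [hu.diff, hv.diff] with x h1 h2
  rw [G_add h1 h2, inner_add_left]
  ring

theorem aF_smul_left {u w : E3 → ℝ} (hu : 𝒯.MemW u) (c : ℝ) :
    𝒯.aF (fun x => c * u x) w = c * 𝒯.aF u w := by
  unfold aF
  rw [← integral_const_mul]
  apply integral_congr_ae
  filter_upwards [hu.diff] with x h1
  rw [G_smul c h1, real_inner_smul_left]
  ring

theorem aF_sub_left {u v w : E3 → ℝ} (hu : 𝒯.MemW u) (hv : 𝒯.MemW v) (hw : 𝒯.MemW w) :
    𝒯.aF (fun x => u x - v x) w = 𝒯.aF u w - 𝒯.aF v w := by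
  unfold aF
  rw [← integral_sub (hu.int_a hw) (hv.int_a hw)]
  apply integral_congr_ae
  filter_upwards [hu.diff, hv.diff] with x h1 h2
  rw [G_sub h1 h2, inner_sub_left]
  ring

theorem aF_add_right {u v w : E3 → ℝ} (hu : 𝒯.MemW u) (hv : 𝒯.MemW v) (hw : 𝒯.MemW w) :
    𝒯.aF w (fun x => u x + v x) = 𝒯.aF w u + 𝒯.aF w v := by
  rw [aF_comm, aF_add_left hu hv hw, aF_comm u, aF_comm v]

theorem aF_sub_right {u v w : E3 → ℝ} (hu : 𝒯.MemW u) (hv : 𝒯.MemW v) (hw : 𝒯.MemW w) :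
    𝒯.aF w (fun x => u x - v x) = 𝒯.aF w u - 𝒯.aF w v := by
  rw [aF_comm, aF_sub_left hu hv hw, aF_comm u, aF_comm v]

theorem aF_smul_right {u w : E3 → ℝ} (hu : 𝒯.MemW u) (c : ℝ) :
    𝒯.aF w (fun x => c * u x) = c * 𝒯.aF w u := by
  rw [aF_comm, aF_smul_left hu, aF_comm]

theorem aF_self (v : E3 → ℝ) : 𝒯.aF v v = ∫ x, (‖𝒯.G v x‖ ^ 2 + v x ^ 2) ∂Srf.μ := by
  unfold aF
  congr 1
  ext x
  rw [real_inner_self_eq_norm_sq]; ring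

theorem aF_nonneg (v : E3 → ℝ) : 0 ≤ 𝒯.aF v v := by
  rw [aF_self]; exact integral_nonneg fun x => by positivity

theorem N_nonneg (v : E3 → ℝ) : 0 ≤ 𝒯.N v := Real.sqrt_nonneg _

theorem N_sq (v : E3 → ℝ) : 𝒯.N v ^ 2 = 𝒯.aF v v := Real.sq_sqrt (aF_nonneg v)

theorem pt_cs (X Y : E3) (s t : ℝ) : (⟪X, Y⟫ + s * t) ^ 2 ≤ (‖X‖ ^ 2 + s ^ 2) * (‖Y‖ ^ 2 + t ^ 2) := by
  have h1 := abs_real_inner_le_norm X Y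
  have h2 : |⟪X, Y⟫ + s * t| ≤ ‖X‖ * ‖Y‖ + |s| * |t| := by
    refine (abs_add_le _ _).trans ?_
    rw [abs_mul]; linarith
  have h3 : (⟪X, Y⟫ + s * t) ^ 2 ≤ (‖X‖ * ‖Y‖ + |s| * |t|) ^ 2 := by
    rw [← sq_abs (⟪X, Y⟫ + s * t)]; gcongr
  refine h3.trans ?_
  rw [← sq_abs s, ← sq_abs t]
  nlinarith [sq_nonneg (‖X‖ * |t| - |s| * ‖Y‖)]

theorem aF_cs {v w : E3 → ℝ} (hv : 𝒯.MemW v) (hw : 𝒯.MemW w) : |𝒯.aF v w| ≤ 𝒯.N v * 𝒯.N w := by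
  unfold N
  rw [aF_self, aF_self]
  exact cs_int hv.int_e hw.int_e (Filter.Eventually.of_forall fun x => by positivity)
    (Filter.Eventually.of_forall fun x => by positivity)
    (Filter.Eventually.of_forall fun x => pt_cs _ _ _ _)

theorem N_add {v w : E3 → ℝ} (hv : 𝒯.MemW v) (hw : 𝒯.MemW w) :
    𝒯.N (fun x => v x + w x) ≤ 𝒯.N v + 𝒯.N w := by
  apply abs_le_of_sq_le_sq' _ (add_nonneg (N_nonneg _) (N_nonneg _)) |>.2
  rw [N_sq, aF_add_left hv hw (hv.add hw), aF_add_right hv hw hv, aF_add_right hv hw hw,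
    aF_comm w v, ← N_sq, ← N_sq]
  have := (abs_le.1 (aF_cs hv hw)).2
  nlinarith

theorem N_smul {v : E3 → ℝ} (hv : 𝒯.MemW v) (c : ℝ) : 𝒯.N (fun x => c * v x) = |c| * 𝒯.N v := by
  unfold N
  rw [aF_smul_left hv, aF_smul_right hv, ← mul_assoc, ← sq, Real.sqrt_mul (sq_nonneg c), Real.sqrt_sq_eq_abs]

theorem N_sub {v w : E3 → ℝ} (hv : 𝒯.MemW v) (hw : 𝒯.MemW w) :
    𝒯.N (fun x => v x - w x) ≤ 𝒯.N v + 𝒯.N w := by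
  have := N_add hv (hw.smul (-1))
  rw [N_smul hw] at this
  simpa [sub_eq_add_neg] using this

/-- `L²` norm -/
def l2 (Srf : SmoothSurface) (f : E3 → ℝ) : ℝ := √(∫ x, f x ^ 2 ∂Srf.μ)

theorem l2_nonneg (f : E3 → ℝ) : 0 ≤ l2 Srf f := Real.sqrt_nonneg _

theorem l2_sq (f : E3 → ℝ) : l2 Srf f ^ 2 = ∫ x, f x ^ 2 ∂Srf.μ :=
  Real.sq_sqrt (integral_nonneg fun x => by positivity)

theorem l2_le_N {v : E3 → ℝ} (hv : 𝒯.MemW v) : l2 Srf v ≤ 𝒯.N v := by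
  unfold l2 N
  rw [aF_self]
  apply Real.sqrt_le_sqrt
  exact integral_mono hv.int_sq hv.int_e fun x => by simp

theorem l2_cs {f g : E3 → ℝ} (hf : Integrable (fun x => f x ^ 2) Srf.μ)
    (hg : Integrable (fun x => g x ^ 2) Srf.μ) : |∫ x, f x * g x ∂Srf.μ| ≤ l2 Srf f * l2 Srf g :=
  cs_int hf hg (Filter.Eventually.of_forall fun x => by positivity)
    (Filter.Eventually.of_forall fun x => by positivity)
    (Filter.Eventually.of_forall fun x => by simp only [mul_pow]; exact le_rfl)

theorem bar_eq_ev {x : E3} (hx : x ∈ 𝒯.U) {v w : E3 → ℝ} (h : ∀ y ∈ Srf.S, v y = w y) :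
    v ∘ 𝒯.A =ᶠ[nhds x] w ∘ 𝒯.A :=
  Filter.mem_of_superset (𝒯.U_open.mem_nhds hx) fun _ hy => h _ (𝒯.A_mem hy)

theorem G_congr {x : E3} (hx : x ∈ 𝒯.U) {v w : E3 → ℝ} (h : ∀ y ∈ Srf.S, v y = w y) :
    𝒯.G v x = 𝒯.G w x := by
  rw [G, G, (bar_eq_ev hx h).fderiv_eq]

/-- the derivative of the lifted function through the projection -/
theorem bar_hasFDeriv {z : E3} (hz : z ∈ 𝒯.U) {w : E3 → ℝ}
    (hw : DifferentiableAt ℝ (w ∘ 𝒯.A) (𝒯.A z)) :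
    HasFDerivAt (w ∘ 𝒯.A) ((fderiv ℝ (w ∘ 𝒯.A) (𝒯.A z)).comp (𝒯.D z)) z := by
  refine (hw.hasFDerivAt.comp z (𝒯.hasD z)).congr_of_eventuallyEq ?_
  filter_upwards [𝒯.A_eq_ev hz] with y hy
  simp [hy]

theorem G_bar {z : E3} (hz : z ∈ 𝒯.U) {w : E3 → ℝ}
    (hw : DifferentiableAt ℝ (w ∘ 𝒯.A) (𝒯.A z)) (τ : E3) :
    ⟪𝒯.G w z, τ⟫ = ⟪𝒯.G w (𝒯.A z), 𝒯.D z τ⟫ := by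
  rw [G_inner, (bar_hasFDeriv hz hw).fderiv, G_inner]
  rfl

theorem G_tangent {x : E3} (hx : x ∈ Srf.S) {w : E3 → ℝ}
    (hw : DifferentiableAt ℝ (w ∘ 𝒯.A) x) (τ : E3) : ⟪𝒯.G w x, 𝒯.D x τ⟫ = ⟪𝒯.G w x, τ⟫ := by
  have := G_bar (𝒯.S_sub_U hx) (w := w) (by rwa [𝒯.fix hx]) τ
  rw [𝒯.fix hx] at this
  exact this.symm

theorem D_G {x : E3} (hx : x ∈ Srf.S) {w : E3 → ℝ}
    (hw : DifferentiableAt ℝ (w ∘ 𝒯.A) x) : 𝒯.D x (𝒯.G w x) = 𝒯.G w x := by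
  apply ext_inner_right ℝ
  intro τ
  rw [𝒯.D_symm hx, G_tangent hx hw]

theorem grad_eq {x : E3} (hx : x ∈ Srf.S) {w : E3 → ℝ}
    (hw : DifferentiableAt ℝ (w ∘ 𝒯.A) x) : Srf.grad w x = 𝒯.G w x := by
  have hS : ∀ y ∈ Srf.S, w y = (w ∘ 𝒯.A) y := fun y hy => by simp [𝒯.fix hy]
  have h1 : HasFDerivWithinAt w (fderiv ℝ (w ∘ 𝒯.A) x) Srf.S x :=
    hw.hasFDerivAt.hasFDerivWithinAt.congr hS (hS x hx)
  have h2 : HasFDerivWithinAt w (fderivWithin ℝ w Srf.S x) Srf.S x :=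
    h1.differentiableWithinAt.hasFDerivWithinAt
  have h3 : HasFDerivAt (w ∘ 𝒯.A) ((fderivWithin ℝ w Srf.S x).comp (𝒯.D x)) x := by
    have hA : HasFDerivWithinAt 𝒯.A (𝒯.D x) 𝒯.U x := (𝒯.hasD x).hasFDerivWithinAt
    have h2' : HasFDerivWithinAt w (fderivWithin ℝ w Srf.S x) Srf.S (𝒯.A x) := by
      rw [𝒯.fix hx]; exact h2
    have := h2'.comp x hA (fun y hy => 𝒯.A_mem hy)
    exact this.hasFDerivAt (𝒯.U_open.mem_nhds (𝒯.S_sub_U hx))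
  unfold SmoothSurface.grad tGrad
  rw [𝒯.D_eq_proj hx]
  apply ext_inner_right ℝ
  intro τ
  rw [𝒯.D_symm hx, InnerProductSpace.toDual_symm_apply, G_inner, h3.fderiv]
  rfl

theorem aForm_eq {v w : E3 → ℝ} (hv : ∀ᵐ x ∂Srf.μ, DifferentiableAt ℝ (v ∘ 𝒯.A) x)
    (hw : ∀ᵐ x ∂Srf.μ, DifferentiableAt ℝ (w ∘ 𝒯.A) x) : Srf.aForm v w = 𝒯.aF v w := by
  unfold SmoothSurface.aForm aF
  apply integral_congr_ae
  change ∀ᵐ x ∂Srf.μ, _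
  filter_upwards [hv, hw, ae_mem_S (Srf := Srf)] with x h1 h2 h3
  rw [grad_eq h3 h1, grad_eq h3 h2]

theorem MemW.of_C1 {w : E3 → ℝ} {K : ℝ≥0} (hK : LipschitzWith K w) (h : Differentiable ℝ w) : 𝒯.MemW w :=
  ⟨⟨K, hK⟩, Filter.Eventually.of_forall fun x => (h _).comp x (𝒯.diff x)⟩

/-- for a differentiable function `G` is the tangential part of the gradient -/
theorem G_of_diff {x : E3} (hx : x ∈ Srf.S) {w : E3 → ℝ} (h : DifferentiableAt ℝ w x) (τ : E3) :
    ⟪𝒯.G w x, τ⟫ = fderiv ℝ w x (𝒯.D x τ) := by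
  rw [G_inner]
  have h0 : HasFDerivAt w (fderiv ℝ w x) (𝒯.A x) := by rw [𝒯.fix hx]; exact h.hasFDerivAt
  rw [(h0.comp x (𝒯.hasD x)).fderiv]
  rfl

end Tube

end

section
namespace Tube
variable {Srf : SmoothSurface} (𝒯 : Tube Srf)

/-- small translations -/
def Small (v : E3) : Prop := 32 * 𝒯.L ^ 3 * ‖v‖ ≤ 𝒯.δ

/-- global diffeomorphism extending `x ↦ A (x + v)` -/
def Φ (v z : E3) : E3 := z + (𝒯.A (𝒯.A z + v) - 𝒯.A (𝒯.A z))

variable {𝒯}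

theorem Small.k3 {v : E3} (h : 𝒯.Small v) : 𝒯.L ^ 3 * ‖v‖ ≤ 1 / 32 := by
  have := 𝒯.hδ1
  unfold Small at h; linarith

theorem L23 (v : E3) : 𝒯.L ^ 2 * ‖v‖ ≤ 𝒯.L ^ 3 * ‖v‖ := by
  have h1 := 𝒯.hL
  exact mul_le_mul_of_nonneg_right (pow_le_pow_right₀ h1 (by norm_num)) (norm_nonneg _)

theorem Small.k {v : E3} (h : 𝒯.Small v) : 𝒯.L ^ 2 * ‖v‖ ≤ 1 / 8 := (L23 v).trans (h.k3.trans (by norm_num))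

theorem Small.Lv {v : E3} (h : 𝒯.Small v) : 𝒯.L * ‖v‖ < 𝒯.δ := by
  have h1 := 𝒯.hL
  have h2 := 𝒯.hδ
  unfold Small at h
  have : 𝒯.L * ‖v‖ ≤ 𝒯.L ^ 3 * ‖v‖ :=
    mul_le_mul_of_nonneg_right (le_self_pow₀ h1 (by norm_num)) (norm_nonneg _)
  linarith

theorem Small.mul {v : E3} (h : 𝒯.Small v) {s : ℝ} (hs : |s| ≤ 1) : 𝒯.Small (s • v) := by
  unfold Small at *
  rw [norm_smul, Real.norm_eq_abs]
  have h1 := 𝒯.L_pos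
  have : |s| * ‖v‖ ≤ 1 * ‖v‖ := by gcongr
  have := mul_le_mul_of_nonneg_left this (by positivity : 0 ≤ 32 * 𝒯.L ^ 3)
  linarith

theorem Small.lt {v : E3} (h : 𝒯.Small v) : ‖v‖ < 𝒯.δ := by
  have h1 := 𝒯.hL
  have := h.Lv
  nlinarith [norm_nonneg v]

theorem Φ_dist (v x y : E3) : ‖𝒯.Φ v x - 𝒯.Φ v y - (x - y)‖ ≤ 𝒯.L ^ 2 * ‖v‖ * ‖x - y‖ := by
  have h := 𝒯.second_diff (𝒯.A x) (𝒯.A y) v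
  have e : 𝒯.Φ v x - 𝒯.Φ v y - (x - y) = (𝒯.A (𝒯.A x + v) - 𝒯.A (𝒯.A x)) - (𝒯.A (𝒯.A y + v) - 𝒯.A (𝒯.A y)) := by
    unfold Φ; abel
  rw [e]
  refine h.trans ?_
  have := mul_le_mul_of_nonneg_left (𝒯.lip x y) (mul_nonneg 𝒯.L_pos.le (norm_nonneg v))
  nlinarith

theorem Φ_approx (v : E3) : ApproximatesLinearOn (𝒯.Φ v) ((ContinuousLinearEquiv.refl ℝ E3 : E3 ≃L[ℝ] E3) : E3 →L[ℝ] E3)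
    Set.univ (𝒯.L ^ 2 * ‖v‖).toNNReal := by
  intro x _ y _
  rw [Real.coe_toNNReal _ (by positivity)]
  simpa using Φ_dist v x y

/-- the homeomorphism -/
def Φh {v : E3} (hv : 𝒯.Small v) : E3 ≃ₜ E3 :=
  (Φ_approx v).toHomeomorph (𝒯.Φ v) (Or.inr (by
    have h1 := hv.k
    have h2 : ‖((ContinuousLinearEquiv.refl ℝ E3).symm : E3 →L[ℝ] E3)‖₊ = 1 := by
      ext; simp
    rw [h2, inv_one]
    rw [← NNReal.coe_lt_coe, Real.coe_toNNReal _ (by positivity)]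
    push_cast; linarith))

/-- its inverse -/
def Ψ {v : E3} (hv : 𝒯.Small v) : E3 → E3 := (Φh hv).symm

theorem Φ_Ψ {v : E3} (hv : 𝒯.Small v) (y : E3) : 𝒯.Φ v (Ψ hv y) = y := (Φh hv).apply_symm_apply y
theorem Ψ_Φ {v : E3} (hv : 𝒯.Small v) (y : E3) : Ψ hv (𝒯.Φ v y) = y := (Φh hv).symm_apply_apply y
theorem Ψ_cont {v : E3} (hv : 𝒯.Small v) : Continuous (Ψ hv) := (Φh hv).symm.continuous
theorem Φ_cont (v : E3) : Continuous (𝒯.Φ v) := by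
  unfold Φ
  have := 𝒯.cont
  fun_prop

theorem Φ_lo {v : E3} (hv : 𝒯.Small v) (x y : E3) :
    ‖x - y‖ ≤ (1 + 2 * (𝒯.L ^ 2 * ‖v‖)) * ‖𝒯.Φ v x - 𝒯.Φ v y‖ := by
  have h := Φ_dist (𝒯 := 𝒯) v x y
  have hk := hv.k
  have h0 : 0 ≤ 𝒯.L ^ 2 * ‖v‖ := by positivity
  have h2 : ‖x - y‖ ≤ ‖𝒯.Φ v x - 𝒯.Φ v y‖ + ‖𝒯.Φ v x - 𝒯.Φ v y - (x - y)‖ := by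
    have := norm_sub_le (𝒯.Φ v x - 𝒯.Φ v y) (𝒯.Φ v x - 𝒯.Φ v y - (x - y))
    simpa using this
  have h3 := norm_nonneg (x - y)
  have h4 := norm_nonneg (𝒯.Φ v x - 𝒯.Φ v y)
  set k := 𝒯.L ^ 2 * ‖v‖
  have h5 : (1 - k) * ‖x - y‖ ≤ ‖𝒯.Φ v x - 𝒯.Φ v y‖ := by linarith
  have h6 : 1 ≤ (1 + 2 * k) * (1 - k) := by nlinarith
  nlinarith [mul_le_mul_of_nonneg_left h5 (by linarith : 0 ≤ 1 + 2 * k)]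

theorem Φ_hi (v : E3) (x y : E3) :
    ‖𝒯.Φ v x - 𝒯.Φ v y‖ ≤ (1 + 𝒯.L ^ 2 * ‖v‖) * ‖x - y‖ := by
  have h := Φ_dist (𝒯 := 𝒯) v x y
  have h2 := norm_add_le (𝒯.Φ v x - 𝒯.Φ v y - (x - y)) (x - y)
  rw [sub_add_cancel] at h2
  linarith

theorem Φ_S {v x : E3} (hx : x ∈ Srf.S) : 𝒯.Φ v x = 𝒯.A (x + v) := by
  unfold Φ
  rw [𝒯.fix hx, 𝒯.fix hx]; abel

theorem add_mem_U {v x : E3} (hv : 𝒯.Small v) (hx : x ∈ Srf.S) : x + v ∈ 𝒯.U :=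
  𝒯.mem_U_of hx (by simpa using hv.lt)

theorem Φ_mem {v x : E3} (hv : 𝒯.Small v) (hx : x ∈ Srf.S) : 𝒯.Φ v x ∈ Srf.S := by
  rw [Φ_S hx]; exact 𝒯.A_mem (add_mem_U hv hx)

theorem Φ_near {v x : E3} (hx : x ∈ Srf.S) : ‖𝒯.Φ v x - x‖ ≤ 𝒯.L * ‖v‖ := by
  rw [Φ_S hx]
  have := 𝒯.lip (x + v) x
  rw [𝒯.fix hx] at this
  simpa using this

theorem Ψ_mem {v y : E3} (hv : 𝒯.Small v) (hy : y ∈ Srf.S) : Ψ hv y ∈ Srf.S := by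
  set x := Ψ hv y with hx
  have hxy : 𝒯.Φ v x = y := Φ_Ψ hv y
  have h1 : ‖x - y‖ ≤ 𝒯.L * ‖v‖ := by
    rw [← hxy]
    unfold Φ
    rw [norm_sub_rev, add_sub_cancel_left]
    simpa using 𝒯.lip (𝒯.A x + v) (𝒯.A x)
  have hxU : x ∈ 𝒯.U := 𝒯.mem_U_of hy (h1.trans_lt hv.Lv)
  have hx'S : 𝒯.A x ∈ Srf.S := 𝒯.A_mem hxU
  have hq : x - 𝒯.A x = y - 𝒯.A (𝒯.A x + v) := by
    rw [← hxy]; unfold Φ; rw [𝒯.idem hxU]; abel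
  have h2 : ‖x - 𝒯.A x‖ ≤ 𝒯.L * ‖v‖ := (𝒯.A_nearest hxU hy).trans h1
  have h3 : ‖y - 𝒯.A x‖ ≤ 2 * (𝒯.L * ‖v‖) := by
    have : y - 𝒯.A x = (x - 𝒯.A x) - (x - y) := by abel
    rw [this]
    exact (norm_sub_le _ _).trans (by linarith)
  have h0 : 0 ≤ 𝒯.L * ‖v‖ := mul_nonneg 𝒯.L_pos.le (norm_nonneg _)
  have h4 : ‖𝒯.A (𝒯.A x + v) - 𝒯.A x‖ ≤ 2 * (𝒯.L * ‖v‖) := by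
    have := Φ_near (𝒯 := 𝒯) (v := v) hx'S
    rw [Φ_S hx'S] at this
    linarith
  have h5 := 𝒯.normal_small (ν := x - 𝒯.A x) hy (𝒯.A_mem (add_mem_U hv hx'S)) (fun w => 𝒯.normality hxU w) h3 h4
  rw [← hq, real_inner_self_eq_norm_sq, abs_of_nonneg (by positivity)] at h5
  have h6 : ‖x - 𝒯.A x‖ = 0 := by
    have hk := hv.k
    have := norm_nonneg (x - 𝒯.A x)
    by_contra hne
    have hpos : 0 < ‖x - 𝒯.A x‖ ^ 2 := by positivity
    nlinarith
  rw [norm_eq_zero, sub_eq_zero] at h6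
  rw [h6]; exact hx'S

theorem map_Φ_le {v : E3} (hv : 𝒯.Small v) :
    Srf.μ.map (𝒯.Φ v) ≤ ENNReal.ofReal (1 + 5 * (𝒯.L ^ 2 * ‖v‖)) • Srf.μ := by
  have h := map_le (X := Srf.S) (Y := Srf.S) (φ := 𝒯.Φ v) (Φ_cont v).measurable (fun x hx => Φ_mem hv hx)
    (Λ := 1 + 2 * (𝒯.L ^ 2 * ‖v‖)) (by positivity) (fun x _ y _ => Φ_lo hv x y)
  refine h.trans ?_
  refine Measure.le_iff.2 fun s _ => ?_
  simp only [Measure.smul_apply, smul_eq_mul]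
  gcongr
  · have hk := hv.k
    have h0 : 0 ≤ 𝒯.L ^ 2 * ‖v‖ := by positivity
    nlinarith
  · exact le_rfl

theorem map_Ψ_le {v : E3} (hv : 𝒯.Small v) :
    Srf.μ.map (Ψ hv) ≤ ENNReal.ofReal (1 + 5 * (𝒯.L ^ 2 * ‖v‖)) • Srf.μ := by
  have h := map_le (X := Srf.S) (Y := Srf.S) (φ := Ψ hv) (Ψ_cont hv).measurable (fun x hx => Ψ_mem hv hx)
    (Λ := 1 + 𝒯.L ^ 2 * ‖v‖) (by positivity) (fun x _ y _ => by
      have := Φ_hi (𝒯 := 𝒯) v (Ψ hv x) (Ψ hv y)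
      rwa [Φ_Ψ, Φ_Ψ] at this)
  refine h.trans ?_
  refine Measure.le_iff.2 fun s _ => ?_
  simp only [Measure.smul_apply, smul_eq_mul]
  gcongr
  · have hk := hv.k
    have h0 : 0 ≤ 𝒯.L ^ 2 * ‖v‖ := by positivity
    nlinarith
  · exact le_rfl

theorem le_map_Φ {v : E3} (hv : 𝒯.Small v) :
    Srf.μ ≤ ENNReal.ofReal (1 + 5 * (𝒯.L ^ 2 * ‖v‖)) • Srf.μ.map (𝒯.Φ v) := by
  refine Measure.le_iff.2 fun s hs => ?_
  have h2 := Measure.le_iff.1 (map_Ψ_le hv) ((𝒯.Φ v) ⁻¹' s) ((Φ_cont v).measurable hs)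
  rw [Measure.map_apply (Ψ_cont hv).measurable ((Φ_cont v).measurable hs), ← Set.preimage_comp] at h2
  have e : 𝒯.Φ v ∘ Ψ hv = id := funext fun y => Φ_Ψ hv y
  rw [e, Set.preimage_id] at h2
  refine h2.trans ?_
  simp only [Measure.smul_apply, smul_eq_mul]
  rw [Measure.map_apply (Φ_cont v).measurable hs]

theorem Φ_ae {v : E3} (hv : 𝒯.Small v) {p : E3 → Prop} (h : ∀ᵐ x ∂Srf.μ, p x) :
    ∀ᵐ x ∂Srf.μ, p (𝒯.Φ v x) := by
  apply ae_of_ae_map (Φ_cont v).aemeasurable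
  exact (Measure.absolutelyContinuous_of_le_smul (map_Φ_le hv)) h

theorem Ψ_ae {v : E3} (hv : 𝒯.Small v) {p : E3 → Prop} (h : ∀ᵐ x ∂Srf.μ, p x) :
    ∀ᵐ x ∂Srf.μ, p (Ψ hv x) := by
  apply ae_of_ae_map (Ψ_cont hv).aemeasurable
  exact (Measure.absolutelyContinuous_of_le_smul (map_Ψ_le hv)) h

theorem Φ_integrable {v : E3} (hv : 𝒯.Small v) {g : E3 → ℝ} (hg : Integrable g Srf.μ) :
    Integrable (fun x => g (𝒯.Φ v x)) Srf.μ := by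
  have h1 : Integrable g (Srf.μ.map (𝒯.Φ v)) :=
    (hg.smul_measure (c := ENNReal.ofReal (1 + 5 * (𝒯.L ^ 2 * ‖v‖))) (by simp)).mono_measure (map_Φ_le hv)
  exact h1.comp_measurable (Φ_cont v).measurable

theorem Φ_integral {v : E3} (hv : 𝒯.Small v) {g : E3 → ℝ} (hg : Integrable g Srf.μ) :
    |∫ x, g (𝒯.Φ v x) ∂Srf.μ - ∫ x, g x ∂Srf.μ| ≤ 5 * (𝒯.L ^ 2 * ‖v‖) * ∫ x, |g x| ∂Srf.μ := by
  have h := integral_compare (by positivity) (map_Φ_le hv) (le_map_Φ hv) hg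
  have e := (Φh hv).measurableEmbedding.integral_map (μ := Srf.μ) g
  change ∫ y, g y ∂(Srf.μ.map (𝒯.Φ v)) = ∫ x, g (𝒯.Φ v x) ∂Srf.μ at e
  rwa [e] at h

theorem Φ_integral_le {v : E3} (hv : 𝒯.Small v) {g : E3 → ℝ} (hg : Integrable g Srf.μ)
    (h0 : ∀ x, 0 ≤ g x) : ∫ x, g (𝒯.Φ v x) ∂Srf.μ ≤ 2 * ∫ x, g x ∂Srf.μ := by
  have h := (abs_le.1 (Φ_integral hv hg)).2
  simp_rw [fun x => abs_of_nonneg (h0 x)] at h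
  have hk := hv.k
  have h1 : 0 ≤ ∫ x, g x ∂Srf.μ := integral_nonneg h0
  nlinarith

/-- derivative of Φ -/
def DΦ (𝒯 : Tube Srf) (v z : E3) : E3 →L[ℝ] E3 :=
  ContinuousLinearMap.id ℝ E3 + ((𝒯.D (𝒯.A z + v)).comp (𝒯.D z) - (𝒯.D (𝒯.A z)).comp (𝒯.D z))

theorem Φ_hasD (v z : E3) : HasFDerivAt (𝒯.Φ v) (𝒯.DΦ v z) z := by
  have h1 : HasFDerivAt (fun z => 𝒯.A z + v) (𝒯.D z) z := (𝒯.hasD z).add_const v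
  exact (hasFDerivAt_id z).add ((HasFDerivAt.comp z (𝒯.hasD (𝒯.A z + v)) h1).sub
    (HasFDerivAt.comp z (𝒯.hasD (𝒯.A z)) (𝒯.hasD z)))

theorem DΦ_near (v z τ : E3) : ‖𝒯.DΦ v z τ - τ‖ ≤ 𝒯.L ^ 2 * ‖v‖ * ‖τ‖ := by
  have e : 𝒯.DΦ v z τ - τ = 𝒯.D (𝒯.A z + v) (𝒯.D z τ) - 𝒯.D (𝒯.A z) (𝒯.D z τ) := by
    simp [DΦ]
  rw [e]
  refine (𝒯.D_lip_apply _ _ _).trans ?_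
  rw [add_sub_cancel_left]
  have := mul_le_mul_of_nonneg_left (𝒯.D_le z τ) (mul_nonneg 𝒯.L_pos.le (norm_nonneg v))
  nlinarith

theorem Ψ_diff {v : E3} (hv : 𝒯.Small v) (y : E3) : DifferentiableAt ℝ (Ψ hv) y := by
  have h1 : ‖𝒯.DΦ v (Ψ hv y) - 1‖ < 1 := by
    have : ‖𝒯.DΦ v (Ψ hv y) - 1‖ ≤ 𝒯.L ^ 2 * ‖v‖ :=
      ContinuousLinearMap.opNorm_le_bound _ (by positivity) fun τ => DΦ_near v _ τ
    have := hv.k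
    linarith
  set T : (E3 →L[ℝ] E3)ˣ := Units.ofNearby 1 (𝒯.DΦ v (Ψ hv y)) (by simpa using h1) with hT
  have hTv : (T : E3 →L[ℝ] E3) = 𝒯.DΦ v (Ψ hv y) := Units.val_ofNearby _ _ _
  set e := ContinuousLinearEquiv.ofUnit T with he
  have hev : (e : E3 →L[ℝ] E3) = 𝒯.DΦ v (Ψ hv y) := by rw [← hTv]; rfl
  exact (HasFDerivAt.of_local_left_inverse (f := 𝒯.Φ v) (f' := e) (Ψ_cont hv).continuousAt
    (by rw [hev]; exact Φ_hasD v _) (Filter.Eventually.of_forall fun y => Φ_Ψ hv y)).differentiableAt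

theorem Φ_bar_hasD {v x : E3} (hv : 𝒯.Small v) (hx : x ∈ Srf.S) {w : E3 → ℝ}
    (hw : DifferentiableAt ℝ (w ∘ 𝒯.A) (𝒯.Φ v x)) :
    HasFDerivAt ((fun z => w (𝒯.Φ v z)) ∘ 𝒯.A) (((fderiv ℝ (w ∘ 𝒯.A) (𝒯.Φ v x)).comp (𝒯.DΦ v x)).comp (𝒯.D x)) x := by
  have h1 : HasFDerivAt ((w ∘ 𝒯.A) ∘ 𝒯.Φ v ∘ 𝒯.A)
      (((fderiv ℝ (w ∘ 𝒯.A) (𝒯.Φ v x)).comp (𝒯.DΦ v x)).comp (𝒯.D x)) x := by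
    have ha := 𝒯.hasD x
    have hb := Φ_hasD (𝒯 := 𝒯) v (𝒯.A x)
    have hc := hw.hasFDerivAt
    have hb' := HasFDerivAt.comp x hb ha
    rw [𝒯.fix hx] at hb'
    rw [show 𝒯.Φ v x = (𝒯.Φ v ∘ 𝒯.A) x by simp [𝒯.fix hx]] at hc ⊢
    have hd := HasFDerivAt.comp x hc hb'
    rwa [← ContinuousLinearMap.comp_assoc] at hd
  refine h1.congr_of_eventuallyEq ?_
  filter_upwards [𝒯.U_open.mem_nhds (𝒯.S_sub_U hx)] with z hz
  simp only [Function.comp]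
  rw [𝒯.fix (Φ_mem hv (𝒯.A_mem hz))]

theorem MemW.compΦ {v : E3} (hv : 𝒯.Small v) {w : E3 → ℝ} (hw : 𝒯.MemW w) :
    𝒯.MemW (fun z => w (𝒯.Φ v z)) := by
  obtain ⟨K, hK⟩ := hw.lip
  have hl : LipschitzWith (1 + 𝒯.L ^ 2 * ‖v‖).toNNReal (𝒯.Φ v) := by
    apply LipschitzWith.of_dist_le_mul
    intro x y
    rw [Real.coe_toNNReal _ (by positivity), dist_eq_norm, dist_eq_norm]
    exact Φ_hi v x y
  refine ⟨⟨_, hK.comp hl⟩, ?_⟩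
  filter_upwards [Φ_ae hv hw.diff, ae_mem_S] with x h1 hx
  exact (Φ_bar_hasD hv hx h1).differentiableAt

theorem MemW.compΨ {v : E3} (hv : 𝒯.Small v) {w : E3 → ℝ} (hw : 𝒯.MemW w) :
    𝒯.MemW (fun z => w (Ψ hv z)) := by
  obtain ⟨K, hK⟩ := hw.lip
  have hl : LipschitzWith (1 + 2 * (𝒯.L ^ 2 * ‖v‖)).toNNReal (Ψ hv) := by
    apply LipschitzWith.of_dist_le_mul
    intro x y
    rw [Real.coe_toNNReal _ (by positivity), dist_eq_norm, dist_eq_norm]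
    have := Φ_lo hv (Ψ hv x) (Ψ hv y)
    rwa [Φ_Ψ, Φ_Ψ] at this
  refine ⟨⟨_, hK.comp hl⟩, ?_⟩
  filter_upwards [Ψ_ae hv hw.diff, ae_mem_S] with x h1 hx
  have h2 : DifferentiableAt ℝ ((w ∘ 𝒯.A) ∘ Ψ hv ∘ 𝒯.A) x := by
    apply DifferentiableAt.comp
    · simpa [𝒯.fix hx] using h1
    · exact (Ψ_diff hv _).comp x (𝒯.diff x)
  refine h2.congr_of_eventuallyEq ?_
  filter_upwards [𝒯.U_open.mem_nhds (𝒯.S_sub_U hx)] with z hz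
  simp only [Function.comp]
  rw [𝒯.fix (Ψ_mem hv (𝒯.A_mem hz))]

theorem G_Φ {v x : E3} (hv : 𝒯.Small v) (hx : x ∈ Srf.S) {w : E3 → ℝ}
    (hw : DifferentiableAt ℝ (w ∘ 𝒯.A) (𝒯.Φ v x)) :
    ‖𝒯.G (fun z => w (𝒯.Φ v z)) x - 𝒯.G w (𝒯.Φ v x)‖ ≤ 3 * 𝒯.L ^ 3 * ‖v‖ * ‖𝒯.G w (𝒯.Φ v x)‖ := by
  set g := 𝒯.G w (𝒯.Φ v x) with hg
  have hL := 𝒯.hL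
  have key : ∀ τ, ⟪𝒯.G (fun z => w (𝒯.Φ v z)) x - g, τ⟫ ≤ 3 * 𝒯.L ^ 3 * ‖v‖ * ‖g‖ * ‖τ‖ := by
    intro τ
    have e1 : ⟪𝒯.G (fun z => w (𝒯.Φ v z)) x, τ⟫ = ⟪g, 𝒯.DΦ v x (𝒯.D x τ)⟫ := by
      rw [G_inner, (Φ_bar_hasD hv hx hw).fderiv, hg, G_inner]; rfl
    have e2 : ⟪g, τ⟫ = ⟪g, 𝒯.D (𝒯.Φ v x) τ⟫ := by
      have hyS := Φ_mem hv hx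
      have hw' : DifferentiableAt ℝ (w ∘ 𝒯.A) (𝒯.A (𝒯.Φ v x)) := by rwa [𝒯.fix hyS]
      have := 𝒯.G_bar (𝒯.S_sub_U hyS) hw' τ
      rwa [𝒯.fix hyS] at this
    rw [inner_sub_left, e1, e2, ← inner_sub_right]
    refine (real_inner_le_norm _ _).trans ?_
    have e3 : 𝒯.DΦ v x (𝒯.D x τ) - 𝒯.D (𝒯.Φ v x) τ = (𝒯.DΦ v x (𝒯.D x τ) - 𝒯.D x τ) + (𝒯.D x τ - 𝒯.D (𝒯.Φ v x) τ) := by abel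
    have h1 := DΦ_near (𝒯 := 𝒯) v x (𝒯.D x τ)
    have h2 := 𝒯.D_lip_apply x (𝒯.Φ v x) τ
    have h3 := 𝒯.D_le x τ
    have h4 := Φ_near (𝒯 := 𝒯) (v := v) hx
    rw [norm_sub_rev] at h4
    have h5 : ‖𝒯.DΦ v x (𝒯.D x τ) - 𝒯.D (𝒯.Φ v x) τ‖ ≤ 3 * 𝒯.L ^ 3 * ‖v‖ * ‖τ‖ := by
      rw [e3]
      refine (norm_add_le _ _).trans ?_
      have i1 : 𝒯.L ^ 2 * ‖v‖ * ‖𝒯.D x τ‖ ≤ 𝒯.L ^ 2 * ‖v‖ * (𝒯.L * ‖τ‖) := by gcongr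
      have i2 : 𝒯.L * ‖x - 𝒯.Φ v x‖ * ‖τ‖ ≤ 𝒯.L * (𝒯.L * ‖v‖) * ‖τ‖ := by gcongr
      have i3 : 𝒯.L * (𝒯.L * ‖v‖) * ‖τ‖ ≤ 𝒯.L * (𝒯.L * (𝒯.L * ‖v‖)) * ‖τ‖ := by
        have : ‖v‖ ≤ 𝒯.L * ‖v‖ := by nlinarith [norm_nonneg v]
        gcongr
      have : 0 ≤ 𝒯.L ^ 3 * ‖v‖ * ‖τ‖ := by positivity
      nlinarith
    calc ‖g‖ * _ ≤ ‖g‖ * (3 * 𝒯.L ^ 3 * ‖v‖ * ‖τ‖) := by gcongr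
      _ = _ := by ring
  set q := 𝒯.G (fun z => w (𝒯.Φ v z)) x - g
  have := key q
  rw [real_inner_self_eq_norm_sq] at this
  rcases eq_or_lt_of_le (norm_nonneg q) with h0 | h0
  · rw [← h0]; positivity
  · nlinarith

end Tube

end

section
namespace Tube
variable {Srf : SmoothSurface} {𝒯 : Tube Srf}

theorem int_absq {w z : E3 → ℝ} (hw : 𝒯.MemW w) (hz : 𝒯.MemW z) :
    ∫ x, |⟪𝒯.G w x, 𝒯.G z x⟫ + w x * z x| ∂Srf.μ ≤ 𝒯.N w * 𝒯.N z := by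
  refine (le_abs_self _).trans ?_
  unfold N
  rw [aF_self, aF_self]
  exact cs_int hw.int_e hz.int_e (Filter.Eventually.of_forall fun x => by positivity)
    (Filter.Eventually.of_forall fun x => by positivity)
    (Filter.Eventually.of_forall fun x => by simp only [sq_abs]; exact pt_cs _ _ _ _)

theorem MemW.int_gg {w z : E3 → ℝ} (hw : 𝒯.MemW w) (hz : 𝒯.MemW z) :
    Integrable (fun x => ‖𝒯.G w x‖ * ‖𝒯.G z x‖) Srf.μ := by
  obtain ⟨K, hK0, hK⟩ := hw.G_bdd
  obtain ⟨K', hK0', hK'⟩ := hz.G_bdd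
  apply 𝒯.integrable_of_bdd (K := K * K')
  · exact ((𝒯.G_measurable w).norm.mul (𝒯.G_measurable z).norm).aestronglyMeasurable
  · refine Filter.Eventually.of_forall fun x => ?_
    rw [abs_of_nonneg (by positivity)]
    exact mul_le_mul (hK x) (hK' x) (norm_nonneg _) hK0

theorem int_gg_le {w z : E3 → ℝ} (hw : 𝒯.MemW w) (hz : 𝒯.MemW z) :
    ∫ x, ‖𝒯.G w x‖ * ‖𝒯.G z x‖ ∂Srf.μ ≤ 𝒯.N w * 𝒯.N z := by
  refine (le_abs_self _).trans ?_
  unfold N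
  rw [aF_self, aF_self]
  exact cs_int hw.int_e hz.int_e (Filter.Eventually.of_forall fun x => by positivity)
    (Filter.Eventually.of_forall fun x => by positivity)
    (Filter.Eventually.of_forall fun x => by
      simp only [mul_pow]
      exact mul_le_mul (by nlinarith [sq_nonneg (w x)]) (by nlinarith [sq_nonneg (z x)]) (by positivity) (by positivity))

theorem int_g2_le {w : E3 → ℝ} (hw : 𝒯.MemW w) : ∫ x, ‖𝒯.G w x‖ ^ 2 ∂Srf.μ ≤ 𝒯.N w ^ 2 := by
  have := int_gg_le hw hw
  simpa [← sq] using this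

theorem pt_near {X Y X0 Y0 : E3} {ε : ℝ} (hε : 0 ≤ ε) (hε1 : ε ≤ 1) (hX : ‖X - X0‖ ≤ ε * ‖X0‖) (hY : ‖Y - Y0‖ ≤ ε * ‖Y0‖) :
    |⟪X, Y⟫ - ⟪X0, Y0⟫| ≤ 3 * ε * (‖X0‖ * ‖Y0‖) := by
  have e : ⟪X, Y⟫ - ⟪X0, Y0⟫ = ⟪X - X0, Y - Y0⟫ + ⟪X - X0, Y0⟫ + ⟪X0, Y - Y0⟫ := by
    simp only [inner_sub_left, inner_sub_right]; ring
  rw [e]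
  have h1 := abs_real_inner_le_norm (X - X0) (Y - Y0)
  have h2 := abs_real_inner_le_norm (X - X0) Y0
  have h3 := abs_real_inner_le_norm X0 (Y - Y0)
  have a1 : ‖X - X0‖ * ‖Y - Y0‖ ≤ (ε * ‖X0‖) * (ε * ‖Y0‖) := mul_le_mul hX hY (norm_nonneg _) (by positivity)
  have a2 : ‖X - X0‖ * ‖Y0‖ ≤ (ε * ‖X0‖) * ‖Y0‖ := by gcongr
  have a3 : ‖X0‖ * ‖Y - Y0‖ ≤ ‖X0‖ * (ε * ‖Y0‖) := by gcongr
  have a4 : (ε * ‖X0‖) * (ε * ‖Y0‖) ≤ 1 * ‖X0‖ * (ε * ‖Y0‖) := by gcongr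
  have := abs_add_le (⟪X - X0, Y - Y0⟫ + ⟪X - X0, Y0⟫) ⟪X0, Y - Y0⟫
  have := abs_add_le ⟪X - X0, Y - Y0⟫ ⟪X - X0, Y0⟫
  nlinarith

theorem R1 {v : E3} (hv : 𝒯.Small v) {w z : E3 → ℝ} (hw : 𝒯.MemW w) (hz : 𝒯.MemW z) :
    |𝒯.aF (fun x => w (𝒯.Φ v x)) (fun x => z (𝒯.Φ v x)) - 𝒯.aF w z| ≤
      23 * 𝒯.L ^ 3 * ‖v‖ * (𝒯.N w * 𝒯.N z) := by
  have hL := 𝒯.L_pos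
  set q : E3 → ℝ := fun x => ⟪𝒯.G w x, 𝒯.G z x⟫ + w x * z x with hq
  have hqi : Integrable q Srf.μ := hw.int_a hz
  set ε := 3 * 𝒯.L ^ 3 * ‖v‖ with hε
  have hε0 : 0 ≤ ε := by positivity
  have hε1 : ε ≤ 1 := by have := hv.k3; rw [hε]; linarith
  have h1 := Φ_integral hv hqi
  have h2 := int_absq hw hz
  have hNN : 0 ≤ 𝒯.N w * 𝒯.N z := mul_nonneg (N_nonneg _) (N_nonneg _)
  have h3 : |𝒯.aF (fun x => w (𝒯.Φ v x)) (fun x => z (𝒯.Φ v x)) - ∫ x, q (𝒯.Φ v x) ∂Srf.μ| ≤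
      3 * ε * (2 * (𝒯.N w * 𝒯.N z)) := by
    unfold aF
    rw [← integral_sub ((hw.compΦ hv).int_a (hz.compΦ hv)) (Φ_integrable hv hqi), ← Real.norm_eq_abs]
    have b : ∫ x, 3 * ε * (‖𝒯.G w (𝒯.Φ v x)‖ * ‖𝒯.G z (𝒯.Φ v x)‖) ∂Srf.μ ≤ 3 * ε * (2 * (𝒯.N w * 𝒯.N z)) := by
      rw [integral_const_mul]
      have i1 := Φ_integral_le hv (hw.int_gg hz) (fun x => by positivity)
      have i2 := int_gg_le hw hz
      have : 0 ≤ 3 * ε := by positivity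
      exact mul_le_mul_of_nonneg_left (i1.trans (by linarith)) this
    refine (norm_integral_le_of_norm_le ((Φ_integrable hv (hw.int_gg hz)).const_mul (3 * ε)) ?_).trans b
    filter_upwards [Φ_ae hv hw.diff, Φ_ae hv hz.diff, ae_mem_S] with x d1 d2 hx
    have := pt_near hε0 hε1 (G_Φ hv hx d1) (G_Φ hv hx d2)
    rw [Real.norm_eq_abs]
    refine le_trans (le_of_eq ?_) this
    congr 1
    simp only [hq]; ring
  have h4 : 𝒯.aF w z = ∫ x, q x ∂Srf.μ := rfl
  have h5 := L23 (𝒯 := 𝒯) v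
  have h6 : 5 * (𝒯.L ^ 2 * ‖v‖) * ∫ x, |q x| ∂Srf.μ ≤ 5 * (𝒯.L ^ 3 * ‖v‖) * (𝒯.N w * 𝒯.N z) := by
    have : (0:ℝ) ≤ ∫ x, |q x| ∂Srf.μ := integral_nonneg fun x => abs_nonneg _
    gcongr
  rw [h4]
  have := abs_sub_le (𝒯.aF (fun x => w (𝒯.Φ v x)) (fun x => z (𝒯.Φ v x))) (∫ x, q (𝒯.Φ v x) ∂Srf.μ) (∫ x, q x ∂Srf.μ)
  have e : 3 * ε * (2 * (𝒯.N w * 𝒯.N z)) + 5 * (𝒯.L ^ 3 * ‖v‖) * (𝒯.N w * 𝒯.N z) = 23 * 𝒯.L ^ 3 * ‖v‖ * (𝒯.N w * 𝒯.N z) := by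
    rw [hε]; ring
  linarith

theorem G_trans {v x : E3} (hv : 𝒯.Small v) (hx : x ∈ Srf.S) {w : E3 → ℝ}
    (hw : DifferentiableAt ℝ (w ∘ 𝒯.A) (𝒯.Φ v x)) : ‖𝒯.G w (x + v)‖ ≤ 𝒯.L * ‖𝒯.G w (𝒯.Φ v x)‖ := by
  rw [Φ_S hx] at *
  have h := 𝒯.G_bar (add_mem_U hv hx) hw (𝒯.G w (x + v))
  rw [real_inner_self_eq_norm_sq] at h
  have h2 := real_inner_le_norm (𝒯.G w (𝒯.A (x + v))) (𝒯.D (x + v) (𝒯.G w (x + v)))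
  have h3 := mul_le_mul_of_nonneg_left (𝒯.D_le (x + v) (𝒯.G w (x + v))) (norm_nonneg (𝒯.G w (𝒯.A (x + v))))
  rcases eq_or_lt_of_le (norm_nonneg (𝒯.G w (x + v))) with h0 | h0
  · rw [← h0]; have := 𝒯.L_pos; positivity
  · nlinarith

theorem diff_trans {v x : E3} (hv : 𝒯.Small v) (hx : x ∈ Srf.S) {w : E3 → ℝ}
    (hw : DifferentiableAt ℝ (w ∘ 𝒯.A) (𝒯.Φ v x)) : DifferentiableAt ℝ (w ∘ 𝒯.A) (x + v) := by
  rw [Φ_S hx] at hw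
  exact (𝒯.bar_hasFDeriv (add_mem_U hv hx) hw).differentiableAt

theorem MemW.int_tr {w : E3 → ℝ} (hw : 𝒯.MemW w) (v : E3) :
    Integrable (fun x => ‖𝒯.G w (x + v)‖ ^ 2) Srf.μ := by
  obtain ⟨K, hK0, hK⟩ := hw.G_bdd
  refine 𝒯.integrable_of_bdd (K := K ^ 2) ?_ ?_
  · exact (((𝒯.G_measurable w).comp (measurable_id.add_const v)).norm.pow_const 2).aestronglyMeasurable
  · refine Filter.Eventually.of_forall fun x => ?_
    rw [abs_of_nonneg (by positivity)]
    exact pow_le_pow_left₀ (norm_nonneg _) (hK _) 2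

theorem E_est {v : E3} (hv : 𝒯.Small v) {w : E3 → ℝ} (hw : 𝒯.MemW w) :
    ∫ x, ‖𝒯.G w (x + v)‖ ^ 2 ∂Srf.μ ≤ 2 * 𝒯.L ^ 2 * 𝒯.N w ^ 2 := by
  have h1 : ∫ x, ‖𝒯.G w (x + v)‖ ^ 2 ∂Srf.μ ≤ ∫ x, 𝒯.L ^ 2 * ‖𝒯.G w (𝒯.Φ v x)‖ ^ 2 ∂Srf.μ := by
    apply integral_mono_ae (hw.int_tr v) ((Φ_integrable hv hw.int_g2).const_mul _)
    filter_upwards [Φ_ae hv hw.diff, ae_mem_S] with x d hx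
    have := pow_le_pow_left₀ (norm_nonneg _) (G_trans hv hx d) 2
    simpa [mul_pow] using this
  rw [integral_const_mul] at h1
  have h2 := Φ_integral_le hv hw.int_g2 (fun x => by positivity)
  have h3 := int_g2_le hw
  have : 0 ≤ 𝒯.L ^ 2 := by positivity
  nlinarith

theorem l2_add {f g : E3 → ℝ} (hf : Integrable (fun x => f x ^ 2) Srf.μ)
    (hg : Integrable (fun x => g x ^ 2) Srf.μ) (hfg : Integrable (fun x => f x * g x) Srf.μ) :
    l2 Srf (fun x => f x + g x) ≤ l2 Srf f + l2 Srf g := by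
  apply abs_le_of_sq_le_sq' _ (add_nonneg (l2_nonneg _) (l2_nonneg _)) |>.2
  have e : ∫ x, (f x + g x) ^ 2 ∂Srf.μ = ∫ x, f x ^ 2 ∂Srf.μ + 2 * ∫ x, f x * g x ∂Srf.μ + ∫ x, g x ^ 2 ∂Srf.μ := by
    rw [← integral_const_mul, ← integral_add hf (hfg.const_mul 2), ← integral_add _ hg]
    · congr 1; ext x; ring
    · exact hf.add (hfg.const_mul 2)
  rw [l2_sq, e, add_sq, l2_sq, l2_sq]
  have := (abs_le.1 (l2_cs hf hg)).2
  linarith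

theorem l2_add_cont (𝒯 : Tube Srf) {f g : E3 → ℝ} (hf : Continuous f) (hg : Continuous g) :
    l2 Srf (fun x => f x + g x) ≤ l2 Srf f + l2 Srf g :=
  l2_add (𝒯.integrable_cont (hf.pow 2)) (𝒯.integrable_cont (hg.pow 2)) (𝒯.integrable_cont (hf.mul hg))

theorem l2_smul (c : ℝ) (f : E3 → ℝ) : l2 Srf (fun x => c * f x) = |c| * l2 Srf f := by
  unfold l2
  simp_rw [mul_pow]
  rw [integral_const_mul, Real.sqrt_mul (sq_nonneg c), Real.sqrt_sq_eq_abs]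

theorem l2_tri (𝒯 : Tube Srf) {f g : E3 → ℝ} (hf : Continuous f) (hg : Continuous g) :
    l2 Srf f - l2 Srf g ≤ l2 Srf (fun x => f x - g x) := by
  have := 𝒯.l2_add_cont (hf.sub hg) hg
  simp only [Pi.sub_apply, sub_add_cancel] at this
  simp only [Pi.sub_def] at this
  linarith

theorem bar_slope {w : E3 → ℝ} {x v : E3} {s : ℝ} (h : DifferentiableAt ℝ (w ∘ 𝒯.A) (x + s • v)) :
    Filter.Tendsto (fun t : ℝ => (t - s)⁻¹ * ((w ∘ 𝒯.A) (x + t • v) - (w ∘ 𝒯.A) (x + s • v))) (nhdsWithin s {s}ᶜ)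
      (nhds ⟪𝒯.G w (x + s • v), v⟫) := by
  have h1 : HasDerivAt (fun t : ℝ => x + t • v) v s := by
    simpa using ((hasDerivAt_id s).smul_const v).const_add x
  have h2 := HasFDerivAt.comp_hasDerivAt s h.hasFDerivAt h1
  rw [G_inner]
  exact h2.tendsto_slope

theorem slope_bdd {w : E3 → ℝ} {K : ℝ≥0} (hK : LipschitzWith K (w ∘ 𝒯.A)) (x v : E3) {s t : ℝ} (h : t ≠ s) :
    |(t - s)⁻¹ * ((w ∘ 𝒯.A) (x + t • v) - (w ∘ 𝒯.A) (x + s • v))| ≤ K * ‖v‖ := by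
  have h1 := hK.dist_le_mul (x + t • v) (x + s • v)
  rw [dist_eq_norm, dist_eq_norm, add_sub_add_left_eq_sub, ← sub_smul, norm_smul, Real.norm_eq_abs, Real.norm_eq_abs] at h1
  have h2 : 0 < |t - s| := abs_pos.2 (sub_ne_zero.2 h)
  rw [abs_mul, abs_inv, inv_mul_le_iff₀ h2]
  linarith

theorem R2 {v : E3} (hv : 𝒯.Small v) {w : E3 → ℝ} (hw : 𝒯.MemW w) :
    l2 Srf (fun x => w (𝒯.Φ v x) - w x) ≤ 2 * 𝒯.L * ‖v‖ * 𝒯.N w := by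
  have hL := 𝒯.L_pos
  obtain ⟨K, hK⟩ := hw.lip_bar
  have hwc : Continuous (w ∘ 𝒯.A) := hK.continuous
  have hwA : ∀ s : ℝ, Continuous fun x : E3 => (w ∘ 𝒯.A) (x + s • v) := fun s =>
    hwc.comp (by fun_prop)
  set F : ℝ → E3 → ℝ := fun s x => (w ∘ 𝒯.A) (x + s • v) - (w ∘ 𝒯.A) x with hF
  have hFc : ∀ s, Continuous (F s) := fun s => ((hwA s).sub hwc)
  set M := 2 * 𝒯.L * ‖v‖ * 𝒯.N w with hM
  have hM0 : 0 ≤ M := by have := N_nonneg (𝒯 := 𝒯) w; positivity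
  have hgc : ContinuousOn (fun s => l2 Srf (F s)) (Set.Icc 0 1) := by
    unfold l2
    have := 𝒯.finite_μ
    refine ContinuousOn.sqrt (continuousOn_of_dominated (bound := fun _ => (K * ‖v‖) ^ 2)
      (fun s _ => ((hFc s).pow 2).aestronglyMeasurable) ?_ (integrable_const _) ?_)
    · intro s hs
      refine Filter.Eventually.of_forall fun x => ?_
      rw [Real.norm_eq_abs, abs_pow]
      refine pow_le_pow_left₀ (abs_nonneg _) ?_ 2
      have := hK.dist_le_mul (x + s • v) x
      rw [dist_eq_norm, dist_eq_norm, add_sub_cancel_left, norm_smul, Real.norm_eq_abs, Real.norm_eq_abs, abs_of_nonneg hs.1] at this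
      refine this.trans ?_
      have h1 := mul_le_mul_of_nonneg_right hs.2 (norm_nonneg v)
      have := mul_le_mul_of_nonneg_left h1 K.2
      simpa using this
    · refine Filter.Eventually.of_forall fun x => Continuous.continuousOn ?_
      have : Continuous fun s : ℝ => (w ∘ 𝒯.A) (x + s • v) := hwc.comp (by fun_prop)
      exact (this.sub continuous_const).pow 2
  have key : l2 Srf (F 1) ≤ M * 1 := by
    refine image_le_of_liminf_slope_right_le_deriv_boundary (a := 0) (b := 1) (f := fun s => l2 Srf (F s))
      (B := fun s => M * s) (B' := fun _ => M) hgc ?_ (by fun_prop) ?_ ?_ (by simp)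
    · simp [hF, l2]
    · intro s _
      simpa using ((hasDerivAt_id s).const_mul M).hasDerivWithinAt
    · intro s hs r hr
      apply Filter.Eventually.frequently
      have hsv : 𝒯.Small (s • v) := hv.mul (by rw [abs_of_nonneg hs.1]; exact hs.2.le)
      have t1 : Filter.Tendsto (fun t : ℝ => ∫ x, ((t - s)⁻¹ * ((w ∘ 𝒯.A) (x + t • v) - (w ∘ 𝒯.A) (x + s • v))) ^ 2 ∂Srf.μ)
          (nhdsWithin s (Set.Ioi s)) (nhds (∫ x, ⟪𝒯.G w (x + s • v), v⟫ ^ 2 ∂Srf.μ)) := by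
        have := 𝒯.finite_μ
        apply tendsto_integral_filter_of_dominated_convergence (fun _ => (K * ‖v‖) ^ 2)
        · refine Filter.Eventually.of_forall fun t => Continuous.aestronglyMeasurable ?_
          exact (continuous_const.mul ((hwA t).sub (hwA s))).pow 2
        · filter_upwards [self_mem_nhdsWithin] with t ht
          refine Filter.Eventually.of_forall fun x => ?_
          rw [Real.norm_eq_abs, abs_pow]
          exact pow_le_pow_left₀ (abs_nonneg _) (slope_bdd hK x v (ne_of_gt ht)) 2
        · exact integrable_const _
        · filter_upwards [Φ_ae hsv hw.diff, ae_mem_S] with x d hx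
          have := (bar_slope (v := v) (diff_trans hsv hx d)).pow 2
          exact this.mono_left (nhdsWithin_mono _ fun t ht => ne_of_gt ht)
      have t2 := t1.sqrt
      have b : √(∫ x, ⟪𝒯.G w (x + s • v), v⟫ ^ 2 ∂Srf.μ) ≤ M := by
        rw [Real.sqrt_le_left hM0]
        have i1 : ∫ x, ⟪𝒯.G w (x + s • v), v⟫ ^ 2 ∂Srf.μ ≤ ∫ x, ‖v‖ ^ 2 * ‖𝒯.G w (x + s • v)‖ ^ 2 ∂Srf.μ := by
          apply integral_mono_of_nonneg (Filter.Eventually.of_forall fun x => by positivity) ((hw.int_tr _).const_mul _)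
          refine Filter.Eventually.of_forall fun x => ?_
          have := pow_le_pow_left₀ (abs_nonneg _) (abs_real_inner_le_norm (𝒯.G w (x + s • v)) v) 2
          rw [sq_abs, mul_pow, mul_comm] at this
          exact this
        rw [integral_const_mul] at i1
        refine i1.trans ?_
        have i2 := mul_le_mul_of_nonneg_left (E_est hsv hw) (sq_nonneg ‖v‖)
        refine i2.trans ?_
        rw [hM]
        have : 0 ≤ ‖v‖ ^ 2 * (𝒯.L ^ 2 * 𝒯.N w ^ 2) := by positivity
        nlinarith
      filter_upwards [t2.eventually_lt_const (b.trans_lt hr), self_mem_nhdsWithin] with t ht hts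
      refine lt_of_le_of_lt ?_ ht
      have hts' : 0 < t - s := sub_pos.2 hts
      rw [slope_def_field, div_le_iff₀ hts']
      have j := 𝒯.l2_tri (hFc t) (hFc s)
      refine j.trans (le_of_eq ?_)
      have e : (fun x => F t x - F s x) = fun x => (t - s) * ((t - s)⁻¹ * ((w ∘ 𝒯.A) (x + t • v) - (w ∘ 𝒯.A) (x + s • v))) := by
        ext x
        rw [mul_inv_cancel_left₀ hts'.ne']; simp only [hF]; ring
      rw [e, l2_smul, abs_of_pos hts', mul_comm]
      rfl
  rw [mul_one] at key
  refine le_trans (le_of_eq ?_) key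
  unfold l2
  congr 1
  apply integral_congr_ae
  filter_upwards [ae_mem_S] with x hx
  simp only [hF, Function.comp, one_smul]
  rw [Φ_S hx, 𝒯.fix hx]

theorem flow {w : E3 → ℝ} (hw : 𝒯.MemW w) (c : E3) :
    |∫ x, ⟪𝒯.G w x, c⟫ ∂Srf.μ| ≤ 5 * 𝒯.L ^ 2 * ‖c‖ * ∫ x, |w x| ∂Srf.μ := by
  have hL := 𝒯.L_pos
  have hδ := 𝒯.hδ
  obtain ⟨K, hK⟩ := hw.lip_bar
  have hwc : Continuous (w ∘ 𝒯.A) := hK.continuous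
  have hwA : ∀ s : ℝ, Continuous fun x : E3 => (w ∘ 𝒯.A) (x + s • c) := fun s =>
    hwc.comp (by fun_prop)
  have t1 : Filter.Tendsto (fun t : ℝ => ∫ x, (t - 0)⁻¹ * ((w ∘ 𝒯.A) (x + t • c) - (w ∘ 𝒯.A) (x + (0:ℝ) • c)) ∂Srf.μ)
      (nhdsWithin 0 (Set.Ioi 0)) (nhds (∫ x, ⟪𝒯.G w x, c⟫ ∂Srf.μ)) := by
    have := 𝒯.finite_μ
    apply tendsto_integral_filter_of_dominated_convergence (fun _ => (K * ‖c‖))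
    · refine Filter.Eventually.of_forall fun t => Continuous.aestronglyMeasurable ?_
      exact continuous_const.mul ((hwA t).sub (hwA 0))
    · filter_upwards [self_mem_nhdsWithin] with t ht
      exact Filter.Eventually.of_forall fun x => (slope_bdd hK x c (ne_of_gt ht))
    · exact integrable_const _
    · filter_upwards [hw.diff] with x d
      have := (bar_slope (w := w) (𝒯 := 𝒯) (x := x) (v := c) (s := 0) (by simpa using d))
      rw [zero_smul, add_zero] at this ⊢
      exact this.mono_left (nhdsWithin_mono _ fun t ht => ne_of_gt ht)
  refine le_of_tendsto t1.abs ?_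
  have hp : 0 < 𝒯.δ / (32 * 𝒯.L ^ 3 * (‖c‖ + 1)) := by positivity
  filter_upwards [self_mem_nhdsWithin, nhdsWithin_le_nhds (Iio_mem_nhds hp)] with t ht ht2
  have ht' : 0 < t := ht
  have hs : 𝒯.Small (t • c) := by
    unfold Small
    rw [norm_smul, Real.norm_eq_abs, abs_of_pos ht']
    have : t < 𝒯.δ / (32 * 𝒯.L ^ 3 * (‖c‖ + 1)) := ht2
    rw [lt_div_iff₀ (by positivity)] at this
    have h2 : t * ‖c‖ ≤ t * (‖c‖ + 1) := by nlinarith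
    have := mul_le_mul_of_nonneg_left h2 (by positivity : 0 ≤ 32 * 𝒯.L ^ 3)
    linarith
  have h := Φ_integral hs (𝒯.integrable_cont hw.continuous)
  have e : ∫ x, (t - 0)⁻¹ * ((w ∘ 𝒯.A) (x + t • c) - (w ∘ 𝒯.A) (x + (0:ℝ) • c)) ∂Srf.μ =
      t⁻¹ * (∫ x, w (𝒯.Φ (t • c) x) ∂Srf.μ - ∫ x, w x ∂Srf.μ) := by
    rw [integral_const_mul, sub_zero, ← integral_sub (Φ_integrable hs (𝒯.integrable_cont hw.continuous)) (𝒯.integrable_cont hw.continuous)]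
    congr 1
    apply integral_congr_ae
    filter_upwards [ae_mem_S] with x hx
    simp only [Function.comp, zero_smul, add_zero]
    rw [Φ_S hx, 𝒯.fix hx]
  rw [e, abs_mul, abs_inv, abs_of_pos ht', inv_mul_le_iff₀ ht']
  rw [norm_smul, Real.norm_eq_abs, abs_of_pos ht'] at h
  linarith

end Tube

end

section
namespace Tube
variable {Srf : SmoothSurface} {𝒯 : Tube Srf}

theorem MemW.zero : 𝒯.MemW (fun _ => 0) :=
  ⟨⟨0, LipschitzWith.const 0⟩, Filter.Eventually.of_forall fun x => by
    have : ((fun _ => 0 : E3 → ℝ) ∘ 𝒯.A) = fun _ => 0 := rfl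
    rw [this]; exact differentiableAt_const _⟩

theorem f_le {f w : E3 → ℝ} (hf : 𝒯.MemW f) (hw : 𝒯.MemW w) :
    |∫ x, f x * w x ∂Srf.μ| ≤ l2 Srf f * 𝒯.N w :=
  (l2_cs hf.int_sq hw.int_sq).trans (mul_le_mul_of_nonneg_left (l2_le_N hw) (l2_nonneg _))

theorem near_min {f : E3 → ℝ} (hf : 𝒯.MemW f) {ε : ℝ} (hε : 0 < ε) :
    ∃ u, 𝒯.MemW u ∧ (∀ w, 𝒯.MemW w → |𝒯.aF u w - ∫ x, f x * w x ∂Srf.μ| ≤ ε * 𝒯.N w) ∧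
      𝒯.N u ≤ l2 Srf f + ε := by
  set J : (E3 → ℝ) → ℝ := fun w => 1 / 2 * 𝒯.aF w w - ∫ x, f x * w x ∂Srf.μ with hJ
  set A : Set ℝ := J '' {w | 𝒯.MemW w} with hA
  have hne : A.Nonempty := ⟨_, _, MemW.zero, rfl⟩
  have hbd : BddBelow A := by
    refine ⟨-(l2 Srf f ^ 2 / 2), ?_⟩
    rintro _ ⟨w, hw, rfl⟩
    have h1 := (abs_le.1 (f_le hf hw)).2
    have h2 := N_sq (𝒯 := 𝒯) w
    simp only [hJ]
    nlinarith [sq_nonneg (𝒯.N w - l2 Srf f)]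
  obtain ⟨_, ⟨u, hu, rfl⟩, hlt⟩ := exists_lt_of_csInf_lt hne (show sInf A < sInf A + ε ^ 2 / 2 by nlinarith)
  have main : ∀ w, 𝒯.MemW w → |𝒯.aF u w - ∫ x, f x * w x ∂Srf.μ| ≤ ε * 𝒯.N w := by
    intro w hw
    set B := 𝒯.aF u w - ∫ x, f x * w x ∂Srf.μ with hB
    have q : ∀ t : ℝ, 0 ≤ (𝒯.N w ^ 2 / 2) * (t * t) + B * t + ε ^ 2 / 2 := by
      intro t
      have hm : 𝒯.MemW (fun x => u x + t * w x) := hu.add (hw.smul t)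
      have h1 : sInf A ≤ J (fun x => u x + t * w x) := csInf_le hbd ⟨_, hm, rfl⟩
      have e1 : 𝒯.aF (fun x => u x + t * w x) (fun x => u x + t * w x) = 𝒯.aF u u + 2 * t * 𝒯.aF u w + t ^ 2 * 𝒯.aF w w := by
        have hs := hw.smul t
        rw [aF_add_left hu hs hm, aF_add_right hu hs hu, aF_add_right hu hs hs, aF_comm (fun x => t * w x) u,
          aF_smul_left hw, aF_smul_right hw, aF_smul_right hw]
        ring
      have e2 : ∫ x, f x * (u x + t * w x) ∂Srf.μ = ∫ x, f x * u x ∂Srf.μ + t * ∫ x, f x * w x ∂Srf.μ := by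
        rw [← integral_const_mul, ← integral_add (hf.int_mul hu) ((hf.int_mul hw).const_mul t)]
        congr 1; ext x; ring
      simp only [hJ] at h1 hlt
      rw [e1, e2] at h1
      rw [N_sq, hB]
      nlinarith
    have hd := discrim_le_zero q
    unfold discrim at hd
    apply abs_le_of_sq_le_sq _ (mul_nonneg hε.le (N_nonneg _))
    nlinarith
  refine ⟨u, hu, main, ?_⟩
  have h1 := (abs_le.1 (main u hu)).2
  have h2 := (abs_le.1 (f_le hf hu)).2
  rw [← N_sq] at h1
  rcases eq_or_lt_of_le (N_nonneg (𝒯 := 𝒯) u) with h0 | h0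
  · rw [← h0]; have := l2_nonneg (Srf := Srf) f; linarith
  · nlinarith

theorem nirenberg {f u : E3 → ℝ} {ε : ℝ} (hε : 0 < ε) (hf : 𝒯.MemW f) (hu : 𝒯.MemW u)
    (h : ∀ w, 𝒯.MemW w → |𝒯.aF u w - ∫ x, f x * w x ∂Srf.μ| ≤ ε * 𝒯.N w)
    (hN : 𝒯.N u ≤ l2 Srf f + ε) {v : E3} (hv : 𝒯.Small v) :
    𝒯.N (fun x => u (𝒯.Φ v x) - u x) ≤ 50 * 𝒯.L ^ 3 * ‖v‖ * l2 Srf f + 5 * ε := by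
  have hL := 𝒯.L_pos
  set F := l2 Srf f with hF
  have hF0 : 0 ≤ F := l2_nonneg _
  have huΦ := hu.compΦ hv
  set d : E3 → ℝ := fun x => u (𝒯.Φ v x) - u x with hd
  have hdm : 𝒯.MemW d := huΦ.sub hu
  set w : E3 → ℝ := fun x => d (Ψ hv x) with hw
  have hwm : 𝒯.MemW w := hdm.compΨ hv
  have hwΦ : (fun x => w (𝒯.Φ v x)) = d := by ext x; simp only [hw]; rw [Ψ_Φ]
  have hk := hv.k3
  set k := 𝒯.L ^ 3 * ‖v‖ with hkd
  have hk0 : 0 ≤ k := by positivity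
  have n0 := N_nonneg (𝒯 := 𝒯) d
  have nw := N_nonneg (𝒯 := 𝒯) w
  have nu := N_nonneg (𝒯 := 𝒯) u
  -- norm of w
  have h1 := R1 hv hwm hwm
  rw [hwΦ, ← N_sq, ← N_sq] at h1
  have hNw : 𝒯.N w ≤ 2 * 𝒯.N d := by
    apply abs_le_of_sq_le_sq' _ (by positivity) |>.2
    have := (abs_le.1 h1).1
    have e : 23 * 𝒯.L ^ 3 * ‖v‖ * (𝒯.N w * 𝒯.N w) = 23 * k * 𝒯.N w ^ 2 := by rw [hkd]; ring
    rw [e] at this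
    nlinarith [sq_nonneg (𝒯.N w)]
  have h2 := R1 hv hu hwm
  rw [hwΦ] at h2
  have h3 := R2 hv hwm
  rw [show (fun x => w (𝒯.Φ v x) - w x) = fun x => d x - w x from by
    ext x; exact congrArg (· - w x) (congrFun hwΦ x)] at h3
  have h4 := (abs_le.1 (h _ (hdm.sub hwm))).1
  have h5 := (abs_le.1 (l2_cs hf.int_sq (hdm.sub hwm).int_sq)).1
  have h6 := N_sub hdm hwm
  have e1 : 𝒯.N d ^ 2 = 𝒯.aF (fun x => u (𝒯.Φ v x)) d - 𝒯.aF u d := by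
    rw [N_sq]; nth_rewrite 1 [hd]; exact aF_sub_left huΦ hu hdm
  have e2 := aF_sub_right hdm hwm hu
  rw [e2] at h4
  have h2' := (abs_le.1 h2).2
  have b1 : 23 * 𝒯.L ^ 3 * ‖v‖ * (𝒯.N u * 𝒯.N w) ≤ 23 * k * ((F + ε) * (2 * 𝒯.N d)) := by
    have : 23 * 𝒯.L ^ 3 * ‖v‖ = 23 * k := by rw [hkd]; ring
    rw [this]
    have := mul_le_mul hN hNw nw (by positivity)
    exact mul_le_mul_of_nonneg_left this (by positivity)
  have b2 : F * l2 Srf (fun x => d x - w x) ≤ F * (2 * k * (2 * 𝒯.N d)) := by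
    apply mul_le_mul_of_nonneg_left _ hF0
    refine h3.trans ?_
    have i1 : 2 * 𝒯.L * ‖v‖ ≤ 2 * k := by
      have : 𝒯.L * ‖v‖ ≤ k := mul_le_mul_of_nonneg_right (le_self_pow₀ 𝒯.hL (by norm_num)) (norm_nonneg _)
      linarith
    exact mul_le_mul i1 hNw nw (by positivity)
  have b3 : ε * 𝒯.N (fun x => d x - w x) ≤ ε * (3 * 𝒯.N d) := by
    apply mul_le_mul_of_nonneg_left _ hε.le
    linarith
  have main : 𝒯.N d ^ 2 ≤ (50 * k * F + 5 * ε) * 𝒯.N d := by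
    have hs : 46 * k * ε * 𝒯.N d ≤ 46 * (1 / 32) * ε * 𝒯.N d := by gcongr
    have : 0 ≤ ε * 𝒯.N d := by positivity
    nlinarith
  have e3 : 50 * 𝒯.L ^ 3 * ‖v‖ * F + 5 * ε = 50 * k * F + 5 * ε := by rw [hkd]; ring
  rw [e3]
  rcases eq_or_lt_of_le n0 with h0 | h0
  · rw [← h0]; positivity
  · nlinarith

end Tube

end

section

/-- a mollification kernel -/
structure Kern where
  ρ : E3 → ℝ
  M : ℝ
  hM : 1 ≤ M
  cont : Continuous ρ
  nn : ∀ v, 0 ≤ ρ v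
  le : ∀ v, ρ v ≤ M
  lip : ∀ v w, |ρ v - ρ w| ≤ M * ‖v - w‖
  supp : ∀ v, 1 < ‖v‖ → ρ v = 0
  int : ∫ v, ρ v = 1

theorem exists_kern : Nonempty Kern := by
  set k : E3 → ℝ := fun v => max 0 (1 - ‖v‖) with hk
  have kc : Continuous k := by fun_prop
  have ks : HasCompactSupport k := by
    apply HasCompactSupport.intro (isCompact_closedBall (0 : E3) 1)
    intro v hv
    simp only [mem_closedBall, dist_zero_right, not_le] at hv
    simp only [hk]; exact max_eq_left (by linarith)
  have kn : 0 ≤ k := fun v => le_max_left _ _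
  have hp : 0 < ∫ v, k v := by
    apply Continuous.integral_pos_of_hasCompactSupport_nonneg_nonzero kc ks kn (x := 0)
    simp [hk]
  set c := ∫ v, k v with hc
  refine ⟨⟨fun v => c⁻¹ * k v, max 1 c⁻¹, le_max_left _ _, by fun_prop, fun v => mul_nonneg (by positivity) (kn v), ?_, ?_, ?_, ?_⟩⟩
  · intro v
    have : k v ≤ 1 := by simp only [hk]; exact max_le (by norm_num) (by linarith [norm_nonneg v])
    have i : (0:ℝ) ≤ c⁻¹ := by positivity
    exact (mul_le_of_le_one_right i this).trans (le_max_right _ _)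
  · intro v w
    have i : (0:ℝ) ≤ c⁻¹ := by positivity
    rw [← mul_sub, abs_mul, abs_of_nonneg i]
    apply mul_le_mul (le_max_right _ _) _ (abs_nonneg _) (by positivity)
    have := abs_max_sub_max_le_abs (1 - ‖v‖) (1 - ‖w‖) 0
    simp only [hk]
    rw [max_comm 0, max_comm 0]
    refine this.trans ?_
    rw [show (1 - ‖v‖ - (1 - ‖w‖)) = -(‖v‖ - ‖w‖) by ring, abs_neg]
    exact abs_norm_sub_norm_le v w
  · intro v hv
    simp only [hk]; rw [max_eq_left (by linarith), mul_zero]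
  · rw [integral_const_mul]; exact inv_mul_cancel₀ hp.ne'

theorem fderiv_sm (U : E3 → ℝ) : StronglyMeasurable (fderiv ℝ U) := by
  have h : Measurable (fun x => (InnerProductSpace.toDual ℝ E3).symm (fderiv ℝ U x)) :=
    (InnerProductSpace.toDual ℝ E3).symm.continuous.measurable.comp (measurable_fderiv ℝ _)
  have h2 := (InnerProductSpace.toDual ℝ E3).continuous.comp_stronglyMeasurable h.stronglyMeasurable
  have e : (fun x => (InnerProductSpace.toDual ℝ E3) ((InnerProductSpace.toDual ℝ E3).symm (fderiv ℝ U x))) = fderiv ℝ U := by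
    funext x; exact (InnerProductSpace.toDual ℝ E3).apply_symm_apply _
  rw [e] at h2
  exact h2

namespace Kern
variable (k : Kern) {F : Type*} [NormedAddCommGroup F] [NormedSpace ℝ F] [CompleteSpace F]

theorem M_pos : 0 < k.M := lt_of_lt_of_le one_pos k.hM

theorem hcs : HasCompactSupport k.ρ := by
  apply HasCompactSupport.intro (isCompact_closedBall (0 : E3) 1)
  intro v hv
  simp only [mem_closedBall, dist_zero_right, not_le] at hv
  exact k.supp v hv

theorem int_sh (y : E3) : ∫ v, k.ρ (v - y) = 1 := by
  rw [integral_sub_right_eq_self (fun v => k.ρ v) y]; exact k.int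

theorem itg (y : E3) : Integrable (fun v => k.ρ (v - y)) :=
  (k.cont.integrable_of_hasCompactSupport k.hcs).comp_sub_right y

theorem itg_smul (y : E3) {φ : E3 → F} (hφ : StronglyMeasurable φ) {K : ℝ} (hK : ∀ x, ‖φ x‖ ≤ K) (x : E3) (h : ℝ) :
    Integrable (fun v => k.ρ (v - y) • φ (x + h • v)) :=
  (k.itg y).smul_bdd K ((hφ.comp_measurable (g := fun v : E3 => x + h • v) (by fun_prop)).aestronglyMeasurable)
    (Filter.Eventually.of_forall fun v => hK _)

theorem supp_sh {R : ℝ} {y v : E3} (hy : ‖y‖ ≤ R) (hv : v ∉ closedBall (0:E3) (R + 1)) : k.ρ (v - y) = 0 := by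
  apply k.supp
  simp only [mem_closedBall, dist_zero_right, not_le] at hv
  have := norm_sub_norm_le v y
  linarith

theorem itg_ball {φ : E3 → F} (hφ : StronglyMeasurable φ) {K : ℝ} (hK : ∀ x, ‖φ x‖ ≤ K) (x : E3) (h R : ℝ) :
    IntegrableOn (fun v => ‖φ (x + h • v)‖) (closedBall (0:E3) R) := by
  apply Measure.integrableOn_of_bounded (M := K)
  · exact (isCompact_closedBall (0:E3) R).measure_lt_top.ne
  · exact ((hφ.comp_measurable (by fun_prop)).norm).aestronglyMeasurable
  · exact Filter.Eventually.of_forall fun v => by rw [norm_norm]; exact hK _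

/-- basic estimate -/
theorem est {σ : E3 → ℝ} {c R : ℝ} (hc : ∀ v, |σ v| ≤ c) (hs : ∀ v ∉ closedBall (0:E3) R, σ v = 0)
    {φ : E3 → F} (hφ : StronglyMeasurable φ) {K : ℝ} (hK : ∀ x, ‖φ x‖ ≤ K) (x : E3) (h : ℝ) :
    ‖∫ v, σ v • φ (x + h • v)‖ ≤ c * ∫ v in closedBall (0:E3) R, ‖φ (x + h • v)‖ := by
  rw [← integral_const_mul, ← integral_indicator measurableSet_closedBall]
  apply norm_integral_le_of_norm_le
  · exact (integrable_indicator_iff measurableSet_closedBall).2 ((itg_ball hφ hK x h R).const_mul c)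
  · refine Filter.Eventually.of_forall fun v => ?_
    by_cases hv : v ∈ closedBall (0:E3) R
    · rw [Set.indicator_of_mem hv, norm_smul]
      exact mul_le_mul_of_nonneg_right (hc v) (norm_nonneg _)
    · rw [Set.indicator_of_notMem hv, hs v hv]; simp

/-- the averaged function, in shifted variables -/
def T (φ : E3 → F) (h : ℝ) (x y : E3) : F := ∫ v, k.ρ (v - y) • φ (x + h • v)

theorem T_shift (φ : E3 → F) (h : ℝ) (x y : E3) : k.T φ h (x + h • y) 0 = k.T φ h x y := by
  unfold T
  rw [← integral_sub_right_eq_self _ y]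
  congr 1; ext v
  rw [sub_zero, smul_sub]
  congr 2; abel

theorem T_bd {φ : E3 → F} (hφ : StronglyMeasurable φ) {K : ℝ} (hK : ∀ x, ‖φ x‖ ≤ K) (h : ℝ) (x : E3) {y : E3} {R : ℝ} (hy : ‖y‖ ≤ R) :
    ‖k.T φ h x y‖ ≤ k.M * ∫ v in closedBall (0:E3) (R + 1), ‖φ (x + h • v)‖ :=
  est (fun v => by rw [abs_of_nonneg (k.nn _)]; exact k.le _) (fun v hv => k.supp_sh hy hv) hφ hK x h

theorem T_lip {φ : E3 → F} (hφ : StronglyMeasurable φ) {K : ℝ} (hK : ∀ x, ‖φ x‖ ≤ K) (h : ℝ) (x : E3) {y y' : E3} {R : ℝ}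
    (hy : ‖y‖ ≤ R) (hy' : ‖y'‖ ≤ R) :
    ‖k.T φ h x y - k.T φ h x y'‖ ≤ k.M * ‖y - y'‖ * ∫ v in closedBall (0:E3) (R + 1), ‖φ (x + h • v) - φ x‖ := by
  have hφ' : StronglyMeasurable (fun z => φ z - φ x) := hφ.sub stronglyMeasurable_const
  have hK' : ∀ z, ‖φ z - φ x‖ ≤ K + K := fun z => (norm_sub_le _ _).trans (add_le_add (hK _) (hK _))
  have := est (σ := fun v => k.ρ (v - y) - k.ρ (v - y')) (c := k.M * ‖y - y'‖) (R := R + 1)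
    (fun v => (k.lip _ _).trans (by rw [sub_sub_sub_cancel_left, norm_sub_rev]))
    (fun v hv => by simp only [k.supp_sh hy hv, k.supp_sh hy' hv, sub_zero]) hφ' hK' x h
  convert this using 2
  unfold T
  rw [← integral_sub (k.itg_smul y hφ hK x h) (k.itg_smul y' hφ hK x h)]
  have e : ∀ v, (k.ρ (v - y) - k.ρ (v - y')) • (φ (x + h • v) - φ x) =
    (k.ρ (v - y) • φ (x + h • v) - k.ρ (v - y') • φ (x + h • v)) - (k.ρ (v - y) - k.ρ (v - y')) • φ x := by
    intro v; rw [smul_sub, sub_smul]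
  simp_rw [e]
  have i1 : Integrable (fun v => k.ρ (v - y) • φ (x + h • v) - k.ρ (v - y') • φ (x + h • v)) :=
    (k.itg_smul y hφ hK x h).sub (k.itg_smul y' hφ hK x h)
  have i2 : Integrable (fun v => (k.ρ (v - y) - k.ρ (v - y')) • φ x) := ((k.itg y).sub (k.itg y')).smul_const _
  rw [integral_sub i1 i2, integral_smul_const, integral_sub (k.itg y) (k.itg y'), k.int_sh, k.int_sh]
  simp

theorem T_near {φ : E3 → F} (hφ : StronglyMeasurable φ) {K : ℝ} (hK : ∀ x, ‖φ x‖ ≤ K) (h : ℝ) (x : E3) {R : ℝ} (hR : 0 ≤ R) :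
    ‖k.T φ h x 0 - φ x‖ ≤ k.M * ∫ v in closedBall (0:E3) (R + 1), ‖φ (x + h • v) - φ x‖ := by
  have hφ' : StronglyMeasurable (fun z => φ z - φ x) := hφ.sub stronglyMeasurable_const
  have hK' : ∀ z, ‖φ z - φ x‖ ≤ K + K := fun z => (norm_sub_le _ _).trans (add_le_add (hK _) (hK _))
  have h0 : ‖(0:E3)‖ ≤ R := by simpa using hR
  have := k.T_bd hφ' hK' h x h0
  convert this using 2
  unfold T
  simp_rw [smul_sub]
  rw [integral_sub (k.itg_smul 0 hφ hK x h) ((k.itg 0).smul_const _), integral_smul_const, k.int_sh, one_smul]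

/-- differentiating the mollification -/
theorem T_deriv {U : E3 → ℝ} {K : ℝ≥0} (hU : LipschitzWith K U) {h : ℝ} (hh : 0 < h) (x : E3) :
    HasFDerivAt (fun x => k.T U h x 0) (k.T (fderiv ℝ U) h x 0) x := by
  unfold T
  simp only [sub_zero]
  have hm : ∀ x : E3, Continuous fun v => k.ρ v • U (x + h • v) := fun x =>
    k.cont.smul (hU.continuous.comp (by fun_prop))
  have hρ : Integrable (fun v => k.ρ v) := by simpa using k.itg 0
  have hcx : ∀ x : E3, Integrable (fun v => k.ρ v • U (x + h • v)) := fun x =>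
    (hm x).integrable_of_hasCompactSupport (k.hcs.smul_right)
  have had : ∀ᵐ v : E3, DifferentiableAt ℝ U (x + h • v) := by
    have h1 : LipschitzWith (K * (‖h‖₊ * 1)) (fun v : E3 => U (x + h • v)) := by
      refine hU.comp ?_
      apply LipschitzWith.of_dist_le_mul
      intro v w
      rw [dist_eq_norm, dist_eq_norm, add_sub_add_left_eq_sub, ← smul_sub, norm_smul]
      simp
    filter_upwards [h1.ae_differentiableAt] with v hv
    have h2 : U = (fun v : E3 => U (x + h • v)) ∘ (fun z => h⁻¹ • (z - x)) := by
      ext z; simp [smul_smul, hh.ne']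
    rw [h2]
    apply DifferentiableAt.comp
    · simpa [smul_smul, hh.ne'] using hv
    · fun_prop
  refine (hasFDerivAt_integral_of_dominated_loc_of_lip (F := fun x v => k.ρ v • U (x + h • v))
    (F' := fun v => k.ρ v • fderiv ℝ U (x + h • v)) (bound := fun v => K * k.ρ v) (s := Set.univ) Filter.univ_mem
    (Filter.Eventually.of_forall fun x => (hm x).aestronglyMeasurable) (hcx x) ?_ ?_ ?_ ?_).2
  · exact (k.cont.stronglyMeasurable.smul ((fderiv_sm U).comp_measurable (by fun_prop))).aestronglyMeasurable
  · refine Filter.Eventually.of_forall fun v => ?_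
    apply LipschitzWith.lipschitzOnWith
    apply LipschitzWith.of_dist_le_mul
    intro a b
    rw [dist_eq_norm, ← smul_sub, norm_smul, Real.norm_eq_abs, abs_of_nonneg (k.nn v)]
    have h1 := hU.dist_le_mul (a + h • v) (b + h • v)
    rw [dist_add_right, dist_eq_norm] at h1
    have h2 : ((K * k.ρ v).nnabs : ℝ) = K * k.ρ v := by
      rw [Real.coe_nnabs, abs_of_nonneg]
      exact mul_nonneg K.2 (k.nn v)
    rw [h2]
    have := mul_le_mul_of_nonneg_left h1 (k.nn v)
    linarith
  · exact hρ.const_mul _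
  · filter_upwards [had] with v hv
    have h1 : HasFDerivAt (fun z : E3 => z + h • v) (ContinuousLinearMap.id ℝ E3) x := (hasFDerivAt_id x).add_const _
    have h2 := (hv.hasFDerivAt.comp x h1).const_smul (k.ρ v)
    rw [ContinuousLinearMap.comp_id] at h2
    exact h2

theorem T_lipschitz {U : E3 → ℝ} {K : ℝ≥0} (hU : LipschitzWith K U) (h : ℝ) :
    LipschitzWith K (fun x => k.T U h x 0) := by
  apply LipschitzWith.of_dist_le_mul
  intro a b
  have hc : ∀ x : E3, Integrable (fun v => k.ρ (v - 0) • U (x + h • v)) := fun x => by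
    simp only [sub_zero]
    have : Continuous fun v => k.ρ v • U (x + h • v) := k.cont.smul (hU.continuous.comp (by fun_prop))
    exact this.integrable_of_hasCompactSupport (k.hcs.smul_right)
  unfold T
  rw [dist_eq_norm, ← integral_sub (hc a) (hc b)]
  have : ‖∫ v, (k.ρ (v - 0) • U (a + h • v) - k.ρ (v - 0) • U (b + h • v))‖ ≤ ∫ v, k.ρ (v - 0) * (K * dist a b) := by
    apply norm_integral_le_of_norm_le ((k.itg 0).mul_const _)
    refine Filter.Eventually.of_forall fun v => ?_
    rw [← smul_sub, norm_smul, Real.norm_eq_abs, abs_of_nonneg (k.nn _)]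
    apply mul_le_mul_of_nonneg_left _ (k.nn _)
    have h1 := hU.dist_le_mul (a + h • v) (b + h • v)
    rwa [dist_add_right, dist_eq_norm] at h1
  refine this.trans ?_
  rw [integral_mul_const, k.int_sh, one_mul]

end Kern

end

section

theorem fub_sq {α β : Type*} [MeasurableSpace α] [MeasurableSpace β] {μ : Measure α} {ν : Measure β} [IsFiniteMeasure μ] [IsFiniteMeasure ν]
    {Q : α → β → ℝ} (hQ : Measurable (Function.uncurry Q)) {K : ℝ} (hK : ∀ x v, |Q x v| ≤ K) {c : ℝ}
    (hc : ∀ᵐ v ∂ν, ∫ x, Q x v ^ 2 ∂μ ≤ c) :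
    Integrable (fun x => (∫ v, Q x v ∂ν) ^ 2) μ ∧ ∫ x, (∫ v, Q x v ∂ν) ^ 2 ∂μ ≤ (ν.real Set.univ) ^ 2 * c := by
  have hq2 : Measurable (Function.uncurry fun x v => Q x v ^ 2) := hQ.pow_const 2
  have hb2 : ∀ x v, |Q x v ^ 2| ≤ K ^ 2 := fun x v => by
    rw [abs_pow]; exact pow_le_pow_left₀ (abs_nonneg _) (hK x v) 2
  have hi : Integrable (Function.uncurry fun x v => Q x v ^ 2) (μ.prod ν) :=
    Integrable.of_bound hq2.aestronglyMeasurable (K ^ 2) (Filter.Eventually.of_forall fun p => hb2 p.1 p.2)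
  have hx : ∀ x, Integrable (fun v => Q x v ^ 2) ν := fun x =>
    Integrable.of_bound (hq2.comp measurable_prodMk_left).aestronglyMeasurable (K ^ 2) (Filter.Eventually.of_forall fun p => hb2 x p)
  have hpt : ∀ x, (∫ v, Q x v ∂ν) ^ 2 ≤ ν.real Set.univ * ∫ v, Q x v ^ 2 ∂ν := by
    intro x
    have h := cs_int (r := fun v => Q x v) (q := fun _ => (1:ℝ)) (hx x) (integrable_const (1:ℝ) (μ := ν))
      (Filter.Eventually.of_forall fun v => sq_nonneg _) (Filter.Eventually.of_forall fun v => by norm_num)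
      (Filter.Eventually.of_forall fun v => by simp)
    have h2 := pow_le_pow_left₀ (abs_nonneg _) h 2
    rw [sq_abs, mul_pow, Real.sq_sqrt (integral_nonneg fun v => sq_nonneg _), Real.sq_sqrt (integral_nonneg fun v => by norm_num)] at h2
    simp only [integral_const, smul_eq_mul, mul_one] at h2
    linarith
  have hm : Measurable fun x => ∫ v, Q x v ∂ν := by
    have := hQ.stronglyMeasurable.integral_prod_right (ν := ν)
    exact this.measurable
  have hI2 : Integrable (fun x => ν.real Set.univ * ∫ v, Q x v ^ 2 ∂ν) μ := (hi.integral_prod_left).const_mul _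
  have hI : Integrable (fun x => (∫ v, Q x v ∂ν) ^ 2) μ := by
    refine hI2.mono' (hm.pow_const 2).aestronglyMeasurable (Filter.Eventually.of_forall fun x => ?_)
    rw [Real.norm_eq_abs, abs_of_nonneg (sq_nonneg _)]
    exact hpt x
  refine ⟨hI, (integral_mono hI hI2 hpt).trans ?_⟩
  rw [integral_const_mul, integral_integral_swap hi, sq, mul_assoc]
  apply mul_le_mul_of_nonneg_left _ measureReal_nonneg
  have h3 := integral_mono_ae hi.integral_prod_right (integrable_const c (μ := ν)) hc
  simpa using h3

namespace Tube
variable {Srf : SmoothSurface} {𝒯 : Tube Srf}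

theorem G_Φ_eq {v x : E3} (hv : 𝒯.Small v) (hx : x ∈ Srf.S) {w : E3 → ℝ}
    (hw : DifferentiableAt ℝ (w ∘ 𝒯.A) (𝒯.Φ v x)) : 𝒯.G (fun y => w (𝒯.Φ v y)) x = 𝒯.D x (𝒯.G w (x + v)) := by
  have hd := diff_trans hv hx hw
  have hev : (fun y => w (𝒯.Φ v y)) ∘ 𝒯.A =ᶠ[nhds x] fun z => (w ∘ 𝒯.A) (𝒯.A z + v) := by
    filter_upwards [𝒯.U_open.mem_nhds (𝒯.S_sub_U hx)] with z hz
    simp only [Function.comp]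
    rw [Φ_S (𝒯.A_mem hz)]
  have h1 : HasFDerivAt (fun z => 𝒯.A z + v) (𝒯.D x) x := (𝒯.hasD x).add_const v
  have h2 : DifferentiableAt ℝ (w ∘ 𝒯.A) (𝒯.A x + v) := by rw [𝒯.fix hx]; exact hd
  have h3 := HasFDerivAt.comp x h2.hasFDerivAt h1
  apply ext_inner_right ℝ
  intro τ
  rw [G_inner, hev.fderiv_eq]
  have h4 : fderiv ℝ (fun z => (w ∘ 𝒯.A) (𝒯.A z + v)) x = _ := h3.fderiv
  rw [h4, 𝒯.D_symm hx, G_inner, 𝒯.fix hx]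
  rfl

theorem D_idem {x : E3} (hx : x ∈ Srf.S) (w : E3) : 𝒯.D x (𝒯.D x w) = 𝒯.D x w := by
  have := 𝒯.D_comp (𝒯.S_sub_U hx) w
  rwa [𝒯.fix hx] at this

theorem normal_part {v x : E3} (hv : 𝒯.Small v) (hx : x ∈ Srf.S) {w : E3 → ℝ}
    (hw : DifferentiableAt ℝ (w ∘ 𝒯.A) (𝒯.Φ v x)) :
    ‖𝒯.G w (x + v) - 𝒯.D x (𝒯.G w (x + v))‖ ≤ 𝒯.L * ‖v‖ * ‖𝒯.G w (𝒯.Φ v x)‖ := by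
  have hL := 𝒯.L_pos
  set g := 𝒯.G w (x + v) with hg
  set q := g - 𝒯.D x g with hq
  have hDq : 𝒯.D x q = 0 := by rw [hq, map_sub, D_idem hx, sub_self]
  have h1 : ‖q‖ ^ 2 = ⟪g, q⟫ := by
    rw [← real_inner_self_eq_norm_sq]
    nth_rewrite 1 [hq]
    rw [inner_sub_left, 𝒯.D_symm hx, hDq, inner_zero_right, sub_zero]
  have hw' := hw
  rw [Φ_S hx] at hw'
  have h2 := 𝒯.G_bar (add_mem_U hv hx) hw' q
  rw [← hg] at h2
  rw [h2, ← Φ_S hx] at h1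
  have h3 : ‖𝒯.D (x + v) q‖ ≤ 𝒯.L * ‖v‖ * ‖q‖ := by
    have := 𝒯.D_lip_apply (x + v) x q
    rw [hDq, sub_zero, add_sub_cancel_left] at this
    exact this
  have h4 := real_inner_le_norm (𝒯.G w (𝒯.Φ v x)) (𝒯.D (x + v) q)
  have h5 := mul_le_mul_of_nonneg_left h3 (norm_nonneg (𝒯.G w (𝒯.Φ v x)))
  rcases eq_or_lt_of_le (norm_nonneg q) with h0 | h0
  · rw [← h0]; positivity
  · nlinarith

theorem trans_est {v : E3} (hv : 𝒯.Small v) {u : E3 → ℝ} (hu : 𝒯.MemW u) :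
    ∫ x, ‖𝒯.G u (x + v) - 𝒯.G u x‖ ^ 2 ∂Srf.μ ≤
      2 * 𝒯.N (fun x => u (𝒯.Φ v x) - u x) ^ 2 + 4 * 𝒯.L ^ 2 * ‖v‖ ^ 2 * 𝒯.N u ^ 2 := by
  have hL := 𝒯.L_pos
  have hd : 𝒯.MemW (fun x => u (𝒯.Φ v x) - u x) := (hu.compΦ hv).sub hu
  obtain ⟨K, hK0, hK⟩ := hu.G_bdd
  have hi : Integrable (fun x => ‖𝒯.G u (x + v) - 𝒯.G u x‖ ^ 2) Srf.μ := by
    refine 𝒯.integrable_of_bdd (K := (K + K) ^ 2) ?_ ?_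
    · exact ((((𝒯.G_measurable u).comp (measurable_id.add_const v)).sub (𝒯.G_measurable u)).norm.pow_const 2).aestronglyMeasurable
    · refine Filter.Eventually.of_forall fun x => ?_
      rw [abs_of_nonneg (by positivity)]
      exact pow_le_pow_left₀ (norm_nonneg _) ((norm_sub_le _ _).trans (add_le_add (hK _) (hK _))) 2
  have h1 : ∫ x, ‖𝒯.G u (x + v) - 𝒯.G u x‖ ^ 2 ∂Srf.μ ≤
      ∫ x, (2 * ‖𝒯.G (fun x => u (𝒯.Φ v x) - u x) x‖ ^ 2 + 2 * 𝒯.L ^ 2 * ‖v‖ ^ 2 * ‖𝒯.G u (𝒯.Φ v x)‖ ^ 2) ∂Srf.μ := by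
    apply integral_mono_ae hi ((hd.int_g2.const_mul _).add ((Φ_integrable hv hu.int_g2).const_mul _))
    filter_upwards [Φ_ae hv hu.diff, hu.diff, ae_mem_S, (hu.compΦ hv).diff] with x d1 d2 hx d3
    have e1 := G_sub (𝒯 := 𝒯) d3 d2
    rw [G_Φ_eq hv hx d1] at e1
    have e2 := normal_part hv hx d1
    simp only [Pi.add_apply]
    rw [e1]
    have e3 : 𝒯.G u (x + v) - 𝒯.G u x = (𝒯.D x (𝒯.G u (x + v)) - 𝒯.G u x) + (𝒯.G u (x + v) - 𝒯.D x (𝒯.G u (x + v))) := by abel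
    rw [e3]
    have e4 := norm_add_le (𝒯.D x (𝒯.G u (x + v)) - 𝒯.G u x) (𝒯.G u (x + v) - 𝒯.D x (𝒯.G u (x + v)))
    set a := ‖𝒯.D x (𝒯.G u (x + v)) - 𝒯.G u x‖
    set b := ‖𝒯.G u (x + v) - 𝒯.D x (𝒯.G u (x + v))‖
    have e5 : b ^ 2 ≤ (𝒯.L * ‖v‖ * ‖𝒯.G u (𝒯.Φ v x)‖) ^ 2 := pow_le_pow_left₀ (norm_nonneg _) e2 2
    have e6 := pow_le_pow_left₀ (norm_nonneg _) e4 2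
    simp only [mul_pow] at e5
    nlinarith [sq_nonneg (a - b)]
  refine h1.trans ?_
  rw [integral_add (hd.int_g2.const_mul _) ((Φ_integrable hv hu.int_g2).const_mul _), integral_const_mul, integral_const_mul]
  have h2 := int_g2_le hd
  have h3 := Φ_integral_le hv hu.int_g2 (fun x => by positivity)
  have h4 := int_g2_le hu
  have h5 : 2 * 𝒯.L ^ 2 * ‖v‖ ^ 2 * ∫ x, ‖𝒯.G u (𝒯.Φ v x)‖ ^ 2 ∂Srf.μ ≤ 2 * 𝒯.L ^ 2 * ‖v‖ ^ 2 * (2 * 𝒯.N u ^ 2) := by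
    apply mul_le_mul_of_nonneg_left _ (by positivity)
    linarith
  linarith

end Tube

end

section
namespace Tube
variable {Srf : SmoothSurface} {𝒯 : Tube Srf}

/-- the quantity controlling the mollification -/
def Qf (𝒯 : Tube Srf) (u : E3 → ℝ) (h : ℝ) (x v : E3) : ℝ :=
  ‖𝒯.G u (x + h • v)‖ + h⁻¹ * ‖𝒯.G u (x + h • v) - 𝒯.G u x‖ + h⁻¹ * |(u ∘ 𝒯.A) (x + h • v) - (u ∘ 𝒯.A) x|

theorem Qf_nonneg {u : E3 → ℝ} {h : ℝ} (hh : 0 < h) (x v : E3) : 0 ≤ 𝒯.Qf u h x v := by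
  unfold Qf; positivity

theorem Qf_meas {u : E3 → ℝ} (hu : 𝒯.MemW u) (h : ℝ) : Measurable (Function.uncurry (𝒯.Qf u h)) := by
  have hG := 𝒯.G_measurable u
  have hc : Continuous (u ∘ 𝒯.A) := hu.lip_bar.choose_spec.continuous
  have hm : Measurable fun p : E3 × E3 => p.1 + h • p.2 := by fun_prop
  have h1 : Measurable fun p : E3 × E3 => 𝒯.G u (p.1 + h • p.2) := hG.comp hm
  have h2 : Measurable fun p : E3 × E3 => 𝒯.G u p.1 := hG.comp measurable_fst
  have h3 : Measurable fun p : E3 × E3 => (u ∘ 𝒯.A) (p.1 + h • p.2) := hc.measurable.comp hm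
  have h4 : Measurable fun p : E3 × E3 => (u ∘ 𝒯.A) p.1 := hc.measurable.comp measurable_fst
  have h5 : Measurable fun p : E3 × E3 => |(u ∘ 𝒯.A) (p.1 + h • p.2) - (u ∘ 𝒯.A) p.1| := (h3.sub h4).norm
  exact (h1.norm.add ((h1.sub h2).norm.const_mul _)).add (h5.const_mul _)

theorem Qf_bdd {u : E3 → ℝ} (hu : 𝒯.MemW u) {h : ℝ} (hh : 0 < h) (R : ℝ) (hR : 0 ≤ R) :
    ∃ K, 0 ≤ K ∧ ∀ x, ∀ v ∈ closedBall (0:E3) R, |𝒯.Qf u h x v| ≤ K := by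
  obtain ⟨K, hK0, hK⟩ := hu.G_bdd
  obtain ⟨K', hK'⟩ := hu.lip_bar
  refine ⟨K + h⁻¹ * (K + K) + h⁻¹ * (K' * (h * R)), by positivity, fun x v hv => ?_⟩
  rw [abs_of_nonneg (Qf_nonneg hh x v)]
  unfold Qf
  have h1 := hK'.dist_le_mul (x + h • v) x
  rw [dist_self_add_left, norm_smul, Real.norm_eq_abs, abs_of_pos hh, Real.dist_eq] at h1
  have hv' : ‖v‖ ≤ R := by simpa using hv
  gcongr
  · exact hK _
  · exact (norm_sub_le _ _).trans (add_le_add (hK _) (hK _))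
  · refine h1.trans ?_
    gcongr

theorem Qf_sq {u : E3 → ℝ} (hu : 𝒯.MemW u) {h : ℝ} (hh : 0 < h) {v : E3} (hv : 𝒯.Small (h • v)) {F R : ℝ} (hF : 0 ≤ F)
    (hvR : ‖v‖ ≤ R) (hN : 𝒯.N u ≤ 2 * F) (hd : 𝒯.N (fun x => u (𝒯.Φ (h • v) x) - u x) ≤ h * (50 * 𝒯.L ^ 3 * R + 5) * F) :
    ∫ x, 𝒯.Qf u h x v ^ 2 ∂Srf.μ ≤ 3 * (8 * 𝒯.L ^ 2 + (2 * (50 * 𝒯.L ^ 3 * R + 5) ^ 2 + 16 * 𝒯.L ^ 2 * R ^ 2) + 16 * 𝒯.L ^ 2 * R ^ 2) * F ^ 2 := by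
  have hL := 𝒯.L_pos
  have hR : 0 ≤ R := (norm_nonneg _).trans hvR
  obtain ⟨K, hK0, hK⟩ := hu.G_bdd
  have hc : Continuous (u ∘ 𝒯.A) := hu.lip_bar.choose_spec.continuous
  have i1 := hu.int_tr (h • v)
  have i2 : Integrable (fun x => ‖𝒯.G u (x + h • v) - 𝒯.G u x‖ ^ 2) Srf.μ := by
    refine 𝒯.integrable_of_bdd (K := (K + K) ^ 2) ?_ ?_
    · exact ((((𝒯.G_measurable u).comp (measurable_id.add_const (h • v))).sub (𝒯.G_measurable u)).norm.pow_const 2).aestronglyMeasurable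
    · refine Filter.Eventually.of_forall fun x => ?_
      rw [abs_of_nonneg (by positivity)]
      exact pow_le_pow_left₀ (norm_nonneg _) ((norm_sub_le _ _).trans (add_le_add (hK _) (hK _))) 2
  have i3 : Integrable (fun x => ((u ∘ 𝒯.A) (x + h • v) - (u ∘ 𝒯.A) x) ^ 2) Srf.μ := by
    apply 𝒯.integrable_cont
    exact ((hc.comp (by fun_prop)).sub hc).pow 2
  have e1 := E_est hv hu
  have e2 := trans_est hv hu
  have e3 := R2 hv hu
  have e3' : ∫ x, ((u ∘ 𝒯.A) (x + h • v) - (u ∘ 𝒯.A) x) ^ 2 ∂Srf.μ = l2 Srf (fun x => u (𝒯.Φ (h • v) x) - u x) ^ 2 := by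
    rw [l2_sq]
    apply integral_congr_ae
    filter_upwards [ae_mem_S] with x hx
    simp only [Function.comp]
    rw [Φ_S hx, 𝒯.fix hx]
  have hpt : ∫ x, 𝒯.Qf u h x v ^ 2 ∂Srf.μ ≤ ∫ x, 3 * (‖𝒯.G u (x + h • v)‖ ^ 2 + (h⁻¹ ^ 2 * ‖𝒯.G u (x + h • v) - 𝒯.G u x‖ ^ 2 +
      h⁻¹ ^ 2 * ((u ∘ 𝒯.A) (x + h • v) - (u ∘ 𝒯.A) x) ^ 2)) ∂Srf.μ := by
    apply integral_mono_of_nonneg (Filter.Eventually.of_forall fun x => sq_nonneg _)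
    · exact (i1.add ((i2.const_mul _).add (i3.const_mul _))).const_mul 3
    · refine Filter.Eventually.of_forall fun x => ?_
      simp only [Qf]
      rw [← sq_abs ((u ∘ 𝒯.A) (x + h • v) - (u ∘ 𝒯.A) x)]
      set a := ‖𝒯.G u (x + h • v)‖
      set b := ‖𝒯.G u (x + h • v) - 𝒯.G u x‖
      set c := |(u ∘ 𝒯.A) (x + h • v) - (u ∘ 𝒯.A) x|
      nlinarith [sq_nonneg (a - h⁻¹ * b), sq_nonneg (a - h⁻¹ * c), sq_nonneg (h⁻¹ * b - h⁻¹ * c)]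
  have i23 : Integrable (fun x => h⁻¹ ^ 2 * ‖𝒯.G u (x + h • v) - 𝒯.G u x‖ ^ 2 +
      h⁻¹ ^ 2 * ((u ∘ 𝒯.A) (x + h • v) - (u ∘ 𝒯.A) x) ^ 2) Srf.μ := (i2.const_mul _).add (i3.const_mul _)
  rw [integral_const_mul, integral_add i1 i23, integral_add (i2.const_mul _) (i3.const_mul _), integral_const_mul, integral_const_mul, e3'] at hpt
  refine hpt.trans ?_
  have hhv : ‖h • v‖ ≤ h * R := by
    rw [norm_smul, Real.norm_eq_abs, abs_of_pos hh]; gcongr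
  have n0 := N_nonneg (𝒯 := 𝒯) u
  have b1 : 𝒯.N u ^ 2 ≤ (2 * F) ^ 2 := pow_le_pow_left₀ n0 hN 2
  have hl0 : 0 ≤ l2 Srf (fun x => u (𝒯.Φ (h • v) x) - u x) := l2_nonneg _
  have b3 : l2 Srf (fun x => u (𝒯.Φ (h • v) x) - u x) ^ 2 ≤ (2 * 𝒯.L * (h * R) * (2 * F)) ^ 2 := by
    apply pow_le_pow_left₀ hl0
    refine e3.trans ?_
    gcongr
  have b2 : 2 * 𝒯.N (fun x => u (𝒯.Φ (h • v) x) - u x) ^ 2 + 4 * 𝒯.L ^ 2 * ‖h • v‖ ^ 2 * 𝒯.N u ^ 2 ≤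
     2 * (h * (50 * 𝒯.L ^ 3 * R + 5) * F) ^ 2 + 4 * 𝒯.L ^ 2 * (h * R) ^ 2 * (2 * F) ^ 2 := by
    have := N_nonneg (𝒯 := 𝒯) (fun x => u (𝒯.Φ (h • v) x) - u x)
    gcongr
  have c2 : h⁻¹ ^ 2 * ∫ x, ‖𝒯.G u (x + h • v) - 𝒯.G u x‖ ^ 2 ∂Srf.μ ≤ h⁻¹ ^ 2 * (2 * (h * (50 * 𝒯.L ^ 3 * R + 5) * F) ^ 2 + 4 * 𝒯.L ^ 2 * (h * R) ^ 2 * (2 * F) ^ 2) := by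
    apply mul_le_mul_of_nonneg_left (e2.trans b2) (by positivity)
  have c3 := mul_le_mul_of_nonneg_left b3 (show 0 ≤ h⁻¹ ^ 2 by positivity)
  have c1 : 2 * 𝒯.L ^ 2 * 𝒯.N u ^ 2 ≤ 2 * 𝒯.L ^ 2 * (2 * F) ^ 2 := by gcongr
  have f2 : h⁻¹ ^ 2 * (2 * (h * (50 * 𝒯.L ^ 3 * R + 5) * F) ^ 2 + 4 * 𝒯.L ^ 2 * (h * R) ^ 2 * (2 * F) ^ 2) = (2 * (50 * 𝒯.L ^ 3 * R + 5) ^ 2 + 16 * 𝒯.L ^ 2 * R ^ 2) * F ^ 2 := by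
    field_simp; ring
  have f3 : h⁻¹ ^ 2 * (2 * 𝒯.L * (h * R) * (2 * F)) ^ 2 = 16 * 𝒯.L ^ 2 * R ^ 2 * F ^ 2 := by
    field_simp; ring
  rw [f2] at c2
  rw [f3] at c3
  linarith

end Tube

end

section

theorem Kern.T_near_lip (k : Kern) {U : E3 → ℝ} (hU : Continuous U) (h : ℝ) (x : E3) {R : ℝ} (hR : 0 ≤ R) :
    |k.T U h x 0 - U x| ≤ k.M * ∫ v in closedBall (0:E3) (R + 1), |U (x + h • v) - U x| := by
  have hc : Integrable (fun v => k.ρ (v - 0) • U (x + h • v)) := by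
    simp only [sub_zero]
    have : Continuous fun v => k.ρ v • U (x + h • v) := k.cont.smul (hU.comp (by fun_prop))
    exact this.integrable_of_hasCompactSupport (k.hcs.smul_right)
  have e : k.T U h x 0 - U x = ∫ v, k.ρ (v - 0) • (U (x + h • v) - U x) := by
    unfold Kern.T
    simp_rw [smul_sub]
    rw [integral_sub hc ((k.itg 0).smul_const _), integral_smul_const, k.int_sh, one_smul]
  rw [e, ← integral_const_mul, ← integral_indicator measurableSet_closedBall, ← Real.norm_eq_abs]
  apply norm_integral_le_of_norm_le
  · apply (integrable_indicator_iff measurableSet_closedBall).2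
    have : Continuous fun v => U (x + h • v) := hU.comp (by fun_prop)
    have h2 : Continuous fun v => k.M * |U (x + h • v) - U x| := by fun_prop
    exact h2.continuousOn.integrableOn_compact (isCompact_closedBall _ _)
  · refine Filter.Eventually.of_forall fun v => ?_
    by_cases hv : v ∈ closedBall (0:E3) (R + 1)
    · rw [Set.indicator_of_mem hv, norm_smul, Real.norm_eq_abs, Real.norm_eq_abs, abs_of_nonneg (k.nn _)]
      exact mul_le_mul_of_nonneg_right (k.le _) (abs_nonneg _)
    · rw [Set.indicator_of_notMem hv, k.supp_sh (by simpa using hR) hv]; simp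

namespace Tube
variable {Srf : SmoothSurface} {𝒯 : Tube Srf}

theorem G_sub_norm (u : E3 → ℝ) (x y : E3) : ‖fderiv ℝ (u ∘ 𝒯.A) x - fderiv ℝ (u ∘ 𝒯.A) y‖ = ‖𝒯.G u x - 𝒯.G u y‖ := by
  rw [G, G, ← map_sub, LinearIsometryEquiv.norm_map]

theorem Qf_int {u : E3 → ℝ} (hu : 𝒯.MemW u) {h : ℝ} (hh : 0 < h) {R : ℝ} (hR : 0 ≤ R) (x : E3) :
    IntegrableOn (fun v => 𝒯.Qf u h x v) (closedBall (0:E3) R) := by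
  obtain ⟨K, hK0, hK⟩ := Qf_bdd hu hh R hR
  apply Measure.integrableOn_of_bounded (M := K)
  · exact (isCompact_closedBall (0:E3) R).measure_lt_top.ne
  · exact ((Qf_meas hu h).comp measurable_prodMk_left).aestronglyMeasurable
  · filter_upwards [ae_restrict_mem measurableSet_closedBall] with v hv
    exact hK x v hv

set_option maxHeartbeats 1600000 in
theorem moll_main (𝒯 : Tube Srf) {R : ℝ} (hR : 0 ≤ R) : ∃ C > 0, ∃ h₀ > 0, ∀ h : ℝ, 0 < h → h ≤ h₀ → ∀ f : E3 → ℝ, 𝒯.MemW f → 0 < l2 Srf f →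
    ∃ u uh H : E3 → ℝ, 𝒯.MemW u ∧ 𝒯.MemW uh ∧ Differentiable ℝ uh ∧
      (∀ w, 𝒯.MemW w → |𝒯.aF u w - ∫ x, f x * w x ∂Srf.μ| ≤ h * l2 Srf f * 𝒯.N w) ∧
      𝒯.N u ≤ 2 * l2 Srf f ∧ 𝒯.N (fun x => u x - uh x) ≤ C * h * l2 Srf f ∧ 𝒯.N uh ≤ C * l2 Srf f ∧
      (∀ x, 0 ≤ H x) ∧ Measurable H ∧ Integrable (fun x => H x ^ 2) Srf.μ ∧ ∫ x, H x ^ 2 ∂Srf.μ ≤ C * l2 Srf f ^ 2 ∧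
      ∀ x₁ : E3, ∀ x ∈ closedBall x₁ (R * h), ‖fderiv ℝ uh x‖ ≤ H x₁ ∧
        ∀ y ∈ closedBall x₁ (R * h), ‖fderiv ℝ uh x - fderiv ℝ uh y‖ ≤ H x₁ * ‖x - y‖ := by
  obtain ⟨k⟩ := exists_kern
  have hL := 𝒯.L_pos
  have hδ := 𝒯.hδ
  have hM := k.M_pos
  have hfin := 𝒯.finite_μ
  set R' := R + 1 with hR'
  have hR0 : 0 < R' := by positivity
  set C1 := 3 * (8 * 𝒯.L ^ 2 + (2 * (50 * 𝒯.L ^ 3 * R' + 5) ^ 2 + 16 * 𝒯.L ^ 2 * R' ^ 2) + 16 * 𝒯.L ^ 2 * R' ^ 2) with hC1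
  have hC1p : 0 < C1 := by positivity
  set B := closedBall (0:E3) R' with hB
  set b := (volume.restrict B).real Set.univ with hb
  have hb0 : 0 ≤ b := measureReal_nonneg
  set C2 := k.M ^ 2 * (b ^ 2 * C1) with hC2
  have hC2p : 0 ≤ C2 := by positivity
  have hfB : IsFiniteMeasure (volume.restrict B) := ⟨by simpa using (isCompact_closedBall (0:E3) R').measure_lt_top⟩
  refine ⟨C2 + √(2 * C2) + 2, by positivity, min 1 (𝒯.δ / (32 * 𝒯.L ^ 3 * R')), by positivity, ?_⟩
  intro h hh hh0 f hf hF
  set F := l2 Srf f with hFd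
  have hh1 : h ≤ 1 := hh0.trans (min_le_left _ _)
  have hh2 : 32 * 𝒯.L ^ 3 * (R' * h) ≤ 𝒯.δ := by
    have := hh0.trans (min_le_right _ _)
    rw [le_div_iff₀ (by positivity)] at this
    linarith
  obtain ⟨u, hu, hmin, hNu⟩ := near_min hf (show 0 < h * F by positivity)
  have hNu2 : 𝒯.N u ≤ 2 * F := by nlinarith
  obtain ⟨K, hK⟩ := hu.lip_bar
  set U := u ∘ 𝒯.A with hU
  set uh : E3 → ℝ := fun x => k.T U h x 0 with huh
  have hder : ∀ x, HasFDerivAt uh (k.T (fderiv ℝ U) h x 0) x := fun x => k.T_deriv hK hh x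
  have hdiff : Differentiable ℝ uh := fun x => (hder x).differentiableAt
  have huhW : 𝒯.MemW uh := MemW.of_C1 (k.T_lipschitz hK h) hdiff
  set H : E3 → ℝ := fun x => k.M * ∫ v in B, 𝒯.Qf u h x v with hH
  have hgK : ∀ x, ‖fderiv ℝ U x‖ ≤ K := fun x => norm_fderiv_le_of_lipschitz ℝ hK
  have hgs : StronglyMeasurable (fderiv ℝ U) := fderiv_sm U
  have hH0 : ∀ x, 0 ≤ H x := fun x => mul_nonneg hM.le (integral_nonneg fun v => Qf_nonneg hh x v)
  have hsm : ∀ v ∈ B, 𝒯.Small (h • v) := by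
    intro v hv
    have hv' : ‖v‖ ≤ R' := by simpa [hB] using hv
    unfold Small
    rw [norm_smul, Real.norm_eq_abs, abs_of_pos hh]
    refine le_trans ?_ hh2
    rw [mul_comm R']
    gcongr
  -- comparison of partial integrals with H
  have hq1 : ∀ x, k.M * ∫ v in B, ‖fderiv ℝ U (x + h • v)‖ ≤ H x := by
    intro x
    apply mul_le_mul_of_nonneg_left _ hM.le
    apply integral_mono_of_nonneg (Filter.Eventually.of_forall fun v => norm_nonneg _) (Qf_int hu hh hR0.le x)
    refine Filter.Eventually.of_forall fun v => ?_
    simp only [Qf]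
    rw [hU, ← G_norm]
    have : 0 ≤ h⁻¹ * ‖𝒯.G u (x + h • v) - 𝒯.G u x‖ := by positivity
    have : 0 ≤ h⁻¹ * |(u ∘ 𝒯.A) (x + h • v) - (u ∘ 𝒯.A) x| := by positivity
    linarith
  have hq2 : ∀ x, k.M * ∫ v in B, ‖fderiv ℝ U (x + h • v) - fderiv ℝ U x‖ ≤ h * H x := by
    intro x
    simp only [hH]
    have e0 : h * (k.M * ∫ v in B, 𝒯.Qf u h x v) = k.M * ∫ v in B, h * 𝒯.Qf u h x v := by
      rw [integral_const_mul]; ring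
    rw [e0]
    apply mul_le_mul_of_nonneg_left _ hM.le
    apply integral_mono_of_nonneg (Filter.Eventually.of_forall fun v => norm_nonneg _) ((Qf_int hu hh hR0.le x).const_mul h)
    refine Filter.Eventually.of_forall fun v => ?_
    simp only [Qf]
    rw [hU, G_sub_norm, mul_add, mul_add, mul_inv_cancel_left₀ hh.ne']
    have : 0 ≤ h * ‖𝒯.G u (x + h • v)‖ := by positivity
    have : 0 ≤ h * (h⁻¹ * |(u ∘ 𝒯.A) (x + h • v) - (u ∘ 𝒯.A) x|) := by positivity
    linarith
  have hq3 : ∀ x, k.M * ∫ v in B, |U (x + h • v) - U x| ≤ h * H x := by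
    intro x
    simp only [hH]
    have e0 : h * (k.M * ∫ v in B, 𝒯.Qf u h x v) = k.M * ∫ v in B, h * 𝒯.Qf u h x v := by
      rw [integral_const_mul]; ring
    rw [e0]
    apply mul_le_mul_of_nonneg_left _ hM.le
    apply integral_mono_of_nonneg (Filter.Eventually.of_forall fun v => abs_nonneg _) ((Qf_int hu hh hR0.le x).const_mul h)
    refine Filter.Eventually.of_forall fun v => ?_
    simp only [Qf]
    rw [hU, mul_add, mul_inv_cancel_left₀ hh.ne']
    have : 0 ≤ h * (‖𝒯.G u (x + h • v)‖ + h⁻¹ * ‖𝒯.G u (x + h • v) - 𝒯.G u x‖) := by positivity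
    linarith
  -- L² bound of H
  have hHsq : Integrable (fun x => H x ^ 2) Srf.μ ∧ ∫ x, H x ^ 2 ∂Srf.μ ≤ C2 * F ^ 2 := by
    obtain ⟨K2, hK20, hK2⟩ := Qf_bdd hu hh R' hR0.le
    have hQm : Measurable (Function.uncurry fun x v => B.indicator (𝒯.Qf u h x) v) := by
      have : (Function.uncurry fun x v => B.indicator (𝒯.Qf u h x) v) = (Prod.snd ⁻¹' B).indicator (Function.uncurry (𝒯.Qf u h)) := by
        ext p; rfl
      rw [this]
      exact (Qf_meas hu h).indicator (measurable_snd measurableSet_closedBall)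
    have := fub_sq (μ := Srf.μ) (ν := volume.restrict B) hQm (K := K2) (c := C1 * F ^ 2) ?_ ?_
    · have e : ∀ x, ∫ v in B, B.indicator (𝒯.Qf u h x) v = ∫ v in B, 𝒯.Qf u h x v := fun x =>
        setIntegral_congr_fun measurableSet_closedBall fun v hv => Set.indicator_of_mem hv _
      simp_rw [e] at this
      simp only [hH, mul_pow]
      refine ⟨this.1.const_mul _, ?_⟩
      rw [integral_const_mul, hC2, mul_assoc (k.M ^ 2), mul_assoc]
      exact mul_le_mul_of_nonneg_left this.2 (by positivity)
    · intro x v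
      by_cases hv : v ∈ B
      · rw [Set.indicator_of_mem hv]; exact hK2 x v hv
      · rw [Set.indicator_of_notMem hv, abs_zero]; exact hK20
    · filter_upwards [ae_restrict_mem measurableSet_closedBall] with v hv
      simp_rw [Set.indicator_of_mem hv]
      have hv' : ‖v‖ ≤ R' := by simpa [hB] using hv
      apply Qf_sq hu hh (hsm v hv) hF.le hv' hNu2
      refine (nirenberg (by positivity) hf hu hmin hNu (hsm v hv)).trans ?_
      rw [norm_smul, Real.norm_eq_abs, abs_of_pos hh]
      have : 50 * 𝒯.L ^ 3 * (h * ‖v‖) * F ≤ 50 * 𝒯.L ^ 3 * (h * R') * F := by gcongr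
      linarith
  have hHm : Measurable H := by
    have := (Qf_meas hu h).stronglyMeasurable.integral_prod_right (ν := volume.restrict B)
    exact this.measurable.const_mul k.M
  have hdW : 𝒯.MemW (fun x => u x - uh x) := hu.sub huhW
  have hNd : 𝒯.N (fun x => u x - uh x) ≤ √(2 * C2) * h * F := by
    apply abs_le_of_sq_le_sq' _ (by positivity) |>.2
    rw [N_sq, aF_self, mul_pow, mul_pow, Real.sq_sqrt (by positivity)]
    have : ∫ x, (‖𝒯.G (fun x => u x - uh x) x‖ ^ 2 + (u x - uh x) ^ 2) ∂Srf.μ ≤ ∫ x, 2 * h ^ 2 * H x ^ 2 ∂Srf.μ := by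
      apply integral_mono_ae hdW.int_e (hHsq.1.const_mul _)
      filter_upwards [hu.diff, huhW.diff, ae_mem_S] with x d1 d2 hx
      have n1 : ‖𝒯.G (fun x => u x - uh x) x‖ ≤ h * H x := by
        rw [G_sub d1 d2]
        refine le_trans ?_ ((k.T_near hgs hgK h x hR).trans (hq2 x))
        set q := 𝒯.G u x - 𝒯.G uh x with hq
        have e : ‖q‖ ^ 2 = (fderiv ℝ U x - k.T (fderiv ℝ U) h x 0) (𝒯.D x q) := by
          rw [← real_inner_self_eq_norm_sq]
          nth_rewrite 1 [hq]
          rw [inner_sub_left, G_of_diff hx (hdiff x), (hder x).fderiv, ← 𝒯.G_tangent hx d1, G_inner]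
          rfl
        have e2 := (le_abs_self _).trans ((fderiv ℝ U x - k.T (fderiv ℝ U) h x 0).le_opNorm (𝒯.D x q))
        rw [← e, norm_sub_rev (fderiv ℝ U x)] at e2
        have e3 := mul_le_mul_of_nonneg_left (𝒯.D_proj_norm hx q) (norm_nonneg (k.T (fderiv ℝ U) h x 0 - fderiv ℝ U x))
        rcases eq_or_lt_of_le (norm_nonneg q) with h0 | h0
        · rw [← h0]; positivity
        · nlinarith
      have n2 : |u x - uh x| ≤ h * H x := by
        have := (k.T_near_lip hK.continuous h x hR).trans (hq3 x)
        rw [abs_sub_comm] at this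
        simpa [hU, 𝒯.fix hx, huh] using this
      have m1 := pow_le_pow_left₀ (norm_nonneg _) n1 2
      have m2 := pow_le_pow_left₀ (abs_nonneg _) n2 2
      rw [sq_abs] at m2
      nlinarith
    refine this.trans ?_
    rw [integral_const_mul]
    have := mul_le_mul_of_nonneg_left hHsq.2 (show 0 ≤ 2 * h ^ 2 by positivity)
    linarith
  have hs0 : 0 ≤ √(2 * C2) := Real.sqrt_nonneg _
  refine ⟨u, uh, H, hu, huhW, hdiff, hmin, hNu2, ?_, ?_, hH0, hHm, hHsq.1, ?_, ?_⟩
  · refine hNd.trans ?_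
    gcongr
    linarith
  · have h1 := N_sub hu hdW
    have e : (fun x => u x - (u x - uh x)) = uh := by ext x; ring
    rw [e] at h1
    have h2 : √(2 * C2) * h * F ≤ √(2 * C2) * 1 * F := by gcongr
    have : 0 ≤ C2 * F := by positivity
    linarith
  · refine hHsq.2.trans ?_
    gcongr
    linarith
  · intro x₁ x hx
    have key : ∀ z ∈ closedBall x₁ (R * h), ‖h⁻¹ • (z - x₁)‖ ≤ R ∧ fderiv ℝ uh z = k.T (fderiv ℝ U) h x₁ (h⁻¹ • (z - x₁)) := by
      intro z hz
      rw [mem_closedBall, dist_eq_norm] at hz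
      refine ⟨?_, ?_⟩
      · rw [norm_smul, norm_inv, Real.norm_eq_abs, abs_of_pos hh, inv_mul_le_iff₀ hh]; linarith
      · rw [(hder z).fderiv, ← k.T_shift _ _ _ (h⁻¹ • (z - x₁))]
        congr 1
        rw [smul_smul, mul_inv_cancel₀ hh.ne', one_smul]; abel
    obtain ⟨kx1, kx2⟩ := key x hx
    refine ⟨?_, fun y hy => ?_⟩
    · rw [kx2]
      exact (k.T_bd hgs hgK h x₁ kx1).trans (hq1 x₁)
    · obtain ⟨ky1, ky2⟩ := key y hy
      rw [kx2, ky2]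
      refine (k.T_lip hgs hgK h x₁ kx1 ky1).trans ?_
      rw [← smul_sub, sub_sub_sub_cancel_right, norm_smul, norm_inv, Real.norm_eq_abs, abs_of_pos hh]
      have := mul_le_mul_of_nonneg_left (hq2 x₁) (show 0 ≤ h⁻¹ * ‖x - y‖ by positivity)
      have e : h⁻¹ * ‖x - y‖ * (h * H x₁) = H x₁ * ‖x - y‖ := by field_simp
      rw [e] at this
      linarith

end Tube

end

section

theorem tri_convex (t : E3 × E3 × E3) : Convex ℝ (triOf t) := convex_convexHull ℝ _

theorem verts_finite (t : E3 × E3 × E3) : (vertsOf t).Finite := by unfold vertsOf; simp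

theorem tri_compact (t : E3 × E3 × E3) : IsCompact (triOf t) :=
  (verts_finite t).isCompact_convexHull (𝕜 := ℝ)

theorem tri_verts (t : E3 × E3 × E3) : vertsOf t ⊆ triOf t := subset_convexHull ℝ _

theorem tri_sub_mem {t : E3 × E3 × E3} {x y : E3} (hx : x ∈ triOf t) (hy : y ∈ triOf t) : x - y ∈ dirOf t :=
  AffineSubspace.vsub_mem_direction (convexHull_subset_affineSpan _ hx) (convexHull_subset_affineSpan _ hy)

theorem int_lemma {F : Type*} [NormedAddCommGroup F] [NormedSpace ℝ F] {t : E3 × E3 × E3} {y₀ : E3} {γ h κ : ℝ}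
    (hγ : 0 < γ) (hh : 0 < h) (hκ : 0 ≤ κ)
    (hd : ∀ x ∈ triOf t, ∀ y ∈ triOf t, ‖x - y‖ ≤ h) (hy₀ : ∀ τ ∈ dirOf t, ‖τ‖ ≤ γ * h → y₀ + τ ∈ triOf t)
    {q : E3 → F} {q' : E3 → E3 →L[ℝ] F} (hq : ∀ x ∈ triOf t, HasFDerivAt q (q' x) x)
    (hl : ∀ x ∈ triOf t, ∀ y ∈ triOf t, ‖q' x - q' y‖ ≤ κ * ‖x - y‖) (h0 : ∀ p ∈ vertsOf t, q p = 0) :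
    ∀ x ∈ triOf t, ‖q x‖ ≤ κ * h ^ 2 ∧ ∀ τ ∈ dirOf t, ‖q' x τ‖ ≤ κ / γ * h * ‖τ‖ := by
  intro x hx
  have h1 : ∀ p ∈ vertsOf t, ‖q x + q' x (p - x)‖ ≤ κ * h ^ 2 := by
    intro p hp
    have hpt := tri_verts t hp
    have := (tri_convex t).norm_image_sub_le_of_norm_hasFDerivWithin_le' (f' := q') (φ := q' x) (C := κ * h)
      (fun w hw => (hq w hw).hasFDerivWithinAt) (fun w hw => (hl w hw x hx).trans
        (mul_le_mul_of_nonneg_left (hd w hw x hx) hκ)) hx hpt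
    rw [h0 p hp, zero_sub, ← neg_add', norm_neg] at this
    refine this.trans ?_
    have := mul_le_mul_of_nonneg_left (hd p hpt x hx) (mul_nonneg hκ hh.le)
    linarith
  have h2 : ∀ z ∈ triOf t, ‖q x + q' x (z - x)‖ ≤ κ * h ^ 2 := by
    have hc : Convex ℝ {z : E3 | ‖q x + q' x (z - x)‖ ≤ κ * h ^ 2} := by
      have := ((convex_closedBall (0:F) (κ * h ^ 2)).translate_preimage_right (q x - q' x x)).linear_preimage (q' x).toLinearMap
      have e : {z : E3 | ‖q x + q' x (z - x)‖ ≤ κ * h ^ 2} = (q' x).toLinearMap ⁻¹' ((fun w => q x - q' x x + w) ⁻¹' closedBall (0:F) (κ * h ^ 2)) := by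
        refine Set.ext fun z => ?_
        simp only [Set.mem_setOf_eq, Set.mem_preimage, mem_closedBall, dist_zero_right, ContinuousLinearMap.coe_coe, map_sub]
        rw [add_sub, sub_add_eq_add_sub]
      rw [e]; exact this
    exact fun z hz => convexHull_min (s := vertsOf t) h1 hc hz
  refine ⟨by simpa using h2 x hx, fun τ hτ => ?_⟩
  rcases eq_or_ne τ 0 with rfl | hne
  · simp
  have hn : 0 < ‖τ‖ := norm_pos_iff.2 hne
  set c := γ * h / ‖τ‖ with hc
  have hcp : 0 < c := by positivity
  have hcn : ‖c • τ‖ ≤ γ * h := by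
    rw [norm_smul, Real.norm_eq_abs, abs_of_pos hcp, hc, div_mul_cancel₀ _ hn.ne']
  have e1 := h2 _ (hy₀ (c • τ) (Submodule.smul_mem _ _ hτ) hcn)
  have e2 := h2 _ (hy₀ (-(c • τ)) (Submodule.neg_mem _ (Submodule.smul_mem _ _ hτ)) (by rwa [norm_neg]))
  have e3 := norm_sub_le (q x + q' x (y₀ + c • τ - x)) (q x + q' x (y₀ + -(c • τ) - x))
  have e4 : q x + q' x (y₀ + c • τ - x) - (q x + q' x (y₀ + -(c • τ) - x)) = (2 * c) • q' x τ := by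
    rw [add_sub_add_left_eq_sub, ← map_sub, ← map_smul]; congr 1; module
  rw [e4, norm_smul, Real.norm_eq_abs, abs_of_pos (by positivity)] at e3
  have e5 : c * ‖q' x τ‖ ≤ κ * h ^ 2 := by linarith
  rw [hc, div_mul_eq_mul_div, div_le_iff₀ hn] at e5
  rw [div_mul_eq_mul_div, div_mul_eq_mul_div, le_div_iff₀ hγ]
  have : h * (‖q' x τ‖ * γ) ≤ h * (κ * h * ‖τ‖) := by linarith
  exact le_of_mul_le_mul_left this hh

namespace Triangulation
variable {Srf : SmoothSurface} {γ₀ h : ℝ} (Tr : Triangulation Srf γ₀ h)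

theorem tri_dist {t : E3 × E3 × E3} (ht : t ∈ Tr.T) : ∀ x ∈ triOf t, ∀ y ∈ triOf t, ‖x - y‖ ≤ h := by
  intro x hx y hy
  rw [← dist_eq_norm]
  exact (dist_le_diam_of_mem (tri_compact t).isBounded hx hy).trans (Tr.diam_le t ht)

theorem tri_disk {t : E3 × E3 × E3} (ht : t ∈ Tr.T) : ∃ y ∈ triOf t, ∀ τ ∈ dirOf t, ‖τ‖ ≤ γ₀ * h → y + τ ∈ triOf t := by
  obtain ⟨y, hy, hd⟩ := Tr.disk t ht
  refine ⟨y, hy, fun τ hτ hn => hd ⟨by simpa using hn, ?_⟩⟩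
  have := AffineSubspace.vadd_mem_of_mem_direction hτ (convexHull_subset_affineSpan _ hy)
  rw [vadd_eq_add, add_comm] at this
  exact this

theorem dir_finrank {t : E3 × E3 × E3} (ht : t ∈ Tr.T) : Module.finrank ℝ (dirOf t) = 2 := by
  have := (Tr.indep t ht).finrank_vectorSpan (n := 2) (by simp)
  have e : vertsOf t = Set.range ![t.1, t.2.1, t.2.2] := by
    ext x
    simp only [vertsOf, Set.mem_insert_iff, Set.mem_singleton_iff, Set.mem_range, Fin.exists_fin_succ]
    simp [eq_comm]
  rw [dirOf, direction_affineSpan, e, this]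

end Triangulation

namespace Tube
variable {Srf : SmoothSurface} (𝒯 : Tube Srf)

/-- The combined geometric constant. -/
def K (γ : ℝ) : ℝ := 𝒯.L * (1 + 1 / γ)

/-- The mesh is fine. -/
structure Fine (γ h : ℝ) : Prop where
  hγ : 0 < γ
  hh : 0 < h
  le : 20 * 𝒯.K γ * h ≤ 𝒯.δ

variable {𝒯} {γ h : ℝ}

theorem Fine.L_le (hf : 𝒯.Fine γ h) : 𝒯.L ≤ 𝒯.K γ := by
  have := hf.hγ; have := 𝒯.L_pos
  unfold K
  have : 0 ≤ 𝒯.L * (1 / γ) := by positivity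
  linarith

theorem Fine.Lγ_le (hf : 𝒯.Fine γ h) : 𝒯.L / γ ≤ 𝒯.K γ := by
  have := hf.hγ; have := 𝒯.L_pos
  unfold K
  rw [mul_add, mul_one_div]; linarith

theorem Fine.K1 (hf : 𝒯.Fine γ h) : 1 ≤ 𝒯.K γ := 𝒯.hL.trans hf.L_le

theorem Fine.Kh (hf : 𝒯.Fine γ h) : 𝒯.K γ * h ≤ 1 / 20 := by
  have := hf.le; have := 𝒯.hδ1; linarith

theorem Fine.Kh0 (hf : 𝒯.Fine γ h) : 0 < 𝒯.K γ * h := mul_pos (by linarith [hf.K1]) hf.hh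

theorem Fine.h_lt (hf : 𝒯.Fine γ h) : 20 * h ≤ 𝒯.δ := by
  have := hf.le; have := mul_le_mul_of_nonneg_right hf.K1 hf.hh.le; linarith

theorem Fine.eps (hf : 𝒯.Fine γ h) : 5 * 𝒯.K γ ^ 2 * h ^ 2 ≤ 1 / 80 := by
  have := hf.Kh; have := hf.Kh0
  nlinarith

variable {Tr : Triangulation Srf γ h} {t : E3 × E3 × E3}

theorem tri_U (hf : 𝒯.Fine γ h) (ht : t ∈ Tr.T) {x : E3} (hx : x ∈ triOf t) : x ∈ 𝒯.U := by
  have h1 : t.1 ∈ vertsOf t := by simp [vertsOf]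
  apply 𝒯.mem_U_of (Tr.verts_on t ht h1)
  have := Tr.tri_dist ht x hx _ (tri_verts t h1)
  have := hf.h_lt; have := hf.hh
  linarith

theorem a_eq (hf : 𝒯.Fine γ h) {x : E3} (hx : x ∈ Tr.Sh) : Tr.a x = 𝒯.A x := by
  obtain ⟨t, ht, hxt⟩ := Set.mem_iUnion₂.1 hx
  have hU := tri_U hf ht hxt
  have hN := Tr.Sh_sub hx
  obtain ⟨p, hp, hd⟩ := 𝒯.mem_U.1 hU
  refine 𝒯.unique x p hp hd _ (Tr.a_mem x hN) (le_antisymm ?_ ?_)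
  · exact Tr.a_nearest x hN _ (𝒯.A_mem hU)
  · exact 𝒯.nearest x p hp hd _ (Tr.a_mem x hN)

theorem b_est (hf : 𝒯.Fine γ h) (ht : t ∈ Tr.T) {x : E3} (hx : x ∈ triOf t) :
    ‖𝒯.A x - x‖ ≤ 𝒯.K γ * h ^ 2 ∧ ∀ τ ∈ dirOf t, ‖𝒯.D x τ - τ‖ ≤ 𝒯.K γ * h * ‖τ‖ := by
  obtain ⟨y₀, -, hy₀⟩ := Tr.tri_disk ht
  have := int_lemma hf.hγ hf.hh 𝒯.L_pos.le (Tr.tri_dist ht) hy₀ (q := fun x => 𝒯.A x - x)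
    (q' := fun x => 𝒯.D x - ContinuousLinearMap.id ℝ E3)
    (fun x _ => (𝒯.hasD x).sub (hasFDerivAt_id x)) (fun x _ y _ => by simpa using 𝒯.D_lip x y)
    (fun p hp => by simp [𝒯.fix (Tr.verts_on t ht hp)]) x hx
  refine ⟨this.1.trans ?_, fun τ hτ => (this.2 τ hτ).trans ?_⟩
  · exact mul_le_mul_of_nonneg_right hf.L_le (by positivity)
  · exact mul_le_mul_of_nonneg_right (mul_le_mul_of_nonneg_right hf.Lγ_le hf.hh.le) (norm_nonneg _)

theorem Db_inner (hf : 𝒯.Fine γ h) (ht : t ∈ Tr.T) {x : E3} (hx : x ∈ triOf t) {σ τ : E3} (hσ : σ ∈ dirOf t) (hτ : τ ∈ dirOf t) :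
    |⟪𝒯.D x σ - σ, τ⟫| ≤ 2 * 𝒯.K γ ^ 2 * h ^ 2 * (‖σ‖ * ‖τ‖) := by
  have hU := tri_U hf ht hx
  have hy := 𝒯.A_mem hU
  obtain ⟨b1, b2⟩ := b_est hf ht hx
  have nn : ∀ τ ∈ dirOf t, |⟪Srf.n (𝒯.A x), τ⟫| ≤ 𝒯.K γ * h * ‖τ‖ := by
    intro τ hτ
    have e : ⟪Srf.n (𝒯.A x), τ⟫ = - ⟪Srf.n (𝒯.A x), 𝒯.D x τ - τ⟫ := by
      rw [inner_sub_right, 𝒯.n_D hU]; ring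
    rw [e, abs_neg]
    refine (abs_real_inner_le_norm _ _).trans ?_
    rw [Srf.n_unit _ hy, one_mul]; exact b2 τ hτ
  have e : ⟪𝒯.D x σ - σ, τ⟫ = ⟪𝒯.D x σ - 𝒯.D (𝒯.A x) σ, τ⟫ - ⟪Srf.n (𝒯.A x), σ⟫ * ⟪Srf.n (𝒯.A x), τ⟫ := by
    rw [𝒯.D_apply hy, inner_sub_left, inner_sub_left, inner_sub_left, inner_smul_left]; simp; ring
  rw [e]
  have e1 : |⟪𝒯.D x σ - 𝒯.D (𝒯.A x) σ, τ⟫| ≤ 𝒯.K γ ^ 2 * h ^ 2 * (‖σ‖ * ‖τ‖) := by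
    refine (abs_real_inner_le_norm _ _).trans ?_
    have h1 := 𝒯.D_lip_apply x (𝒯.A x) σ
    rw [norm_sub_rev x] at h1
    have h2 : 𝒯.L * ‖𝒯.A x - x‖ ≤ 𝒯.K γ * (𝒯.K γ * h ^ 2) :=
      mul_le_mul hf.L_le b1 (norm_nonneg _) (by linarith [hf.K1])
    have h3 := mul_le_mul_of_nonneg_right (h1.trans (mul_le_mul_of_nonneg_right h2 (norm_nonneg σ))) (norm_nonneg τ)
    linarith
  have e2 : |⟪Srf.n (𝒯.A x), σ⟫ * ⟪Srf.n (𝒯.A x), τ⟫| ≤ 𝒯.K γ ^ 2 * h ^ 2 * (‖σ‖ * ‖τ‖) := by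
    rw [abs_mul]
    have := mul_le_mul (nn σ hσ) (nn τ hτ) (abs_nonneg _) (mul_nonneg hf.Kh0.le (norm_nonneg _))
    linarith
  refine (abs_sub _ _).trans ?_
  linarith

theorem B_inner (hf : 𝒯.Fine γ h) (ht : t ∈ Tr.T) {x : E3} (hx : x ∈ triOf t) {σ τ : E3} (hσ : σ ∈ dirOf t) (hτ : τ ∈ dirOf t) :
    |⟪𝒯.D x σ, 𝒯.D x τ⟫ - ⟪σ, τ⟫| ≤ 5 * 𝒯.K γ ^ 2 * h ^ 2 * (‖σ‖ * ‖τ‖) := by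
  have e : ⟪𝒯.D x σ, 𝒯.D x τ⟫ - ⟪σ, τ⟫ = ⟪𝒯.D x σ - σ, τ⟫ + ⟪𝒯.D x τ - τ, σ⟫ + ⟪𝒯.D x σ - σ, 𝒯.D x τ - τ⟫ := by
    simp only [inner_sub_left, inner_sub_right]
    rw [real_inner_comm (𝒯.D x τ) σ, real_inner_comm τ σ]; ring
  rw [e]
  have h1 := Db_inner hf ht hx hσ hτ
  have h2 := Db_inner hf ht hx hτ hσ
  obtain ⟨b1, b2⟩ := b_est hf ht hx
  have h3 := (abs_real_inner_le_norm (𝒯.D x σ - σ) (𝒯.D x τ - τ)).trans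
    (mul_le_mul (b2 σ hσ) (b2 τ hτ) (norm_nonneg _) (mul_nonneg hf.Kh0.le (norm_nonneg _)))
  refine (abs_add_three _ _ _).trans ?_
  linarith

theorem B_norm (hf : 𝒯.Fine γ h) (ht : t ∈ Tr.T) {x : E3} (hx : x ∈ triOf t) {τ : E3} (hτ : τ ∈ dirOf t) :
    ‖τ‖ ≤ 2 * ‖𝒯.D x τ‖ ∧ ‖𝒯.D x τ‖ ≤ 2 * ‖τ‖ := by
  have h1 := (b_est hf ht hx).2 τ hτ
  have h2 : 𝒯.K γ * h * ‖τ‖ ≤ 1 / 20 * ‖τ‖ := mul_le_mul_of_nonneg_right hf.Kh (norm_nonneg _)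
  have h3 := norm_sub_norm_le (𝒯.D x τ) τ
  have h4 := norm_sub_norm_le τ (𝒯.D x τ)
  rw [norm_sub_rev] at h4
  have := norm_nonneg τ
  constructor <;> linarith

theorem bilip (hf : 𝒯.Fine γ h) (ht : t ∈ Tr.T) {x y : E3} (hx : x ∈ triOf t) (hy : y ∈ triOf t) :
    |‖𝒯.A y - 𝒯.A x‖ ^ 2 - ‖y - x‖ ^ 2| ≤ 5 * 𝒯.K γ ^ 2 * h ^ 2 * ‖y - x‖ ^ 2 := by
  set τ := y - x with hτ
  have hτd : τ ∈ dirOf t := tri_sub_mem hy hx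
  set b : E3 → E3 := fun z => 𝒯.A z - z with hb
  have hbd : ∀ z, HasFDerivAt b (𝒯.D z - ContinuousLinearMap.id ℝ E3) z := fun z => (𝒯.hasD z).sub (hasFDerivAt_id z)
  have hl : ∀ s ∈ Set.Icc (0:ℝ) 1, x + s • τ ∈ triOf t := by
    intro s hs
    exact (tri_convex t).add_smul_sub_mem hx hy hs
  have hbs : ∀ s, HasDerivAt (fun s : ℝ => b (x + s • τ)) (𝒯.D (x + s • τ) τ - τ) s := by
    intro s
    have h1 : HasDerivAt (fun s : ℝ => x + s • τ) τ s := by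
      simpa using ((hasDerivAt_id s).smul_const τ).const_add x
    exact (hbd (x + s • τ)).comp_hasDerivAt s h1
  have b1 : ‖b y - b x‖ ≤ 𝒯.K γ * h * ‖τ‖ := by
    have := norm_image_sub_le_of_norm_deriv_le_segment_01' (f := fun s : ℝ => b (x + s • τ)) (C := 𝒯.K γ * h * ‖τ‖)
      (fun s hs => (hbs s).hasDerivWithinAt) (fun s hs => (b_est hf ht (hl s ⟨hs.1, hs.2.le⟩)).2 τ hτd)
    simpa [hτ] using this
  have b2 : |⟪b y - b x, τ⟫| ≤ 2 * 𝒯.K γ ^ 2 * h ^ 2 * (‖τ‖ * ‖τ‖) := by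
    have := norm_image_sub_le_of_norm_deriv_le_segment_01' (f := fun s : ℝ => ⟪b (x + s • τ), τ⟫) (C := 2 * 𝒯.K γ ^ 2 * h ^ 2 * (‖τ‖ * ‖τ‖))
      (f' := fun s => ⟪𝒯.D (x + s • τ) τ - τ, τ⟫)
      (fun s hs => by
        have := ((hbs s).inner ℝ (hasDerivAt_const s τ))
        simp only [inner_zero_right, zero_add] at this
        exact this.hasDerivWithinAt) (fun s hs => by
        rw [Real.norm_eq_abs]; exact Db_inner hf ht (hl s ⟨hs.1, hs.2.le⟩) hτd hτd)
    rw [inner_sub_left]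
    simpa [hτ] using this
  have e : 𝒯.A y - 𝒯.A x = (b y - b x) + τ := by simp only [hb, hτ]; abel
  rw [e, norm_add_sq_real]
  have b3 := pow_le_pow_left₀ (norm_nonneg _) b1 2
  rw [abs_le] at b2 ⊢
  have := sq_nonneg ‖b y - b x‖
  constructor <;> nlinarith

theorem bilip_lin (hf : 𝒯.Fine γ h) (ht : t ∈ Tr.T) {x y : E3} (hx : x ∈ triOf t) (hy : y ∈ triOf t) :
    ‖x - y‖ ≤ 2 * ‖𝒯.A x - 𝒯.A y‖ := by
  have h1 := bilip hf ht hy hx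
  have h2 := mul_le_mul_of_nonneg_right hf.eps (sq_nonneg ‖x - y‖)
  rw [abs_le] at h1
  apply abs_le_of_sq_le_sq' _ (by positivity) |>.2
  nlinarith [h1.1, sq_nonneg ‖x - y‖]

theorem B_surj (hf : 𝒯.Fine γ h) (ht : t ∈ Tr.T) {x : E3} (hx : x ∈ triOf t) {ξ : E3} (hξ : ξ ∈ Srf.tangent (𝒯.A x)) :
    ∃ σ ∈ dirOf t, 𝒯.D x σ = ξ := by
  have hU := tri_U hf ht hx
  let f : dirOf t →ₗ[ℝ] Srf.tangent (𝒯.A x) := LinearMap.codRestrict _ ((𝒯.D x).toLinearMap.comp (dirOf t).subtype)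
    (fun τ => tangent_mem.2 (𝒯.n_D hU τ))
  have hi : Function.Injective f := by
    rw [injective_iff_map_eq_zero]
    intro τ hτ
    have h1 : 𝒯.D x τ = 0 := congrArg Subtype.val hτ
    have h2 := (B_norm hf ht hx τ.2).1
    rw [h1, norm_zero, mul_zero] at h2
    exact Subtype.ext (norm_le_zero_iff.1 h2)
  have hs := (LinearMap.injective_iff_surjective_of_finrank_eq_finrank
    ((Tr.dir_finrank ht).trans (finrank_tangent (𝒯.A_mem hU)).symm)).1 hi
  obtain ⟨σ, hσ⟩ := hs ⟨ξ, hξ⟩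
  exact ⟨σ, σ.2, congrArg Subtype.val hσ⟩

end Tube

end

section

theorem lip_1d {φ : ℝ → ℝ} {K : ℝ}
    (hloc : ∀ x ∈ Set.Icc (0:ℝ) 1, ∀ᶠ z in nhdsWithin x (Set.Icc 0 1), |φ z - φ x| ≤ K * |z - x|) : φ 1 ≤ φ 0 + K := by
  have hc : ContinuousOn φ (Set.Icc 0 1) := by
    intro x hx
    rw [ContinuousWithinAt, tendsto_iff_dist_tendsto_zero]
    refine squeeze_zero' (Filter.Eventually.of_forall fun _ => dist_nonneg) (hloc x hx) ?_
    have : Filter.Tendsto (fun z => K * |z - x|) (nhds x) (nhds (K * |x - x|)) := by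
      apply Continuous.tendsto; fun_prop
    simp only [sub_self, abs_zero, mul_zero] at this
    exact this.mono_left nhdsWithin_le_nhds
  have := image_le_of_liminf_slope_right_le_deriv_boundary (f := φ) (a := 0) (b := 1) (B := fun s => φ 0 + K * s) (B' := fun _ => K) hc
    (by simp) (by fun_prop) (fun x _ => by
      have := ((hasDerivAt_id x).const_mul K).const_add (φ 0)
      simpa using this.hasDerivWithinAt) (fun x hx r hr => by
      apply Filter.Eventually.frequently
      have h1 := nhdsWithin_mono x (Set.Ioc_subset_Icc_self.trans (Set.Icc_subset_Icc_left hx.1)) (hloc x ⟨hx.1, hx.2.le⟩)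
      rw [nhdsWithin_Ioc_eq_nhdsGT hx.2] at h1
      filter_upwards [h1, self_mem_nhdsWithin] with z hz hxz
      have hp : 0 < z - x := sub_pos.2 hxz
      rw [slope_def_field, div_lt_iff₀ hp]
      rw [abs_of_pos hp] at hz
      have := le_abs_self (φ z - φ x)
      nlinarith) (x := 1) (by simp)
  simpa using this

namespace Tube
variable {Srf : SmoothSurface} {𝒯 : Tube Srf} {γ h : ℝ} {Tr : Triangulation Srf γ h} {t : E3 × E3 × E3}

theorem tri_Sh (ht : t ∈ Tr.T) {x : E3} (hx : x ∈ triOf t) : x ∈ Tr.Sh := Set.mem_iUnion₂.2 ⟨t, ht, hx⟩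

theorem A_inj (hf : 𝒯.Fine γ h) {x y : E3} (hx : x ∈ Tr.Sh) (hy : y ∈ Tr.Sh) (e : 𝒯.A x = 𝒯.A y) : x = y :=
  Tr.a_bij.injOn hx hy (by rw [a_eq hf hx, a_eq hf hy, e])

theorem A_surj (hf : 𝒯.Fine γ h) (Tr : Triangulation Srf γ h) {y : E3} (hy : y ∈ Srf.S) : ∃ t ∈ Tr.T, ∃ x ∈ triOf t, 𝒯.A x = y := by
  obtain ⟨x, hx, e⟩ := Tr.a_bij.surjOn hy
  obtain ⟨t, ht, hxt⟩ := Set.mem_iUnion₂.1 hx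
  exact ⟨t, ht, x, hxt, by rw [← a_eq hf hx, e]⟩

theorem lift_A (hf : 𝒯.Fine γ h) (w : E3 → ℝ) {x : E3} (hx : x ∈ Tr.Sh) : Tr.liftS w (𝒯.A x) = w x := by
  have h1 : 𝒯.A x ∈ Tr.a '' Tr.Sh := ⟨x, hx, a_eq hf hx⟩
  have h2 := Function.invFunOn_mem h1
  have h3 := Function.invFunOn_eq h1
  rw [a_eq hf h2] at h3
  unfold Triangulation.liftS
  rw [A_inj hf h2 hx h3]

theorem At_closed (t : E3 × E3 × E3) : IsClosed (𝒯.A '' triOf t) := ((tri_compact t).image 𝒯.cont).isClosed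

theorem lift_loc (hf : 𝒯.Fine γ h) {v : E3 → ℝ} (hv : Tr.IsVh v) : ∃ K ≥ 0, ∀ y ∈ Srf.S,
    ∀ᶠ y' in nhdsWithin y Srf.S, |Tr.liftS v y' - Tr.liftS v y| ≤ K * ‖y' - y‖ := by
  choose! L c hL using hv.2
  refine ⟨∑ t ∈ Tr.T, 2 * ‖(L t).toContinuousLinearMap‖, by positivity, fun y hy => ?_⟩
  have h1 : ∀ t ∈ Tr.T, ∀ᶠ y' in nhdsWithin y Srf.S, y' ∈ 𝒯.A '' triOf t → y ∈ 𝒯.A '' triOf t := by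
    intro t ht
    by_cases h : y ∈ 𝒯.A '' triOf t
    · exact Filter.Eventually.of_forall fun _ _ => h
    · filter_upwards [nhdsWithin_le_nhds ((At_closed t).isOpen_compl.mem_nhds h)] with y' hy' h2
      exact absurd h2 hy'
  filter_upwards [(Filter.eventually_all_finset Tr.T).2 h1, self_mem_nhdsWithin] with y' hy' hy'S
  obtain ⟨t, ht, x', hx', rfl⟩ := A_surj hf Tr hy'S
  obtain ⟨x, hx, rfl⟩ := hy' t ht ⟨x', hx', rfl⟩
  rw [lift_A hf v (tri_Sh ht hx), lift_A hf v (tri_Sh ht hx'), hL t ht x hx, hL t ht x' hx']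
  have e : L t x' + c t - (L t x + c t) = (L t).toContinuousLinearMap (x' - x) := by simp
  rw [e, ← Real.norm_eq_abs]
  refine ((L t).toContinuousLinearMap.le_opNorm _).trans ?_
  have h2 := bilip_lin hf ht hx' hx
  have h3 : 2 * ‖(L t).toContinuousLinearMap‖ ≤ ∑ t ∈ Tr.T, 2 * ‖(L t).toContinuousLinearMap‖ :=
    Finset.single_le_sum (f := fun t => 2 * ‖(L t).toContinuousLinearMap‖) (fun _ _ => by positivity) ht
  have h4 := mul_le_mul_of_nonneg_left h2 (norm_nonneg (L t).toContinuousLinearMap)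
  have h5 := mul_le_mul_of_nonneg_right h3 (norm_nonneg (𝒯.A x' - 𝒯.A x))
  linarith

theorem lift_lip (hf : 𝒯.Fine γ h) {v : E3 → ℝ} (hv : Tr.IsVh v) : ∃ K : ℝ≥0, LipschitzOnWith K (Tr.liftS v) Srf.S := by
  obtain ⟨K, hK0, hK⟩ := lift_loc hf hv
  have hc : ContinuousOn (Tr.liftS v) Srf.S := by
    intro x hx
    rw [ContinuousWithinAt, tendsto_iff_dist_tendsto_zero]
    refine squeeze_zero' (Filter.Eventually.of_forall fun _ => dist_nonneg) (hK x hx) ?_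
    have : Filter.Tendsto (fun z => K * ‖z - x‖) (nhds x) (nhds (K * ‖x - x‖)) := by
      apply Continuous.tendsto; fun_prop
    simp only [sub_self, norm_zero, mul_zero] at this
    exact this.mono_left nhdsWithin_le_nhds
  obtain ⟨M, hM⟩ := Srf.compact.exists_bound_of_continuousOn hc
  have hδ := 𝒯.hδ
  have hLp := 𝒯.L_pos
  have hM0 : 0 ≤ M := by
    obtain ⟨x, hx⟩ := Srf.nonempty
    exact (norm_nonneg _).trans (hM x hx)
  have key : ∀ x ∈ Srf.S, ∀ y ∈ Srf.S, Tr.liftS v y - Tr.liftS v x ≤ (K * 𝒯.L + 2 * M / 𝒯.δ) * ‖y - x‖ := by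
    intro x hx y hy
    have n0 := norm_nonneg (y - x)
    by_cases hd : ‖y - x‖ < 𝒯.δ
    · have hU : ∀ s ∈ Set.Icc (0:ℝ) 1, x + s • (y - x) ∈ 𝒯.U := by
        intro s hs
        apply 𝒯.mem_U_of hx
        rw [add_sub_cancel_left, norm_smul, Real.norm_eq_abs, abs_of_nonneg hs.1]
        have := mul_le_mul_of_nonneg_right hs.2 n0
        linarith
      have := lip_1d (φ := fun s : ℝ => Tr.liftS v (𝒯.A (x + s • (y - x)))) (K := K * 𝒯.L * ‖y - x‖) (by
        intro s hs
        have ht : Filter.Tendsto (fun s : ℝ => 𝒯.A (x + s • (y - x))) (nhdsWithin s (Set.Icc 0 1))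
            (nhdsWithin (𝒯.A (x + s • (y - x))) Srf.S) := by
          apply tendsto_nhdsWithin_of_tendsto_nhds_of_eventually_within
          · have : Continuous fun s : ℝ => 𝒯.A (x + s • (y - x)) := 𝒯.cont.comp (by fun_prop)
            exact this.continuousWithinAt
          · filter_upwards [self_mem_nhdsWithin] with s' hs'
            exact 𝒯.A_mem (hU s' hs')
        filter_upwards [ht.eventually (hK _ (𝒯.A_mem (hU s hs)))] with z hz
        refine hz.trans ?_
        have h1 : ‖𝒯.A (x + z • (y - x)) - 𝒯.A (x + s • (y - x))‖ ≤ 𝒯.L * (|z - s| * ‖y - x‖) := by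
          refine (𝒯.lip _ _).trans ?_
          rw [add_sub_add_left_eq_sub, ← sub_smul, norm_smul, Real.norm_eq_abs]
        have := mul_le_mul_of_nonneg_left h1 hK0
        linarith)
      simp only [one_smul, add_sub_cancel, zero_smul, add_zero, 𝒯.fix hx, 𝒯.fix hy] at this
      have : 0 ≤ 2 * M / 𝒯.δ * ‖y - x‖ := by positivity
      linarith
    · have h1 := hM x hx
      have h2 := hM y hy
      rw [Real.norm_eq_abs, abs_le] at h1 h2
      have h3 : 2 * M ≤ 2 * M / 𝒯.δ * ‖y - x‖ := by
        rw [div_mul_eq_mul_div, le_div_iff₀ hδ]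
        exact mul_le_mul_of_nonneg_left (not_lt.1 hd) (by positivity)
      have : 0 ≤ K * 𝒯.L * ‖y - x‖ := by positivity
      linarith
  refine ⟨⟨K * 𝒯.L + 2 * M / 𝒯.δ, by positivity⟩, LipschitzOnWith.of_dist_le_mul fun x hx y hy => ?_⟩
  rw [Real.dist_eq, dist_eq_norm, abs_le]
  have h1 := key x hx y hy
  have h2 := key y hy x hx
  rw [norm_sub_rev] at h1
  constructor
  · have := neg_le_neg h1; rw [neg_sub] at this; exact this
  · exact h2

/-- a point of a triangle that is not in another triangle -/
def Good (Tr : Triangulation Srf γ h) (t : E3 × E3 × E3) (x : E3) : Prop := x ∈ triOf t ∧ ∀ t' ∈ Tr.T, t' ≠ t → x ∉ triOf t'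

theorem lift_diff (hf : 𝒯.Fine γ h) {v V : E3 → ℝ} (hV : ∀ y ∈ Srf.S, V y = Tr.liftS v y) (ht : t ∈ Tr.T)
    {L : E3 →ₗ[ℝ] ℝ} {c : ℝ} (hL : ∀ x ∈ triOf t, v x = L x + c) {x : E3} (hx : Good Tr t x) :
    DifferentiableAt ℝ (V ∘ 𝒯.A) (𝒯.A x) ∧ ∀ τ ∈ dirOf t, ⟪𝒯.G V (𝒯.A x), 𝒯.D x τ⟫ = L τ := by
  have hU := tri_U hf ht hx.1
  have hyS := 𝒯.A_mem hU
  set y := 𝒯.A x with hy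
  let B : dirOf t →ₗ[ℝ] E3 := (𝒯.D x).toLinearMap.comp (dirOf t).subtype
  have hB : LinearMap.ker B = ⊥ := by
    rw [LinearMap.ker_eq_bot, injective_iff_map_eq_zero]
    intro τ hτ
    have h2 := (B_norm hf ht hx.1 τ.2).1
    have h1 : 𝒯.D x τ = 0 := hτ
    rw [h1, norm_zero, mul_zero] at h2
    exact Subtype.ext (norm_le_zero_iff.1 h2)
  obtain ⟨M0, hM0⟩ := B.exists_leftInverse_of_injective hB
  let M : E3 →L[ℝ] E3 := ((dirOf t).subtype.comp M0).toContinuousLinearMap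
  have hM : ∀ τ ∈ dirOf t, M (𝒯.D x τ) = τ := by
    intro τ hτ
    have := congrArg Subtype.val (LinearMap.congr_fun hM0 ⟨τ, hτ⟩)
    exact this
  -- points near y lie in A t
  have h1 : ∀ᶠ z in nhds y, z ∈ 𝒯.U ∧ 𝒯.A z ∈ 𝒯.A '' triOf t := by
    have h2 : ∀ t' ∈ Tr.T, ∀ᶠ z in nhds y, t' ≠ t → 𝒯.A z ∉ 𝒯.A '' triOf t' := by
      intro t' ht'
      by_cases e : t' = t
      · exact Filter.Eventually.of_forall fun _ h => absurd e h
      · have h3 : 𝒯.A y ∉ 𝒯.A '' triOf t' := by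
          rintro ⟨x', hx', e'⟩
          rw [𝒯.fix hyS] at e'
          have := A_inj hf (tri_Sh ht' hx') (tri_Sh ht hx.1) e'
          exact hx.2 t' ht' e (this ▸ hx')
        filter_upwards [𝒯.cont.continuousAt.preimage_mem_nhds ((At_closed t').isOpen_compl.mem_nhds h3)] with z hz _
        exact hz
    filter_upwards [(Filter.eventually_all_finset Tr.T).2 h2, 𝒯.U_open.mem_nhds (𝒯.S_sub_U hyS)] with z hz hzU
    refine ⟨hzU, ?_⟩
    obtain ⟨t', ht', x', hx', e⟩ := A_surj hf Tr (𝒯.A_mem hzU)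
    by_cases e' : t' = t
    · subst e'; exact ⟨x', hx', e⟩
    · exact absurd ⟨x', hx', e⟩ (hz t' ht' e')
  let Lc : E3 →L[ℝ] ℝ := L.toContinuousLinearMap
  have hd : HasFDerivAt (V ∘ 𝒯.A) (Lc.comp (M.comp (𝒯.D y))) y := by
    have hAy := 𝒯.hasD y
    rw [hasFDerivAt_iff_isLittleO, Asymptotics.isLittleO_iff]
    intro ε hε
    -- error of the left inverse
    set m := ‖Lc‖ * ‖M‖ with hm
    have hm0 : 0 ≤ m := by positivity
    have hLp := 𝒯.L_pos
    set ε1 := ε / (2 * (m + 1)) with hε1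
    set ρ := ε / (2 * (m + 1) * (4 * 𝒯.L ^ 3)) with hρ
    rw [hasFDerivAt_iff_isLittleO, Asymptotics.isLittleO_iff] at hAy
    have hε1p : 0 < ε1 := by positivity
    have hρp : 0 < ρ := by positivity
    filter_upwards [h1, hAy hε1p, ball_mem_nhds y hρp] with z hz hAz hzy
    obtain ⟨hzU, x', hx', e⟩ := hz
    rw [mem_ball, dist_eq_norm] at hzy
    simp only [Function.comp_apply]
    rw [𝒯.fix hyS, hV _ (𝒯.A_mem hzU), hV _ hyS, ← e, hy, lift_A hf v (tri_Sh ht hx.1), lift_A hf v (tri_Sh ht hx'),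
      hL x hx.1, hL x' hx', ← hy]
    rw [𝒯.fix hyS, ← e] at hAz
    have hτ : x' - x ∈ dirOf t := tri_sub_mem hx' hx.1
    have e1 : L x' + c - (L x + c) - (Lc.comp (M.comp (𝒯.D y))) (z - y)
        = Lc (M (𝒯.D x (x' - x) - (𝒯.A x' - y) + ((𝒯.A x' - y) - 𝒯.D y (z - y)))) := by
      have : L x' + c - (L x + c) = Lc (M (𝒯.D x (x' - x))) := by
        rw [hM _ hτ, map_sub]; simp [Lc]
      rw [this]
      simp only [ContinuousLinearMap.comp_apply, ← map_sub]
      congr 2; abel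
    rw [e1]
    have b1 : ‖x' - x‖ ≤ 2 * ‖𝒯.A x' - y‖ := bilip_lin hf ht hx' hx.1
    have b2 : ‖𝒯.A x' - y‖ ≤ 𝒯.L * ‖z - y‖ := by
      rw [e]; nth_rewrite 1 [← 𝒯.fix hyS]; exact 𝒯.lip z y
    have b3 := 𝒯.taylor (x := x) (y := x') (z := x) (ρ := ‖x' - x‖) le_rfl (by simp)
    have b4 : ‖𝒯.D x (x' - x) - (𝒯.A x' - y)‖ ≤ ε1 * ‖z - y‖ := by
      rw [norm_sub_rev]
      refine b3.trans ?_
      have b5 : ‖x' - x‖ ≤ 2 * 𝒯.L * ‖z - y‖ := by linarith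
      calc 𝒯.L * ‖x' - x‖ * ‖x' - x‖ ≤ 𝒯.L * (2 * 𝒯.L * ‖z - y‖) * (2 * 𝒯.L * ‖z - y‖) := by gcongr
        _ = (4 * 𝒯.L ^ 3 * ‖z - y‖) * ‖z - y‖ := by ring
        _ ≤ (4 * 𝒯.L ^ 3 * ρ) * ‖z - y‖ := by gcongr
        _ = ε1 * ‖z - y‖ := by rw [hρ, hε1]; field_simp
    have b6 : ‖𝒯.D x (x' - x) - (𝒯.A x' - y) + ((𝒯.A x' - y) - 𝒯.D y (z - y))‖ ≤ 2 * ε1 * ‖z - y‖ := by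
      refine (norm_add_le _ _).trans ?_
      linarith
    calc _ ≤ ‖Lc‖ * (‖M‖ * (2 * ε1 * ‖z - y‖)) :=
          (Lc.le_opNorm _).trans (mul_le_mul_of_nonneg_left ((M.le_opNorm _).trans
            (mul_le_mul_of_nonneg_left b6 (norm_nonneg _))) (norm_nonneg _))
      _ = m * (2 * ε1) * ‖z - y‖ := by rw [hm]; ring
      _ ≤ ε * ‖z - y‖ := by
        gcongr
        rw [hε1, show m * (2 * (ε / (2 * (m + 1)))) = m / (m + 1) * ε by field_simp]
        have : m / (m + 1) ≤ 1 := by rw [div_le_one (by positivity)]; linarith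
        nlinarith
  refine ⟨hd.differentiableAt, fun τ hτ => ?_⟩
  rw [G_inner, hd.fderiv]
  simp only [ContinuousLinearMap.comp_apply]
  rw [𝒯.D_comp hU, hM τ hτ]; rfl

end Tube

end

section

namespace Tube
variable {Srf : SmoothSurface} {𝒯 : Tube Srf} {γ h : ℝ} {Tr : Triangulation Srf γ h} {t : E3 × E3 × E3}

theorem tri_meas (t : E3 × E3 × E3) : MeasurableSet (triOf t) := (tri_compact t).isClosed.measurableSet

theorem At_meas (t : E3 × E3 × E3) : MeasurableSet (𝒯.A '' triOf t) := (At_closed t).measurableSet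

theorem At_sub (hf : 𝒯.Fine γ h) (ht : t ∈ Tr.T) : 𝒯.A '' triOf t ⊆ Srf.S := by
  rintro _ ⟨x, hx, rfl⟩
  exact 𝒯.A_mem (tri_U hf ht hx)

theorem inter_null (Tr : Triangulation Srf γ h) {t' : E3 × E3 × E3} (ht : t ∈ Tr.T) (ht' : t' ∈ Tr.T) (hne : t ≠ t') :
    μH[2] (triOf t ∩ triOf t') = 0 := by
  rcases Tr.meet t ht t' ht' hne with h | ⟨v, -, h⟩ | ⟨v, w, -, -, -, h⟩
  · rw [h]; exact measure_empty
  · rw [h, ← segment_same ℝ v]; exact seg_null v v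
  · rw [h]; exact seg_null v w

theorem A_null {E : Set E3} (hE : μH[2] E = 0) : μH[2] (𝒯.A '' E) = 0 := by
  have hl : LipschitzOnWith ⟨𝒯.L, 𝒯.L_pos.le⟩ 𝒯.A E :=
    (LipschitzWith.of_dist_le_mul fun x y => by rw [dist_eq_norm, dist_eq_norm]; exact 𝒯.lip x y).lipschitzOnWith
  have := hl.hausdorffMeasure_image_le (d := 2) (by norm_num)
  rw [hE, mul_zero] at this
  exact le_antisymm this bot_le

theorem good_ae (Tr : Triangulation Srf γ h) (ht : t ∈ Tr.T) : ∀ᵐ x ∂(μH[2] : Measure E3).restrict (triOf t), Good Tr t x := by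
  have h1 : ∀ t' ∈ Tr.T, ∀ᵐ x ∂(μH[2] : Measure E3).restrict (triOf t), t' ≠ t → x ∉ triOf t' := by
    intro t' ht'
    by_cases e : t' = t
    · exact Filter.Eventually.of_forall fun _ h => absurd e h
    · rw [ae_iff, Measure.restrict_apply₀']
      · refine measure_mono_null ?_ (inter_null Tr ht' ht e)
        rintro x ⟨hx, hxt⟩
        simp only [Set.mem_setOf_eq, Classical.not_imp, not_not] at hx
        exact ⟨hx.2, hxt⟩
      · exact (tri_meas t).nullMeasurableSet
  filter_upwards [ae_restrict_mem (tri_meas t), (Filter.eventually_all_finset Tr.T).2 h1] with x hx h2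
  exact ⟨hx, h2⟩

theorem good_ae_S (hf : 𝒯.Fine γ h) (Tr : Triangulation Srf γ h) :
    ∀ᵐ y ∂Srf.μ, ∃ t ∈ Tr.T, ∃ x, Good Tr t x ∧ 𝒯.A x = y := by
  have h1 : ∀ t ∈ Tr.T, ∀ t' ∈ Tr.T, ∀ᵐ y ∂Srf.μ, t' ≠ t → y ∉ 𝒯.A '' (triOf t' ∩ triOf t) := by
    intro t ht t' ht'
    by_cases e : t' = t
    · exact Filter.Eventually.of_forall fun _ h => absurd e h
    · rw [ae_iff]
      refine measure_mono_null (t := 𝒯.A '' (triOf t' ∩ triOf t)) ?_ ?_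
      · intro x hx
        simp only [Set.mem_setOf_eq, Classical.not_imp, not_not] at hx
        exact hx.2
      · exact le_antisymm ((Measure.restrict_apply_le _ _).trans (A_null (inter_null Tr ht' ht e)).le) bot_le
  filter_upwards [ae_mem_S, (Filter.eventually_all_finset Tr.T).2 fun t ht => (Filter.eventually_all_finset Tr.T).2 (h1 t ht)] with y hy h2
  obtain ⟨t, ht, x, hx, rfl⟩ := A_surj hf Tr hy
  exact ⟨t, ht, x, ⟨hx, fun t' ht' hne hx' => h2 t ht t' ht' hne ⟨x, ⟨hx', hx⟩, rfl⟩⟩, rfl⟩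

theorem lift_memW (hf : 𝒯.Fine γ h) {v : E3 → ℝ} (hv : Tr.IsVh v) : ∃ V, 𝒯.MemW V ∧ ∀ y ∈ Srf.S, V y = Tr.liftS v y := by
  obtain ⟨K, hK⟩ := lift_lip hf hv
  obtain ⟨V, hV, e⟩ := hK.extend_real
  have e' : ∀ y ∈ Srf.S, V y = Tr.liftS v y := fun y hy => (e hy).symm
  refine ⟨V, ⟨⟨K, hV⟩, ?_⟩, e'⟩
  filter_upwards [good_ae_S hf Tr] with y hy
  obtain ⟨t, ht, x, hx, rfl⟩ := hy
  obtain ⟨L, c, hL⟩ := hv.2 t ht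
  exact (lift_diff hf e' ht hL hx).1

theorem gradTri_mem (t : E3 × E3 × E3) (v : E3 → ℝ) (x : E3) : gradTri t v x ∈ dirOf t := Submodule.coe_mem _

theorem gradTri_inner (hγ : 0 < γ) (hh : 0 < h) (ht : t ∈ Tr.T) {v : E3 → ℝ} {L : E3 →ₗ[ℝ] ℝ} {c : ℝ} (hL : ∀ x ∈ triOf t, v x = L x + c)
    {x : E3} (hx : x ∈ triOf t) {τ : E3} (hτ : τ ∈ dirOf t) : ⟪gradTri t v x, τ⟫ = L τ := by
  let Lc : E3 →L[ℝ] ℝ := L.toContinuousLinearMap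
  have h1 : HasFDerivWithinAt v Lc (triOf t) x := by
    have : HasFDerivWithinAt (fun z => Lc z + c) Lc (triOf t) x := (Lc.hasFDerivAt.add_const c).hasFDerivWithinAt
    exact this.congr (fun z hz => hL z hz) (hL x hx)
  have h2 := h1.differentiableWithinAt.hasFDerivWithinAt
  have h3 := HasFDerivWithinAt.unique_on h2 h1
  have h4 : ∀ p ∈ triOf t, fderivWithin ℝ v (triOf t) x (p - x) = L (p - x) := fun p hp =>
    h3 (mem_tangentConeAt_of_segment_subset ((tri_convex t).segment_subset hx hp))
  have h5 : fderivWithin ℝ v (triOf t) x τ = L τ := by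
    obtain ⟨y₀, hy₀, hd⟩ := Tr.tri_disk ht
    rcases eq_or_ne τ 0 with rfl | hne
    · simp
    have hn : 0 < ‖τ‖ := norm_pos_iff.2 hne
    set s := γ * h / ‖τ‖ with hs
    have hsp : 0 < s := by positivity
    have hsn : ‖s • τ‖ ≤ γ * h := by
      rw [norm_smul, Real.norm_eq_abs, abs_of_pos hsp, hs, div_mul_cancel₀ _ hn.ne']
    have e1 := h4 _ (hd (s • τ) (Submodule.smul_mem _ _ hτ) hsn)
    have e2 := h4 _ hy₀
    have e3 : y₀ + s • τ - x = (y₀ - x) + s • τ := by abel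
    rw [e3, map_add, map_add, e2, map_smul, map_smul, smul_eq_mul, smul_eq_mul] at e1
    exact mul_left_cancel₀ hsp.ne' (add_left_cancel e1)
  rw [gradTri, tGrad, ← h5]
  have := Submodule.inner_orthogonalProjectionOnto_eq_of_mem_right (K := dirOf t) ⟨τ, hτ⟩ ((InnerProductSpace.toDual ℝ E3).symm (fderivWithin ℝ v (triOf t) x))
  rw [Submodule.coe_inner] at this
  exact this.trans InnerProductSpace.toDual_symm_apply

end Tube

end

section

namespace Tube
variable {Srf : SmoothSurface} {𝒯 : Tube Srf} {γ h : ℝ} {Tr : Triangulation Srf γ h} {t : E3 × E3 × E3}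

/-- geometric error constant -/
def e0 (𝒯 : Tube Srf) (γ h : ℝ) : ℝ := 5 * 𝒯.K γ ^ 2 * h ^ 2

theorem e0_nonneg : 0 ≤ 𝒯.e0 γ h := by unfold e0; positivity

theorem A_meas (𝒯 : Tube Srf) : Measurable 𝒯.A :=
  (𝒯.cont).measurable

theorem cmp1 (hf : 𝒯.Fine γ h) (ht : t ∈ Tr.T) :
    ((μH[2] : Measure E3).restrict (triOf t)).map 𝒯.A ≤ ENNReal.ofReal (1 + 2 * 𝒯.e0 γ h) • (μH[2] : Measure E3).restrict (𝒯.A '' triOf t) := by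
  have h0 := e0_nonneg (𝒯 := 𝒯) (γ := γ) (h := h)
  have h80 : 𝒯.e0 γ h ≤ 1 / 80 := hf.eps
  have := map_le (A_meas 𝒯) (Set.mapsTo_image 𝒯.A (triOf t)) (Real.sqrt_nonneg (1 + 2 * 𝒯.e0 γ h)) (by
    intro x hx y hy
    have h1 := abs_le.1 (bilip hf ht hy hx)
    change -(𝒯.e0 γ h * _) ≤ _ ∧ _ ≤ 𝒯.e0 γ h * _ at h1
    refine abs_le_of_sq_le_sq' ?_ (by positivity) |>.2
    rw [mul_pow, Real.sq_sqrt (by linarith)]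
    have h2 : (1 - 𝒯.e0 γ h) * ‖x - y‖ ^ 2 ≤ ‖𝒯.A x - 𝒯.A y‖ ^ 2 := by linarith [h1.1]
    have h3 : (1 + 2 * 𝒯.e0 γ h) * ((1 - 𝒯.e0 γ h) * ‖x - y‖ ^ 2) ≤ (1 + 2 * 𝒯.e0 γ h) * ‖𝒯.A x - 𝒯.A y‖ ^ 2 :=
      mul_le_mul_of_nonneg_left h2 (by linarith)
    have h4 : 0 ≤ (𝒯.e0 γ h * (1 - 2 * 𝒯.e0 γ h)) * ‖x - y‖ ^ 2 := mul_nonneg (mul_nonneg h0 (by linarith)) (by positivity)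
    linarith)
  rwa [Real.sq_sqrt (by linarith)] at this

theorem cmp2 (hf : 𝒯.Fine γ h) (ht : t ∈ Tr.T) :
    (μH[2] : Measure E3).restrict (𝒯.A '' triOf t) ≤ ENNReal.ofReal (1 + 2 * 𝒯.e0 γ h) • ((μH[2] : Measure E3).restrict (triOf t)).map 𝒯.A := by
  have h0 := e0_nonneg (𝒯 := 𝒯) (γ := γ) (h := h)
  rw [Measure.le_iff]
  intro E hE
  rw [Measure.restrict_apply hE, Measure.smul_apply, Measure.map_apply (A_meas 𝒯) hE,
    Measure.restrict_apply (A_meas 𝒯 hE), smul_eq_mul]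
  have hl : LipschitzOnWith (√(1 + 2 * 𝒯.e0 γ h)).toNNReal 𝒯.A (𝒯.A ⁻¹' E ∩ triOf t) := by
    refine LipschitzOnWith.of_dist_le_mul fun x hx y hy => ?_
    rw [dist_eq_norm, dist_eq_norm, Real.coe_toNNReal _ (Real.sqrt_nonneg _)]
    have h1 := abs_le.1 (bilip hf ht hy.2 hx.2)
    change -(𝒯.e0 γ h * _) ≤ _ ∧ _ ≤ 𝒯.e0 γ h * _ at h1
    refine abs_le_of_sq_le_sq' ?_ (by positivity) |>.2
    rw [mul_pow, Real.sq_sqrt (by linarith)]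
    have : 0 ≤ 𝒯.e0 γ h * ‖x - y‖ ^ 2 := by positivity
    linarith [h1.2]
  have h2 := hl.hausdorffMeasure_image_le (d := 2) (by norm_num)
  refine (measure_mono ?_).trans (h2.trans (le_of_eq ?_))
  · rintro _ ⟨hx, x, hxt, rfl⟩
    exact ⟨x, ⟨hx, hxt⟩, rfl⟩
  · congr 1
    rw [ENNReal.rpow_ofNat]
    change ENNReal.ofReal _ ^ 2 = _
    rw [← ENNReal.ofReal_pow (Real.sqrt_nonneg _), Real.sq_sqrt (by linarith)]

theorem cmp_int (hf : 𝒯.Fine γ h) (ht : t ∈ Tr.T) {g : E3 → ℝ} (hg : Integrable g Srf.μ) :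
    IntegrableOn g (𝒯.A '' triOf t) μH[2] ∧ IntegrableOn (fun x => g (𝒯.A x)) (triOf t) μH[2] ∧
    |∫ x in triOf t, g (𝒯.A x) ∂μH[2] - ∫ y in 𝒯.A '' triOf t, g y ∂μH[2]| ≤ 2 * 𝒯.e0 γ h * ∫ y in 𝒯.A '' triOf t, |g y| ∂μH[2] := by
  have h0 := e0_nonneg (𝒯 := 𝒯) (γ := γ) (h := h)
  have h1 : IntegrableOn g (𝒯.A '' triOf t) μH[2] := IntegrableOn.mono_set hg (At_sub hf ht)
  have h2 : Integrable g (((μH[2] : Measure E3).restrict (triOf t)).map 𝒯.A) :=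
    (h1.integrable.smul_measure (c := ENNReal.ofReal (1 + 2 * 𝒯.e0 γ h)) (by simp)).mono_measure (cmp1 hf ht)
  have h3 := integral_compare (by positivity) (cmp1 hf ht) (cmp2 hf ht) h1.integrable
  rw [integral_map (A_meas 𝒯).aemeasurable h2.aestronglyMeasurable] at h3
  exact ⟨h1, (integrable_map_measure h2.aestronglyMeasurable (A_meas 𝒯).aemeasurable).1 h2, h3⟩

theorem mu_sum (hf : 𝒯.Fine γ h) (Tr : Triangulation Srf γ h) : Srf.μ = ∑ t ∈ Tr.T, (μH[2] : Measure E3).restrict (𝒯.A '' triOf t) := by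
  have e : Srf.S = ⋃ t : Tr.T, 𝒯.A '' triOf t := by
    ext y
    simp only [Set.mem_iUnion, Subtype.exists]
    constructor
    · intro hy
      obtain ⟨t, ht, x, hx, rfl⟩ := A_surj hf Tr hy
      exact ⟨t, ht, x, hx, rfl⟩
    · rintro ⟨t, ht, hy⟩
      exact At_sub hf ht hy
  rw [SmoothSurface.μ, e, Measure.restrict_iUnion_ae, Measure.sum_fintype]
  · exact Finset.sum_coe_sort Tr.T (fun t => (μH[2] : Measure E3).restrict (𝒯.A '' triOf t))
  · intro t t' hne
    have hne' : (t : E3 × E3 × E3) ≠ t' := fun h => hne (Subtype.ext h)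
    refine measure_mono_null ?_ (A_null (𝒯 := 𝒯) (inter_null Tr t.2 t'.2 hne'))
    rintro _ ⟨⟨x, hx, rfl⟩, x', hx', ee⟩
    have := A_inj hf (tri_Sh t'.2 hx') (tri_Sh t.2 hx) ee
    subst this
    exact ⟨x', ⟨hx, hx'⟩, rfl⟩
  · exact fun t => (At_meas _).nullMeasurableSet

theorem int_sum (hf : 𝒯.Fine γ h) (Tr : Triangulation Srf γ h) {g : E3 → ℝ} (hg : Integrable g Srf.μ) :
    ∫ y, g y ∂Srf.μ = ∑ t ∈ Tr.T, ∫ y in 𝒯.A '' triOf t, g y ∂μH[2] := by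
  have h1 := hg
  rw [mu_sum hf Tr] at h1 ⊢
  exact integral_finsetSum_measure (integrable_finsetSum_measure.1 h1)

theorem tri_mu_lt (hf : 𝒯.Fine γ h) (ht : t ∈ Tr.T) : μH[2] (triOf t) < ⊤ := by
  have h1 := haus_le (W := triOf t) 𝒯.A (Λ := 2) (by norm_num) (by
    intro x hx y hy
    rw [dist_eq_norm, dist_eq_norm]
    exact bilip_lin hf ht hx hy)
  refine h1.trans_lt (ENNReal.mul_lt_top (by simp) ((measure_mono (At_sub hf ht)).trans_lt 𝒯.mu_S_lt))

end Tube

end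

section

namespace Tube
variable {Srf : SmoothSurface} {𝒯 : Tube Srf} {γ h : ℝ} {Tr : Triangulation Srf γ h} {t : E3 × E3 × E3}

theorem pt_grad (hf : 𝒯.Fine γ h) {v V : E3 → ℝ} (hV : ∀ y ∈ Srf.S, V y = Tr.liftS v y) (hv : Tr.IsVh v) (ht : t ∈ Tr.T)
    {x : E3} (hx : Good Tr t x) : ‖gradTri t v x‖ ≤ 2 * ‖𝒯.G V (𝒯.A x)‖ ∧ ‖𝒯.G V (𝒯.A x)‖ ≤ 2 * ‖gradTri t v x‖ ∧
      (∀ τ ∈ dirOf t, ⟪𝒯.G V (𝒯.A x), 𝒯.D x τ⟫ = ⟪gradTri t v x, τ⟫) ∧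
      ∃ σ ∈ dirOf t, 𝒯.D x σ = 𝒯.G V (𝒯.A x) ∧ ‖σ‖ ≤ 2 * ‖𝒯.G V (𝒯.A x)‖ := by
  obtain ⟨L, c, hL⟩ := hv.2 t ht
  obtain ⟨hd, hG⟩ := lift_diff hf hV ht hL hx
  have hyS := 𝒯.A_mem (tri_U hf ht hx.1)
  have h1 : ∀ τ ∈ dirOf t, ⟪𝒯.G V (𝒯.A x), 𝒯.D x τ⟫ = ⟪gradTri t v x, τ⟫ := fun τ hτ => by
    rw [hG τ hτ, gradTri_inner hf.hγ hf.hh ht hL hx.1 hτ]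
  have hgm := gradTri_mem t v x
  have hT : 𝒯.G V (𝒯.A x) ∈ Srf.tangent (𝒯.A x) := by
    rw [← D_G hyS hd]; exact 𝒯.D_mem_tangent hyS _
  obtain ⟨σ, hσ, hσe⟩ := B_surj hf ht hx.1 hT
  have hσn := (B_norm hf ht hx.1 hσ).1
  rw [hσe] at hσn
  refine ⟨?_, ?_, h1, σ, hσ, hσe, hσn⟩
  · rcases eq_or_ne (gradTri t v x) 0 with e | hne
    · rw [e, norm_zero]; positivity
    have hp := norm_pos_iff.2 hne
    have h2 := h1 _ hgm
    rw [real_inner_self_eq_norm_sq] at h2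
    have h3 := real_inner_le_norm (𝒯.G V (𝒯.A x)) (𝒯.D x (gradTri t v x))
    have h4 := mul_le_mul_of_nonneg_left (B_norm hf ht hx.1 hgm).2 (norm_nonneg (𝒯.G V (𝒯.A x)))
    nlinarith
  · rcases eq_or_ne (𝒯.G V (𝒯.A x)) 0 with e | hne
    · rw [e, norm_zero]; positivity
    have hp := norm_pos_iff.2 hne
    have h2 := h1 _ hσ
    rw [hσe, real_inner_self_eq_norm_sq] at h2
    have h3 := real_inner_le_norm (gradTri t v x) σ
    have h4 := mul_le_mul_of_nonneg_left hσn (norm_nonneg (gradTri t v x))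
    nlinarith

theorem pt_F1 (hf : 𝒯.Fine γ h) {v V w W : E3 → ℝ} (hV : ∀ y ∈ Srf.S, V y = Tr.liftS v y) (hv : Tr.IsVh v)
    (hW : ∀ y ∈ Srf.S, W y = Tr.liftS w y) (hw : Tr.IsVh w) (ht : t ∈ Tr.T)
    {x : E3} (hx : Good Tr t x) :
    |(⟪gradTri t v x, gradTri t w x⟫ + v x * w x) - (⟪𝒯.G V (𝒯.A x), 𝒯.G W (𝒯.A x)⟫ + V (𝒯.A x) * W (𝒯.A x))| ≤
      4 * 𝒯.e0 γ h * (‖𝒯.G V (𝒯.A x)‖ * ‖𝒯.G W (𝒯.A x)‖) := by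
  have hyS := 𝒯.A_mem (tri_U hf ht hx.1)
  have hSh := tri_Sh ht hx.1
  rw [hV _ hyS, hW _ hyS, lift_A hf v hSh, lift_A hf w hSh]
  obtain ⟨n1, -, hv1, -⟩ := pt_grad hf hV hv ht hx
  obtain ⟨-, -, hw1, σ, hσ, hσe, hσn⟩ := pt_grad hf hW hw ht hx
  have hgm := gradTri_mem t v x
  have e1 := hv1 σ hσ
  have e2 := hw1 _ hgm
  rw [hσe] at e1
  rw [← hσe] at e2
  have hb := B_inner hf ht hx.1 hσ hgm
  have e3 : ⟪gradTri t v x, gradTri t w x⟫ + v x * w x - (⟪𝒯.G V (𝒯.A x), 𝒯.G W (𝒯.A x)⟫ + v x * w x) =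
      ⟪𝒯.D x σ, 𝒯.D x (gradTri t v x)⟫ - ⟪σ, gradTri t v x⟫ := by
    rw [e2, e1, real_inner_comm σ, real_inner_comm (gradTri t v x) (gradTri t w x)]; ring
  rw [e3]
  refine hb.trans ?_
  change 𝒯.e0 γ h * _ ≤ _
  have h0 := e0_nonneg (𝒯 := 𝒯) (γ := γ) (h := h)
  have : ‖σ‖ * ‖gradTri t v x‖ ≤ (2 * ‖𝒯.G W (𝒯.A x)‖) * (2 * ‖𝒯.G V (𝒯.A x)‖) := mul_le_mul hσn n1 (norm_nonneg _) (by positivity)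
  nlinarith [mul_le_mul_of_nonneg_left this h0]

theorem grad_const (hf : 𝒯.Fine γ h) {v : E3 → ℝ} (hv : Tr.IsVh v) (ht : t ∈ Tr.T) {x y : E3} (hx : x ∈ triOf t) (hy : y ∈ triOf t) :
    gradTri t v x = gradTri t v y := by
  obtain ⟨L, c, hL⟩ := hv.2 t ht
  have h1 := fun τ (hτ : τ ∈ dirOf t) => (gradTri_inner hf.hγ hf.hh ht hL hx hτ).trans (gradTri_inner hf.hγ hf.hh ht hL hy hτ).symm
  have h2 := h1 _ (Submodule.sub_mem _ (gradTri_mem t v x) (gradTri_mem t v y))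
  rw [← sub_eq_zero, ← inner_sub_left] at h2
  exact sub_eq_zero.1 (inner_self_eq_zero.1 h2)

theorem tri_cont_int (hf : 𝒯.Fine γ h) (ht : t ∈ Tr.T) {f : E3 → ℝ} (hc : ContinuousOn f (triOf t)) : IntegrableOn f (triOf t) μH[2] := by
  obtain ⟨C, hC⟩ := (tri_compact t).exists_bound_of_continuousOn hc
  haveI : IsFiniteMeasure ((μH[2] : Measure E3).restrict (triOf t)) := ⟨by
    rw [Measure.restrict_apply_univ]; exact tri_mu_lt hf ht⟩
  refine Integrable.of_bound (hc.aestronglyMeasurable (tri_meas t)) C ?_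
  filter_upwards [ae_restrict_mem (tri_meas t)] with x hx using hC x hx

theorem gg_int (hf : 𝒯.Fine γ h) {v w : E3 → ℝ} (hv : Tr.IsVh v) (hw : Tr.IsVh w) (ht : t ∈ Tr.T) :
    IntegrableOn (fun x => ⟪gradTri t v x, gradTri t w x⟫ + v x * w x) (triOf t) μH[2] := by
  apply tri_cont_int hf ht
  obtain ⟨y, hy, -⟩ := Tr.tri_disk ht
  have hs : triOf t ⊆ Tr.Sh := fun x hx => tri_Sh ht hx
  refine ContinuousOn.add ?_ ((hv.1.mono hs).mul (hw.1.mono hs))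
  refine (continuousOn_const (c := ⟪gradTri t v y, gradTri t w y⟫)).congr fun x hx => ?_
  rw [grad_const hf hv ht hx hy, grad_const hf hw ht hx hy]

theorem F1 (hf : 𝒯.Fine γ h) {v V w W : E3 → ℝ} (hVW : 𝒯.MemW V) (hWW : 𝒯.MemW W) (hV : ∀ y ∈ Srf.S, V y = Tr.liftS v y) (hv : Tr.IsVh v)
    (hW : ∀ y ∈ Srf.S, W y = Tr.liftS w y) (hw : Tr.IsVh w) :
    |Tr.ahForm v w - 𝒯.aF V W| ≤ 7 * 𝒯.e0 γ h * (𝒯.N V * 𝒯.N W) := by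
  have h0 := e0_nonneg (𝒯 := 𝒯) (γ := γ) (h := h)
  have h80 : 𝒯.e0 γ h ≤ 1 / 80 := hf.eps
  unfold Triangulation.ahForm aF
  have hI := hVW.int_a hWW
  have hJ := hVW.int_gg hWW
  rw [int_sum hf Tr hI, ← Finset.sum_sub_distrib]
  have key : ∀ t ∈ Tr.T, |∫ x in triOf t, (⟪gradTri t v x, gradTri t w x⟫ + v x * w x) ∂μH[2]
      - ∫ y in 𝒯.A '' triOf t, (⟪𝒯.G V y, 𝒯.G W y⟫ + V y * W y) ∂μH[2]| ≤
      5 * 𝒯.e0 γ h * (∫ y in 𝒯.A '' triOf t, ‖𝒯.G V y‖ * ‖𝒯.G W y‖ ∂μH[2]) +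
      2 * 𝒯.e0 γ h * (∫ y in 𝒯.A '' triOf t, |⟪𝒯.G V y, 𝒯.G W y⟫ + V y * W y| ∂μH[2]) := by
    intro t ht
    obtain ⟨-, i1, c1⟩ := cmp_int hf ht hI
    obtain ⟨-, i2, c2⟩ := cmp_int hf ht hJ
    have h1 : |∫ x in triOf t, (⟪gradTri t v x, gradTri t w x⟫ + v x * w x) ∂μH[2]
      - ∫ x in triOf t, (⟪𝒯.G V (𝒯.A x), 𝒯.G W (𝒯.A x)⟫ + V (𝒯.A x) * W (𝒯.A x)) ∂μH[2]| ≤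
      4 * 𝒯.e0 γ h * ∫ x in triOf t, ‖𝒯.G V (𝒯.A x)‖ * ‖𝒯.G W (𝒯.A x)‖ ∂μH[2] := by
      rw [← integral_sub (gg_int hf hv hw ht) i1, ← integral_const_mul, ← Real.norm_eq_abs]
      refine norm_integral_le_of_norm_le (i2.const_mul _) ?_
      filter_upwards [good_ae Tr ht] with x hx
      exact pt_F1 hf hV hv hW hw ht hx
    have hn : 0 ≤ ∫ y in 𝒯.A '' triOf t, ‖𝒯.G V y‖ * ‖𝒯.G W y‖ ∂μH[2] := integral_nonneg fun y => by positivity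
    have hab : ∫ y in 𝒯.A '' triOf t, |‖𝒯.G V y‖ * ‖𝒯.G W y‖| ∂μH[2] = ∫ y in 𝒯.A '' triOf t, ‖𝒯.G V y‖ * ‖𝒯.G W y‖ ∂μH[2] :=
      integral_congr_ae (Filter.Eventually.of_forall fun y => abs_of_nonneg (by positivity))
    rw [hab] at c2
    have c3 := (abs_le.1 c2).2
    have c4 : ∫ x in triOf t, ‖𝒯.G V (𝒯.A x)‖ * ‖𝒯.G W (𝒯.A x)‖ ∂μH[2] ≤ 5 / 4 * ∫ y in 𝒯.A '' triOf t, ‖𝒯.G V y‖ * ‖𝒯.G W y‖ ∂μH[2] := by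
      nlinarith
    have c5 := mul_le_mul_of_nonneg_left c4 (by positivity : 0 ≤ 4 * 𝒯.e0 γ h)
    have := (abs_sub_le _ (∫ x in triOf t, (⟪𝒯.G V (𝒯.A x), 𝒯.G W (𝒯.A x)⟫ + V (𝒯.A x) * W (𝒯.A x)) ∂μH[2]) _).trans (add_le_add h1 c1)
    linarith
  refine (Finset.abs_sum_le_sum_abs _ _).trans ((Finset.sum_le_sum key).trans ?_)
  rw [Finset.sum_add_distrib, ← Finset.mul_sum, ← Finset.mul_sum, ← int_sum hf Tr hJ, ← int_sum hf Tr hI.abs]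
  have := mul_le_mul_of_nonneg_left (int_gg_le hVW hWW) (by positivity : 0 ≤ 5 * 𝒯.e0 γ h)
  have := mul_le_mul_of_nonneg_left (int_absq hVW hWW) (by positivity : 0 ≤ 2 * 𝒯.e0 γ h)
  linarith

theorem tri_mu_ge (hf : 𝒯.Fine γ h) (ht : t ∈ Tr.T) : (γ * h) ^ 2 ≤ (μH[2] : Measure E3).real (triOf t) := by
  obtain ⟨y, hy, hd⟩ := Tr.tri_disk ht
  have h1 := plane_lower (Tr.dir_finrank ht) (mul_nonneg hf.hγ.le hf.hh.le) hd
  exact (ENNReal.ofReal_le_iff_le_toReal (tri_mu_lt hf ht).ne).1 h1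

theorem inv_est (hf : 𝒯.Fine γ h) {v V : E3 → ℝ} (hVW : 𝒯.MemW V) (hV : ∀ y ∈ Srf.S, V y = Tr.liftS v y) (hv : Tr.IsVh v) :
    ∀ᵐ y ∂Srf.μ, ‖𝒯.G V y‖ ≤ 6 * 𝒯.N V / (γ * h) := by
  have hγ := hf.hγ
  have hh := hf.hh
  have h0 := e0_nonneg (𝒯 := 𝒯) (γ := γ) (h := h)
  have h80 : 𝒯.e0 γ h ≤ 1 / 80 := hf.eps
  filter_upwards [good_ae_S hf Tr] with y hy
  obtain ⟨t, ht, x, hx, rfl⟩ := hy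
  obtain ⟨-, h1, -⟩ := pt_grad hf hV hv ht hx
  obtain ⟨-, i2, c2⟩ := cmp_int hf ht hVW.int_g2
  have h2 : ‖gradTri t v x‖ ^ 2 * (μH[2] : Measure E3).real (triOf t) ≤ ∫ z in triOf t, 4 * ‖𝒯.G V (𝒯.A z)‖ ^ 2 ∂μH[2] := by
    have : ‖gradTri t v x‖ ^ 2 * (μH[2] : Measure E3).real (triOf t) = ∫ z in triOf t, ‖gradTri t v x‖ ^ 2 ∂μH[2] := by
      rw [setIntegral_const, smul_eq_mul, mul_comm]
    rw [this]
    refine integral_mono_ae ?_ (i2.const_mul 4) ?_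
    · exact tri_cont_int hf ht continuousOn_const
    · filter_upwards [good_ae Tr ht] with z hz
      have := (pt_grad hf hV hv ht hz).1
      rw [grad_const hf hv ht hx.1 hz.1]
      nlinarith [norm_nonneg (gradTri t v z)]
  rw [integral_const_mul] at h2
  have hab : ∫ y in 𝒯.A '' triOf t, |‖𝒯.G V y‖ ^ 2| ∂μH[2] = ∫ y in 𝒯.A '' triOf t, ‖𝒯.G V y‖ ^ 2 ∂μH[2] :=
    integral_congr_ae (Filter.Eventually.of_forall fun y => abs_of_nonneg (by positivity))
  rw [hab] at c2
  have h3 : ∫ y in 𝒯.A '' triOf t, ‖𝒯.G V y‖ ^ 2 ∂μH[2] ≤ 𝒯.N V ^ 2 := by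
    refine le_trans ?_ (int_g2_le hVW)
    exact setIntegral_mono_set hVW.int_g2 (Filter.Eventually.of_forall fun y => by positivity) (At_sub hf ht).eventuallyLE
  have h3' : 0 ≤ ∫ y in 𝒯.A '' triOf t, ‖𝒯.G V y‖ ^ 2 ∂μH[2] := integral_nonneg fun y => by positivity
  have c3 := (abs_le.1 c2).2
  have h4 := mul_le_mul_of_nonneg_left (tri_mu_ge hf ht) (sq_nonneg ‖gradTri t v x‖)
  have h5 : (‖gradTri t v x‖ * (γ * h)) ^ 2 ≤ (3 * 𝒯.N V) ^ 2 := by nlinarith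
  have h6 := abs_le_of_sq_le_sq' h5 (mul_nonneg (by norm_num) (N_nonneg V)) |>.2
  rw [le_div_iff₀ (by positivity)]
  nlinarith [mul_le_mul_of_nonneg_right h1 (by positivity : 0 ≤ γ * h)]

end Tube

end

section

theorem li_dual {E : Type*} [AddCommGroup E] [Module ℝ E] {ι : Type*} [Fintype ι] {u : ι → E} (hu : LinearIndependent ℝ u) (b : ι → ℝ) :
    ∃ L : E →ₗ[ℝ] ℝ, ∀ i, L (u i) = b i := by
  classical
  have hinj := linearIndependent_iff_injective_fintypeLinearCombination.1 hu
  obtain ⟨g, hg⟩ := LinearMap.exists_leftInverse_of_injective _ (LinearMap.ker_eq_bot.2 hinj)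
  refine ⟨(Fintype.linearCombination ℝ b).comp g, fun i => ?_⟩
  have h1 : g (u i) = Pi.single i 1 := by
    have := congrArg (fun f => f (Pi.single i 1)) hg
    simpa using this
  rw [LinearMap.comp_apply, h1]
  simp

namespace Tube
variable {Srf : SmoothSurface} {𝒯 : Tube Srf} {γ h : ℝ} {Tr : Triangulation Srf γ h} {t : E3 × E3 × E3}

theorem affine_ex (ht : t ∈ Tr.T) (p : E3 → ℝ) : ∃ (L : E3 →ₗ[ℝ] ℝ) (c : ℝ), ∀ v ∈ vertsOf t, p v = L v + c := by
  have h1 := (affineIndependent_iff_linearIndependent_vsub ℝ _ (0 : Fin 3)).1 (Tr.indep t ht)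
  obtain ⟨L, hL⟩ := li_dual h1 (fun i => p (![t.1, t.2.1, t.2.2] i) - p t.1)
  have a1 := hL ⟨1, by decide⟩
  have a2 := hL ⟨2, by decide⟩
  simp at a1 a2
  refine ⟨L, p t.1 - L t.1, ?_⟩
  intro v hv
  rcases hv with rfl | rfl | hv
  · ring
  · linarith
  · rw [Set.mem_singleton_iff.1 hv]; linarith

theorem affine_agree {L L' : E3 →ₗ[ℝ] ℝ} {c c' : ℝ} {v w x : E3} (hv : L v + c = L' v + c') (hw : L w + c = L' w + c')
    (hx : x ∈ segment ℝ v w) : L x + c = L' x + c' := by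
  obtain ⟨a, b, -, -, hab, rfl⟩ := hx
  simp only [map_add, map_smul, smul_eq_mul]
  have : b = 1 - a := by linarith
  subst this
  linear_combination a * hv + (1 - a) * hw

theorem interp_ex (Tr : Triangulation Srf γ h) (p : E3 → ℝ) : ∃ v, Tr.IsVh v ∧ ∀ t ∈ Tr.T, ∀ x ∈ vertsOf t, v x = p x := by
  classical
  have h1 : ∀ t : E3 × E3 × E3, ∃ (L : E3 →ₗ[ℝ] ℝ) (c : ℝ), t ∈ Tr.T → ∀ v ∈ vertsOf t, p v = L v + c := fun t => by
    by_cases ht : t ∈ Tr.T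
    · obtain ⟨L, c, hL⟩ := affine_ex ht p
      exact ⟨L, c, fun _ => hL⟩
    · exact ⟨0, 0, fun h => absurd h ht⟩
  choose L c hLc using h1
  have hag : ∀ t ∈ Tr.T, ∀ t' ∈ Tr.T, ∀ x, x ∈ triOf t → x ∈ triOf t' → L t x + c t = L t' x + c t' := by
    intro t ht t' ht' x hx hx'
    by_cases e : t = t'
    · rw [e]
    have hm : x ∈ triOf t ∩ triOf t' := ⟨hx, hx'⟩
    have hvv : ∀ v ∈ vertsOf t ∩ vertsOf t', L t v + c t = L t' v + c t' := fun v hv => by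
      rw [← hLc t ht v hv.1, hLc t' ht' v hv.2]
    rcases Tr.meet t ht t' ht' e with h | ⟨v, hv, h⟩ | ⟨v, w, -, hv, hw, h⟩
    · rw [h] at hm; exact absurd hm (Set.notMem_empty _)
    · rw [h] at hm; rw [Set.mem_singleton_iff.1 hm]; exact hvv v hv
    · rw [h] at hm; exact affine_agree (hvv v hv) (hvv w hw) hm
  let f : E3 → ℝ := fun x => if hx : ∃ t ∈ Tr.T, x ∈ triOf t then L hx.choose x + c hx.choose else 0
  have hfe : ∀ t ∈ Tr.T, ∀ x ∈ triOf t, f x = L t x + c t := by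
    intro t ht x hx
    have hx' : ∃ t ∈ Tr.T, x ∈ triOf t := ⟨t, ht, hx⟩
    have : f x = L hx'.choose x + c hx'.choose := dif_pos hx'
    rw [this]
    exact hag _ hx'.choose_spec.1 t ht x hx'.choose_spec.2 hx
  refine ⟨f, ⟨?_, fun t ht => ⟨L t, c t, hfe t ht⟩⟩, fun t ht x hx => ?_⟩
  · have e : Tr.Sh = ⋃ t : Tr.T, triOf t := by
      unfold Triangulation.Sh
      exact Set.biUnion_eq_iUnion _ _
    rw [e]
    apply LocallyFinite.continuousOn_iUnion (locallyFinite_of_finite _) (fun t => (tri_compact _).isClosed)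
    intro t
    have : Continuous fun x => L t x + c t := ((L t).continuous_of_finiteDimensional).add continuous_const
    exact this.continuousOn.congr fun x hx => hfe t t.2 x hx
  · rw [hfe t ht x (tri_verts t hx), hLc t ht x hx]

theorem interp_pt (hf : 𝒯.Fine γ h) (ht : t ∈ Tr.T) {p v P : E3 → ℝ} {κ : ℝ} (hκ : 0 ≤ κ) (hp : Differentiable ℝ p)
    (h1 : ∀ y ∈ 𝒯.A '' triOf t, ‖fderiv ℝ p y‖ ≤ κ)
    (h2 : ∀ y ∈ 𝒯.A '' triOf t, ∀ z ∈ 𝒯.A '' triOf t, ‖fderiv ℝ p y - fderiv ℝ p z‖ ≤ κ * ‖y - z‖)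
    (hv : Tr.IsVh v) (hvp : ∀ x ∈ vertsOf t, v x = p x) (hP : ∀ y ∈ Srf.S, P y = Tr.liftS v y) {x : E3} (hx : Good Tr t x) :
    ‖𝒯.G (fun y => p y - P y) (𝒯.A x)‖ ≤ 4 * 𝒯.L ^ 2 / γ * h * κ ∧ |p (𝒯.A x) - P (𝒯.A x)| ≤ 2 * 𝒯.L ^ 2 * h ^ 2 * κ := by
  obtain ⟨L, c, hL⟩ := hv.2 t ht
  let Lc : E3 →L[ℝ] ℝ := L.toContinuousLinearMap
  have hLpos := 𝒯.L_pos
  have hL1 := 𝒯.hL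
  have hγ := hf.hγ
  have hh := hf.hh
  obtain ⟨y₀, -, hy₀⟩ := Tr.tri_disk ht
  have hU := tri_U hf ht hx.1
  have hyS := 𝒯.A_mem hU
  have hq := int_lemma hf.hγ hf.hh (κ := 2 * κ * 𝒯.L ^ 2) (by positivity) (Tr.tri_dist ht) hy₀ (q := fun x => p (𝒯.A x) - (Lc x + c))
    (q' := fun x => (fderiv ℝ p (𝒯.A x)).comp (𝒯.D x) - Lc)
    (fun x _ => ((hp (𝒯.A x)).hasFDerivAt.comp x (𝒯.hasD x)).sub (Lc.hasFDerivAt.add_const c))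
    (by
      intro x hx y hy
      have e : ((fderiv ℝ p (𝒯.A x)).comp (𝒯.D x) - Lc) - ((fderiv ℝ p (𝒯.A y)).comp (𝒯.D y) - Lc) =
        (fderiv ℝ p (𝒯.A x) - fderiv ℝ p (𝒯.A y)).comp (𝒯.D x) + (fderiv ℝ p (𝒯.A y)).comp (𝒯.D x - 𝒯.D y) := by
        ext τ; simp
      rw [e]
      refine (norm_add_le _ _).trans ?_
      have a1 := (fderiv ℝ p (𝒯.A x) - fderiv ℝ p (𝒯.A y)).opNorm_comp_le (𝒯.D x)
      have a2 := (fderiv ℝ p (𝒯.A y)).opNorm_comp_le (𝒯.D x - 𝒯.D y)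
      have b1 := h2 _ ⟨x, hx, rfl⟩ _ ⟨y, hy, rfl⟩
      have b2 := h1 _ ⟨y, hy, rfl⟩
      have b3 : ‖𝒯.D x‖ ≤ 𝒯.L := 𝒯.D_norm x
      have b4 := 𝒯.D_lip x y
      have b5 := 𝒯.lip x y
      have c1 : ‖fderiv ℝ p (𝒯.A x) - fderiv ℝ p (𝒯.A y)‖ * ‖𝒯.D x‖ ≤ (κ * (𝒯.L * ‖x - y‖)) * 𝒯.L :=
        mul_le_mul (b1.trans (mul_le_mul_of_nonneg_left b5 hκ)) b3 (norm_nonneg _) (by positivity)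
      have c2 : ‖fderiv ℝ p (𝒯.A y)‖ * ‖𝒯.D x - 𝒯.D y‖ ≤ κ * (𝒯.L * ‖x - y‖) := mul_le_mul b2 b4 (norm_nonneg _) hκ
      have c3 : κ * (𝒯.L * ‖x - y‖) * 1 ≤ κ * (𝒯.L * ‖x - y‖) * 𝒯.L := mul_le_mul_of_nonneg_left hL1 (by positivity)
      nlinarith)
    (by
      intro z hz
      have e1 := hvp z hz
      have e2 := hL z (tri_verts t hz)
      have e3 : Lc z = L z := rfl
      rw [𝒯.fix (Tr.verts_on t ht hz), e3, ← e2, e1, sub_self]) x hx.1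
  obtain ⟨hd, hG⟩ := lift_diff hf hP ht hL hx
  have hdp : DifferentiableAt ℝ (p ∘ 𝒯.A) (𝒯.A x) := (hp _).comp _ (𝒯.hasD _).differentiableAt
  have hdd : DifferentiableAt ℝ ((fun y => p y - P y) ∘ 𝒯.A) (𝒯.A x) := hdp.sub hd
  have hT : 𝒯.G (fun y => p y - P y) (𝒯.A x) ∈ Srf.tangent (𝒯.A x) := by
    rw [← D_G hyS hdd]; exact 𝒯.D_mem_tangent hyS _
  constructor
  · obtain ⟨σ, hσ, hσe⟩ := B_surj hf ht hx.1 hT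
    have hσn := (B_norm hf ht hx.1 hσ).1
    have e1 : ⟪𝒯.G (fun y => p y - P y) (𝒯.A x), 𝒯.D x σ⟫ = ((fderiv ℝ p (𝒯.A x)).comp (𝒯.D x) - Lc) σ := by
      rw [G_sub hdp hd, inner_sub_left, hG σ hσ, G_of_diff hyS (hp _), 𝒯.D_comp hU]
      rfl
    rw [hσe, real_inner_self_eq_norm_sq] at e1
    have h3 := hq.2 σ hσ
    rw [← e1, Real.norm_eq_abs, abs_of_nonneg (by positivity)] at h3
    rw [hσe] at hσn
    rcases eq_or_lt_of_le (norm_nonneg (𝒯.G (fun y => p y - P y) (𝒯.A x))) with e0 | hpos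
    · rw [← e0]; positivity
    have h4 := mul_le_mul_of_nonneg_left hσn (by positivity : 0 ≤ 2 * κ * 𝒯.L ^ 2 / γ * h)
    have h5 : ‖𝒯.G (fun y => p y - P y) (𝒯.A x)‖ * ‖𝒯.G (fun y => p y - P y) (𝒯.A x)‖ ≤ (4 * 𝒯.L ^ 2 / γ * h * κ) * ‖𝒯.G (fun y => p y - P y) (𝒯.A x)‖ := by
      refine le_trans (le_of_eq ?_) ((h3.trans h4).trans (le_of_eq ?_)) <;> ring
    exact le_of_mul_le_mul_right h5 hpos
  · have h3 := hq.1
    rw [Real.norm_eq_abs] at h3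
    have e3 : Lc x = L x := rfl
    rw [hP _ hyS, lift_A hf v (tri_Sh ht hx.1), hL x hx.1]
    rw [e3] at h3
    linarith

/-- local derivative control structure -/
def HS (Srf : SmoothSurface) (R h : ℝ) (p H : E3 → ℝ) : Prop :=
  ∀ x₁ ∈ Srf.S, ∀ x ∈ closedBall x₁ (R * h), ‖fderiv ℝ p x‖ ≤ H x₁ ∧
    ∀ y ∈ closedBall x₁ (R * h), ‖fderiv ℝ p x - fderiv ℝ p y‖ ≤ H x₁ * ‖x - y‖

theorem interp_main (hf : 𝒯.Fine γ h) (Tr : Triangulation Srf γ h) {p H : E3 → ℝ} (hpW : 𝒯.MemW p) (hp : Differentiable ℝ p)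
    {R : ℝ} (hR : 𝒯.L ≤ R) (hS : HS Srf R h p H) (hH : ∀ x, 0 ≤ H x) (hHi : Integrable (fun x => H x ^ 2) Srf.μ) :
    ∃ v P, Tr.IsVh v ∧ 𝒯.MemW P ∧ (∀ y ∈ Srf.S, P y = Tr.liftS v y) ∧
      (∀ᵐ y ∂Srf.μ, ‖𝒯.G (fun y => p y - P y) y‖ ≤ 4 * 𝒯.L ^ 2 / γ * h * H y ∧ |p y - P y| ≤ 2 * 𝒯.L ^ 2 * h ^ 2 * H y) ∧
      𝒯.N (fun y => p y - P y) ^ 2 ≤ ((4 * 𝒯.L ^ 2 / γ) ^ 2 + (2 * 𝒯.L ^ 2) ^ 2) * h ^ 2 * ∫ x, H x ^ 2 ∂Srf.μ := by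
  obtain ⟨v, hv, hvp⟩ := interp_ex Tr p
  obtain ⟨P, hPW, hP⟩ := lift_memW hf hv
  have hγ := hf.hγ
  have hh := hf.hh
  have hLpos := 𝒯.L_pos
  have hh1 : h ≤ 1 := by have := hf.h_lt; have := 𝒯.hδ1; linarith
  have hpt : ∀ᵐ y ∂Srf.μ, ‖𝒯.G (fun y => p y - P y) y‖ ≤ 4 * 𝒯.L ^ 2 / γ * h * H y ∧ |p y - P y| ≤ 2 * 𝒯.L ^ 2 * h ^ 2 * H y := by
    filter_upwards [good_ae_S hf Tr] with y hy
    obtain ⟨t, ht, x, hx, rfl⟩ := hy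
    have hyS := 𝒯.A_mem (tri_U hf ht hx.1)
    have hb : ∀ y ∈ 𝒯.A '' triOf t, y ∈ closedBall (𝒯.A x) (R * h) := by
      rintro _ ⟨z, hz, rfl⟩
      rw [mem_closedBall, dist_eq_norm]
      exact (𝒯.lip z x).trans (mul_le_mul hR (Tr.tri_dist ht z hz x hx.1) (norm_nonneg _) (hLpos.le.trans hR))
    exact interp_pt hf ht (hH _) hp (fun y hy => (hS _ hyS y (hb y hy)).1) (fun y hy z hz => (hS _ hyS y (hb y hy)).2 z (hb z hz)) hv
      (hvp t ht) hP hx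
  refine ⟨v, P, hv, hPW, hP, hpt, ?_⟩
  rw [N_sq, aF_self, ← integral_const_mul]
  refine integral_mono_ae (hpW.sub hPW).int_e (hHi.const_mul _) ?_
  filter_upwards [hpt] with y hy
  have h1 : ‖𝒯.G (fun y => p y - P y) y‖ ^ 2 ≤ (4 * 𝒯.L ^ 2 / γ * h * H y) ^ 2 := by
    exact pow_le_pow_left₀ (norm_nonneg _) hy.1 2
  have h2 : (p y - P y) ^ 2 ≤ (2 * 𝒯.L ^ 2 * h * H y) ^ 2 := by
    rw [← sq_abs (p y - P y)]
    refine pow_le_pow_left₀ (abs_nonneg _) (hy.2.trans ?_) 2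
    have : h ^ 2 ≤ h := by nlinarith
    have := mul_le_mul_of_nonneg_left this (by have := hH y; positivity : 0 ≤ 2 * 𝒯.L ^ 2 * H y)
    nlinarith
  refine (add_le_add h1 h2).trans (le_of_eq ?_)
  ring

end Tube

end

section

namespace Tube
variable {Srf : SmoothSurface} {𝒯 : Tube Srf}

theorem null_pt (𝒯 : Tube Srf) {z : E3} (hz : z ∈ Srf.S) : ∀ᵐ x ∂Srf.μ, x ≠ z := by
  obtain ⟨C, hC, h⟩ := 𝒯.mu_ball
  have := h z hz 0 le_rfl
  rw [ae_iff]
  refine le_antisymm ((measure_mono ?_).trans (this.trans (by simp))) bot_le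
  intro x hx
  simp only [Set.mem_setOf_eq, not_not] at hx
  rw [hx]
  exact mem_closedBall_self le_rfl

theorem dyadic {C : ℝ} {z : E3} (hz : z ∈ Srf.S) (𝒯 : Tube Srf) (hC : ∀ x ∈ Srf.S, ∀ ρ, 0 ≤ ρ → Srf.μ (closedBall x ρ) ≤ ENNReal.ofReal (C * ρ ^ 2))
    {f : E3 → ℝ} (hfm : AEStronglyMeasurable f Srf.μ) (hf0 : ∀ x, 0 ≤ f x) {c ρ : ℕ → ℝ} (hρ : ∀ k, 0 ≤ ρ k) (hc : ∀ k, 0 ≤ c k) {a : ℝ} (ha : 0 ≤ a)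
    (hk : ∀ k, c k * (C * ρ k ^ 2) ≤ a * (1 / 2) ^ k)
    (hp : ∀ x, x ≠ z → f x ≤ 0 ∨ ∃ k, dist x z ≤ ρ k ∧ f x ≤ c k) : Integrable f Srf.μ ∧ ∫ x, f x ∂Srf.μ ≤ 2 * a := by
  have h1 : ∫⁻ x, ENNReal.ofReal (f x) ∂Srf.μ ≤ ENNReal.ofReal (2 * a) := by
    calc ∫⁻ x, ENNReal.ofReal (f x) ∂Srf.μ ≤ ∫⁻ x, ∑' k, (closedBall z (ρ k)).indicator (fun _ => ENNReal.ofReal (c k)) x ∂Srf.μ := by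
          refine lintegral_mono_ae ?_
          filter_upwards [null_pt 𝒯 hz] with x hx
          obtain h0 | ⟨k, h1, h2⟩ := hp x hx
          · rw [ENNReal.ofReal_of_nonpos h0]; exact bot_le
          refine le_trans ?_ (ENNReal.le_tsum k)
          rw [Set.indicator_of_mem (mem_closedBall.2 h1)]
          exact ENNReal.ofReal_le_ofReal h2
      _ = ∑' k, ENNReal.ofReal (c k) * Srf.μ (closedBall z (ρ k)) := by
          rw [lintegral_tsum fun k => (measurable_const.indicator measurableSet_closedBall).aemeasurable]
          congr 1
          ext k
          rw [lintegral_indicator_const measurableSet_closedBall]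
      _ ≤ ∑' k, ENNReal.ofReal (a * (1 / 2) ^ k) := by
          refine ENNReal.tsum_le_tsum fun k => ?_
          refine (mul_le_mul_right (hC z hz _ (hρ k)) _).trans ?_
          rw [← ENNReal.ofReal_mul (hc k)]
          exact ENNReal.ofReal_le_ofReal (hk k)
      _ = ENNReal.ofReal (2 * a) := by
          rw [← ENNReal.ofReal_tsum_of_nonneg (fun k => by positivity) (summable_geometric_two.mul_left a), tsum_mul_left, tsum_geometric_two, mul_comm]
  have h2 : Integrable f Srf.μ := by
    refine ⟨hfm, ?_⟩
    rw [hasFiniteIntegral_iff_ofReal (Filter.Eventually.of_forall hf0)]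
    exact h1.trans_lt ENNReal.ofReal_lt_top
  refine ⟨h2, ?_⟩
  rw [integral_eq_lintegral_of_nonneg_ae (Filter.Eventually.of_forall hf0) hfm]
  exact ENNReal.toReal_le_of_le_ofReal (by positivity) h1

/-- `1/d` restricted to a ball. -/
def invd (z : E3) (ρ : ℝ) (x : E3) : ℝ := if ‖x - z‖ ≤ ρ then 1 / ‖x - z‖ else 0

theorem invd_nonneg (z : E3) (ρ : ℝ) (x : E3) : 0 ≤ invd z ρ x := by
  unfold invd; split_ifs <;> positivity

theorem invd_meas (z : E3) (ρ : ℝ) : Measurable (invd z ρ) := by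
  unfold invd
  have h : Measurable fun x : E3 => ‖x - z‖ := (measurable_id.sub_const z).norm
  exact Measurable.ite (measurableSet_le h measurable_const) (measurable_const.div h) measurable_const

theorem invd_int (𝒯 : Tube Srf) : ∃ C > 0, ∀ z ∈ Srf.S, ∀ ρ, 0 < ρ → Integrable (invd z ρ) Srf.μ ∧ ∫ x, invd z ρ x ∂Srf.μ ≤ C * ρ := by
  obtain ⟨C, hC, h⟩ := 𝒯.mu_ball
  refine ⟨4 * C, by positivity, fun z hz ρ hρ => ?_⟩
  have := dyadic hz 𝒯 h (invd_meas z ρ).aestronglyMeasurable (invd_nonneg z ρ) (ρ := fun k => ρ * (1 / 2) ^ k) (c := fun k => 2 / ρ * 2 ^ k) (a := 2 * C * ρ)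
    (fun k => by positivity) (fun k => by positivity) (by positivity) (fun k => by
      refine le_of_eq ?_
      have : (2 : ℝ) ^ k * (1 / 2) ^ k = 1 := by rw [← mul_pow]; norm_num
      field_simp
      exact this) (fun x hx => by
      have hd : 0 < ‖x - z‖ := norm_pos_iff.2 (sub_ne_zero.2 hx)
      by_cases hle : ‖x - z‖ ≤ ρ
      · obtain ⟨k, hk1, hk2⟩ := exists_nat_pow_near_of_lt_one (x := ‖x - z‖ / ρ) (y := 1 / 2) (by positivity) ((div_le_one hρ).2 hle) (by norm_num) (by norm_num)
        refine Or.inr ⟨k, ?_, ?_⟩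
        · rw [dist_eq_norm]
          rw [div_le_iff₀ hρ] at hk2
          linarith
        · rw [invd, if_pos hle, div_le_iff₀ hd]
          rw [lt_div_iff₀ hρ] at hk1
          have : (2 : ℝ) ^ k * (1 / 2) ^ k = 1 := by rw [← mul_pow]; norm_num
          have e : (1 : ℝ) = 2 / ρ * 2 ^ k * ((1 / 2) ^ (k + 1) * ρ) := by
            rw [pow_succ]; field_simp; linarith
          calc (1 : ℝ) = 2 / ρ * 2 ^ k * ((1 / 2) ^ (k + 1) * ρ) := e
            _ ≤ _ := mul_le_mul_of_nonneg_left hk1.le (by positivity)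
      · exact Or.inl (by rw [invd, if_neg hle]))
  exact ⟨this.1, this.2.trans (by linarith)⟩

theorem quad_int (𝒯 : Tube Srf) : ∃ C > 0, ∀ z ∈ Srf.S, ∀ η, 0 < η → Integrable (fun x => (1 / (η ^ 2 + ‖x - z‖ ^ 2)) ^ 2) Srf.μ ∧ ∫ x, (1 / (η ^ 2 + ‖x - z‖ ^ 2)) ^ 2 ∂Srf.μ ≤ C / η ^ 2 := by
  obtain ⟨C, hC, h⟩ := 𝒯.mu_ball
  refine ⟨32 * C, by positivity, fun z hz η hη => ?_⟩
  have hm : Measurable fun x : E3 => ‖x - z‖ := (measurable_id.sub_const z).norm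
  have := dyadic hz 𝒯 h (f := fun x => (1 / (η ^ 2 + ‖x - z‖ ^ 2)) ^ 2) ((measurable_const.div (measurable_const.add (hm.pow_const 2))).pow_const 2).aestronglyMeasurable
    (fun x => by positivity) (ρ := fun k => η * 2 ^ k) (c := fun k => 16 / η ^ 4 * (1 / 16) ^ k) (a := 16 * C / η ^ 2)
    (fun k => by positivity) (fun k => by positivity) (by positivity) (fun k => by
      have e1 : ((2 : ℝ) ^ k) ^ 2 * (1 / 16) ^ k = (1 / 4) ^ k := by rw [← pow_mul, mul_comm k 2, pow_mul, ← mul_pow]; norm_num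
      have e2 : ((1 : ℝ) / 4) ^ k ≤ (1 / 2) ^ k := pow_le_pow_left₀ (by norm_num) (by norm_num) k
      calc 16 / η ^ 4 * (1 / 16) ^ k * (C * (η * 2 ^ k) ^ 2) = 16 * C / η ^ 2 * (((2 : ℝ) ^ k) ^ 2 * (1 / 16) ^ k) := by field_simp
        _ ≤ _ := by rw [e1]; exact mul_le_mul_of_nonneg_left e2 (by positivity)) (fun x hx => by
      right
      by_cases hle : ‖x - z‖ ≤ η
      · refine ⟨0, ?_, ?_⟩
        · rw [dist_eq_norm]; simpa using hle
        · have : 1 / (η ^ 2 + ‖x - z‖ ^ 2) ≤ 1 / η ^ 2 := one_div_le_one_div_of_le (by positivity) (by nlinarith [norm_nonneg (x - z)])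
          calc (1 / (η ^ 2 + ‖x - z‖ ^ 2)) ^ 2 ≤ (1 / η ^ 2) ^ 2 := pow_le_pow_left₀ (by positivity) this 2
            _ = 1 / η ^ 4 := by field_simp
            _ ≤ 16 / η ^ 4 * (1 / 16) ^ 0 := by rw [pow_zero, mul_one]; gcongr; norm_num
      · push Not at hle
        obtain ⟨k, hk1, hk2⟩ := exists_nat_pow_near (x := ‖x - z‖ / η) (y := 2) ((one_le_div hη).2 hle.le) (by norm_num)
        rw [le_div_iff₀ hη] at hk1
        rw [div_lt_iff₀ hη] at hk2
        refine ⟨k + 1, ?_, ?_⟩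
        · rw [dist_eq_norm]; linarith
        · have h0 : 0 < (2 : ℝ) ^ k * η := by positivity
          have : 1 / (η ^ 2 + ‖x - z‖ ^ 2) ≤ 1 / (2 ^ k * η) ^ 2 := one_div_le_one_div_of_le (by positivity) (by nlinarith [norm_nonneg (x - z)])
          have e : ((2 : ℝ) ^ k) ^ 4 * (1 / 16) ^ k = 1 := by rw [← pow_mul, mul_comm k 4, pow_mul, ← mul_pow]; norm_num
          calc (1 / (η ^ 2 + ‖x - z‖ ^ 2)) ^ 2 ≤ (1 / (2 ^ k * η) ^ 2) ^ 2 := pow_le_pow_left₀ (by positivity) this 2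
            _ = 16 / η ^ 4 * (1 / 16) ^ (k + 1) := by
              rw [pow_succ (1 / 16 : ℝ)]; field_simp; linarith)
  refine ⟨this.1, this.2.trans (le_of_eq (by ring))⟩

end Tube

end

section

namespace Tube
variable {Srf : SmoothSurface} {𝒯 : Tube Srf}

theorem rfn_eq (𝒯 : Tube Srf) {z : E3} (hz : z ∈ Srf.S) (x : E3) : Srf.rfn z x = ‖𝒯.D z (x - z)‖ := by
  rw [SmoothSurface.rfn, SmoothSurface.P0, add_sub_cancel_left, D_eq_proj 𝒯 hz]

theorem rfn_near (𝒯 : Tube Srf) {z x : E3} (hz : z ∈ Srf.S) (hx : x ∈ Srf.S) (hd : ‖x - z‖ ≤ 1 / (2 * 𝒯.L)) :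
    1 / 2 * ‖x - z‖ ≤ ‖𝒯.D z (x - z)‖ := by
  have hL := 𝒯.L_pos
  have h1 := normal_small 𝒯 (ν := Srf.n z) hx hz (x := z) (fun w => by
    rw [D_apply 𝒯 hz, inner_sub_right, real_inner_smul_right, real_inner_self_eq_norm_sq, Srf.n_unit z hz]; ring) hd (by simp; positivity)
  rw [Srf.n_unit z hz] at h1
  have e : x - z = 𝒯.D z (x - z) + ⟪Srf.n z, x - z⟫ • Srf.n z := by rw [D_apply 𝒯 hz]; abel
  have h2 : ‖x - z‖ ≤ ‖𝒯.D z (x - z)‖ + |⟪Srf.n z, x - z⟫| := by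
    conv_lhs => rw [e]
    refine (norm_add_le _ _).trans ?_
    rw [norm_smul, Srf.n_unit z hz, mul_one, Real.norm_eq_abs]
  have h3 : 𝒯.L * (1 / (2 * 𝒯.L)) * 1 * ‖x - z‖ = 1 / 2 * ‖x - z‖ := by field_simp
  linarith

theorem rfn_lower (𝒯 : Tube Srf) {r₁ : ℝ} (hr : Srf.IsGraphRadius r₁) : ∃ c > 0, c ≤ 1 ∧ ∀ z ∈ Srf.S, ∀ x ∈ Srf.S, ‖x - z‖ ≤ 2 * r₁ →
    c * ‖x - z‖ ≤ ‖𝒯.D z (x - z)‖ := by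
  obtain ⟨hr0, hr1, hinj⟩ := hr
  have hL := 𝒯.L_pos
  set K : Set (E3 × E3) := (Srf.S ×ˢ Srf.S) ∩ {p | 1 / (2 * 𝒯.L) ≤ ‖p.2 - p.1‖ ∧ ‖p.2 - p.1‖ ≤ 2 * r₁} with hK
  have hcn : Continuous fun p : E3 × E3 => ‖p.2 - p.1‖ := (continuous_snd.sub continuous_fst).norm
  have hKc : IsCompact K := (Srf.compact.prod Srf.compact).inter_right ((isClosed_le continuous_const hcn).inter (isClosed_le hcn continuous_const))
  have hf : Continuous fun p : E3 × E3 => ‖𝒯.D p.1 (p.2 - p.1)‖ := ((𝒯.D_cont.comp continuous_fst).clm_apply (continuous_snd.sub continuous_fst)).norm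
  have key : ∃ m > 0, ∀ p ∈ K, m ≤ ‖𝒯.D p.1 (p.2 - p.1)‖ := by
    by_cases hne : K.Nonempty
    · obtain ⟨p, hp, hmin⟩ := hKc.exists_isMinOn hne hf.continuousOn
      refine ⟨_, ?_, fun q hq => hmin hq⟩
      obtain ⟨⟨hp1, hp2⟩, hp3, hp4⟩ := hp
      have hz2 : p.1 ∈ closedBall p.1 (2 * r₁) := mem_closedBall_self (by linarith)
      have hne' : p.2 ≠ p.1 := by
        intro e
        rw [e, sub_self, norm_zero] at hp3
        have : 0 < 1 / (2 * 𝒯.L) := by positivity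
        linarith
      rw [gt_iff_lt, norm_pos_iff]
      intro h0
      apply hne'
      refine hinj p.1 hp1 ⟨hp2, by rw [mem_closedBall, dist_eq_norm]; exact hp4⟩ ⟨hp1, hz2⟩ ?_
      rw [SmoothSurface.P0, SmoothSurface.P0, D_eq_proj 𝒯 hp1, D_eq_proj 𝒯 hp1, h0, sub_self, map_zero]
    · exact ⟨1, one_pos, fun p hp => (hne ⟨p, hp⟩).elim⟩
  obtain ⟨m, hm, hmK⟩ := key
  refine ⟨min (1 / 2) (m / (2 * r₁)), by positivity, (min_le_left _ _).trans (by norm_num), fun z hz x hx hd => ?_⟩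
  by_cases hn : ‖x - z‖ ≤ 1 / (2 * 𝒯.L)
  · exact (mul_le_mul_of_nonneg_right (min_le_left _ _) (norm_nonneg _)).trans (rfn_near 𝒯 hz hx hn)
  · have := hmK (z, x) ⟨⟨hz, hx⟩, (not_le.1 hn).le, hd⟩
    calc _ ≤ m / (2 * r₁) * (2 * r₁) := mul_le_mul (min_le_right _ _) hd (norm_nonneg _) (by positivity)
      _ = m := by field_simp
      _ ≤ _ := this

/-- The regularized half-logarithm. -/
def mlog (η s : ℝ) : ℝ := Real.log η + ∫ t in (η ^ 2)..s, 1 / (2 * max t (η ^ 2))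

theorem mlog_deriv {η : ℝ} (hη : 0 < η) (s : ℝ) : HasDerivAt (mlog η) (1 / (2 * max s (η ^ 2))) s := by
  have hc : Continuous fun t : ℝ => 1 / (2 * max t (η ^ 2)) := by
    refine continuous_const.div (continuous_const.mul (continuous_id.max continuous_const)) fun t => ?_
    have : 0 < max t (η ^ 2) := lt_max_of_lt_right (by positivity)
    positivity
  exact (intervalIntegral.integral_hasDerivAt_right (hc.intervalIntegrable _ _) (hc.stronglyMeasurableAtFilter _ _) hc.continuousAt).const_add _

theorem mlog_ge {η r : ℝ} (hη : 0 < η) (h : η ≤ r) : mlog η (r ^ 2) = Real.log r := by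
  have hr : 0 < r := hη.trans_le h
  have hle : η ^ 2 ≤ r ^ 2 := by nlinarith
  rw [mlog]
  have : ∫ t in (η ^ 2)..(r ^ 2), 1 / (2 * max t (η ^ 2)) = ∫ t in (η ^ 2)..(r ^ 2), 1 / 2 * (1 / t) := by
    refine intervalIntegral.integral_congr fun t ht => ?_
    rw [Set.uIcc_of_le hle] at ht
    rw [max_eq_left ht.1]; ring
  rw [this, intervalIntegral.integral_const_mul, integral_one_div_of_pos (by positivity) (by positivity), Real.log_div (by positivity) (by positivity), Real.log_pow, Real.log_pow]
  push_cast; ring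

theorem mlog_lt {η s : ℝ} (hη : 0 < η) (h : s ≤ η ^ 2) : mlog η s = Real.log η + (s - η ^ 2) / (2 * η ^ 2) := by
  rw [mlog]
  have : ∫ t in (η ^ 2)..s, 1 / (2 * max t (η ^ 2)) = ∫ t in (η ^ 2)..s, 1 / (2 * η ^ 2) := by
    refine intervalIntegral.integral_congr fun t ht => ?_
    rw [Set.uIcc_of_ge h] at ht
    rw [max_eq_right ht.2]
  rw [this, intervalIntegral.integral_const]
  simp only [smul_eq_mul]; ring

theorem mlog_near {η r : ℝ} (hη : 0 < η) (hr : 0 ≤ r) : |mlog η (r ^ 2) - Real.log (max r η)| ≤ 1 / 2 := by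
  rcases le_total η r with h | h
  · rw [mlog_ge hη h, max_eq_left h, sub_self, abs_zero]; norm_num
  · have h2 : r ^ 2 ≤ η ^ 2 := by nlinarith
    rw [mlog_lt hη h2, max_eq_right h, add_sub_cancel_left, abs_le]
    have : 0 < 2 * η ^ 2 := by positivity
    constructor
    · rw [le_div_iff₀ this]; nlinarith
    · rw [div_le_iff₀ this]; nlinarith

theorem mlog_bound {η r : ℝ} (hη : 0 < η) (hr : 0 ≤ r) (ha : max r η ≤ 3) : |mlog η (r ^ 2)| ≤ 10 / max r η := by
  have h1 := mlog_near hη hr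
  set a := max r η
  have hpos : 0 < a := lt_max_of_lt_right hη
  have h2 : Real.log a ≤ 2 := (Real.log_le_sub_one_of_pos hpos).trans (by linarith)
  have h3 : -Real.log a ≤ 1 / a := by
    rw [← Real.log_inv, ← one_div]
    exact (Real.log_le_sub_one_of_pos (by positivity)).trans (by linarith)
  have h4 : 3 ≤ 9 / a := by rw [le_div_iff₀ hpos]; linarith
  have h5 : 10 / a = 1 / a + 9 / a := by ring
  have h6 : 0 < 1 / a := by positivity
  rw [abs_le] at h1 ⊢
  constructor <;> linarith [h1.1, h1.2]

/-- Truncated `v/|v|^2`. -/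
def gv (η : ℝ) (v : E3) : E3 := (1 / max ‖v‖ η ^ 2) • v

theorem gv_norm {η : ℝ} (hη : 0 < η) (v : E3) : ‖gv η v‖ ≤ 1 / max ‖v‖ η := by
  have hpos : 0 < max ‖v‖ η := lt_max_of_lt_right hη
  rw [gv, norm_smul, Real.norm_of_nonneg (by positivity), div_mul_eq_mul_div, one_mul, div_le_div_iff₀ (by positivity) hpos]
  nlinarith [le_max_left ‖v‖ η]

theorem gv_lip {η μ : ℝ} (hη : 0 < η) (hμ : 0 < μ) {v w : E3} (hv : μ ≤ max ‖v‖ η) (hw : μ ≤ max ‖w‖ η) :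
    ‖gv η v - gv η w‖ ≤ 3 / μ ^ 2 * ‖v - w‖ := by
  have hab : |max ‖w‖ η - max ‖v‖ η| ≤ ‖v - w‖ := by
    refine (abs_max_sub_max_le_abs _ _ _).trans ?_
    rw [norm_sub_rev]; exact abs_norm_sub_norm_le w v
  have hwb : ‖w‖ ≤ max ‖w‖ η := le_max_left _ _
  unfold gv
  set a := max ‖v‖ η
  set b := max ‖w‖ η
  have ha : 0 < a := hμ.trans_le hv
  have hb : 0 < b := hμ.trans_le hw
  have e : (1 / a ^ 2) • v - (1 / b ^ 2) • w = (1 / a ^ 2) • (v - w) + ((b - a) * (a + b) / (a ^ 2 * b ^ 2)) • w := by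
    have : (b - a) * (a + b) / (a ^ 2 * b ^ 2) = 1 / a ^ 2 - 1 / b ^ 2 := by field_simp; ring
    rw [this, smul_sub, sub_smul]; abel
  have h1 : 1 / a ^ 2 ≤ 1 / μ ^ 2 := one_div_le_one_div_of_le (by positivity) (by nlinarith)
  have h2 : 1 / (a * b) ≤ 1 / μ ^ 2 := one_div_le_one_div_of_le (by positivity) (by nlinarith)
  have h3 : ‖((b - a) * (a + b) / (a ^ 2 * b ^ 2)) • w‖ ≤ ‖v - w‖ * (1 / a ^ 2 + 1 / (a * b)) := by
    rw [norm_smul, Real.norm_eq_abs, abs_div, abs_mul, abs_of_pos (show 0 < a + b by positivity), abs_of_pos (show 0 < a ^ 2 * b ^ 2 by positivity)]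
    calc |b - a| * (a + b) / (a ^ 2 * b ^ 2) * ‖w‖ ≤ ‖v - w‖ * (a + b) / (a ^ 2 * b ^ 2) * b := by gcongr
      _ = _ := by field_simp; ring
  rw [e]
  refine (norm_add_le _ _).trans ?_
  rw [norm_smul, Real.norm_of_nonneg (by positivity)]
  have h0 := norm_nonneg (v - w)
  have e3 : 3 / μ ^ 2 * ‖v - w‖ = 1 / μ ^ 2 * ‖v - w‖ + ‖v - w‖ * (1 / μ ^ 2 + 1 / μ ^ 2) := by ring
  rw [e3]
  exact add_le_add (mul_le_mul_of_nonneg_right h1 h0) (h3.trans (mul_le_mul_of_nonneg_left (add_le_add h1 h2) h0))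

/-- Regularized logarithm of the projected distance. -/
def Mlog (𝒯 : Tube Srf) (z : E3) (η : ℝ) (x : E3) : ℝ := mlog η (‖𝒯.D z (x - z)‖ ^ 2)

theorem Mlog_hasFDeriv (𝒯 : Tube Srf) (z : E3) {η : ℝ} (hη : 0 < η) (x : E3) :
    HasFDerivAt (𝒯.Mlog z η) ((innerSL ℝ (gv η (𝒯.D z (x - z)))).comp (𝒯.D z)) x := by
  have h1 : HasFDerivAt (fun x => 𝒯.D z (x - z)) (𝒯.D z) x := ((𝒯.D z).hasFDerivAt).comp x ((hasFDerivAt_id x).sub_const z)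
  have h2 := (mlog_deriv hη (‖𝒯.D z (x - z)‖ ^ 2)).comp_hasFDerivAt x h1.norm_sq
  refine h2.congr_fderiv ?_
  have hm : max (‖𝒯.D z (x - z)‖ ^ 2) (η ^ 2) = max ‖𝒯.D z (x - z)‖ η ^ 2 := by
    rcases le_total ‖𝒯.D z (x - z)‖ η with h | h
    · rw [max_eq_right h, max_eq_right (by gcongr)]
    · rw [max_eq_left h, max_eq_left (by gcongr)]
  ext q
  simp only [hm, gv, ContinuousLinearMap.smul_apply, ContinuousLinearMap.comp_apply, innerSL_apply_apply, real_inner_smul_left, smul_eq_mul, nsmul_eq_mul]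
  push_cast
  have : 0 < max ‖𝒯.D z (x - z)‖ η := lt_max_of_lt_right hη
  field_simp

theorem clm_inner_norm (𝒯 : Tube Srf) {z : E3} (hz : z ∈ Srf.S) (v : E3) : ‖(innerSL ℝ v).comp (𝒯.D z)‖ ≤ ‖v‖ := by
  refine ContinuousLinearMap.opNorm_le_bound _ (norm_nonneg _) fun q => ?_
  rw [ContinuousLinearMap.comp_apply, innerSL_apply_apply]
  exact (norm_inner_le_norm _ _).trans (mul_le_mul_of_nonneg_left (D_proj_norm 𝒯 hz q) (norm_nonneg _))

theorem Mlog_d1 (𝒯 : Tube Srf) {z : E3} (hz : z ∈ Srf.S) {η : ℝ} (hη : 0 < η) (x : E3) :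
    ‖fderiv ℝ (𝒯.Mlog z η) x‖ ≤ 1 / max ‖𝒯.D z (x - z)‖ η := by
  rw [(Mlog_hasFDeriv 𝒯 z hη x).fderiv]
  exact (clm_inner_norm 𝒯 hz _).trans (gv_norm hη _)

theorem Mlog_d2 (𝒯 : Tube Srf) {z : E3} (hz : z ∈ Srf.S) {η μ : ℝ} (hη : 0 < η) (hμ : 0 < μ) {x y : E3}
    (hx : μ ≤ max ‖𝒯.D z (x - z)‖ η) (hy : μ ≤ max ‖𝒯.D z (y - z)‖ η) :
    ‖fderiv ℝ (𝒯.Mlog z η) x - fderiv ℝ (𝒯.Mlog z η) y‖ ≤ 3 / μ ^ 2 * ‖x - y‖ := by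
  rw [(Mlog_hasFDeriv 𝒯 z hη x).fderiv, (Mlog_hasFDeriv 𝒯 z hη y).fderiv, ← ContinuousLinearMap.sub_comp, ← map_sub]
  refine (clm_inner_norm 𝒯 hz _).trans ((gv_lip hη hμ hx hy).trans ?_)
  refine mul_le_mul_of_nonneg_left ?_ (by positivity)
  rw [← map_sub, sub_sub_sub_cancel_right]
  exact D_proj_norm 𝒯 hz _

end Tube

end

section

namespace Tube
variable {Srf : SmoothSurface} {𝒯 : Tube Srf}

/-- Regularized cut-off logarithm. -/
def lreg (𝒯 : Tube Srf) (z : E3) (ζ : E3 → ℝ) (η : ℝ) (x : E3) : ℝ := ζ x * 𝒯.Mlog z η x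

/-- The truncated projected distance. -/
def aa (𝒯 : Tube Srf) (z : E3) (η : ℝ) (x : E3) : ℝ := max ‖𝒯.D z (x - z)‖ η

theorem cutoff_diff {z : E3} {r₁ Cζ : ℝ} {ζ : E3 → ℝ} (hζ : IsCutoff z r₁ Cζ ζ) : Differentiable ℝ ζ :=
  hζ.1.differentiable (by simp)

theorem cutoff_bd {z : E3} {r₁ Cζ : ℝ} {ζ : E3 → ℝ} (hζ : IsCutoff z r₁ Cζ ζ) (x : E3) : |ζ x| ≤ Cζ ∧ ‖fderiv ℝ ζ x‖ ≤ Cζ := by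
  have := hζ.2.2.2 x
  have h1 := abs_nonneg (ζ x)
  have h2 := norm_nonneg (fderiv ℝ ζ x)
  have h3 := norm_nonneg (fderiv ℝ (fderiv ℝ ζ) x)
  constructor <;> linarith

theorem cutoff_lip {z : E3} {r₁ Cζ : ℝ} {ζ : E3 → ℝ} (hζ : IsCutoff z r₁ Cζ ζ) (x y : E3) :
    |ζ x - ζ y| ≤ Cζ * ‖x - y‖ ∧ ‖fderiv ℝ ζ x - fderiv ℝ ζ y‖ ≤ Cζ * ‖x - y‖ := by
  constructor
  · exact convex_univ.norm_image_sub_le_of_norm_fderiv_le (f := ζ) (fun w _ => cutoff_diff hζ w) (fun w _ => (cutoff_bd hζ w).2) (Set.mem_univ y) (Set.mem_univ x)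
  · have hd : Differentiable ℝ (fderiv ℝ ζ) := ((contDiff_infty.1 hζ.1 2).fderiv_right (m := 1) (by norm_num)).differentiable (by simp)
    refine convex_univ.norm_image_sub_le_of_norm_fderiv_le (f := fderiv ℝ ζ) (fun w _ => hd w) (fun w _ => ?_) (Set.mem_univ y) (Set.mem_univ x)
    have := hζ.2.2.2 w
    have h1 := abs_nonneg (ζ w)
    have h2 := norm_nonneg (fderiv ℝ ζ w)
    linarith

theorem cutoff_off {z : E3} {r₁ Cζ : ℝ} {ζ : E3 → ℝ} (hζ : IsCutoff z r₁ Cζ ζ) {x : E3} (hx : 3 / 2 * r₁ < ‖x - z‖) : x ∉ tsupport ζ := by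
  intro h
  have := hζ.2.1 h
  rw [mem_closedBall, dist_eq_norm] at this
  linarith

theorem Mlog_diff (𝒯 : Tube Srf) (z : E3) {η : ℝ} (hη : 0 < η) : Differentiable ℝ (𝒯.Mlog z η) :=
  fun x => (Mlog_hasFDeriv 𝒯 z hη x).differentiableAt

theorem lreg_diff {z : E3} {r₁ Cζ : ℝ} {ζ : E3 → ℝ} (hζ : IsCutoff z r₁ Cζ ζ) (𝒯 : Tube Srf) {η : ℝ} (hη : 0 < η) : Differentiable ℝ (𝒯.lreg z ζ η) :=
  (cutoff_diff hζ).mul (Mlog_diff 𝒯 z hη)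

theorem lreg_fderiv {z : E3} {r₁ Cζ : ℝ} {ζ : E3 → ℝ} (hζ : IsCutoff z r₁ Cζ ζ) (𝒯 : Tube Srf) {η : ℝ} (hη : 0 < η) (x : E3) :
    fderiv ℝ (𝒯.lreg z ζ η) x = ζ x • fderiv ℝ (𝒯.Mlog z η) x + 𝒯.Mlog z η x • fderiv ℝ ζ x :=
  ((cutoff_diff hζ x).hasFDerivAt.mul (Mlog_diff 𝒯 z hη x).hasFDerivAt).fderiv

theorem lreg_off {z : E3} {r₁ Cζ : ℝ} {ζ : E3 → ℝ} (hζ : IsCutoff z r₁ Cζ ζ) (𝒯 : Tube Srf) {η : ℝ} (hη : 0 < η) {x : E3} (hx : 3 / 2 * r₁ < ‖x - z‖) :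
    fderiv ℝ (𝒯.lreg z ζ η) x = 0 := by
  have := cutoff_off hζ hx
  rw [lreg_fderiv hζ 𝒯 hη, image_eq_zero_of_notMem_tsupport this, fderiv_of_notMem_tsupport ℝ this, zero_smul, smul_zero, add_zero]

theorem aa_le {z : E3} (hz : z ∈ Srf.S) {η : ℝ} {x : E3} (h1 : ‖x - z‖ ≤ 3) (h2 : η ≤ 3) : 𝒯.aa z η x ≤ 3 :=
  max_le ((D_proj_norm 𝒯 hz _).trans h1) h2

theorem lreg_d1 {z : E3} (hz : z ∈ Srf.S) {r₁ Cζ : ℝ} (hC : 0 < Cζ) {ζ : E3 → ℝ} (hζ : IsCutoff z r₁ Cζ ζ) {η μ : ℝ} (hη : 0 < η) (hμ : 0 < μ) {x : E3}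
    (h1 : μ ≤ 𝒯.aa z η x) (h2 : 𝒯.aa z η x ≤ 3) : ‖fderiv ℝ (𝒯.lreg z ζ η) x‖ ≤ 11 * Cζ / μ ∧ |𝒯.lreg z ζ η x| ≤ 10 * Cζ / μ ∧ |𝒯.Mlog z η x| ≤ 10 / μ ∧ ‖fderiv ℝ (𝒯.Mlog z η) x‖ ≤ 1 / μ := by
  have ha : 0 < 𝒯.aa z η x := hμ.trans_le h1
  have hM : |𝒯.Mlog z η x| ≤ 10 / μ := (mlog_bound hη (norm_nonneg _) h2).trans (div_le_div_of_nonneg_left (by norm_num) hμ h1)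
  have hM' : ‖fderiv ℝ (𝒯.Mlog z η) x‖ ≤ 1 / μ := (Mlog_d1 𝒯 hz hη x).trans (div_le_div_of_nonneg_left (by norm_num) hμ h1)
  obtain ⟨hz1, hz2⟩ := cutoff_bd hζ x
  refine ⟨?_, ?_, hM, hM'⟩
  · rw [lreg_fderiv hζ 𝒯 hη]
    refine (norm_add_le _ _).trans ?_
    rw [norm_smul, norm_smul, Real.norm_eq_abs, Real.norm_eq_abs]
    calc _ ≤ Cζ * (1 / μ) + 10 / μ * Cζ := by gcongr
      _ = _ := by ring
  · rw [lreg, abs_mul]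
    calc _ ≤ Cζ * (10 / μ) := by gcongr
      _ = _ := by ring

theorem lreg_d2 {z : E3} (hz : z ∈ Srf.S) {r₁ Cζ : ℝ} (hC : 0 < Cζ) {ζ : E3 → ℝ} (hζ : IsCutoff z r₁ Cζ ζ) {η μ : ℝ} (hη : 0 < η) (hμ : 0 < μ) {x₁ : E3} {ρ : ℝ}
    (h1 : ∀ x ∈ closedBall x₁ ρ, μ ≤ 𝒯.aa z η x ∧ 𝒯.aa z η x ≤ 3) {x y : E3} (hx : x ∈ closedBall x₁ ρ) (hy : y ∈ closedBall x₁ ρ) :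
    ‖fderiv ℝ (𝒯.lreg z ζ η) x‖ ≤ 39 * Cζ / μ ^ 2 ∧ ‖fderiv ℝ (𝒯.lreg z ζ η) x - fderiv ℝ (𝒯.lreg z ζ η) y‖ ≤ 39 * Cζ / μ ^ 2 * ‖x - y‖ := by
  obtain ⟨hx1, hx2⟩ := h1 x hx
  obtain ⟨hy1, hy2⟩ := h1 y hy
  have hμ3 : μ ≤ 3 := hx1.trans hx2
  have hμ' : 1 / μ ≤ 3 / μ ^ 2 := by rw [div_le_div_iff₀ hμ (by positivity)]; nlinarith
  obtain ⟨a1, -, a3, a4⟩ := lreg_d1 hz hC hζ hη hμ hx1 hx2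
  obtain ⟨b1, -, b3, b4⟩ := lreg_d1 hz hC hζ hη hμ hy1 hy2
  obtain ⟨c1, c2⟩ := cutoff_bd hζ x
  obtain ⟨d1, d2⟩ := cutoff_bd hζ y
  obtain ⟨e1, e2⟩ := cutoff_lip hζ x y
  have hn := norm_nonneg (x - y)
  have hM : |𝒯.Mlog z η x - 𝒯.Mlog z η y| ≤ 1 / μ * ‖x - y‖ :=
    (convex_closedBall x₁ ρ).norm_image_sub_le_of_norm_fderiv_le (f := 𝒯.Mlog z η) (fun w _ => Mlog_diff 𝒯 z hη w)
      (fun w hw => (lreg_d1 hz hC hζ hη hμ (h1 w hw).1 (h1 w hw).2).2.2.2) hy hx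
  have hM2 := Mlog_d2 𝒯 hz hη hμ hx1 hy1
  constructor
  · refine a1.trans ?_
    calc 11 * Cζ / μ = 11 * Cζ * (1 / μ) := by ring
      _ ≤ 11 * Cζ * (3 / μ ^ 2) := by gcongr
      _ = 33 * Cζ / μ ^ 2 := by ring
      _ ≤ _ := by gcongr; norm_num
  · rw [lreg_fderiv hζ 𝒯 hη, lreg_fderiv hζ 𝒯 hη]
    have e : ζ x • fderiv ℝ (𝒯.Mlog z η) x + 𝒯.Mlog z η x • fderiv ℝ ζ x - (ζ y • fderiv ℝ (𝒯.Mlog z η) y + 𝒯.Mlog z η y • fderiv ℝ ζ y)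
        = (ζ x • (fderiv ℝ (𝒯.Mlog z η) x - fderiv ℝ (𝒯.Mlog z η) y) + (ζ x - ζ y) • fderiv ℝ (𝒯.Mlog z η) y)
          + (𝒯.Mlog z η x • (fderiv ℝ ζ x - fderiv ℝ ζ y) + (𝒯.Mlog z η x - 𝒯.Mlog z η y) • fderiv ℝ ζ y) := by module
    rw [e]
    refine (norm_add_le _ _).trans ((add_le_add (norm_add_le _ _) (norm_add_le _ _)).trans ?_)
    simp only [norm_smul, Real.norm_eq_abs]
    calc _ ≤ (Cζ * (3 / μ ^ 2 * ‖x - y‖) + Cζ * ‖x - y‖ * (1 / μ)) + (10 / μ * (Cζ * ‖x - y‖) + 1 / μ * ‖x - y‖ * Cζ) := by gcongr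
      _ = Cζ * ‖x - y‖ * (3 / μ ^ 2 + 12 * (1 / μ)) := by ring
      _ ≤ Cζ * ‖x - y‖ * (3 / μ ^ 2 + 12 * (3 / μ ^ 2)) := by gcongr
      _ = _ := by ring

theorem lreg_glob {z : E3} (hz : z ∈ Srf.S) {r₁ Cζ : ℝ} (hr : r₁ ≤ 1) (hC : 0 < Cζ) {ζ : E3 → ℝ} (hζ : IsCutoff z r₁ Cζ ζ) {η : ℝ} (hη : 0 < η) (hη1 : η ≤ 1) (x : E3) :
    ‖fderiv ℝ (𝒯.lreg z ζ η) x‖ ≤ 11 * Cζ / η ∧ |𝒯.lreg z ζ η x| ≤ 10 * Cζ / η := by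
  by_cases hx : 3 / 2 * r₁ < ‖x - z‖
  · rw [lreg_off hζ 𝒯 hη hx, lreg, image_eq_zero_of_notMem_tsupport (cutoff_off hζ hx), norm_zero, zero_mul, abs_zero]
    constructor <;> positivity
  · obtain ⟨h1, h2, -⟩ := lreg_d1 hz hC hζ hη hη (le_max_right ‖𝒯.D z (x - z)‖ η) (aa_le hz (by linarith) (by linarith))
    exact ⟨h1, h2⟩

theorem lreg_memW {z : E3} (hz : z ∈ Srf.S) {r₁ Cζ : ℝ} (hr : r₁ ≤ 1) (hC : 0 < Cζ) {ζ : E3 → ℝ} (hζ : IsCutoff z r₁ Cζ ζ) {η : ℝ} (hη : 0 < η) (hη1 : η ≤ 1) :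
    𝒯.MemW (𝒯.lreg z ζ η) := by
  refine MemW.of_C1 (K := (11 * Cζ / η).toNNReal) (lipschitzWith_of_nnnorm_fderiv_le (𝕜 := ℝ) (lreg_diff hζ 𝒯 hη) fun x => ?_) (lreg_diff hζ 𝒯 hη)
  rw [← NNReal.coe_le_coe, Real.coe_toNNReal _ (by positivity), coe_nnnorm]
  exact (lreg_glob hz hr hC hζ hη hη1 x).1

theorem G_le_fderiv {w : E3 → ℝ} {x : E3} (hx : x ∈ Srf.S) (hw : DifferentiableAt ℝ w x) : ‖𝒯.G w x‖ ≤ ‖fderiv ℝ w x‖ := by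
  have h := G_of_diff (𝒯 := 𝒯) hx hw (𝒯.G w x)
  rw [real_inner_self_eq_norm_sq] at h
  have h1 : fderiv ℝ w x (𝒯.D x (𝒯.G w x)) ≤ ‖fderiv ℝ w x‖ * ‖𝒯.G w x‖ :=
    (Real.le_norm_self _).trans (((fderiv ℝ w x).le_opNorm _).trans (mul_le_mul_of_nonneg_left (D_proj_norm 𝒯 hx _) (norm_nonneg _)))
  by_contra hc
  push Not at hc
  nlinarith [norm_nonneg (fderiv ℝ w x)]

theorem N_le_sup (𝒯 : Tube Srf) {w : E3 → ℝ} {K : ℝ} (hK : 0 ≤ K) (h : ∀ᵐ x ∂Srf.μ, ‖𝒯.G w x‖ ≤ K ∧ |w x| ≤ K) :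
    𝒯.N w ≤ √(2 * Srf.μ.real Set.univ) * K := by
  have := 𝒯.finite_μ
  have h1 : 𝒯.aF w w ≤ 2 * Srf.μ.real Set.univ * K ^ 2 := by
    refine (Real.le_norm_self _).trans ((norm_integral_le_of_norm_le_const (C := 2 * K ^ 2) ?_).trans (le_of_eq (by ring)))
    filter_upwards [h] with x ⟨hx1, hx2⟩
    rw [real_inner_self_eq_norm_sq, Real.norm_of_nonneg (add_nonneg (sq_nonneg _) (mul_self_nonneg _)), ← sq, ← sq_abs (w x)]
    nlinarith [norm_nonneg (𝒯.G w x), abs_nonneg (w x)]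
  rw [N]
  refine (Real.sqrt_le_sqrt h1).trans ?_
  rw [Real.sqrt_mul (mul_nonneg (by norm_num) measureReal_nonneg), Real.sqrt_sq hK]

theorem lreg_HS {z : E3} (hz : z ∈ Srf.S) {r₁ Cζ c R : ℝ} (hr0 : 0 < r₁) (hr : r₁ ≤ 1) (hC : 0 < Cζ) {ζ : E3 → ℝ} (hζ : IsCutoff z r₁ Cζ ζ)
    (hc : 0 < c) (hc1 : c ≤ 1) (hlow : ∀ x ∈ Srf.S, ‖x - z‖ ≤ 2 * r₁ → c * ‖x - z‖ ≤ ‖𝒯.D z (x - z)‖) (hR : 0 ≤ R)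
    {η : ℝ} (hη : 0 < η) (hη1 : η ≤ 1) (hηR : R * η ≤ r₁ / 2) :
    HS Srf R η (𝒯.lreg z ζ η) (fun x => (39 * Cζ * (2 + R) ^ 2 / c ^ 2) / (η ^ 2 + ‖x - z‖ ^ 2)) := by
  intro x₁ hx₁
  have tri : ∀ x ∈ closedBall x₁ (R * η), ‖x - x₁‖ ≤ R * η := fun x hx => by rwa [mem_closedBall, dist_eq_norm] at hx
  by_cases hfar : 3 / 2 * r₁ + R * η < ‖x₁ - z‖
  · have hz0 : ∀ x ∈ closedBall x₁ (R * η), fderiv ℝ (𝒯.lreg z ζ η) x = 0 := fun x hx => by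
      apply lreg_off hζ 𝒯 hη
      have := tri x hx
      have h2 : ‖x₁ - z‖ ≤ ‖x - x₁‖ + ‖x - z‖ := by
        rw [norm_sub_rev x x₁]; exact norm_sub_le_norm_sub_add_norm_sub _ _ _
      linarith
    intro x hx
    rw [hz0 x hx, norm_zero]
    refine ⟨by positivity, fun y hy => ?_⟩
    rw [hz0 y hy, sub_zero, norm_zero]
    positivity
  · push Not at hfar
    have hd2 : ‖x₁ - z‖ ≤ 2 * r₁ := by linarith
    have hl := hlow x₁ hx₁ hd2
    set d := ‖x₁ - z‖ with hd
    have hd0 : 0 ≤ d := norm_nonneg _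
    set μ := c * (η + d) / (2 + R) with hμd
    have hμ : 0 < μ := by positivity
    have h1 : ∀ x ∈ closedBall x₁ (R * η), μ ≤ 𝒯.aa z η x ∧ 𝒯.aa z η x ≤ 3 := fun x hx => by
      have hxx := tri x hx
      have hb : ‖𝒯.D z (x₁ - z)‖ ≤ R * η + ‖𝒯.D z (x - z)‖ := by
        have e : x₁ - z = (x₁ - x) + (x - z) := by abel
        rw [e, map_add]
        refine (norm_add_le _ _).trans (add_le_add ((D_proj_norm 𝒯 hz _).trans ?_) le_rfl)
        rwa [norm_sub_rev]
      constructor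
      · rw [hμd, div_le_iff₀ (by positivity)]
        have a1 : ‖𝒯.D z (x - z)‖ ≤ 𝒯.aa z η x := le_max_left _ _
        have a2 : η ≤ 𝒯.aa z η x := le_max_right _ _
        nlinarith
      · refine aa_le hz ?_ (by linarith)
        have : ‖x - z‖ ≤ ‖x - x₁‖ + d := norm_sub_le_norm_sub_add_norm_sub _ _ _
        linarith
    have hH : 39 * Cζ / μ ^ 2 ≤ (39 * Cζ * (2 + R) ^ 2 / c ^ 2) / (η ^ 2 + d ^ 2) := by
      have : 39 * Cζ / μ ^ 2 = (39 * Cζ * (2 + R) ^ 2 / c ^ 2) / (η + d) ^ 2 := by rw [hμd]; field_simp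
      rw [this]
      refine div_le_div_of_nonneg_left (by positivity) (by positivity) (by nlinarith)
    intro x hx
    refine ⟨(lreg_d2 hz hC hζ hη hμ h1 hx hx).1.trans hH, fun y hy => (lreg_d2 hz hC hζ hη hμ h1 hx hy).2.trans ?_⟩
    exact mul_le_mul_of_nonneg_right hH (norm_nonneg _)

end Tube

end

section
open scoped Topology

namespace Tube
variable {Srf : SmoothSurface} {𝒯 : Tube Srf}

theorem rfn_cont (𝒯 : Tube Srf) (z : E3) : Continuous fun x => ‖𝒯.D z (x - z)‖ :=
  ((𝒯.D z).continuous.comp (continuous_id.sub continuous_const)).norm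

theorem cut_ev {z : E3} (hz : z ∈ Srf.S) (𝒯 : Tube Srf) (ζ : E3 → ℝ) {η : ℝ} (hη : 0 < η) {x : E3} (hx : η < ‖𝒯.D z (x - z)‖) :
    cutLog Srf z ζ =ᶠ[𝓝 x] 𝒯.lreg z ζ η := by
  filter_upwards [(rfn_cont 𝒯 z).continuousAt.eventually (lt_mem_nhds hx)] with y hy
  rw [cutLog, lreg, Mlog, mlog_ge hη hy.le, rfn_eq 𝒯 hz]

theorem cut_meas {z : E3} (hz : z ∈ Srf.S) (𝒯 : Tube Srf) {r₁ Cζ : ℝ} {ζ : E3 → ℝ} (hζ : IsCutoff z r₁ Cζ ζ) : Measurable (cutLog Srf z ζ) := by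
  have e : cutLog Srf z ζ = fun x => ζ x * Real.log ‖𝒯.D z (x - z)‖ := by
    ext x; rw [cutLog, rfn_eq 𝒯 hz]
  rw [e]
  exact (cutoff_diff hζ).continuous.measurable.mul (Real.measurable_log.comp (rfn_cont 𝒯 z).measurable)

theorem log_half {t : ℝ} (ht : 1 ≤ t) : Real.log t + 1 / 2 ≤ t ∧ (Real.log t + 1 / 2) ^ 2 ≤ 4 * t := by
  have h0 : 0 < t := by linarith
  have hl0 : 0 ≤ Real.log t := Real.log_nonneg ht
  have h1 := Real.log_le_sub_one_of_pos h0
  have h2 := Real.log_le_sub_one_of_pos (Real.sqrt_pos.2 h0)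
  rw [Real.log_sqrt h0.le] at h2
  have h3 := Real.sq_sqrt h0.le
  have h4 := Real.sqrt_nonneg t
  refine ⟨by linarith, ?_⟩
  have h5 : Real.log t + 1 / 2 ≤ 2 * √t := by linarith
  calc (Real.log t + 1 / 2) ^ 2 ≤ (2 * √t) ^ 2 := pow_le_pow_left₀ (by linarith) h5 2
    _ = 4 * t := by rw [mul_pow, h3]; norm_num

theorem cut_pt {z : E3} (hz : z ∈ Srf.S) {r₁ Cζ c : ℝ} (hr : r₁ ≤ 1) (hr0 : 0 < r₁) (hC : 0 < Cζ) {ζ : E3 → ℝ} (hζ : IsCutoff z r₁ Cζ ζ)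
    (hc : 0 < c) (hlow : ∀ x ∈ Srf.S, ‖x - z‖ ≤ 2 * r₁ → c * ‖x - z‖ ≤ ‖𝒯.D z (x - z)‖)
    {η : ℝ} (hη : 0 < η) (hη1 : η ≤ 1) {x : E3} (hx : x ∈ Srf.S) (hxz : x ≠ z) :
    DifferentiableAt ℝ (cutLog Srf z ζ) x ∧ ‖fderiv ℝ (cutLog Srf z ζ) x - fderiv ℝ (𝒯.lreg z ζ η) x‖ ≤ 22 * Cζ / c * invd z (η / c) x ∧
    |cutLog Srf z ζ x - 𝒯.lreg z ζ η x| ≤ Cζ / c * η * invd z (η / c) x ∧ (cutLog Srf z ζ x - 𝒯.lreg z ζ η x) ^ 2 ≤ 4 * Cζ ^ 2 / c * η * invd z (η / c) x := by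
  have hd : 0 < ‖x - z‖ := norm_pos_iff.2 (sub_ne_zero.2 hxz)
  have hi := invd_nonneg z (η / c) x
  have triv : cutLog Srf z ζ =ᶠ[𝓝 x] 𝒯.lreg z ζ η → DifferentiableAt ℝ (cutLog Srf z ζ) x ∧ ‖fderiv ℝ (cutLog Srf z ζ) x - fderiv ℝ (𝒯.lreg z ζ η) x‖ ≤ 22 * Cζ / c * invd z (η / c) x ∧
    |cutLog Srf z ζ x - 𝒯.lreg z ζ η x| ≤ Cζ / c * η * invd z (η / c) x ∧ (cutLog Srf z ζ x - 𝒯.lreg z ζ η x) ^ 2 ≤ 4 * Cζ ^ 2 / c * η * invd z (η / c) x := by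
    intro he
    refine ⟨(lreg_diff hζ 𝒯 hη x).congr_of_eventuallyEq he, ?_, ?_, ?_⟩
    · rw [he.fderiv_eq, sub_self, norm_zero]; positivity
    · rw [he.eq_of_nhds, sub_self, abs_zero]; positivity
    · rw [he.eq_of_nhds, sub_self]; simp only [ne_eq, OfNat.ofNat_ne_zero, not_false_eq_true, zero_pow]; positivity
  by_cases hfar : 3 / 2 * r₁ < ‖x - z‖
  · apply triv
    have := notMem_tsupport_iff_eventuallyEq.1 (cutoff_off hζ hfar)
    filter_upwards [this] with y hy
    rw [cutLog, lreg, hy, Pi.zero_apply, zero_mul, zero_mul]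
  push Not at hfar
  have hl := hlow x hx (by linarith)
  have hrpos : 0 < ‖𝒯.D z (x - z)‖ := lt_of_lt_of_le (by positivity) hl
  by_cases hrη : η < ‖𝒯.D z (x - z)‖
  · exact triv (cut_ev hz 𝒯 ζ hη hrη)
  push Not at hrη
  set r := ‖𝒯.D z (x - z)‖ with hrd
  have hdc : ‖x - z‖ ≤ η / c := by rw [le_div_iff₀ hc]; linarith
  have hinv : 1 / r ≤ 1 / c * invd z (η / c) x := by
    rw [invd, if_pos hdc, one_div_mul_one_div]
    exact one_div_le_one_div_of_le (by positivity) hl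
  have hev := cut_ev hz 𝒯 ζ (η := r / 2) (by positivity) (x := x) (by rw [← hrd]; linarith)
  have hr3 : r ≤ 3 := hrη.trans (by linarith)
  have g1 : ‖fderiv ℝ (cutLog Srf z ζ) x‖ ≤ 11 * Cζ / r := by
    rw [hev.fderiv_eq]
    refine (lreg_d1 hz hC hζ (by positivity) hrpos ?_ ?_).1
    · exact le_max_left _ _
    · exact max_le hr3 (by linarith)
  have g2 : ‖fderiv ℝ (𝒯.lreg z ζ η) x‖ ≤ 11 * Cζ / r := (lreg_glob hz hr hC hζ hη hη1 x).1.trans (div_le_div_of_nonneg_left (by positivity) hrpos hrη)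
  have t1 : 1 ≤ η / r := (one_le_div hrpos).2 hrη
  obtain ⟨q1, q2⟩ := log_half t1
  have hM : |Real.log r - 𝒯.Mlog z η x| ≤ Real.log (η / r) + 1 / 2 := by
    have h1 := mlog_near hη hrpos.le
    rw [max_eq_right hrη] at h1
    have h2 : 𝒯.Mlog z η x = mlog η (r ^ 2) := rfl
    have h3 := Real.log_nonneg t1
    rw [Real.log_div hη.ne' hrpos.ne'] at h3 ⊢
    rw [abs_le] at h1 ⊢
    rw [h2]
    constructor <;> linarith [h1.1, h1.2]
  have hval : |cutLog Srf z ζ x - 𝒯.lreg z ζ η x| ≤ Cζ * (Real.log (η / r) + 1 / 2) := by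
    rw [cutLog, lreg, rfn_eq 𝒯 hz, ← mul_sub, abs_mul]
    exact mul_le_mul (cutoff_bd hζ x).1 hM (abs_nonneg _) hC.le
  refine ⟨(lreg_diff hζ 𝒯 (by positivity) x).congr_of_eventuallyEq hev, ?_, ?_, ?_⟩
  · refine (norm_sub_le _ _).trans ((add_le_add g1 g2).trans ?_)
    calc 11 * Cζ / r + 11 * Cζ / r = 22 * Cζ * (1 / r) := by ring
      _ ≤ 22 * Cζ * (1 / c * invd z (η / c) x) := by gcongr
      _ = _ := by ring
  · calc _ ≤ Cζ * (η / r) := hval.trans (by gcongr)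
      _ = Cζ * η * (1 / r) := by ring
      _ ≤ Cζ * η * (1 / c * invd z (η / c) x) := by gcongr
      _ = _ := by ring
  · rw [← sq_abs]
    calc _ ≤ (Cζ * (Real.log (η / r) + 1 / 2)) ^ 2 := pow_le_pow_left₀ (abs_nonneg _) hval 2
      _ = Cζ ^ 2 * (Real.log (η / r) + 1 / 2) ^ 2 := by ring
      _ ≤ Cζ ^ 2 * (4 * (η / r)) := by gcongr
      _ = 4 * Cζ ^ 2 * η * (1 / r) := by ring
      _ ≤ 4 * Cζ ^ 2 * η * (1 / c * invd z (η / c) x) := by gcongr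
      _ = _ := by ring

/-- Collected properties of the regularized logarithm. -/
structure LogApp (𝒯 : Tube Srf) (z : E3) (ζ : E3 → ℝ) (R C η : ℝ) : Prop where
  diff : Differentiable ℝ (𝒯.lreg z ζ η)
  memW : 𝒯.MemW (𝒯.lreg z ζ η)
  hs : ∃ H : E3 → ℝ, (∀ x, 0 ≤ H x) ∧ HS Srf R η (𝒯.lreg z ζ η) H ∧ Integrable (fun x => H x ^ 2) Srf.μ ∧ ∫ x, H x ^ 2 ∂Srf.μ ≤ C / η ^ 2
  nb : 𝒯.N (𝒯.lreg z ζ η) ≤ C / η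
  cdiff : ∀ᵐ x ∂Srf.μ, DifferentiableAt ℝ (cutLog Srf z ζ ∘ 𝒯.A) x
  gi : Integrable (fun x => ‖𝒯.G (cutLog Srf z ζ) x - 𝒯.G (𝒯.lreg z ζ η) x‖) Srf.μ
  gb : ∫ x, ‖𝒯.G (cutLog Srf z ζ) x - 𝒯.G (𝒯.lreg z ζ η) x‖ ∂Srf.μ ≤ C * η
  supp : ∀ᵐ x ∂Srf.μ, C * η < ‖x - z‖ → 𝒯.G (cutLog Srf z ζ) x = 𝒯.G (𝒯.lreg z ζ η) x
  ai : Integrable (fun x => |cutLog Srf z ζ x - 𝒯.lreg z ζ η x|) Srf.μ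
  ab : ∫ x, |cutLog Srf z ζ x - 𝒯.lreg z ζ η x| ∂Srf.μ ≤ C * η ^ 2
  si : Integrable (fun x => (cutLog Srf z ζ x - 𝒯.lreg z ζ η x) ^ 2) Srf.μ
  sb : ∫ x, (cutLog Srf z ζ x - 𝒯.lreg z ζ η x) ^ 2 ∂Srf.μ ≤ C * η ^ 2

theorem dom_int {f g : E3 → ℝ} (hg : Integrable g Srf.μ) (hf : AEStronglyMeasurable f Srf.μ) (h0 : ∀ x, 0 ≤ f x) (h : ∀ᵐ x ∂Srf.μ, f x ≤ g x) :
    Integrable f Srf.μ ∧ ∫ x, f x ∂Srf.μ ≤ ∫ x, g x ∂Srf.μ := by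
  have hi : Integrable f Srf.μ := hg.mono' hf (by filter_upwards [h] with x hx; rwa [Real.norm_of_nonneg (h0 x)])
  exact ⟨hi, integral_mono_ae hi hg h⟩

theorem bar_diff {w : E3 → ℝ} {x : E3} (hx : x ∈ Srf.S) (hw : DifferentiableAt ℝ w x) : DifferentiableAt ℝ (w ∘ 𝒯.A) x := by
  refine DifferentiableAt.comp x ?_ (𝒯.hasD x).differentiableAt
  rwa [𝒯.fix hx]

theorem log_main (𝒯 : Tube Srf) {r₁ Cζ R : ℝ} (hr : Srf.IsGraphRadius r₁) (hC : 0 < Cζ) (hR : 0 ≤ R) : ∃ C > 0, ∃ h₁ > 0, ∀ z ∈ Srf.S, ∀ ζ, IsCutoff z r₁ Cζ ζ →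
    ∀ η, 0 < η → η ≤ h₁ → LogApp 𝒯 z ζ R C η := by
  obtain ⟨c, hc, hc1, hlow⟩ := rfn_lower 𝒯 hr
  obtain ⟨hr0, hr1, -⟩ := hr
  obtain ⟨C1, hC1, hinv⟩ := invd_int 𝒯
  obtain ⟨C2, hC2, hquad⟩ := quad_int 𝒯
  set Ch := 39 * Cζ * (2 + R) ^ 2 / c ^ 2 with hCh
  have hCh0 : 0 < Ch := by positivity
  set CN := √(2 * Srf.μ.real Set.univ) * (11 * Cζ) with hCN
  have hCN0 : 0 ≤ CN := by positivity
  set C := 1 / c + Ch + Ch ^ 2 * C2 + (CN + 22 * Cζ / c * (C1 / c) + Cζ / c * (C1 / c) + 4 * Cζ ^ 2 / c * (C1 / c)) with hCd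
  have p1 : 0 ≤ 22 * Cζ / c * (C1 / c) := by positivity
  have p2 : 0 ≤ Cζ / c * (C1 / c) := by positivity
  have p3 : 0 ≤ 4 * Cζ ^ 2 / c * (C1 / c) := by positivity
  have p4 : 0 ≤ Ch ^ 2 * C2 := by positivity
  have p5 : 0 < 1 / c := by positivity
  have hC0 : 0 < C := by positivity
  have hfin := 𝒯.finite_μ
  refine ⟨C, hC0, min 1 (r₁ / (2 * (R + 1))), by positivity, fun z hz ζ hζ η hη hηh => ?_⟩
  have hη1 : η ≤ 1 := hηh.trans (min_le_left _ _)
  have hηR : R * η ≤ r₁ / 2 := by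
    have h := hηh.trans (min_le_right _ _)
    rw [le_div_iff₀ (by positivity)] at h
    nlinarith
  have hηc : 0 < η / c := by positivity
  obtain ⟨hi1, hi2⟩ := hinv z hz (η / c) hηc
  have pt := fun {x : E3} (hx : x ∈ Srf.S) (hxz : x ≠ z) => cut_pt hz hr1 hr0 hC hζ hc (hlow z hz) hη hη1 hx hxz
  have hld := lreg_diff hζ 𝒯 hη
  have hcm := cut_meas hz 𝒯 hζ
  have hlm : Measurable (𝒯.lreg z ζ η) := hld.continuous.measurable
  have i1 := dom_int (hi1.const_mul (22 * Cζ / c)) (f := fun x => ‖𝒯.G (cutLog Srf z ζ) x - 𝒯.G (𝒯.lreg z ζ η) x‖)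
    ((G_measurable 𝒯 _).sub (G_measurable 𝒯 _)).norm.aestronglyMeasurable (fun x => norm_nonneg _) (by
      filter_upwards [ae_mem_S, null_pt 𝒯 hz] with x hx hxz
      obtain ⟨h1, h2, -⟩ := pt hx hxz
      rw [← G_sub (bar_diff hx h1) (bar_diff hx (hld x))]
      refine (G_le_fderiv hx (h1.sub (hld x))).trans ?_
      rwa [fderiv_sub h1 (hld x)])
  have i2 := dom_int (hi1.const_mul (Cζ / c * η)) (f := fun x => |cutLog Srf z ζ x - 𝒯.lreg z ζ η x|)
    (hcm.sub hlm).norm.aestronglyMeasurable (fun x => abs_nonneg _) (by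
      filter_upwards [ae_mem_S, null_pt 𝒯 hz] with x hx hxz using (pt hx hxz).2.2.1)
  have i3 := dom_int (hi1.const_mul (4 * Cζ ^ 2 / c * η)) (f := fun x => (cutLog Srf z ζ x - 𝒯.lreg z ζ η x) ^ 2)
    ((hcm.sub hlm).pow_const 2).aestronglyMeasurable (fun x => sq_nonneg _) (by
      filter_upwards [ae_mem_S, null_pt 𝒯 hz] with x hx hxz using (pt hx hxz).2.2.2)
  rw [integral_const_mul] at i1 i2 i3
  obtain ⟨q1, q2⟩ := hquad z hz η hη
  have eH : (fun x => (Ch / (η ^ 2 + ‖x - z‖ ^ 2)) ^ 2) = fun x => Ch ^ 2 * (1 / (η ^ 2 + ‖x - z‖ ^ 2)) ^ 2 := by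
    ext x; ring
  exact {
    diff := hld
    memW := lreg_memW hz hr1 hC hζ hη hη1
    hs := by
      refine ⟨_, fun x => ?_, lreg_HS hz hr0 hr1 hC hζ hc hc1 (hlow z hz) hR hη hη1 hηR, ?_, ?_⟩
      · positivity
      · simp only [← hCh, eH]
        exact q1.const_mul _
      · simp only [← hCh, eH]
        rw [integral_const_mul]
        calc _ ≤ Ch ^ 2 * (C2 / η ^ 2) := by gcongr
          _ = Ch ^ 2 * C2 / η ^ 2 := by ring
          _ ≤ C / η ^ 2 := by gcongr; linarith
    nb := by
      refine (N_le_sup 𝒯 (K := 11 * Cζ / η) (by positivity) ?_).trans ?_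
      · filter_upwards [ae_mem_S] with x hx
        obtain ⟨h1, h2⟩ := lreg_glob (𝒯 := 𝒯) hz hr1 hC hζ hη hη1 x
        refine ⟨(G_le_fderiv hx (hld x)).trans h1, h2.trans ?_⟩
        gcongr; norm_num
      · calc _ = CN / η := by rw [hCN]; ring
          _ ≤ _ := by gcongr; linarith
    cdiff := by
      filter_upwards [ae_mem_S, null_pt 𝒯 hz] with x hx hxz using bar_diff hx (pt hx hxz).1
    gi := i1.1
    gb := i1.2.trans (by
      calc _ ≤ 22 * Cζ / c * (C1 * (η / c)) := by gcongr
        _ = 22 * Cζ / c * (C1 / c) * η := by ring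
        _ ≤ _ := by gcongr; linarith)
    supp := by
      filter_upwards [ae_mem_S, null_pt 𝒯 hz] with x hx hxz hlt
      obtain ⟨h1, h2, -⟩ := pt hx hxz
      have hn : ¬ ‖x - z‖ ≤ η / c := by
        rw [not_le]
        refine lt_of_le_of_lt ?_ hlt
        calc η / c = 1 / c * η := by ring
          _ ≤ C * η := by gcongr; linarith
      rw [invd, if_neg hn, mul_zero] at h2
      rw [← sub_eq_zero, ← G_sub (bar_diff hx h1) (bar_diff hx (hld x)), ← norm_le_zero_iff]
      refine (G_le_fderiv hx (h1.sub (hld x))).trans ?_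
      rwa [fderiv_sub h1 (hld x)]
    ai := i2.1
    ab := i2.2.trans (by
      calc _ ≤ Cζ / c * η * (C1 * (η / c)) := by gcongr
        _ = Cζ / c * (C1 / c) * η ^ 2 := by ring
        _ ≤ _ := by gcongr; linarith)
    si := i3.1
    sb := i3.2.trans (by
      calc _ ≤ 4 * Cζ ^ 2 / c * η * (C1 * (η / c)) := by gcongr
        _ = 4 * Cζ ^ 2 / c * (C1 / c) * η ^ 2 := by ring
        _ ≤ _ := by gcongr; linarith) }

end Tube

end

section
open scoped Topology

namespace Tube
variable {Srf : SmoothSurface} {𝒯 : Tube Srf} {γ h : ℝ} {Tr : Triangulation Srf γ h}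

/-- Gradient error of the regularized logarithm. -/
def dG (𝒯 : Tube Srf) (z : E3) (ζ : E3 → ℝ) (η : ℝ) (x : E3) : E3 := 𝒯.G (cutLog Srf z ζ) x - 𝒯.G (𝒯.lreg z ζ η) x

/-- Value error of the regularized logarithm. -/
def dV (𝒯 : Tube Srf) (z : E3) (ζ : E3 → ℝ) (η : ℝ) (x : E3) : ℝ := cutLog Srf z ζ x - 𝒯.lreg z ζ η x

theorem dG_meas (𝒯 : Tube Srf) (z : E3) (ζ : E3 → ℝ) (η : ℝ) : Measurable (𝒯.dG z ζ η) := (G_measurable 𝒯 _).sub (G_measurable 𝒯 _)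

section
variable {z : E3} {ζ : E3 → ℝ} {R C η : ℝ}

theorem dG_int (hl : LogApp 𝒯 z ζ R C η) : Integrable (𝒯.dG z ζ η) Srf.μ :=
  (integrable_norm_iff (dG_meas 𝒯 z ζ η).aestronglyMeasurable).1 hl.gi

theorem dV_int (hl : LogApp 𝒯 z ζ R C η) (hm : Measurable (cutLog Srf z ζ)) : Integrable (𝒯.dV z ζ η) Srf.μ :=
  (integrable_norm_iff (hm.sub hl.diff.continuous.measurable).aestronglyMeasurable).1 hl.ai

/-- Pairing with a bounded field. -/
theorem pair_bd (hl : LogApp 𝒯 z ζ R C η) {X : E3 → E3} (hX : Measurable X) {K : ℝ} (hK : 0 ≤ K)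
    (hb : ∀ᵐ x ∂Srf.μ, ‖x - z‖ ≤ C * η → ‖X x‖ ≤ K) : Integrable (fun x => ⟪𝒯.dG z ζ η x, X x⟫) Srf.μ ∧ |∫ x, ⟪𝒯.dG z ζ η x, X x⟫ ∂Srf.μ| ≤ K * (C * η) := by
  have hp : ∀ᵐ x ∂Srf.μ, ‖⟪𝒯.dG z ζ η x, X x⟫‖ ≤ K * ‖𝒯.dG z ζ η x‖ := by
    filter_upwards [hl.supp, hb] with x h1 h2
    refine (norm_inner_le_norm _ _).trans ?_
    rw [mul_comm]
    by_cases hd : ‖x - z‖ ≤ C * η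
    · exact mul_le_mul_of_nonneg_right (h2 hd) (norm_nonneg _)
    · have : 𝒯.dG z ζ η x = 0 := by rw [dG, h1 (not_le.1 hd), sub_self]
      rw [this, norm_zero, mul_zero, mul_zero]
  have hi := hl.gi.const_mul K
  refine ⟨hi.mono' ((dG_meas 𝒯 z ζ η).inner hX).aestronglyMeasurable hp, ?_⟩
  refine (norm_integral_le_of_norm_le hi hp).trans ?_
  rw [integral_const_mul]
  exact mul_le_mul_of_nonneg_left hl.gb hK

theorem pair_W (hl : LogApp 𝒯 z ζ R C η) {w : E3 → ℝ} (hw : 𝒯.MemW w) : Integrable (fun x => ⟪𝒯.dG z ζ η x, 𝒯.G w x⟫) Srf.μ := by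
  obtain ⟨K, hK, h⟩ := hw.G_bdd
  exact (pair_bd hl (G_measurable 𝒯 w) hK (Filter.Eventually.of_forall fun x _ => h x)).1

theorem val_W (hl : LogApp 𝒯 z ζ R C η) (hm : Measurable (cutLog Srf z ζ)) (hC : 0 ≤ C) (hη : 0 ≤ η) {w : E3 → ℝ} (hw : 𝒯.MemW w) :
    Integrable (fun x => 𝒯.dV z ζ η x * w x) Srf.μ ∧ |∫ x, 𝒯.dV z ζ η x * w x ∂Srf.μ| ≤ √C * η * 𝒯.N w := by
  obtain ⟨K, hK, h⟩ := cont_bdd (Srf := Srf) hw.continuous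
  refine ⟨(dV_int hl hm).mul_bdd (c := K) hw.continuous.measurable.aestronglyMeasurable (by filter_upwards [ae_mem_S] with x hx using h x hx), ?_⟩
  refine (l2_cs hl.si hw.int_sq).trans ?_
  refine mul_le_mul ?_ (l2_le_N hw) (l2_nonneg _) (by positivity)
  rw [l2]
  refine (Real.sqrt_le_sqrt hl.sb).trans ?_
  rw [Real.sqrt_mul hC, Real.sqrt_sq hη]

theorem aF_cut (hl : LogApp 𝒯 z ζ R C η) (hm : Measurable (cutLog Srf z ζ)) (hC : 0 ≤ C) (hη : 0 ≤ η) {w : E3 → ℝ} (hw : 𝒯.MemW w) :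
    𝒯.aF (cutLog Srf z ζ) w = 𝒯.aF (𝒯.lreg z ζ η) w + (∫ x, ⟪𝒯.dG z ζ η x, 𝒯.G w x⟫ ∂Srf.μ + ∫ x, 𝒯.dV z ζ η x * w x ∂Srf.μ) := by
  have hi : Integrable (fun x => ⟪𝒯.dG z ζ η x, 𝒯.G w x⟫ + 𝒯.dV z ζ η x * w x) Srf.μ := (pair_W hl hw).add (val_W hl hm hC hη hw).1
  rw [← integral_add (pair_W hl hw) (val_W hl hm hC hη hw).1, aF, aF, ← integral_add (hl.memW.int_a hw) hi]
  congr 1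
  ext x
  simp only [dG, dV, inner_sub_left]
  ring

theorem aForm_cut (hl : LogApp 𝒯 z ζ R C η) (hm : Measurable (cutLog Srf z ζ)) (hC : 0 ≤ C) (hη : 0 ≤ η) {v w : E3 → ℝ} (hw : 𝒯.MemW w) (hv : ∀ y ∈ Srf.S, w y = v y) :
    Srf.aForm (cutLog Srf z ζ) v = 𝒯.aF (𝒯.lreg z ζ η) w + (∫ x, ⟪𝒯.dG z ζ η x, 𝒯.G w x⟫ ∂Srf.μ + ∫ x, 𝒯.dV z ζ η x * w x ∂Srf.μ) := by
  rw [← aF_cut hl hm hC hη hw, aForm_eq (𝒯 := 𝒯) hl.cdiff (by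
    filter_upwards [hw.diff, ae_mem_S] with x h1 hx using h1.congr_of_eventuallyEq (bar_eq_ev (𝒯.S_sub_U hx) hv).symm)]
  unfold aF
  refine integral_congr_ae ?_
  filter_upwards [ae_mem_S] with x hx
  rw [G_congr (𝒯.S_sub_U hx) hv, hv x hx]

/-- Constant-field pairing, by comparison with a much finer regularization. -/
theorem pair_const {C : ℝ} (hm : Measurable (cutLog Srf z ζ)) (hC : 0 ≤ C) {h : ℝ} (hh : 0 < h) (hh1 : h ≤ 1) (hl : LogApp 𝒯 z ζ R C h) (hl2 : LogApp 𝒯 z ζ R C (h ^ 2)) (c : E3) :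
    |∫ x, ⟪𝒯.dG z ζ h x, c⟫ ∂Srf.μ| ≤ (C + 10 * 𝒯.L ^ 2 * C) * ‖c‖ * h ^ 2 := by
  have p1 := pair_bd hl (X := fun _ => c) measurable_const (norm_nonneg c) (Filter.Eventually.of_forall fun x _ => le_rfl)
  have p2 := pair_bd hl2 (X := fun _ => c) measurable_const (norm_nonneg c) (Filter.Eventually.of_forall fun x _ => le_rfl)
  have hw := hl2.memW.sub hl.memW
  have hfl := flow hw c
  have e : ∫ x, ⟪𝒯.dG z ζ h x, c⟫ ∂Srf.μ = ∫ x, ⟪𝒯.dG z ζ (h ^ 2) x, c⟫ ∂Srf.μ + ∫ x, ⟪𝒯.G (fun x => 𝒯.lreg z ζ (h ^ 2) x - 𝒯.lreg z ζ h x) x, c⟫ ∂Srf.μ := by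
    have ae : ∀ᵐ x ∂Srf.μ, ⟪𝒯.G (fun x => 𝒯.lreg z ζ (h ^ 2) x - 𝒯.lreg z ζ h x) x, c⟫ = ⟪𝒯.dG z ζ h x, c⟫ - ⟪𝒯.dG z ζ (h ^ 2) x, c⟫ := by
      filter_upwards [hl.memW.diff, hl2.memW.diff] with x h1 h2
      rw [G_sub h2 h1, ← inner_sub_left, dG, dG]
      congr 1
      abel
    rw [integral_congr_ae ae, integral_sub p1.1 p2.1]; ring
  have hI : ∫ x, |𝒯.lreg z ζ (h ^ 2) x - 𝒯.lreg z ζ h x| ∂Srf.μ ≤ C * (h ^ 2) ^ 2 + C * h ^ 2 := by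
    refine le_trans ?_ (add_le_add hl2.ab hl.ab)
    rw [← integral_add hl2.ai hl.ai]
    refine integral_mono (𝒯.integrable_cont hw.continuous.abs) (hl2.ai.add hl.ai) fun x => ?_
    have : 𝒯.lreg z ζ (h ^ 2) x - 𝒯.lreg z ζ h x = -(cutLog Srf z ζ x - 𝒯.lreg z ζ (h ^ 2) x) + (cutLog Srf z ζ x - 𝒯.lreg z ζ h x) := by ring
    simp only [this, Pi.add_apply]
    refine (abs_add_le _ _).trans ?_
    rw [abs_neg]
  have h4 : (h ^ 2) ^ 2 ≤ h ^ 2 := by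
    have : h ^ 2 ≤ 1 := by nlinarith
    nlinarith [sq_nonneg h]
  rw [e]
  refine (abs_add_le _ _).trans ((add_le_add p2.2 hfl).trans ?_)
  have hLc : 0 ≤ 5 * 𝒯.L ^ 2 * ‖c‖ := by positivity
  calc ‖c‖ * (C * h ^ 2) + 5 * 𝒯.L ^ 2 * ‖c‖ * ∫ x, |𝒯.lreg z ζ (h ^ 2) x - 𝒯.lreg z ζ h x| ∂Srf.μ
      ≤ ‖c‖ * (C * h ^ 2) + 5 * 𝒯.L ^ 2 * ‖c‖ * (C * h ^ 2 + C * h ^ 2) := by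
        gcongr
        exact hI.trans (by gcongr)
    _ = _ := by ring

end

/-- Consistency relation for the discrete projection. -/
theorem consist {z : E3} {ζ : E3 → ℝ} {R C : ℝ} (hf : 𝒯.Fine γ h) (hl : LogApp 𝒯 z ζ R C h) (hm : Measurable (cutLog Srf z ζ)) (hC : 0 ≤ C)
    {lh Lh : E3 → ℝ} (hp : Tr.IsDiscreteProjection (cutLog Srf z ζ) lh) (hL : 𝒯.MemW Lh) (hLl : ∀ y ∈ Srf.S, Lh y = Tr.liftS lh y)
    {v V : E3 → ℝ} (hv : Tr.IsVh v) (hV : 𝒯.MemW V) (hVl : ∀ y ∈ Srf.S, V y = Tr.liftS v y) :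
    |𝒯.aF (fun x => Lh x - 𝒯.lreg z ζ h x) V - ∫ x, ⟪𝒯.dG z ζ h x, 𝒯.G V x⟫ ∂Srf.μ| ≤ √C * h * 𝒯.N V + 7 * 𝒯.e0 γ h * (𝒯.N Lh * 𝒯.N V) := by
  have h1 := hp.2 v hv
  rw [aForm_cut hl hm hC hf.hh.le hV hVl] at h1
  have h2 := F1 hf hL hV hLl hp.1 hVl hv
  have h3 := (val_W hl hm hC hf.hh.le hV).2
  rw [aF_sub_left hL hl.memW hV]
  rw [h1, abs_le] at h2
  rw [abs_le] at h3 ⊢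
  constructor <;> linarith [h2.1, h2.2, h3.1, h3.2]

end Tube

end

section
open scoped Topology

namespace Tube
variable {Srf : SmoothSurface} {𝒯 : Tube Srf} {γ h : ℝ} {Tr : Triangulation Srf γ h}

theorem Vh_sub {u v : E3 → ℝ} (hu : Tr.IsVh u) (hv : Tr.IsVh v) : Tr.IsVh (fun x => u x - v x) := by
  refine ⟨hu.1.sub hv.1, fun t ht => ?_⟩
  obtain ⟨L1, c1, h1⟩ := hu.2 t ht
  obtain ⟨L2, c2, h2⟩ := hv.2 t ht
  refine ⟨L1 - L2, c1 - c2, fun x hx => ?_⟩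
  show u x - v x = _
  rw [h1 x hx, h2 x hx, LinearMap.sub_apply]; ring

theorem Fine.h1 (hf : 𝒯.Fine γ h) : h ≤ 1 := by
  have := hf.h_lt; have := 𝒯.hδ1; have := hf.hh; linarith

/-- Constant of the energy estimate. -/
def cA (𝒯 : Tube Srf) (γ C : ℝ) : ℝ :=
  2 * (6 * C / γ + √C + 35 * 𝒯.K γ ^ 2 * C + 2 * √(((4 * 𝒯.L ^ 2 / γ) ^ 2 + (2 * 𝒯.L ^ 2) ^ 2) * C))

theorem cA_nonneg {C : ℝ} (hγ : 0 < γ) (hC : 0 ≤ C) : 0 ≤ 𝒯.cA γ C := by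
  unfold cA; positivity

theorem arithA {n a b s k c : ℝ} (hn : 0 ≤ n) (ha : 0 ≤ a) (hb : 0 ≤ b) (hs : 0 ≤ s) (hk : 0 ≤ k) (hc : c = 2 * (b + s + k + 2 * a))
    (h2 : n ^ 2 ≤ (b + s + (7 / 80 * n + k + 7 / 80 * a) + a) * n) : n ≤ c := by
  by_contra hcon
  push Not at hcon
  have hn' : 0 < n := by subst hc; exact lt_of_le_of_lt (by positivity) hcon
  have : n ≤ b + s + (7 / 80 * n + k + 7 / 80 * a) + a := by
    rw [sq] at h2; exact le_of_mul_le_mul_right h2 hn'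
  linarith

set_option maxHeartbeats 800000 in
/-- Energy bounds for the error against the regularized logarithm. -/
theorem stepA {z : E3} {ζ : E3 → ℝ} {R C : ℝ} (hf : 𝒯.Fine γ h) (hR : 𝒯.L ≤ R) (hl : LogApp 𝒯 z ζ R C h) (hm : Measurable (cutLog Srf z ζ)) (hC : 0 ≤ C)
    {lh Lh : E3 → ℝ} (hp : Tr.IsDiscreteProjection (cutLog Srf z ζ) lh) (hL : 𝒯.MemW Lh) (hLl : ∀ y ∈ Srf.S, Lh y = Tr.liftS lh y) :
    𝒯.N (fun x => 𝒯.lreg z ζ h x - Lh x) ≤ 2 * 𝒯.cA γ C ∧ 𝒯.N Lh * h ≤ 2 * 𝒯.cA γ C + C := by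
  obtain ⟨H, hH0, hHS, hHi, hHb⟩ := hl.hs
  obtain ⟨lam, Lam, hlam, hLam, hLaml, -, hN⟩ := interp_main hf Tr hl.memW hl.diff hR hHS hH0 hHi
  have hh := hf.hh
  have hγ := hf.hγ
  have hh1 := hf.h1
  set a1 := √(((4 * 𝒯.L ^ 2 / γ) ^ 2 + (2 * 𝒯.L ^ 2) ^ 2) * C) with ha1
  have ha0 : 0 ≤ a1 := Real.sqrt_nonneg _
  have hNa : 𝒯.N (fun y => 𝒯.lreg z ζ h y - Lam y) ≤ a1 := by
    apply Real.le_sqrt_of_sq_le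
    refine hN.trans ?_
    have : ((4 * 𝒯.L ^ 2 / γ) ^ 2 + (2 * 𝒯.L ^ 2) ^ 2) * h ^ 2 * ∫ x, H x ^ 2 ∂Srf.μ ≤ ((4 * 𝒯.L ^ 2 / γ) ^ 2 + (2 * 𝒯.L ^ 2) ^ 2) * h ^ 2 * (C / h ^ 2) := by gcongr
    refine this.trans (le_of_eq ?_)
    field_simp
  have hE : 𝒯.MemW (fun x => Lh x - Lam x) := hL.sub hLam
  have hEv := Vh_sub hp.1 hlam
  have hEl : ∀ y ∈ Srf.S, Lh y - Lam y = Tr.liftS (fun x => lh x - lam x) y := fun y hy => by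
    rw [hLl y hy, hLaml y hy]; rfl
  set n := 𝒯.N (fun x => Lh x - Lam x) with hn
  have hn0 : 0 ≤ n := N_nonneg _
  have c1 := consist hf hl hm hC hp hL hLl hEv hE hEl
  have c2 := (pair_bd hl (G_measurable 𝒯 (fun x => Lh x - Lam x)) (K := 6 * n / (γ * h)) (by positivity) (by
    filter_upwards [inv_est hf hE hEl hEv] with x hx _ using hx)).2
  have hla := hl.memW.sub hLam
  have c3 := aF_cs hla hE
  have c4 : n ^ 2 = 𝒯.aF (fun x => Lh x - 𝒯.lreg z ζ h x) (fun x => Lh x - Lam x) + 𝒯.aF (fun x => 𝒯.lreg z ζ h x - Lam x) (fun x => Lh x - Lam x) := by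
    rw [hn, N_sq, ← aF_add_left (hL.sub hl.memW) hla hE]
    congr 1
    ext x; ring
  have c5 : 𝒯.N Lh ≤ n + (C / h + a1) := by
    have e : Lh = fun x => (Lh x - Lam x) + (𝒯.lreg z ζ h x - (𝒯.lreg z ζ h x - Lam x)) := by ext x; ring
    rw [e]
    refine (N_add hE (hl.memW.sub hla)).trans ?_
    gcongr
    exact (N_sub hl.memW hla).trans (add_le_add hl.nb hNa)
  have c6 : 𝒯.N (fun x => 𝒯.lreg z ζ h x - Lh x) ≤ a1 + n := by
    have e : (fun x => 𝒯.lreg z ζ h x - Lh x) = fun x => (𝒯.lreg z ζ h x - Lam x) - (Lh x - Lam x) := by ext x; ring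
    rw [e]
    exact (N_sub hla hE).trans (add_le_add hNa le_rfl)
  have he0 := e0_nonneg (𝒯 := 𝒯) (γ := γ) (h := h)
  have h80 : 𝒯.e0 γ h ≤ 1 / 80 := hf.eps
  have k2 : 6 * n / (γ * h) * (C * h) = 6 * C / γ * n := by field_simp
  rw [k2] at c2
  have k3 : 7 * 𝒯.e0 γ h * (𝒯.N Lh * n) ≤ (7 / 80 * n + 35 * 𝒯.K γ ^ 2 * C + 7 / 80 * a1) * n := by
    have : 7 * 𝒯.e0 γ h * (𝒯.N Lh * n) ≤ 7 * 𝒯.e0 γ h * ((n + (C / h + a1)) * n) := by gcongr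
    refine this.trans ?_
    have e1 : 𝒯.e0 γ h * (C / h) ≤ 5 * 𝒯.K γ ^ 2 * C := by
      have : 𝒯.e0 γ h * (C / h) = 5 * 𝒯.K γ ^ 2 * C * h := by rw [e0]; field_simp
      rw [this]
      have : 0 ≤ 5 * 𝒯.K γ ^ 2 * C := by positivity
      nlinarith
    have e2 : 𝒯.e0 γ h * n ≤ 1 / 80 * n := by gcongr
    have e3 : 𝒯.e0 γ h * a1 ≤ 1 / 80 * a1 := by gcongr
    calc 7 * 𝒯.e0 γ h * ((n + (C / h + a1)) * n) = (7 * (𝒯.e0 γ h * n) + 7 * (𝒯.e0 γ h * (C / h)) + 7 * (𝒯.e0 γ h * a1)) * n := by ring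
      _ ≤ _ := mul_le_mul_of_nonneg_right (by linarith) hn0
  have k4 : √C * h * n ≤ √C * n := by
    have : √C * h ≤ √C := mul_le_of_le_one_right (Real.sqrt_nonneg _) hh1
    exact mul_le_mul_of_nonneg_right this hn0
  have k5 : 𝒯.N (fun y => 𝒯.lreg z ζ h y - Lam y) * n ≤ a1 * n := by gcongr
  have hcA : 𝒯.cA γ C = 2 * (6 * C / γ + √C + 35 * 𝒯.K γ ^ 2 * C + 2 * a1) := rfl
  have hCγ : 0 ≤ 6 * C / γ := by positivity
  have hK2 : 0 ≤ 35 * 𝒯.K γ ^ 2 * C := by positivity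
  have hsC := Real.sqrt_nonneg C
  have hn2 : n ^ 2 ≤ (6 * C / γ + √C + (7 / 80 * n + 35 * 𝒯.K γ ^ 2 * C + 7 / 80 * a1) + a1) * n := by
    rw [abs_le] at c1 c2 c3
    linarith [c1.1, c1.2, c2.1, c2.2, c3.1, c3.2]
  have hnle : n ≤ 𝒯.cA γ C := arithA hn0 ha0 hCγ hsC hK2 hcA hn2
  have ha1c : a1 ≤ 𝒯.cA γ C := by rw [hcA]; linarith
  refine ⟨by linarith, ?_⟩
  calc 𝒯.N Lh * h ≤ (n + (C / h + a1)) * h := by gcongr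
    _ = n * h + C + a1 * h := by field_simp; ring
    _ ≤ _ := by
      have q1 : n * h ≤ n := mul_le_of_le_one_right hn0 hh1
      have q2 : a1 * h ≤ a1 := mul_le_of_le_one_right ha0 hh1
      linarith

/-- Choice of a good centre near the pole. -/
theorem good_centre (hf : 𝒯.Fine γ h) (Tr : Triangulation Srf γ h) {z : E3} (hz : z ∈ Srf.S) {H : E3 → ℝ} {M : ℝ} (hM : 0 < M)
    (hHi : Integrable (fun x => H x ^ 2) Srf.μ) (hHb : ∫ x, H x ^ 2 ∂Srf.μ ≤ M) :
    ∃ x₁ ∈ Srf.S, ‖x₁ - z‖ ≤ 𝒯.L * h ∧ H x₁ ^ 2 * (γ * h) ^ 2 ≤ 3 * M := by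
  obtain ⟨t, ht, x₀, hx₀, rfl⟩ := A_surj hf Tr hz
  by_contra hcon
  push Not at hcon
  have hγh : 0 < (γ * h) ^ 2 := by have := hf.hγ; have := hf.hh; positivity
  have key : ∀ x ∈ triOf t, 3 * M / (γ * h) ^ 2 ≤ H (𝒯.A x) ^ 2 := fun x hx => by
    have := hcon (𝒯.A x) (𝒯.A_mem (tri_U hf ht hx)) ((𝒯.lip _ _).trans (by
      have := Tr.tri_dist ht x hx x₀ hx₀
      have := 𝒯.L_pos
      gcongr))
    rw [div_le_iff₀ hγh]; exact this.le
  obtain ⟨i1, i2, i3⟩ := cmp_int hf ht hHi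
  have he0 := e0_nonneg (𝒯 := 𝒯) (γ := γ) (h := h)
  have h80 : 𝒯.e0 γ h ≤ 1 / 80 := hf.eps
  have b1 : ∫ y in 𝒯.A '' triOf t, H y ^ 2 ∂μH[2] ≤ M :=
    (setIntegral_mono_set hHi (Filter.Eventually.of_forall fun x => sq_nonneg _) (HasSubset.Subset.eventuallyLE (At_sub hf ht))).trans hHb
  have b2 : 3 * M / (γ * h) ^ 2 * (μH[2] : Measure E3).real (triOf t) ≤ ∫ x in triOf t, H (𝒯.A x) ^ 2 ∂μH[2] :=
    setIntegral_ge_of_const_le_real (tri_meas t) (tri_mu_lt hf ht).ne key i2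
  have b3 : 3 * M ≤ 3 * M / (γ * h) ^ 2 * (μH[2] : Measure E3).real (triOf t) := by
    calc 3 * M = 3 * M / (γ * h) ^ 2 * (γ * h) ^ 2 := (div_mul_cancel₀ _ hγh.ne').symm
      _ ≤ _ := mul_le_mul_of_nonneg_left (tri_mu_ge hf ht) (by positivity)
  have b0 : 0 ≤ ∫ y in 𝒯.A '' triOf t, H y ^ 2 ∂μH[2] := integral_nonneg fun x => sq_nonneg _
  simp only [abs_of_nonneg (sq_nonneg (H _))] at i3
  rw [abs_le] at i3
  nlinarith [i3.1, i3.2]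

/-- Replacing the majorant near the pole by the value at a good centre. -/
theorem flat_H (hf : 𝒯.Fine γ h) {z x₁ : E3} (hz : z ∈ Srf.S) (hx : ‖x₁ - z‖ ≤ 𝒯.L * h) {H uh : E3 → ℝ} {M R₁ Cm : ℝ} (hR₁ : 0 ≤ R₁)
    (hκ : H x₁ ^ 2 * (γ * h) ^ 2 ≤ 3 * M) (hH0 : ∀ x, 0 ≤ H x) (hHm : Measurable H) (hCm : 0 ≤ Cm) (hM : 0 ≤ M)
    (hball : ∀ x ∈ Srf.S, ∀ ρ, 0 ≤ ρ → Srf.μ (closedBall x ρ) ≤ ENNReal.ofReal (Cm * ρ ^ 2))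
    (hHi : Integrable (fun x => H x ^ 2) Srf.μ) (hHb : ∫ x, H x ^ 2 ∂Srf.μ ≤ M)
    (hHS : ∀ x₁ : E3, ∀ x ∈ closedBall x₁ ((2 * 𝒯.L + R₁) * h), ‖fderiv ℝ uh x‖ ≤ H x₁ ∧
        ∀ y ∈ closedBall x₁ ((2 * 𝒯.L + R₁) * h), ‖fderiv ℝ uh x - fderiv ℝ uh y‖ ≤ H x₁ * ‖x - y‖) :
    ∃ H' : E3 → ℝ, (∀ x, 0 ≤ H' x) ∧ HS Srf 𝒯.L h uh H' ∧ Integrable (fun x => H' x ^ 2) Srf.μ ∧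
      ∫ x, H' x ^ 2 ∂Srf.μ ≤ (1 + 3 * Cm * R₁ ^ 2 / γ ^ 2) * M ∧ ∀ x, ‖x - z‖ ≤ R₁ * h → H' x = H x₁ := by
  classical
  have hh := hf.hh
  have hγ := hf.hγ
  have hL := 𝒯.L_pos
  have hfin := 𝒯.finite_μ
  set B := closedBall z (R₁ * h) with hB
  have hBm : MeasurableSet B := measurableSet_closedBall
  set H' : E3 → ℝ := fun x => if x ∈ B then H x₁ else H x with hH'
  have hm' : Measurable H' := Measurable.ite hBm measurable_const hHm
  have hi : Integrable (fun x => H x ^ 2 + B.indicator (fun _ => H x₁ ^ 2) x) Srf.μ :=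
    hHi.add ((integrable_const _).indicator hBm)
  have hle : ∀ x, H' x ^ 2 ≤ H x ^ 2 + B.indicator (fun _ => H x₁ ^ 2) x := fun x => by
    by_cases hxB : x ∈ B
    · simp only [hH', if_pos hxB, Set.indicator_of_mem hxB]; nlinarith [sq_nonneg (H x)]
    · simp only [hH', if_neg hxB, Set.indicator_of_notMem hxB]; linarith
  obtain ⟨j1, j2⟩ := dom_int hi (hm'.pow_const 2).aestronglyMeasurable (fun x => sq_nonneg _) (Filter.Eventually.of_forall hle)
  refine ⟨H', fun x => by simp only [hH']; split_ifs <;> exact hH0 _, ?_, j1, ?_, ?_⟩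
  · intro y hy x hxy
    by_cases hyB : y ∈ B
    · have e : H' y = H x₁ := if_pos hyB
      have sub : closedBall y (𝒯.L * h) ⊆ closedBall x₁ ((2 * 𝒯.L + R₁) * h) := by
        apply closedBall_subset_closedBall'
        have h1 : dist y z ≤ R₁ * h := hyB
        have h2 : dist x₁ z ≤ 𝒯.L * h := by rw [dist_eq_norm]; exact hx
        have := dist_triangle_right y x₁ z
        linarith
      rw [e]
      exact ⟨(hHS x₁ x (sub hxy)).1, fun w hw => (hHS x₁ x (sub hxy)).2 w (sub hw)⟩
    · have e : H' y = H y := if_neg hyB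
      have sub : closedBall y (𝒯.L * h) ⊆ closedBall y ((2 * 𝒯.L + R₁) * h) := by
        apply closedBall_subset_closedBall
        have : 0 ≤ R₁ * h := by positivity
        nlinarith
      rw [e]
      exact ⟨(hHS y x (sub hxy)).1, fun w hw => (hHS y x (sub hxy)).2 w (sub hw)⟩
  · refine j2.trans ?_
    rw [integral_add hHi ((integrable_const _).indicator hBm), integral_indicator hBm, setIntegral_const, smul_eq_mul]
    have hmu : Srf.μ.real B ≤ Cm * (R₁ * h) ^ 2 := by
      have := hball z hz (R₁ * h) (by positivity)
      exact ENNReal.toReal_le_of_le_ofReal (by positivity) this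
    have : Srf.μ.real B * H x₁ ^ 2 ≤ Cm * (R₁ * h) ^ 2 * H x₁ ^ 2 := by gcongr
    have e : Cm * (R₁ * h) ^ 2 * H x₁ ^ 2 = Cm * R₁ ^ 2 / γ ^ 2 * (H x₁ ^ 2 * (γ * h) ^ 2) := by field_simp
    have : Cm * R₁ ^ 2 / γ ^ 2 * (H x₁ ^ 2 * (γ * h) ^ 2) ≤ Cm * R₁ ^ 2 / γ ^ 2 * (3 * M) := by gcongr
    have e2 : (1 + 3 * Cm * R₁ ^ 2 / γ ^ 2) * M = M + Cm * R₁ ^ 2 / γ ^ 2 * (3 * M) := by ring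
    linarith
  · intro x hxz
    exact if_pos (by rw [hB, mem_closedBall, dist_eq_norm]; exact hxz)

/-- Pairing of the gradient error with a smooth field. -/
theorem pair_smooth {z : E3} {ζ : E3 → ℝ} {R C κ : ℝ} (hz : z ∈ Srf.S) (hm : Measurable (cutLog Srf z ζ)) (hC : 0 ≤ C) (hh : 0 < h) (hh1 : h ≤ 1)
    (hl : LogApp 𝒯 z ζ R C h) (hl2 : LogApp 𝒯 z ζ R C (h ^ 2)) {uh : E3 → ℝ} (hu : Differentiable ℝ uh) (hκ : ‖fderiv ℝ uh z‖ ≤ κ)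
    (hd : ∀ x, ‖x - z‖ ≤ C * h → ‖fderiv ℝ uh x - fderiv ℝ uh z‖ ≤ κ * ‖x - z‖) :
    |∫ x, ⟪𝒯.dG z ζ h x, 𝒯.G uh x⟫ ∂Srf.μ| ≤ (C + 10 * 𝒯.L ^ 2 * C + C ^ 2) * κ * h ^ 2 := by
  have hκ0 : 0 ≤ κ := (norm_nonneg _).trans hκ
  set g : E3 → E3 := fun x => (InnerProductSpace.toDual ℝ E3).symm (fderiv ℝ uh x) with hg
  have hgm : Measurable g := (InnerProductSpace.toDual ℝ E3).symm.continuous.measurable.comp (measurable_fderiv ℝ uh)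
  have p1 := pair_const hm hC hh hh1 hl hl2 (g z)
  have p1i := (pair_bd hl (X := fun _ => g z) measurable_const (norm_nonneg (g z)) (Filter.Eventually.of_forall fun x _ => le_rfl)).1
  have p2 := pair_bd hl (X := fun x => g x - g z) (hgm.sub measurable_const) (K := κ * (C * h)) (by positivity) (Filter.Eventually.of_forall fun x hx => by
    simp only [hg, ← map_sub, LinearIsometryEquiv.norm_map]
    exact (hd x hx).trans (by gcongr))
  have e : ∫ x, ⟪𝒯.dG z ζ h x, 𝒯.G uh x⟫ ∂Srf.μ = ∫ x, ⟪𝒯.dG z ζ h x, g z⟫ ∂Srf.μ + ∫ x, ⟪𝒯.dG z ζ h x, g x - g z⟫ ∂Srf.μ := by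
    rw [← integral_add p1i p2.1]
    refine integral_congr_ae ?_
    filter_upwards [ae_mem_S, hl.cdiff, hl.memW.diff] with x hx h1 h2
    have hD : 𝒯.D x (𝒯.dG z ζ h x) = 𝒯.dG z ζ h x := by rw [dG, map_sub, D_G hx h1, D_G hx h2]
    rw [← inner_add_right, add_sub_cancel, real_inner_comm, G_of_diff hx (hu x), hD, real_inner_comm]
    simp only [hg, InnerProductSpace.toDual_symm_apply]
  have hgz : ‖g z‖ ≤ κ := by simp only [hg, LinearIsometryEquiv.norm_map]; exact hκ
  rw [e]
  refine (abs_add_le _ _).trans ((add_le_add p1 p2.2).trans ?_)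
  have : (C + 10 * 𝒯.L ^ 2 * C) * ‖g z‖ * h ^ 2 ≤ (C + 10 * 𝒯.L ^ 2 * C) * κ * h ^ 2 := by gcongr
  nlinarith

end Tube

end

section
open scoped Topology

namespace Tube
variable {Srf : SmoothSurface} {𝒯 : Tube Srf} {γ h : ℝ} {Tr : Triangulation Srf γ h}

/-- The conclusion of `moll_main` at a fixed scale. -/
def MollAt (𝒯 : Tube Srf) (R CB h : ℝ) : Prop := ∀ f : E3 → ℝ, 𝒯.MemW f → 0 < l2 Srf f →
    ∃ u uh H : E3 → ℝ, 𝒯.MemW u ∧ 𝒯.MemW uh ∧ Differentiable ℝ uh ∧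
      (∀ w, 𝒯.MemW w → |𝒯.aF u w - ∫ x, f x * w x ∂Srf.μ| ≤ h * l2 Srf f * 𝒯.N w) ∧
      𝒯.N u ≤ 2 * l2 Srf f ∧ 𝒯.N (fun x => u x - uh x) ≤ CB * h * l2 Srf f ∧ 𝒯.N uh ≤ CB * l2 Srf f ∧
      (∀ x, 0 ≤ H x) ∧ Measurable H ∧ Integrable (fun x => H x ^ 2) Srf.μ ∧ ∫ x, H x ^ 2 ∂Srf.μ ≤ CB * l2 Srf f ^ 2 ∧
      ∀ x₁ : E3, ∀ x ∈ closedBall x₁ (R * h), ‖fderiv ℝ uh x‖ ≤ H x₁ ∧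
        ∀ y ∈ closedBall x₁ (R * h), ‖fderiv ℝ uh x - fderiv ℝ uh y‖ ≤ H x₁ * ‖x - y‖

/-- Interpolation constant for the dual problem. -/
def c2 (𝒯 : Tube Srf) (γ C Cm CB : ℝ) : ℝ :=
  √(((4 * 𝒯.L ^ 2 / γ) ^ 2 + (2 * 𝒯.L ^ 2) ^ 2) * ((1 + 3 * Cm * C ^ 2 / γ ^ 2) * CB))

/-- Constant of the final duality estimate. -/
def cB (𝒯 : Tube Srf) (γ C Cm CB a b : ℝ) : ℝ :=
  a + CB * a + 𝒯.c2 γ C Cm CB * a + (√C + 35 * 𝒯.K γ ^ 2 * b) * (CB + 𝒯.c2 γ C Cm CB) +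
    ((C + 10 * 𝒯.L ^ 2 * C + C ^ 2) + 4 * 𝒯.L ^ 2 / γ * C) * (√(3 * CB) / γ)

theorem sqrt_mul_sq {x s : ℝ} (hx : 0 ≤ x) (hs : 0 ≤ s) : √(x * s ^ 2) = √x * s := by
  rw [Real.sqrt_mul hx, Real.sqrt_sq hs]

/-- Discrete approximation of the dual solution. -/
theorem dual_approx {z : E3} {ζ : E3 → ℝ} {C Cm CB : ℝ} (hf : 𝒯.Fine γ h) (Tr : Triangulation Srf γ h) (hz : z ∈ Srf.S) (hm : Measurable (cutLog Srf z ζ))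
    (hC : 0 ≤ C) (hCm : 0 ≤ Cm) (hCB : 0 < CB) (hl : LogApp 𝒯 z ζ 𝒯.L C h) (hl2 : LogApp 𝒯 z ζ 𝒯.L C (h ^ 2))
    (hball : ∀ x ∈ Srf.S, ∀ ρ, 0 ≤ ρ → Srf.μ (closedBall x ρ) ≤ ENNReal.ofReal (Cm * ρ ^ 2))
    {uh H : E3 → ℝ} {F : ℝ} (hF : 0 < F) (huW : 𝒯.MemW uh) (hud : Differentiable ℝ uh) (hH0 : ∀ x, 0 ≤ H x) (hHm : Measurable H)
    (hHi : Integrable (fun x => H x ^ 2) Srf.μ) (hHb : ∫ x, H x ^ 2 ∂Srf.μ ≤ CB * F ^ 2)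
    (hHS : ∀ x₁ : E3, ∀ x ∈ closedBall x₁ ((2 * 𝒯.L + C) * h), ‖fderiv ℝ uh x‖ ≤ H x₁ ∧
        ∀ y ∈ closedBall x₁ ((2 * 𝒯.L + C) * h), ‖fderiv ℝ uh x - fderiv ℝ uh y‖ ≤ H x₁ * ‖x - y‖) :
    ∃ v U : E3 → ℝ, Tr.IsVh v ∧ 𝒯.MemW U ∧ (∀ y ∈ Srf.S, U y = Tr.liftS v y) ∧ 𝒯.N (fun x => uh x - U x) ≤ 𝒯.c2 γ C Cm CB * h * F ∧
      |∫ x, ⟪𝒯.dG z ζ h x, 𝒯.G U x⟫ ∂Srf.μ| ≤ ((C + 10 * 𝒯.L ^ 2 * C + C ^ 2) + 4 * 𝒯.L ^ 2 / γ * C) * (√(3 * CB) / γ) * h * F := by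
  have hh := hf.hh
  have hγ := hf.hγ
  have hL := 𝒯.L_pos
  have hM : 0 < CB * F ^ 2 := by positivity
  obtain ⟨x₁, hx₁, hxz, hκ⟩ := good_centre hf Tr hz hM hHi hHb
  obtain ⟨H', hH'0, hH'S, hH'i, hH'b, hH'z⟩ := flat_H hf hz hxz hC hκ hH0 hHm hCm hM.le hball hHi hHb hHS
  obtain ⟨v, U, hv, hU, hUl, hpt, hN⟩ := interp_main hf Tr huW hud le_rfl hH'S hH'0 hH'i
  set κ := H x₁ with hκd
  have hκ0 : 0 ≤ κ := hH0 x₁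
  have hκh : κ * h ≤ √(3 * CB) / γ * F := by
    have h1 : κ * (γ * h) ≤ √(3 * CB) * F := by
      rw [show √(3 * CB) * F = √(3 * (CB * F ^ 2)) by
        rw [show 3 * (CB * F ^ 2) = 3 * CB * F ^ 2 by ring, sqrt_mul_sq (by positivity) hF.le]]
      exact Real.le_sqrt_of_sq_le (by rw [mul_pow]; exact hκ)
    rw [div_mul_eq_mul_div, le_div_iff₀ hγ]
    linarith
  refine ⟨v, U, hv, hU, hUl, ?_, ?_⟩
  · have : 𝒯.c2 γ C Cm CB * h * F = √(((4 * 𝒯.L ^ 2 / γ) ^ 2 + (2 * 𝒯.L ^ 2) ^ 2) * h ^ 2 * ((1 + 3 * Cm * C ^ 2 / γ ^ 2) * (CB * F ^ 2))) := by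
      rw [c2, show ((4 * 𝒯.L ^ 2 / γ) ^ 2 + (2 * 𝒯.L ^ 2) ^ 2) * h ^ 2 * ((1 + 3 * Cm * C ^ 2 / γ ^ 2) * (CB * F ^ 2)) =
        ((4 * 𝒯.L ^ 2 / γ) ^ 2 + (2 * 𝒯.L ^ 2) ^ 2) * ((1 + 3 * Cm * C ^ 2 / γ ^ 2) * CB) * (h * F) ^ 2 by ring,
        sqrt_mul_sq (by positivity) (by positivity), mul_assoc]
    rw [this]
    apply Real.le_sqrt_of_sq_le
    refine hN.trans ?_
    gcongr
  · have hzb : z ∈ closedBall x₁ ((2 * 𝒯.L + C) * h) := by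
      rw [mem_closedBall, dist_comm, dist_eq_norm]
      refine hxz.trans ?_
      gcongr
      linarith
    have hb : ∀ x, ‖x - z‖ ≤ C * h → x ∈ closedBall x₁ ((2 * 𝒯.L + C) * h) := fun x hx => by
      rw [mem_closedBall]
      have h2 : dist x₁ z ≤ 𝒯.L * h := by rw [dist_eq_norm]; exact hxz
      have h1 : dist x z ≤ C * h := by rw [dist_eq_norm]; exact hx
      have := dist_triangle_right x x₁ z
      have : 0 ≤ 𝒯.L * h := by positivity
      linarith
    have s1 := pair_smooth (κ := κ) hz hm hC hh hf.h1 hl hl2 hud (hHS x₁ z hzb).1 (fun x hx => (hHS x₁ x (hb x hx)).2 z hzb)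
    have s2 := (pair_bd hl (G_measurable 𝒯 (fun y => uh y - U y)) (K := 4 * 𝒯.L ^ 2 / γ * h * κ) (by positivity) (by
      filter_upwards [hpt] with x hx hxC
      rw [← hH'z x hxC]
      exact hx.1)).2
    have e : ∫ x, ⟪𝒯.dG z ζ h x, 𝒯.G U x⟫ ∂Srf.μ = ∫ x, ⟪𝒯.dG z ζ h x, 𝒯.G uh x⟫ ∂Srf.μ - ∫ x, ⟪𝒯.dG z ζ h x, 𝒯.G (fun y => uh y - U y) x⟫ ∂Srf.μ := by
      rw [← integral_sub (pair_W hl huW) (pair_W hl (huW.sub hU))]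
      refine integral_congr_ae ?_
      filter_upwards [huW.diff, hU.diff] with x h1 h2
      rw [G_sub h1 h2, inner_sub_right]
      ring
    rw [e]
    refine (abs_sub _ _).trans ((add_le_add s1 s2).trans ?_)
    have e2 : (C + 10 * 𝒯.L ^ 2 * C + C ^ 2) * κ * h ^ 2 + 4 * 𝒯.L ^ 2 / γ * h * κ * (C * h) =
      ((C + 10 * 𝒯.L ^ 2 * C + C ^ 2) + 4 * 𝒯.L ^ 2 / γ * C) * h * (κ * h) := by ring
    rw [e2]
    calc ((C + 10 * 𝒯.L ^ 2 * C + C ^ 2) + 4 * 𝒯.L ^ 2 / γ * C) * h * (κ * h) ≤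
        ((C + 10 * 𝒯.L ^ 2 * C + C ^ 2) + 4 * 𝒯.L ^ 2 / γ * C) * h * (√(3 * CB) / γ * F) := by gcongr
      _ = _ := by ring

/-- Duality estimate. -/
theorem stepB {z : E3} {ζ : E3 → ℝ} {C Cm CB a b : ℝ} (hf : 𝒯.Fine γ h) (hz : z ∈ Srf.S) (hm : Measurable (cutLog Srf z ζ))
    (hC : 0 ≤ C) (hCm : 0 ≤ Cm) (hCB : 0 < CB) (hl : LogApp 𝒯 z ζ 𝒯.L C h) (hl2 : LogApp 𝒯 z ζ 𝒯.L C (h ^ 2))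
    (hball : ∀ x ∈ Srf.S, ∀ ρ, 0 ≤ ρ → Srf.μ (closedBall x ρ) ≤ ENNReal.ofReal (Cm * ρ ^ 2)) (hmoll : MollAt 𝒯 (2 * 𝒯.L + C) CB h)
    {lh Lh : E3 → ℝ} (hp : Tr.IsDiscreteProjection (cutLog Srf z ζ) lh) (hL : 𝒯.MemW Lh) (hLl : ∀ y ∈ Srf.S, Lh y = Tr.liftS lh y)
    (ha : 𝒯.N (fun x => 𝒯.lreg z ζ h x - Lh x) ≤ a) (hb : 𝒯.N Lh * h ≤ b) (hF : 0 < l2 Srf (fun x => 𝒯.lreg z ζ h x - Lh x)) :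
    l2 Srf (fun x => 𝒯.lreg z ζ h x - Lh x) ≤ 𝒯.cB γ C Cm CB a b * h := by
  have he := hl.memW.sub hL
  obtain ⟨u, uh, H, hu, huh, hud, hvar, -, hN1, hN2, hH0, hHm, hHi, hHb, hHS⟩ := hmoll _ he hF
  set F := l2 Srf (fun x => 𝒯.lreg z ζ h x - Lh x) with hFd
  set e : E3 → ℝ := fun x => 𝒯.lreg z ζ h x - Lh x with hed
  obtain ⟨v, U, hv, hU, hUl, hUN, hUI⟩ := dual_approx hf Tr hz hm hC hCm hCB hl hl2 hball hF huh hud hH0 hHm hHi hHb hHS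
  have hh := hf.hh
  have hγ := hf.hγ
  have hh1 := hf.h1
  set κ2 := 𝒯.c2 γ C Cm CB with hκ2
  have hκ20 : 0 ≤ κ2 := Real.sqrt_nonneg _
  set κ5 := ((C + 10 * 𝒯.L ^ 2 * C + C ^ 2) + 4 * 𝒯.L ^ 2 / γ * C) * (√(3 * CB) / γ) with hκ5
  have hNe0 : 0 ≤ 𝒯.N e := N_nonneg _
  have hFF : ∫ x, e x * e x ∂Srf.μ = F ^ 2 := by
    rw [hFd, l2_sq]; congr 1; ext x; rw [sq]
  have w1 := hvar e he
  rw [hFF] at w1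
  have w2 := aF_cs (hu.sub huh) he
  have w3 := aF_cs (huh.sub hU) he
  have w4 := consist hf hl hm hC hp hL hLl hv hU hUl
  have NU : 𝒯.N U ≤ (CB + κ2) * F := by
    have eU : U = fun x => uh x - (uh x - U x) := by ext x; ring
    rw [eU]
    refine (N_sub huh (huh.sub hU)).trans ((add_le_add hN2 hUN).trans ?_)
    have : κ2 * h * F ≤ κ2 * 1 * F := by gcongr
    linarith
  have eA : 𝒯.aF u e = 𝒯.aF (fun x => u x - uh x) e + 𝒯.aF (fun x => uh x - U x) e + 𝒯.aF U e := by
    rw [aF_sub_left hu huh he, aF_sub_left huh hU he]; ring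
  have eN : 𝒯.aF U e = -𝒯.aF (fun x => Lh x - 𝒯.lreg z ζ h x) U := by
    rw [aF_comm, aF_sub_left hl.memW hL hU, aF_sub_left hL hl.memW hU]; ring
  have b1 : h * F * 𝒯.N e ≤ h * F * a := by gcongr
  have ha0 : 0 ≤ a := hNe0.trans ha
  have b2 : 𝒯.N (fun x => u x - uh x) * 𝒯.N e ≤ CB * h * F * a := by gcongr
  have b3 : 𝒯.N (fun x => uh x - U x) * 𝒯.N e ≤ κ2 * h * F * a := by gcongr
  have b4 : √C * h * 𝒯.N U ≤ √C * h * ((CB + κ2) * F) := by gcongr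
  have hb0 : 0 ≤ b := (mul_nonneg (N_nonneg Lh) hh.le).trans hb
  have b5 : 7 * 𝒯.e0 γ h * (𝒯.N Lh * 𝒯.N U) ≤ 35 * 𝒯.K γ ^ 2 * h * b * ((CB + κ2) * F) := by
    have : 7 * 𝒯.e0 γ h * (𝒯.N Lh * 𝒯.N U) = 35 * 𝒯.K γ ^ 2 * h * (𝒯.N Lh * h) * 𝒯.N U := by rw [e0]; ring
    rw [this]
    have := N_nonneg (𝒯 := 𝒯) U
    gcongr
  have key : F * F ≤ 𝒯.cB γ C Cm CB a b * h * F := by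
    have e3 : 𝒯.cB γ C Cm CB a b * h * F = h * F * a + CB * h * F * a + κ2 * h * F * a + √C * h * ((CB + κ2) * F) + 35 * 𝒯.K γ ^ 2 * h * b * ((CB + κ2) * F) + κ5 * h * F := by
      rw [cB]; ring
    rw [e3]
    rw [abs_le] at w1 w2 w3 w4 hUI
    have : F * F = F ^ 2 := by ring
    linarith [w1.1, w1.2, w2.1, w2.2, w3.1, w3.2, w4.1, w4.2, hUI.1, hUI.2]
  exact le_of_mul_le_mul_right key hF

/-- Final estimate at a fixed scale. -/
theorem stepC {z : E3} {ζ : E3 → ℝ} {C Cm CB : ℝ} (hf : 𝒯.Fine γ h) (hz : z ∈ Srf.S) (hm : Measurable (cutLog Srf z ζ))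
    (hC : 0 ≤ C) (hCm : 0 ≤ Cm) (hCB : 0 < CB) (hl : LogApp 𝒯 z ζ 𝒯.L C h) (hl2 : LogApp 𝒯 z ζ 𝒯.L C (h ^ 2))
    (hball : ∀ x ∈ Srf.S, ∀ ρ, 0 ≤ ρ → Srf.μ (closedBall x ρ) ≤ ENNReal.ofReal (Cm * ρ ^ 2)) (hmoll : MollAt 𝒯 (2 * 𝒯.L + C) CB h)
    {lh : E3 → ℝ} (hp : Tr.IsDiscreteProjection (cutLog Srf z ζ) lh) :
    √(∫ x in Srf.S, (cutLog Srf z ζ x - Tr.liftS lh x) ^ 2 ∂μH[2]) ≤ (√C + |𝒯.cB γ C Cm CB (2 * 𝒯.cA γ C) (2 * 𝒯.cA γ C + C)|) * h := by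
  obtain ⟨Lh, hL, hLl⟩ := lift_memW hf hp.1
  obtain ⟨ha, hb⟩ := stepA hf le_rfl hl hm hC hp hL hLl
  have hh := hf.hh
  have he := hl.memW.sub hL
  have hFb : l2 Srf (fun x => 𝒯.lreg z ζ h x - Lh x) ≤ |𝒯.cB γ C Cm CB (2 * 𝒯.cA γ C) (2 * 𝒯.cA γ C + C)| * h := by
    rcases (l2_nonneg (Srf := Srf) (fun x => 𝒯.lreg z ζ h x - Lh x)).eq_or_lt with h0 | h0
    · rw [← h0]; positivity
    · refine (stepB hf hz hm hC hCm hCB hl hl2 hball hmoll hp hL hLl ha hb h0).trans ?_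
      exact mul_le_mul_of_nonneg_right (le_abs_self _) hh.le
  have e1 : √(∫ x in Srf.S, (cutLog Srf z ζ x - Tr.liftS lh x) ^ 2 ∂μH[2]) = l2 Srf (fun x => 𝒯.dV z ζ h x + (𝒯.lreg z ζ h x - Lh x)) := by
    rw [l2]
    congr 1
    refine integral_congr_ae ?_
    filter_upwards [ae_mem_S (Srf := Srf)] with x hx
    rw [← hLl x hx, dV]
    congr 1
    ring
  have e2 : l2 Srf (𝒯.dV z ζ h) ≤ √C * h := by
    rw [l2]
    refine (Real.sqrt_le_sqrt hl.sb).trans ?_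
    rw [Real.sqrt_mul hC, Real.sqrt_sq hh.le]
  rw [e1]
  refine (l2_add hl.si he.int_sq (val_W hl hm hC hh.le he).1).trans ?_
  rw [add_mul]
  exact add_le_add e2 hFb

theorem final_tube (𝒯 : Tube Srf) {γ₀ : ℝ} (hγ₀ : 0 < γ₀) {r₁ : ℝ} (hr₁ : Srf.IsGraphRadius r₁) {Cζ : ℝ} (hCζ : 0 < Cζ) :
    ∃ c > 0, ∃ h₀ > 0,
      ∀ z₀ ∈ Srf.S, ∀ ζ : E3 → ℝ, IsCutoff z₀ r₁ Cζ ζ →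
        ∀ h : ℝ, 0 < h → h ≤ h₀ →
          ∀ Tr : Triangulation Srf γ₀ h, ∀ lh : E3 → ℝ,
            Tr.IsDiscreteProjection (cutLog Srf z₀ ζ) lh →
            Real.sqrt (∫ x in Srf.S,
                (cutLog Srf z₀ ζ x - Tr.liftS lh x) ^ 2 ∂μH[2]) ≤ c * h := by
  have hL := 𝒯.L_pos
  obtain ⟨C, hC, h₁, hh₁, hlog⟩ := log_main 𝒯 hr₁ hCζ hL.le
  obtain ⟨CB, hCB, h₂, hh₂, hmoll⟩ := moll_main 𝒯 (R := 2 * 𝒯.L + C) (by positivity)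
  obtain ⟨Cm, hCm, hball⟩ := mu_ball 𝒯
  have hK : 0 < 𝒯.K γ₀ := by unfold K; positivity
  have hδ := 𝒯.hδ
  refine ⟨√C + |𝒯.cB γ₀ C Cm CB (2 * 𝒯.cA γ₀ C) (2 * 𝒯.cA γ₀ C + C)|, by positivity, min (min 1 h₁) (min h₂ (𝒯.δ / (20 * 𝒯.K γ₀))), by positivity, ?_⟩
  intro z hz ζ hζ h hh hle Tr lh hp
  obtain ⟨q1, q2⟩ := le_min_iff.1 hle
  obtain ⟨q1, q3⟩ := le_min_iff.1 q1
  obtain ⟨q2, q4⟩ := le_min_iff.1 q2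
  have hf : 𝒯.Fine γ₀ h := ⟨hγ₀, hh, by rw [le_div_iff₀ (by positivity)] at q4; linarith⟩
  have hsq : h ^ 2 ≤ h := by nlinarith
  exact stepC hf hz (cut_meas hz 𝒯 hζ) hC.le hCm.le hCB (hlog z hz ζ hζ h hh q3) (hlog z hz ζ hζ (h ^ 2) (by positivity) (hsq.trans q3)) hball (hmoll h hh q2) hp

end Tube

end

/-- **L²-estimate for the discrete projection of the cut-off logarithm.**
`‖l̃ − L̃_h‖_{L²(S)} ≤ c h`, with `c` independent of `z₀` and `h`. -/
theorem cutlog_l2_estimate (Srf : SmoothSurface) (γ₀ : ℝ) (hγ₀ : 0 < γ₀)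
    (r₁ : ℝ) (hr₁ : Srf.IsGraphRadius r₁) (Cζ : ℝ) (hCζ : 0 < Cζ) :
    ∃ c > 0, ∃ h₀ > 0,
      ∀ z₀ ∈ Srf.S, ∀ ζ : E3 → ℝ, IsCutoff z₀ r₁ Cζ ζ →
        ∀ h : ℝ, 0 < h → h ≤ h₀ →
          ∀ Tr : Triangulation Srf γ₀ h, ∀ lh : E3 → ℝ,
            Tr.IsDiscreteProjection (cutLog Srf z₀ ζ) lh →
            Real.sqrt (∫ x in Srf.S,
                (cutLog Srf z₀ ζ x - Tr.liftS lh x) ^ 2 ∂μH[2]) ≤ c * h := by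
  by_cases hT : ∃ h : ℝ, Nonempty (Triangulation Srf γ₀ h)
  · obtain ⟨h, ⟨Tr⟩⟩ := hT
    obtain ⟨𝒯⟩ := exists_tube Tr
    exact Tube.final_tube 𝒯 hγ₀ hr₁ hCζ
  · exact ⟨1, one_pos, 1, one_pos, fun z₀ _ ζ _ h _ _ Tr => absurd ⟨h, ⟨Tr⟩⟩ hT⟩

end
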